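/- Let w be a non-negative Schwartz function on (0,∞) with Mellin transform ŵ. There exists a linear polynomial Q, whose coefficients depend only on absolute constants and on ŵ(1) and ŵ′(1), such that for any ε>0, ∑_{n primary} L(1/2, χ_{(1+i)²n}) · w(N(n)/X) = X·Q(log X) + O(X^{1/2+ε}). -/

import Mathlib

open Complex Real Filter Topology
open scoped BigOperators Classical

noncomputable section

/-- The norm `N(n)` of a Gaussian integer, as a real number. -/
def Nm (n : GaussianInt) : ℝ := ((Zsqrtd.norm n : ℤ) : ℝ)

/-- The element `1 + i` of `ℤ[i]`. -/
def ωg : GaussianInt := ⟨1, 1⟩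

/-- The element `i` of `ℤ[i]`. -/
def ig : GaussianInt := ⟨0, 1⟩

/-- `n` is primary: `n ≡ 1 mod (1+i)³`. -/
def IsPrimary (n : GaussianInt) : Prop := ωg ^ 3 ∣ (n - 1)

/-- `ẽ(z) = exp(2πi(z/(2i) − z̄/(2i)))`. -/
def eT (z : ℂ) : ℂ :=
  Complex.exp (2 * (Real.pi : ℂ) * Complex.I *
    (z / (2 * Complex.I) - (starRingEnd ℂ) z / (2 * Complex.I)))

/-- `χ a n = (a/n)` is the quadratic residue symbol of `ℤ[i]`: on odd primes `ϖ` it is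
the `±1` (or `0`) value determined by `(a/ϖ) ≡ a^((N(ϖ)-1)/2) mod ϖ`, it is extended
multiplicatively in the denominator over odd elements, and equals `1` on units. -/
structure IsQuadSym (χ : GaussianInt → GaussianInt → ℤ) : Prop where
  val_prime : ∀ ϖ a : GaussianInt, Prime ϖ → ¬ ωg ∣ ϖ → ¬ ϖ ∣ a →
    (χ a ϖ = 1 ∨ χ a ϖ = -1) ∧
      ϖ ∣ (a ^ (((Zsqrtd.norm ϖ).toNat - 1) / 2) - (χ a ϖ : GaussianInt))
  zero_of_dvd : ∀ ϖ a : GaussianInt, Prime ϖ → ϖ ∣ a → χ a ϖ = 0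
  mul_den : ∀ a m n : GaussianInt, ¬ ωg ∣ m → ¬ ωg ∣ n → χ a (m * n) = χ a m * χ a n
  unit_den : ∀ a u : GaussianInt, IsUnit u → χ a u = 1

/-- `L s m = L(s, χ_m)`: the Hecke `L`-function attached to the quadratic symbol `(m/·)`,
given by its Dirichlet series over primary elements (= odd ideals) for `Re s > 1`,
and analytic away from `s = 1`. -/
def IsHeckeL (χ : GaussianInt → GaussianInt → ℤ) (L : ℂ → GaussianInt → ℂ) : Prop :=
  (∀ (m : GaussianInt) (s : ℂ), 1 < s.re →
      L s m = ∑' n : {n : GaussianInt // IsPrimary n}, (χ m n.1 : ℂ) / (Nm n.1 : ℂ) ^ s) ∧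
    ∀ m : GaussianInt, DifferentiableOn ℂ (fun s => L s m) {s : ℂ | s ≠ 1}

/-- The generalized Riemann hypothesis for the family of quadratic Hecke `L`-functions. -/
def GRHfor (L : ℂ → GaussianInt → ℂ) : Prop :=
  ∀ m : GaussianInt, m ≠ 0 → ∀ s : ℂ, 0 < s.re → s.re < 1 → L s m = 0 → s.re = 1 / 2

/-- The absolute norm of an ideal of `ℤ[i]`, as a complex number. -/
def idN (I : Ideal GaussianInt) : ℂ := (Nat.card (GaussianInt ⧸ I) : ℂ)

/-- The Dedekind zeta function of `ℚ(i)`. -/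
def IsDedekindZetaK (Z : ℂ → ℂ) : Prop :=
  (∀ s : ℂ, 1 < s.re → Z s = ∑' I : {I : Ideal GaussianInt // I ≠ ⊥}, idN I.1 ^ (-s)) ∧
    DifferentiableOn ℂ Z {s : ℂ | s ≠ 1}

/-- `ζ_K^{(2)}`: the Euler product of `ζ_K` with the factor at the prime `(1+i)` omitted. -/
def zeta2 (Z : ℂ → ℂ) (s : ℂ) : ℂ := Z s * (1 - (2 : ℂ) ^ (-s))

/-- `P(z) = ∏_ϖ (1 + ((N(ϖ)^{z-1/2} − 1)(N(ϖ) + 1))⁻¹)`, over all primes of `ℤ[i]`. -/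
def Pfun (z : ℂ) : ℂ :=
  ∏' I : {I : Ideal GaussianInt // I ≠ ⊥ ∧ I.IsPrime},
    (1 + 1 / ((idN I.1 ^ (z - 1 / 2) - 1) * (idN I.1 + 1)))

/-- The Euler product over odd primes appearing in the ratios-conjecture main term. -/
def ratioEuler (α β : ℂ) : ℂ :=
  ∏' I : {I : Ideal GaussianInt // I ≠ ⊥ ∧ I.IsPrime ∧ (2 : GaussianInt) ∉ I},
    (1 + (idN I.1 ^ (α - β) - 1) / (idN I.1 ^ (1 + α - β) * (idN I.1 ^ (1 + α + β) - 1)))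

/-- `g r n` is the quadratic Gauss sum `g(r,n) = ∑_{x mod n} (x/n) ẽ(rx/n)`:
for any complete residue system `S` modulo `n` it is given by the indicated finite sum. -/
def IsGaussSum (χ : GaussianInt → GaussianInt → ℤ) (g : GaussianInt → GaussianInt → ℂ) : Prop :=
  ∀ r n : GaussianInt, n ≠ 0 → ∀ S : Finset GaussianInt,
    (∀ z : GaussianInt, ∃! x, x ∈ S ∧ n ∣ (z - x)) →
    g r n = ∑ x ∈ S, (χ x n : ℂ) * eT (GaussianInt.toComplex (r * x) / GaussianInt.toComplex n)

/-- A Dirichlet character modulo `q` on `ℤ[i]` (extended by zero). -/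
def IsDirichletChar (q : GaussianInt) (χ : GaussianInt → ℂ) : Prop :=
  χ 1 = 1 ∧ (∀ a b : GaussianInt, χ (a * b) = χ a * χ b) ∧
    (∀ a b : GaussianInt, q ∣ (a - b) → χ a = χ b) ∧
    (∀ a : GaussianInt, IsCoprime a q → ‖χ a‖ = 1) ∧
    (∀ a : GaussianInt, ¬ IsCoprime a q → χ a = 0)

/-- The Gauss sum `g(r,χ) = ∑_{x mod q} χ(x) ẽ(rx/q)` of a Dirichlet character modulo `q`. -/
def IsGaussSumChar (q : GaussianInt) (χ : GaussianInt → ℂ) (g : GaussianInt → ℂ) : Prop :=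
  ∀ r : GaussianInt, ∀ S : Finset GaussianInt,
    (∀ z : GaussianInt, ∃! x, x ∈ S ∧ q ∣ (z - x)) →
    g r = ∑ x ∈ S, χ x * eT (GaussianInt.toComplex (r * x) / GaussianInt.toComplex q)

/-- A primary `n = a + bi` is of type 1 if `a ≡ 1, b ≡ 0 (mod 4)` (else it is of type 2). -/
def IsTypeOne (n : GaussianInt) : Prop := n.re % 4 = 1 ∧ n.im % 4 = 0

/-- `ψ₁`, the principal character modulo `2` on `ℤ[i]`. -/
def psi1 (m : GaussianInt) : ℂ := if IsCoprime m 2 then 1 else 0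

/-- `ψ₂`, the primitive quadratic character modulo `2` on `ℤ[i]`:
`ψ₂(m) = 1` for `m ≡ 1 (mod 2)`, `ψ₂(m) = −1` for `m ≡ i (mod 2)`, and `0` otherwise. -/
def psi2 (m : GaussianInt) : ℂ :=
  if (2 : GaussianInt) ∣ (m - 1) then 1 else if (2 : GaussianInt) ∣ (m - ig) then -1 else 0

/-- `χ̃_n = ψ_j · (·/n)`, where `j` is the type of the primary element `n`. -/
def tchi (χ : GaussianInt → GaussianInt → ℤ) (n m : GaussianInt) : ℂ :=
  (if IsTypeOne n then psi1 m else psi2 m) * (χ m n : ℂ)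

namespace GH

abbrev GI := GaussianInt

lemma omega_dvd_iff (z : GI) : ωg ∣ z ↔ (z.re + z.im) % 2 = 0 := by
  constructor
  · rintro ⟨c, rfl⟩
    simp only [ωg, Zsqrtd.re_mul, Zsqrtd.im_mul]
    omega
  · intro h
    refine ⟨⟨(z.re + z.im) / 2, (z.im - z.re) / 2⟩, ?_⟩
    ext
    · simp only [ωg, Zsqrtd.re_mul]; omega
    · simp only [ωg, Zsqrtd.im_mul]; omega

lemma omega_cube : ωg ^ 3 = (⟨-2, 2⟩ : GI) := by decide

lemma primary_iff (z : GI) : IsPrimary z ↔ z.im % 2 = 0 ∧ (z.re + z.im) % 4 = 1 := by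
  unfold IsPrimary
  rw [omega_cube]
  constructor
  · rintro ⟨c, hc⟩
    have h1 := congrArg Zsqrtd.re hc
    have h2 := congrArg Zsqrtd.im hc
    simp only [Zsqrtd.re_mul, Zsqrtd.im_mul, Zsqrtd.re_sub, Zsqrtd.im_sub, Zsqrtd.re_one, Zsqrtd.im_one] at h1 h2
    omega
  · rintro ⟨h1, h2⟩
    refine ⟨⟨(z.im + 2 * (-((z.re - 1 + z.im) / 4))) / 2, -((z.re - 1 + z.im) / 4)⟩, ?_⟩
    ext
    · simp only [Zsqrtd.re_mul, Zsqrtd.re_sub, Zsqrtd.re_one]; omega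
    · simp only [Zsqrtd.im_mul, Zsqrtd.im_sub, Zsqrtd.im_one]; omega

lemma primary_one : IsPrimary 1 := by rw [primary_iff]; decide

lemma primary_odd {z : GI} (h : IsPrimary z) : ¬ ωg ∣ z := by
  rw [primary_iff] at h; rw [omega_dvd_iff]; omega

lemma primary_ne_zero {z : GI} (h : IsPrimary z) : z ≠ 0 := by
  rintro rfl; rw [primary_iff] at h; simp at h

lemma primary_mul {a b : GI} (ha : IsPrimary a) (hb : IsPrimary b) : IsPrimary (a * b) := by
  unfold IsPrimary at *
  have : a * b - 1 = (a - 1) * b + (b - 1) := by ring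
  rw [this]; exact dvd_add (ha.mul_right b) hb

lemma primary_of_mul {a b : GI} (ha : IsPrimary a) (hab : IsPrimary (a * b)) : IsPrimary b := by
  unfold IsPrimary at *
  have : b - 1 = (a * b - 1) - (a - 1) * b := by ring
  rw [this]; exact dvd_sub hab (ha.mul_right b)

lemma odd_of_dvd {a b : GI} (h : a ∣ b) (hb : ¬ ωg ∣ b) : ¬ ωg ∣ a := fun h' => hb (h'.trans h)

lemma exists_primary_assoc {z : GI} (h : ¬ ωg ∣ z) : ∃ u : GI, IsUnit u ∧ IsPrimary (z * u) := by
  rw [omega_dvd_iff] at h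
  have hi : IsUnit (⟨0,1⟩ : GI) := ⟨⟨⟨0,1⟩, ⟨0,-1⟩, by decide, by decide⟩, rfl⟩
  have hi' : IsUnit (⟨0,-1⟩ : GI) := ⟨⟨⟨0,-1⟩, ⟨0,1⟩, by decide, by decide⟩, rfl⟩
  by_cases h1 : IsPrimary z
  · exact ⟨1, isUnit_one, by simpa using h1⟩
  by_cases h2 : IsPrimary (z * -1)
  · exact ⟨-1, isUnit_one.neg, h2⟩
  by_cases h3 : IsPrimary (z * ⟨0,1⟩)
  · exact ⟨_, hi, h3⟩
  refine ⟨_, hi', ?_⟩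
  simp only [primary_iff, Zsqrtd.re_mul, Zsqrtd.im_mul, mul_neg, mul_one, Zsqrtd.re_neg, Zsqrtd.im_neg] at *
  omega

lemma norm_eq (z : GI) : Zsqrtd.norm z = z.re * z.re + z.im * z.im := by
  simp [Zsqrtd.norm_def]

lemma unit_norm {u : GI} (h : IsUnit u) : Zsqrtd.norm u = 1 := by
  have := Zsqrtd.norm_eq_one_iff.mpr h
  have h2 := GaussianInt.norm_nonneg u
  omega

lemma unit_cases {u : GI} (h : IsUnit u) : u = 1 ∨ u = -1 ∨ u = ⟨0,1⟩ ∨ u = ⟨0,-1⟩ := by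
  have h1 := unit_norm h
  rw [norm_eq] at h1
  have a1 : u.re ≤ 1 := by nlinarith [mul_self_nonneg u.im, mul_self_nonneg u.re]
  have a2 : -1 ≤ u.re := by nlinarith [mul_self_nonneg u.im, mul_self_nonneg u.re]
  have a3 : u.im ≤ 1 := by nlinarith [mul_self_nonneg u.im, mul_self_nonneg u.re]
  have a4 : -1 ≤ u.im := by nlinarith [mul_self_nonneg u.im, mul_self_nonneg u.re]
  obtain ⟨x, y⟩ := u
  simp only at *
  interval_cases x <;> interval_cases y <;> simp_all <;> decide

lemma primary_unit {u : GI} (h : IsUnit u) (hp : IsPrimary u) : u = 1 := by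
  rcases unit_cases h with rfl | rfl | rfl | rfl
  · rfl
  all_goals (rw [primary_iff] at hp; simp at hp)

lemma primary_assoc {a b : GI} (ha : IsPrimary a) (hb : IsPrimary b) (h : Associated a b) : a = b := by
  obtain ⟨u, rfl⟩ := h
  have := primary_unit u.isUnit (primary_of_mul ha hb)
  rw [this, mul_one]

lemma norm_pos' {z : GI} (h : z ≠ 0) : 0 < Zsqrtd.norm z := GaussianInt.norm_pos.mpr h

lemma Nm_mul (a b : GI) : Nm (a * b) = Nm a * Nm b := by simp [Nm, Zsqrtd.norm_mul]
lemma Nm_nonneg (a : GI) : 0 ≤ Nm a := by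
  unfold Nm; exact_mod_cast GaussianInt.norm_nonneg a
lemma one_le_Nm {a : GI} (h : a ≠ 0) : 1 ≤ Nm a := by
  unfold Nm; exact_mod_cast norm_pos' h
lemma Nm_pos {a : GI} (h : a ≠ 0) : 0 < Nm a := lt_of_lt_of_le one_pos (one_le_Nm h)
@[simp] lemma Nm_one : Nm 1 = 1 := by simp [Nm]
@[simp] lemma Nm_zero : Nm 0 = 0 := by simp [Nm]
lemma Nm_pow (a : GI) (k : ℕ) : Nm (a ^ k) = Nm a ^ k := by
  induction k with
  | zero => simp
  | succ k ih => rw [pow_succ, Nm_mul, ih, pow_succ]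
lemma Nm_eq (a : GI) : Nm a = (a.re : ℝ)^2 + (a.im : ℝ)^2 := by
  simp [Nm, norm_eq]; ring

/-- primary primes -/
structure PPrime (p : GI) : Prop where
  prime : Prime p
  prim : IsPrimary p

lemma exists_pprime_dvd {n : GI} (hn : IsPrimary n) (h1 : n ≠ 1) : ∃ p, PPrime p ∧ p ∣ n := by
  have hu : ¬ IsUnit n := fun h => h1 (primary_unit h hn)
  obtain ⟨p, hp, hpn⟩ := WfDvdMonoid.exists_irreducible_factor hu (primary_ne_zero hn)
  obtain ⟨u, hu, hpu⟩ := exists_primary_assoc (odd_of_dvd hpn (primary_odd hn))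
  have ha : Associated p (p * u) := ⟨hu.unit, rfl⟩
  exact ⟨p * u, ⟨ha.prime hp.prime, hpu⟩, (ha.symm.dvd).trans hpn⟩

lemma norm_gt_one {p : GI} (hp : Prime p) : 1 < Zsqrtd.norm p := by
  have h0 := norm_pos' hp.ne_zero
  rcases lt_or_eq_of_le (Int.add_one_le_of_lt h0) with h | h
  · simpa using h
  · exfalso
    apply hp.not_isUnit
    apply Zsqrtd.norm_eq_one_iff.mp
    omega

theorem prim_induct {motive : GI → Prop} (h1 : motive 1)
    (hm : ∀ p m, PPrime p → IsPrimary m → motive m → motive (p * m)) :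
    ∀ n, IsPrimary n → motive n := by
  intro n
  induction' hk : (Zsqrtd.norm n).toNat using Nat.strong_induction_on with k ih generalizing n
  intro hn
  by_cases hn1 : n = 1
  · rw [hn1]; exact h1
  obtain ⟨p, hp, m, rfl⟩ := exists_pprime_dvd hn hn1
  have hmp := primary_of_mul hp.prim hn
  refine hm p m hp hmp (ih _ ?_ m rfl hmp)
  have := norm_gt_one hp.prime
  have h2 := norm_pos' (primary_ne_zero hmp)
  rw [← hk, Zsqrtd.norm_mul]
  have : Zsqrtd.norm m < p.norm * m.norm := by nlinarith
  omega

end GH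

namespace GH

section Sym
variable {χ : GaussianInt → GaussianInt → ℤ}

lemma pprime_not_dvd_two {p : GI} (hp : PPrime p) : ¬ p ∣ 2 := by
  intro h
  have h2 : (2 : GI) = ωg * ⟨1, -1⟩ := by decide
  rw [h2] at h
  have key : ∀ z : GI, Zsqrtd.norm z = 2 → ¬ p ∣ z := by
    intro z hz hd
    have h3 : p.norm ∣ z.norm := by
      obtain ⟨c, rfl⟩ := hd; exact ⟨c.norm, Zsqrtd.norm_mul p c⟩
    rw [hz] at h3
    have h4 := norm_gt_one hp.prime
    have h5 := Int.le_of_dvd (by norm_num) h3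
    have h6 : p.norm = 2 := by omega
    have h7 := primary_odd hp.prim
    rw [omega_dvd_iff] at h7
    rw [norm_eq] at h6
    have : (p.re * p.re + p.im * p.im) % 2 = (p.re + p.im) % 2 := by
      rw [Int.add_emod, Int.mul_emod, Int.mul_emod p.im p.im, Int.add_emod p.re]
      rcases Int.emod_two_eq_zero_or_one p.re with h | h <;>
      rcases Int.emod_two_eq_zero_or_one p.im with h' | h' <;> rw [h, h'] <;> norm_num
    omega
  rcases hp.prime.dvd_or_dvd h with h | h
  · exact key _ (by decide) h
  · exact key _ (by decide) h

lemma int_eq_of_dvd {p : GI} (hp : PPrime p) {x y : ℤ} (hx : x = 1 ∨ x = -1) (hy : y = 1 ∨ y = -1)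
    (h : p ∣ ((x : GI) - (y : GI))) : x = y := by
  have h2 := pprime_not_dvd_two hp
  rcases hx with rfl | rfl <;> rcases hy with rfl | rfl
  · rfl
  · exfalso; apply h2; convert h using 1; push_cast; norm_num
  · exfalso; apply h2; rw [← dvd_neg]; convert h using 1; push_cast; norm_num
  · rfl


lemma chi_val (hχ : IsQuadSym χ) {p a : GI} (hp : PPrime p) (h : ¬ p ∣ a) : χ a p = 1 ∨ χ a p = -1 :=
  (hχ.val_prime p a hp.prime (primary_odd hp.prim) h).1
lemma chi_cong (hχ : IsQuadSym χ) {p a : GI} (hp : PPrime p) (h : ¬ p ∣ a) :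
    p ∣ (a ^ (((Zsqrtd.norm p).toNat - 1) / 2) - (χ a p : GaussianInt)) :=
  (hχ.val_prime p a hp.prime (primary_odd hp.prim) h).2

/-- characterisation -/
lemma chi_unique (hχ : IsQuadSym χ) {p a : GI} (hp : PPrime p) (h : ¬ p ∣ a) {y : ℤ} (hy : y = 1 ∨ y = -1)
    (hd : p ∣ (a ^ (((Zsqrtd.norm p).toNat - 1) / 2) - (y : GaussianInt))) : χ a p = y := by
  apply int_eq_of_dvd hp (chi_val hχ hp h) hy
  have := dvd_sub hd (chi_cong hχ hp h)
  convert this using 1; ring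

lemma chi_mul_prime (hχ : IsQuadSym χ) {p : GI} (hp : PPrime p) (a b : GI) : χ (a * b) p = χ a p * χ b p := by
  by_cases ha : p ∣ a
  · rw [hχ.zero_of_dvd p a hp.prime ha, hχ.zero_of_dvd p _ hp.prime (ha.mul_right b), zero_mul]
  by_cases hb : p ∣ b
  · rw [hχ.zero_of_dvd p b hp.prime hb, hχ.zero_of_dvd p _ hp.prime (hb.mul_left a), mul_zero]
  have hab : ¬ p ∣ a * b := fun h => (hp.prime.dvd_or_dvd h).elim ha hb
  apply chi_unique hχ hp hab
  · rcases chi_val hχ hp ha with h | h <;> rcases chi_val hχ hp hb with h' | h' <;> simp [h, h']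
  · have h1 := chi_cong hχ hp ha
    have h2 := chi_cong hχ hp hb
    rw [mul_pow]; push_cast
    set k := ((Zsqrtd.norm p).toNat - 1) / 2
    have := dvd_add (h1.mul_right (b ^ k)) (h2.mul_left (χ a p : GI))
    convert this using 1; ring

lemma chi_one_prime (hχ : IsQuadSym χ) {p : GI} (hp : PPrime p) : χ 1 p = 1 := by
  apply chi_unique hχ hp (fun h => hp.prime.not_isUnit (isUnit_of_dvd_one h)) (Or.inl rfl)
  simp

lemma chi_per_prime (hχ : IsQuadSym χ) {p : GI} (hp : PPrime p) {a b : GI} (h : p ∣ a - b) : χ a p = χ b p := by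
  by_cases ha : p ∣ b
  · have ha' : p ∣ a := by simpa using dvd_add h ha
    rw [hχ.zero_of_dvd p b hp.prime ha, hχ.zero_of_dvd p a hp.prime ha']
  have ha' : ¬ p ∣ a := fun h' => ha (by simpa using dvd_sub h' h)
  apply chi_unique hχ hp ha' (chi_val hχ hp ha)
  have := dvd_add (h.trans (sub_dvd_pow_sub_pow a b (((Zsqrtd.norm p).toNat - 1) / 2))) (chi_cong hχ hp ha)
  convert this using 1; ring

lemma chi_den_mul (hχ : IsQuadSym χ) (a : GI) {m n : GI} (hm : IsPrimary m) (hn : IsPrimary n) :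
    χ a (m * n) = χ a m * χ a n := hχ.mul_den a m n (primary_odd hm) (primary_odd hn)

lemma chi_den_one (hχ : IsQuadSym χ) (a : GI) : χ a 1 = 1 := hχ.unit_den a 1 isUnit_one

lemma chi_mul (hχ : IsQuadSym χ) (a b : GI) {n : GI} (hn : IsPrimary n) : χ (a * b) n = χ a n * χ b n := by
  revert n
  apply prim_induct
  · simp [chi_den_one hχ]
  · intro p m hp hm ih
    rw [chi_den_mul hχ _ hp.prim hm, chi_den_mul hχ _ hp.prim hm, chi_den_mul hχ _ hp.prim hm,
      ih, chi_mul_prime hχ hp]; ring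

lemma chi_one (hχ : IsQuadSym χ) {n : GI} (hn : IsPrimary n) : χ 1 n = 1 := by
  revert n
  apply prim_induct
  · simp [chi_den_one hχ]
  · intro p m hp hm ih
    rw [chi_den_mul hχ _ hp.prim hm, ih, chi_one_prime hχ hp, one_mul]

lemma chi_per (hχ : IsQuadSym χ) {n : GI} (hn : IsPrimary n) : ∀ {a b : GI}, n ∣ a - b → χ a n = χ b n := by
  revert hn
  refine prim_induct (motive := fun n => ∀ {a b : GI}, n ∣ a - b → χ a n = χ b n) ?_ ?_ n
  · simp [chi_den_one hχ]
  · intro p m hp hm ih a b h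
    rw [chi_den_mul hχ _ hp.prim hm, chi_den_mul hχ _ hp.prim hm,
      ih ((dvd_mul_left m p).trans h), chi_per_prime hχ hp ((dvd_mul_right p m).trans h)]

lemma chi_cases (hχ : IsQuadSym χ) {n : GI} (hn : IsPrimary n) (a : GI) :
    (χ a n = 0 ∧ ∃ p, PPrime p ∧ p ∣ n ∧ p ∣ a) ∨ ((χ a n = 1 ∨ χ a n = -1) ∧ IsCoprime a n) := by
  revert hn
  refine prim_induct (motive := fun n => (χ a n = 0 ∧ ∃ p, PPrime p ∧ p ∣ n ∧ p ∣ a) ∨ ((χ a n = 1 ∨ χ a n = -1) ∧ IsCoprime a n)) ?_ ?_ n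
  · right; simp [chi_den_one hχ, isCoprime_one_right]
  · intro p m hp hm ih
    rw [chi_den_mul hχ _ hp.prim hm]
    by_cases h : p ∣ a
    · left
      rw [hχ.zero_of_dvd p a hp.prime h]
      exact ⟨zero_mul _, p, hp, dvd_mul_right _ _, h⟩
    · rcases ih with ⟨h0, q, hq, h1, h2⟩ | ⟨h0, h1⟩
      · left; rw [h0]; exact ⟨mul_zero _, q, hq, h1.mul_left _, h2⟩
      · right
        constructor
        · rcases chi_val hχ hp h with h | h <;> rcases h0 with h' | h' <;> simp [h, h']
        · apply IsCoprime.mul_right _ h1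
          exact (((hp.prime.irreducible).coprime_iff_not_dvd).mpr h).symm

lemma chi_zero (hχ : IsQuadSym χ) {n a p : GI} (hn : IsPrimary n) (hp : PPrime p) (h1 : p ∣ n) (h2 : p ∣ a) : χ a n = 0 := by
  rcases chi_cases hχ hn a with h | h
  · exact h.1
  · exact absurd (h.2.isUnit_of_dvd' h2 h1) hp.prime.not_isUnit

lemma chi_abs_le (hχ : IsQuadSym χ) {n : GI} (hn : IsPrimary n) (a : GI) : |χ a n| ≤ 1 := by
  rcases chi_cases hχ hn a with ⟨h, _⟩ | ⟨h | h, _⟩ <;> simp [h]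

lemma chi_norm_le (hχ : IsQuadSym χ) {n : GI} (hn : IsPrimary n) (a : GI) : ‖(χ a n : ℂ)‖ ≤ 1 := by
  have := chi_abs_le hχ hn a
  rw [Complex.norm_intCast]; exact_mod_cast this

lemma chi_norm_le' (hχ : IsQuadSym χ) {n : GI} (hn : IsPrimary n) (a : GI) : |(χ a n : ℝ)| ≤ 1 := by
  have := chi_abs_le hχ hn a
  exact_mod_cast this

lemma chi_sq (hχ : IsQuadSym χ) {n : GI} (hn : IsPrimary n) {a : GI} (h : IsCoprime a n) : χ a n * χ a n = 1 := by
  rcases chi_cases hχ hn a with ⟨_, p, hp, h1, h2⟩ | ⟨h | h, _⟩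
  · exact absurd (h.isUnit_of_dvd' h2 h1) hp.prime.not_isUnit
  · simp [h]
  · simp [h]

lemma chi_unit_sq (hχ : IsQuadSym χ) {n : GI} (hn : IsPrimary n) {a : GI} (h : IsUnit a) : χ a n * χ a n = 1 :=
  chi_sq hχ hn (by obtain ⟨u, rfl⟩ := h; exact ⟨↑u⁻¹, 0, by simp⟩)

end Sym
end GH

namespace GH

section Recip
variable {χ : GaussianInt → GaussianInt → ℤ}

lemma norm_dvd {a b : GI} (h : a ∣ b) : a.norm ∣ b.norm := by
  obtain ⟨c, rfl⟩ := h; exact ⟨c.norm, Zsqrtd.norm_mul a c⟩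

/-- split prime of norm `P` -/
structure Split (p : GI) (P : ℕ) : Prop where
  pp : PPrime p
  prime : P.Prime
  norm : p.norm = P
  mod4 : P % 4 = 1

structure Inert (p : GI) (Q : ℕ) : Prop where
  pp : PPrime p
  prime : Q.Prime
  eq : p = -(Q : GI)
  mod4 : Q % 4 = 3

lemma primary_norm_mod {p : GI} (hp : IsPrimary p) : p.norm % 4 = 1 := by
  rw [primary_iff] at hp
  rw [norm_eq]
  obtain ⟨h1, h2⟩ := hp
  obtain ⟨y, hy⟩ : ∃ y, p.im = 2 * y := ⟨p.im / 2, by omega⟩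
  obtain ⟨x, hx⟩ : ∃ x, p.re = 2 * x + 1 := ⟨p.re / 2, by omega⟩
  rw [hx, hy]; ring_nf; omega

lemma pprime_classify {p : GI} (hp : PPrime p) : (∃ P, Split p P) ∨ (∃ Q, Inert p Q) := by
  -- p divides a rational prime
  have h0 : p ∣ ((p.norm.toNat : ℕ) : GI) := by
    have h1 : ((p.norm.toNat : ℕ) : ℤ) = p.norm := Int.toNat_of_nonneg (GaussianInt.norm_nonneg p)
    have h2 : ((p.norm.toNat : ℕ) : GI) = ((p.norm.toNat : ℤ) : GI) := by push_cast; rfl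
    rw [h2, h1, Zsqrtd.norm_eq_mul_conj]
    exact dvd_mul_right _ _
  have hex : ∃ q : ℕ, q.Prime ∧ p ∣ (q : GI) := by
    have key : ∀ k : ℕ, k ≠ 0 → p ∣ (k : GI) → ∃ q : ℕ, q.Prime ∧ p ∣ (q : GI) := by
      intro k
      induction k using Nat.recOnMul with
      | zero => simp
      | one => intro _ h; exact absurd (isUnit_of_dvd_one (by simpa using h)) hp.prime.not_isUnit
      | prime q hq => intro _ h; exact ⟨q, hq, h⟩
      | mul a b iha ihb =>
        intro h h'
        rw [Nat.cast_mul] at h'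
        rcases hp.prime.dvd_or_dvd h' with h1 | h1
        · exact iha (by aesop) h1
        · exact ihb (by aesop) h1
    apply key _ _ h0
    have := norm_gt_one hp.prime
    omega
  obtain ⟨q, hq, hpq⟩ := hex
  have hn := norm_dvd hpq
  have hqn : Zsqrtd.norm (q : GI) = (q : ℤ) ^ 2 := by
    rw [norm_eq]; simp; ring
  rw [hqn] at hn
  have hn' : p.norm.natAbs ∣ q ^ 2 := by
    have := Int.natAbs_dvd_natAbs.mpr hn
    simpa [Int.natAbs_pow] using this
  have hg := norm_gt_one hp.prime
  have h4 := primary_norm_mod hp.prim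
  rcases (Nat.dvd_prime_pow hq).mp hn' with ⟨k, hk, hk'⟩
  interval_cases k
  · simp at hk'; omega
  · left
    have e : p.norm = q := by simp at hk'; omega
    exact ⟨q, hp, hq, e, by omega⟩
  · right
    obtain ⟨c, hc⟩ := hpq
    have e1 : p.norm = (q : ℤ) ^ 2 := by
      rw [← Int.natAbs_of_nonneg (GaussianInt.norm_nonneg p), hk']; push_cast; rfl
    have e2 : p.norm * c.norm = (q : ℤ) ^ 2 := by rw [← Zsqrtd.norm_mul, ← hc, hqn]
    have hq0 : (q : ℤ) ^ 2 ≠ 0 := by have := hq.pos; positivity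
    have e3 : c.norm = 1 := by
      rw [e1] at e2; exact mul_left_cancel₀ hq0 (by rw [e2, mul_one])
    have hcu : IsUnit c := by
      apply Zsqrtd.norm_eq_one_iff.mp; rw [e3]; rfl
    have hprimeq : Prime (q : GI) := by
      have ha : Associated p (q : GI) := ⟨hcu.unit, by rw [hc]; rfl⟩
      exact ha.prime hp.prime
    have : Fact q.Prime := ⟨hq⟩
    have hq3 := (GaussianInt.prime_iff_mod_four_eq_three_of_nat_prime q).mp hprimeq
    refine ⟨q, hp, hq, ?_, hq3⟩
    have hpp := hp.prim
    rw [primary_iff] at hpp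
    have r1 := congrArg Zsqrtd.re hc
    have r2 := congrArg Zsqrtd.im hc
    rcases unit_cases hcu with rfl | rfl | rfl | rfl
    · rw [mul_one] at hc; rw [← hc] at hpp; simp at hpp; omega
    · rw [hc]; simp
    · simp only [Zsqrtd.re_mul, Zsqrtd.im_mul, Zsqrtd.re_natCast, Zsqrtd.im_natCast] at r1 r2; omega
    · simp only [Zsqrtd.re_mul, Zsqrtd.im_mul, Zsqrtd.re_natCast, Zsqrtd.im_natCast] at r1 r2; omega

lemma split_dvd_int {p : GI} {P : ℕ} (hp : Split p P) (x : ℤ) : p ∣ (x : GI) ↔ (P : ℤ) ∣ x := by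
  constructor
  · intro h
    have := norm_dvd h
    rw [hp.norm, norm_eq] at this
    simp at this
    rcases (Nat.prime_iff_prime_int.mp hp.prime).dvd_or_dvd this with h | h <;> exact h
  · rintro ⟨c, rfl⟩
    push_cast
    have : ((P : ℤ) : GI) = p * star p := by rw [← hp.norm, Zsqrtd.norm_eq_mul_conj]
    have h2 : ((P : ℕ) : GI) = p * star p := by rw [← this]; push_cast; rfl
    rw [h2, mul_assoc]; exact dvd_mul_right _ _

lemma split_chi_int (hχ : IsQuadSym χ) {p : GI} {P : ℕ} (hp : Split p P) (x : ℤ) :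
    χ (x : GI) p = jacobiSym x P := by
  have : Fact P.Prime := ⟨hp.prime⟩
  rw [← jacobiSym.legendreSym.to_jacobiSym]
  by_cases h : p ∣ (x : GI)
  · rw [hχ.zero_of_dvd p _ hp.pp.prime h]
    rw [split_dvd_int hp] at h
    symm; rw [legendreSym.eq_zero_iff]
    exact (ZMod.intCast_zmod_eq_zero_iff_dvd x P).mpr h
  · have h' := h
    rw [split_dvd_int hp] at h'
    have hx : (x : ZMod P) ≠ 0 := fun h => h' ((ZMod.intCast_zmod_eq_zero_iff_dvd x P).mp h)
    apply chi_unique hχ hp.pp h (legendreSym.eq_one_or_neg_one P hx)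
    have e := legendreSym.eq_pow P x
    have hN : (p.norm.toNat - 1) / 2 = P / 2 := by
      have := hp.mod4
      rw [hp.norm]; simp; omega
    rw [hN]
    have : p ∣ (((x ^ (P / 2) - legendreSym P x : ℤ)) : GI) := by
      rw [split_dvd_int hp, ← ZMod.intCast_zmod_eq_zero_iff_dvd]
      push_cast; rw [e, sub_self]
    convert this using 1; push_cast; ring

lemma jac_flip {c : ℤ} (hc : c % 2 = 1) {P : ℕ} (hP : P % 4 = 1) :
    jacobiSym c P = jacobiSym P c.natAbs := by
  have h1 : jacobiSym (c.natAbs : ℤ) P = jacobiSym P c.natAbs :=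
    jacobiSym.quadratic_reciprocity_one_mod_four' (by rw [Nat.odd_iff]; omega) hP
  rw [← h1]
  rcases Int.natAbs_eq c with h | h
  · rw [← h]
  · conv_lhs => rw [h]
    rw [jacobiSym.neg _ (by rw [Nat.odd_iff]; omega), ZMod.χ₄_nat_one_mod_four hP, one_mul]

lemma jac_sq_add {e f : ℤ} {M : ℕ} (h : (M : ℤ) = e ^ 2 + f ^ 2) (h0 : jacobiSym M e.natAbs ≠ 0) :
    jacobiSym M e.natAbs = 1 := by
  have h1 : jacobiSym M e.natAbs = jacobiSym (f ^ 2) e.natAbs := by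
    apply jacobiSym.mod_left'
    rw [h]
    exact Int.ModEq.symm ((Int.modEq_iff_dvd).mpr (by
      rw [add_sub_cancel_right]; exact (Int.natAbs_dvd.mpr (dvd_pow_self e two_ne_zero))))
  rw [h1, jacobiSym.pow_left] at h0 ⊢
  rcases jacobiSym.trichotomy f e.natAbs with h | h | h
  · rw [h] at h0; simp at h0
  · rw [h]; norm_num
  · rw [h]; norm_num

/-- `a * z ≡ ac+bd` modulo a split prime `a+bi`. -/
lemma split_red {p : GI} (z : GI) :
    p ∣ ((p.re : GI) * z - ((p.re * z.re + p.im * z.im : ℤ) : GI)) := by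
  refine ⟨⟨0, z.im⟩, ?_⟩
  ext
  · simp [Zsqrtd.re_mul]
  · simp [Zsqrtd.im_mul]

lemma split_parity {p : GI} (hp : IsPrimary p) : p.re % 2 = 1 ∧ p.im % 2 = 0 := by
  rw [primary_iff] at hp; omega

lemma split_coprime_re {p : GI} {P : ℕ} (hp : Split p P) : ¬ (P : ℤ) ∣ p.re := by
  intro h
  have hn := hp.norm
  rw [norm_eq] at hn
  have h2 : (P : ℤ) ∣ p.im * p.im := by
    have : p.im * p.im = P - p.re * p.re := by rw [← hn]; ring
    rw [this]; exact dvd_sub (dvd_refl _) (h.mul_right _)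
  have h3 : (P : ℤ) ∣ p.im := by
    rcases (Nat.prime_iff_prime_int.mp hp.prime).dvd_or_dvd h2 with h | h <;> exact h
  have h4 : (P : ℤ) * P ∣ P := by
    conv_rhs => rw [← hn]
    exact dvd_add (mul_dvd_mul h h) (mul_dvd_mul h3 h3)
  have h5 := Int.le_of_dvd (by exact_mod_cast hp.prime.pos) h4
  have h6 : (2 : ℤ) ≤ P := by exact_mod_cast hp.prime.two_le
  nlinarith

lemma split_chi_re (hχ : IsQuadSym χ) {p : GI} {P : ℕ} (hp : Split p P) : χ (p.re : GI) p = 1 := by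
  have hpar := split_parity hp.pp.prim
  have h0 : jacobiSym p.re P ≠ 0 := by
    rw [← split_chi_int hχ hp]
    have : ¬ p ∣ (p.re : GI) := by rw [split_dvd_int hp]; exact split_coprime_re hp
    rcases chi_val hχ hp.pp this with h | h <;> rw [h] <;> norm_num
  rw [split_chi_int hχ hp]
  rw [jac_flip hpar.1 hp.mod4] at h0 ⊢
  apply jac_sq_add (f := p.im) _ h0
  rw [← hp.norm, norm_eq]; ring

/-- symbol at split primes -/
lemma split_chi (hχ : IsQuadSym χ) {p : GI} {P : ℕ} (hp : Split p P) (z : GI) :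
    χ z p = jacobiSym (p.re * z.re + p.im * z.im) P := by
  rw [← split_chi_int hχ hp, ← chi_per_prime hχ hp.pp (split_red z), chi_mul_prime hχ hp.pp,
    split_chi_re hχ hp, one_mul]

lemma inert_norm {q : GI} {Q : ℕ} (hq : Inert q Q) : q.norm = (Q : ℤ) ^ 2 := by
  rw [hq.eq, norm_eq]; simp; ring

lemma inert_dvd_int {q : GI} {Q : ℕ} (hq : Inert q Q) (x : ℤ) : q ∣ (x : GI) ↔ (Q : ℤ) ∣ x := by
  rw [hq.eq, neg_dvd]
  have : ((Q : ℕ) : GI) = ((Q : ℤ) : GI) := by push_cast; rfl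
  rw [this]
  exact Zsqrtd.intCast_dvd_intCast Q x

lemma inert_dvd_norm {q : GI} {Q : ℕ} (hq : Inert q Q) (z : GI) : q ∣ z ↔ (Q : ℤ) ∣ z.norm := by
  rw [← inert_dvd_int hq, Zsqrtd.norm_eq_mul_conj]
  constructor
  · intro h; exact h.mul_right _
  · intro h
    rcases hq.pp.prime.dvd_or_dvd h with h | h
    · exact h
    · have : star q ∣ star (star z) := by
        obtain ⟨c, hc⟩ := h; exact ⟨star c, by rw [hc, star_mul, mul_comm]⟩
      rw [star_star, hq.eq] at this
      rw [hq.eq]; simpa using this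

lemma inert_frob {q : GI} {Q : ℕ} (hq : Inert q Q) (z : GI) : q ∣ (z ^ Q - star z) := by
  have hq4 := hq.mod4
  obtain ⟨r, hr⟩ := exists_add_pow_prime_eq hq.prime (z.re : GI) (⟨0, z.im⟩ : GI)
  have hz : (z.re : GI) + ⟨0, z.im⟩ = z := by ext <;> simp
  rw [hz] at hr
  have hI : (⟨0, z.im⟩ : GI) = (z.im : GI) * ig := by ext <;> simp [ig]
  have hi2 : ig ^ 2 = -1 := by decide
  have hQ : Q = 4 * (Q / 4) + 3 := by omega
  have hiQ : ig ^ Q = - ig := by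
    rw [hQ, pow_add, pow_mul]
    have h4 : ig ^ 4 = 1 := by decide
    rw [h4, one_pow, one_mul]; decide
  have hst : star z = (z.re : GI) - (z.im : GI) * ig := by ext <;> simp [ig]
  have : Fact Q.Prime := ⟨hq.prime⟩
  have fl : ∀ x : ℤ, q ∣ ((x : GI) ^ Q - x) := by
    intro x
    have : q ∣ ((x ^ Q - x : ℤ) : GI) := by
      rw [inert_dvd_int hq, ← ZMod.intCast_zmod_eq_zero_iff_dvd]
      push_cast; rw [ZMod.pow_card, sub_self]
    simpa using this
  have hqQ : q ∣ (Q : GI) := by rw [hq.eq]; exact neg_dvd.mpr dvd_rfl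
  rw [hr, hI, mul_pow, hiQ, hst]
  have := dvd_add (dvd_sub (fl z.re) ((fl z.im).mul_right ig)) (hqQ.mul_right ((z.re : GI) * ((z.im : GI) * ig) * r))
  convert this using 1; ring

lemma inert_chi (hχ : IsQuadSym χ) {q : GI} {Q : ℕ} (hq : Inert q Q) (z : GI) :
    χ z q = jacobiSym z.norm Q := by
  have : Fact Q.Prime := ⟨hq.prime⟩
  have hq4 := hq.mod4
  rw [← jacobiSym.legendreSym.to_jacobiSym]
  by_cases h : q ∣ z
  · rw [hχ.zero_of_dvd q _ hq.pp.prime h]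
    rw [inert_dvd_norm hq] at h
    symm; rw [legendreSym.eq_zero_iff]
    exact (ZMod.intCast_zmod_eq_zero_iff_dvd _ Q).mpr h
  · have h' := h
    rw [inert_dvd_norm hq] at h'
    have hx : (z.norm : ZMod Q) ≠ 0 := fun h => h' ((ZMod.intCast_zmod_eq_zero_iff_dvd _ Q).mp h)
    apply chi_unique hχ hq.pp h (legendreSym.eq_one_or_neg_one Q hx)
    have e := legendreSym.eq_pow Q z.norm
    have hN : (q.norm.toNat - 1) / 2 = (Q + 1) * (Q / 2) := by
      have h1 : q.norm.toNat = Q ^ 2 := by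
        rw [inert_norm hq]; exact_mod_cast Int.toNat_natCast (Q ^ 2)
      rw [h1]
      obtain ⟨k, hk⟩ : ∃ k, Q = 2 * k + 1 := ⟨Q / 2, by omega⟩
      have : Q / 2 = k := by omega
      rw [this]
      have : Q ^ 2 - 1 = 2 * ((Q + 1) * k) := by
        rw [hk]; have : (2 * k + 1) ^ 2 = 2 * ((2 * k + 1 + 1) * k) + 1 := by ring
        omega
      omega
    have hf : q ∣ z ^ (Q + 1) - (z.norm : GI) := by
      rw [Zsqrtd.norm_eq_mul_conj, pow_succ, mul_comm, ← mul_sub]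
      exact (inert_frob hq z).mul_left _
    rw [hN, pow_mul]
    have h1 := hf.trans (sub_dvd_pow_sub_pow (z ^ (Q + 1)) (z.norm : GI) (Q / 2))
    have h2 : q ∣ (((z.norm ^ (Q / 2) - legendreSym Q z.norm : ℤ)) : GI) := by
      rw [inert_dvd_int hq, ← ZMod.intCast_zmod_eq_zero_iff_dvd]
      push_cast; rw [e, sub_self]
    have := dvd_add h1 h2
    convert this using 1; push_cast; ring

lemma recip_split (hχ : IsQuadSym χ) {p q : GI} {P Q : ℕ} (hp : Split p P) (hq : Split q Q)
    (hpq : p ≠ q) : χ q p = χ p q := by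
  have nd : ∀ {x y : GI}, PPrime x → PPrime y → x ≠ y → ¬ x ∣ y := fun hx hy hne h =>
    hne (primary_assoc hx.prim hy.prim (hx.prime.associated_of_dvd hy.prime h))
  have h1 := chi_val hχ hp.pp (nd hp.pp hq.pp hpq)
  have h2 := chi_val hχ hq.pp (nd hq.pp hp.pp hpq.symm)
  have e : q.re * p.re + q.im * p.im = p.re * q.re + p.im * q.im := by ring
  rw [split_chi hχ hp] at h1 ⊢
  rw [split_chi hχ hq, e] at h2 ⊢
  have hpp := split_parity hp.pp.prim
  have hqp := split_parity hq.pp.prim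
  have hodd : (p.re * q.re + p.im * q.im) % 2 = 1 := by
    rw [Int.add_emod, Int.mul_emod, Int.mul_emod p.im, hpp.1, hqp.1, hpp.2]; norm_num
  have hprod : jacobiSym (p.re * q.re + p.im * q.im) P * jacobiSym (p.re * q.re + p.im * q.im) Q = 1 := by
    have hne : jacobiSym (p.re * q.re + p.im * q.im) P * jacobiSym (p.re * q.re + p.im * q.im) Q ≠ 0 := by
      rcases h1 with h | h <;> rcases h2 with h' | h' <;> rw [h, h'] <;> norm_num
    rw [jac_flip hodd hp.mod4, jac_flip hodd hq.mod4, ← jacobiSym.mul_left, ← Nat.cast_mul] at hne ⊢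
    apply jac_sq_add (f := p.re * q.im - p.im * q.re) _ hne
    push_cast
    rw [← hp.norm, ← hq.norm, norm_eq, norm_eq]; ring
  rcases h1 with h | h <;> rcases h2 with h' | h' <;> rw [h, h'] at hprod ⊢ <;> norm_num at hprod

lemma recip_split_inert (hχ : IsQuadSym χ) {p q : GI} {P Q : ℕ} (hp : Split p P) (hq : Inert q Q) :
    χ q p = χ p q := by
  have hq4 := hq.mod4
  rw [inert_chi hχ hq, hp.norm]
  have : q = ((-(Q : ℤ) : ℤ) : GI) := by rw [hq.eq]; push_cast; rfl
  rw [this, split_chi_int hχ hp, jac_flip (by omega) hp.mod4]; simp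

lemma recip_prime (hχ : IsQuadSym χ) {p q : GI} (hp : PPrime p) (hq : PPrime q) : χ q p = χ p q := by
  by_cases hpq : p = q
  · rw [hpq]
  rcases pprime_classify hp with ⟨P, hP⟩ | ⟨P, hP⟩ <;> rcases pprime_classify hq with ⟨Q, hQ⟩ | ⟨Q, hQ⟩
  · exact recip_split hχ hP hQ hpq
  · exact recip_split_inert hχ hP hQ
  · exact (recip_split_inert hχ hQ hP).symm
  · have nd : ∀ {x y : GI}, PPrime x → PPrime y → x ≠ y → ¬ x ∣ y := fun hx hy hne h =>
      hne (primary_assoc hx.prim hy.prim (hx.prime.associated_of_dvd hy.prime h))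
    have h1 := chi_val hχ hp (nd hp hq hpq)
    have h2 := chi_val hχ hq (nd hq hp (Ne.symm hpq))
    rw [inert_chi hχ hP, inert_norm hQ, jacobiSym.pow_left] at *
    rw [inert_chi hχ hQ, inert_norm hP, jacobiSym.pow_left] at *
    have a1 := sq_nonneg (jacobiSym (Q : ℤ) P)
    have a2 := sq_nonneg (jacobiSym (P : ℤ) Q)
    omega

theorem recip (hχ : IsQuadSym χ) {m n : GI} (hm : IsPrimary m) (hn : IsPrimary n) : χ m n = χ n m := by
  revert hn
  refine prim_induct (motive := fun n => χ m n = χ n m) ?_ ?_ n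
  · rw [chi_den_one hχ, chi_one hχ hm]
  · intro p n hp hn ih
    rw [chi_den_mul hχ _ hp.prim hn, chi_mul hχ _ _ hm, ih]
    congr 1
    revert hm
    refine prim_induct (motive := fun m => χ m p = χ p m) ?_ ?_ m
    · rw [chi_den_one hχ, chi_one_prime hχ hp]
    · intro q m hq hm ih
      rw [chi_den_mul hχ _ hq.prim hm, chi_mul_prime hχ hp, ih, recip_prime hχ hp hq]

lemma chi_ig (hχ : IsQuadSym χ) {n : GI} (hn : IsPrimary n) : χ ig n = ZMod.χ₈ (n.norm : ZMod 8) := by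
  revert hn
  refine prim_induct (motive := fun n => χ ig n = ZMod.χ₈ (n.norm : ZMod 8)) ?_ ?_ n
  · rw [chi_den_one hχ]; simp
  · intro p m hp hm ih
    rw [chi_den_mul hχ _ hp.prim hm, ih, Zsqrtd.norm_mul, Int.cast_mul, map_mul]
    congr 1
    have hu : IsUnit ig := ⟨⟨⟨0,1⟩, ⟨0,-1⟩, by decide, by decide⟩, rfl⟩
    have h4 := primary_norm_mod hp.prim
    have hpos := norm_pos' hp.prime.ne_zero
    have hnd : ¬ p ∣ ig := fun h => hp.prime.not_isUnit (isUnit_of_dvd_unit h hu)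
    have h8 : p.norm % 8 = 1 ∨ p.norm % 8 = 5 := by omega
    have hi4 : ig ^ 4 = 1 := by decide
    have hi2 : ig ^ 2 = -1 := by decide
    rcases h8 with h8 | h8
    · have e : (p.norm : ZMod 8) = 1 := by
        have : p.norm = 8 * (p.norm / 8) + 1 := by omega
        rw [this]; push_cast; rw [show (8 : ZMod 8) = 0 from by decide]; simp
      rw [e, map_one]
      apply chi_unique hχ hp hnd (Or.inl rfl)
      have : (p.norm.toNat - 1) / 2 = 4 * (p.norm.toNat / 8) := by omega
      rw [this, pow_mul, hi4]; simp
    · have e : (p.norm : ZMod 8) = 5 := by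
        have : p.norm = 8 * (p.norm / 8) + 5 := by omega
        rw [this]; push_cast; rw [show (8 : ZMod 8) = 0 from by decide]; simp
      rw [e, show ZMod.χ₈ 5 = -1 from by decide]
      apply chi_unique hχ hp hnd (Or.inr rfl)
      have : (p.norm.toNat - 1) / 2 = 4 * (p.norm.toNat / 8) + 2 := by omega
      rw [this, pow_add, pow_mul, hi4, hi2]; simp

lemma pprime_not_dvd_omega {p : GI} (hp : PPrime p) : ¬ p ∣ ωg := fun h =>
  pprime_not_dvd_two hp (h.trans ⟨⟨1, -1⟩, by decide⟩)

lemma chi8_neg (x : ZMod 8) : ZMod.χ₈ (-x) = ZMod.χ₈ x := by revert x; decide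

lemma chi8_natAbs (x : ℤ) : ZMod.χ₈ (x.natAbs : ZMod 8) = ZMod.χ₈ (x : ZMod 8) := by
  rcases Int.natAbs_eq x with h | h
  · conv_rhs => rw [h]
    simp
  · conv_rhs => rw [h]
    rw [Int.cast_neg, chi8_neg, Int.cast_natCast]

lemma chi_omega (hχ : IsQuadSym χ) {n : GI} (hn : IsPrimary n) :
    χ ωg n = ZMod.χ₈ ((n.re + n.im : ℤ) : ZMod 8) := by
  revert hn
  refine prim_induct (motive := fun n => χ ωg n = ZMod.χ₈ ((n.re + n.im : ℤ) : ZMod 8)) ?_ ?_ n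
  · rw [chi_den_one hχ]; simp
  · intro p m hp hm ih
    have hmul : (((p * m).re + (p * m).im : ℤ) : ZMod 8) = ((p.re + p.im : ℤ) : ZMod 8) * ((m.re + m.im : ℤ) : ZMod 8) := by
      rw [primary_iff] at hm
      have hp' := (primary_iff p).mp hp.prim
      obtain ⟨x, hx⟩ : ∃ x, p.im = 2 * x := ⟨p.im / 2, by omega⟩
      obtain ⟨y, hy⟩ : ∃ y, m.im = 2 * y := ⟨m.im / 2, by omega⟩
      rw [← Int.cast_mul, ← sub_eq_zero, ← Int.cast_sub]
      rw [ZMod.intCast_zmod_eq_zero_iff_dvd]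
      refine ⟨-(x * y), ?_⟩
      simp only [Zsqrtd.re_mul, Zsqrtd.im_mul, hx, hy]; push_cast; ring
    rw [chi_den_mul hχ _ hp.prim hm, ih, hmul, map_mul]
    congr 1
    rcases pprime_classify hp with ⟨P, hP⟩ | ⟨Q, hQ⟩
    · have h1 := chi_val hχ hp (pprime_not_dvd_omega hp)
      have hP4 := hP.mod4
      have hpar := split_parity hp.prim
      have hodd : (p.re * ωg.re + p.im * ωg.im) % 2 = 1 := by simp [ωg]; omega
      rw [split_chi hχ hP, jac_flip hodd hP.mod4] at h1 ⊢
      have e : p.re * ωg.re + p.im * ωg.im = p.re + p.im := by simp [ωg]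
      rw [e] at h1 hodd ⊢
      have h2 : jacobiSym 2 (p.re + p.im).natAbs = ZMod.χ₈ ((p.re + p.im).natAbs : ZMod 8) :=
        jacobiSym.at_two (by rw [Nat.odd_iff]; omega)
      rw [chi8_natAbs] at h2
      have h3 : jacobiSym ((2 * P : ℕ) : ℤ) (p.re + p.im).natAbs =
          jacobiSym 2 (p.re + p.im).natAbs * jacobiSym P (p.re + p.im).natAbs := by
        rw [← jacobiSym.mul_left]; push_cast; rfl
      have h5 : ZMod.χ₈ ((p.re + p.im : ℤ) : ZMod 8) = 1 ∨ ZMod.χ₈ ((p.re + p.im : ℤ) : ZMod 8) = -1 := by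
        have h0 : (((p.re + p.im : ℤ) : ZMod 8)) = 1 ∨ (((p.re + p.im : ℤ) : ZMod 8)) = 5 := by
          have := ((primary_iff p).mp hp.prim).2
          rcases (by omega : (p.re + p.im) % 8 = 1 ∨ (p.re + p.im) % 8 = 5) with h | h
          · left
            have : p.re + p.im = 8 * ((p.re + p.im) / 8) + 1 := by omega
            rw [this]; push_cast; rw [show (8 : ZMod 8) = 0 from by decide]; simp
          · right
            have : p.re + p.im = 8 * ((p.re + p.im) / 8) + 5 := by omega
            rw [this]; push_cast; rw [show (8 : ZMod 8) = 0 from by decide]; simp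
        rcases h0 with h | h <;> rw [h] <;> decide
      have h4 : jacobiSym ((2 * P : ℕ) : ℤ) (p.re + p.im).natAbs = 1 := by
        apply jac_sq_add (f := p.re - p.im)
        · push_cast; rw [← hP.norm, norm_eq]; ring
        · rw [h3, h2]
          rcases h1 with h | h <;> rcases h5 with h' | h' <;> rw [h, h'] <;> norm_num
      rw [h3, h2] at h4
      rcases h1 with h | h <;> rcases h5 with h' | h' <;> rw [h, h'] at h4 ⊢ <;> norm_num at h4
    · have hq4 := hQ.mod4
      rw [inert_chi hχ hQ]
      have h2 : jacobiSym 2 Q = ZMod.χ₈ (Q : ZMod 8) := jacobiSym.at_two (by rw [Nat.odd_iff]; omega)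
      have h3 : ωg.norm = 2 := by decide
      rw [h3, h2, hQ.eq, ← chi8_neg]; simp

lemma omega_prime_dvd (z : GI) (hz : z ≠ 0) : ∃ (u : GI) (j : ℕ) (k : GI), IsUnit u ∧ IsPrimary k ∧ z = u * ωg ^ j * k := by
  induction' hN : (Zsqrtd.norm z).toNat using Nat.strong_induction_on with N ih generalizing z
  by_cases h : ωg ∣ z
  · obtain ⟨y, rfl⟩ := h
    have hy : y ≠ 0 := right_ne_zero_of_mul hz
    have h1 := norm_pos' hy
    have h2 : ωg.norm = 2 := by decide
    obtain ⟨u, j, k, hu, hk, e⟩ := ih _ (by rw [← hN, Zsqrtd.norm_mul, h2]; omega) y hy rfl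
    refine ⟨u, j + 1, k, hu, hk, ?_⟩
    conv_lhs => rw [e]
    ring
  · obtain ⟨u, hu, hk⟩ := exists_primary_assoc h
    obtain ⟨v, rfl⟩ := hu
    exact ⟨↑v⁻¹, 0, z * v, Units.isUnit _, hk, by simp [mul_comm]⟩

lemma zmod8_of_dvd {M x y : ℤ} (h : 8 * M ∣ x - y) : (x : ZMod 8) = y := by
  have : (8 : ℤ) ∣ x - y := (dvd_mul_right 8 M).trans h
  rw [← sub_eq_zero, ← Int.cast_sub, ZMod.intCast_zmod_eq_zero_iff_dvd]; exact_mod_cast this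

/-- periodicity of the symbol in the denominator -/
theorem chi_den_per (hχ : IsQuadSym χ) {κ : GI} (hκ : κ ≠ 0) {m n : GI} (hm : IsPrimary m) (hn : IsPrimary n)
    (h1 : 8 * κ.norm ∣ m.re - n.re) (h2 : 8 * κ.norm ∣ m.im - n.im) : χ κ m = χ κ n := by
  obtain ⟨u, j, k, hu, hk, rfl⟩ := omega_prime_dvd κ hκ
  have e1 := zmod8_of_dvd h1
  have e2 := zmod8_of_dvd h2
  have hi : χ ig m = χ ig n := by
    rw [chi_ig hχ hm, chi_ig hχ hn, norm_eq, norm_eq]; push_cast; rw [e1, e2]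
  have ho : χ ωg m = χ ωg n := by
    rw [chi_omega hχ hm, chi_omega hχ hn]; push_cast; rw [e1, e2]
  have hneg : χ (-1) m = χ (-1) n := by
    rw [show (-1 : GI) = ig * ig by decide, chi_mul hχ _ _ hm, chi_mul hχ _ _ hn, hi]
  have hu' : χ u m = χ u n := by
    rcases unit_cases hu with rfl | rfl | rfl | rfl
    · rw [chi_one hχ hm, chi_one hχ hn]
    · exact hneg
    · exact hi
    · rw [show (⟨0, -1⟩ : GI) = (-1) * ig by decide, chi_mul hχ _ _ hm, chi_mul hχ _ _ hn, hi, hneg]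
  have hpow : χ (ωg ^ j) m = χ (ωg ^ j) n := by
    induction j with
    | zero => rw [pow_zero, chi_one hχ hm, chi_one hχ hn]
    | succ j ih =>
      have hκ' : u * ωg ^ j * k ≠ 0 := by
        intro h; apply hκ; rw [pow_succ]; rw [show u * (ωg ^ j * ωg) * k = (u * ωg ^ j * k) * ωg by ring, h, zero_mul]
      have hd : 8 * (u * ωg ^ j * k).norm ∣ 8 * (u * ωg ^ (j+1) * k).norm :=
        mul_dvd_mul_left 8 (norm_dvd ⟨ωg, by ring⟩)
      rw [pow_succ, chi_mul hχ _ _ hm, chi_mul hχ _ _ hn, ho, ih hκ' (hd.trans h1) (hd.trans h2)]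
  rw [chi_mul hχ _ _ hm, chi_mul hχ _ _ hn, chi_mul hχ _ _ hm, chi_mul hχ _ _ hn, hu', hpow]
  congr 1
  rw [recip hχ hk hm, recip hχ hk hn]
  apply chi_per hχ hk
  have hkn : k ∣ (((u * ωg ^ j * k).norm : ℤ) : GI) := by
    rw [Zsqrtd.norm_eq_mul_conj]; exact (dvd_mul_left k _).mul_right _
  have hd : ∀ x : ℤ, 8 * (u * ωg ^ j * k).norm ∣ x → k ∣ (x : GI) := by
    rintro x ⟨c, rfl⟩
    push_cast
    exact (hkn.mul_left 8).mul_right _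
  have : m - n = ((m.re - n.re : ℤ) : GI) + ((m.im - n.im : ℤ) : GI) * ig := by
    ext <;> simp [ig]
  rw [this]
  exact dvd_add (hd _ h1) ((hd _ h2).mul_right _)

end Recip
end GH

namespace GH

section LS

lemma gaussZ_summable {c : ℝ} (hc : 0 < c) (b : ℝ) : Summable fun n : ℤ => Real.exp (-c * (n + b) ^ 2) := by
  have h := (Real.summable_one_div_int_add_rpow b 2).mpr one_lt_two
  have h2 := h.mul_left (1 / c)
  apply Summable.of_norm_bounded_eventually h2
  have hfin : {n : ℤ | (n : ℝ) + b = 0}.Finite := by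
    apply Set.Subsingleton.finite
    intro x hx y hy
    simp only [Set.mem_ofPred_eq] at hx hy
    have : (x : ℝ) = y := by linarith
    exact_mod_cast this
  rw [Filter.eventually_cofinite]
  apply hfin.subset
  intro n hn
  simp only [Set.mem_ofPred_eq] at hn ⊢
  by_contra h0
  apply hn
  have hy : 0 < c * (n + b) ^ 2 := by positivity
  rw [Real.norm_of_nonneg (Real.exp_pos _).le, neg_mul, Real.exp_neg]
  have h3 : c * (n + b) ^ 2 ≤ Real.exp (c * (n + b) ^ 2) := by
    linarith [Real.add_one_le_exp (c * (n + b) ^ 2)]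
  calc (Real.exp (c * (n + b) ^ 2))⁻¹ ≤ (c * (n + b) ^ 2)⁻¹ := inv_anti₀ hy h3
    _ = 1 / c * (1 / |(n : ℝ) + b| ^ (2 : ℝ)) := by
      rw [Real.rpow_two, sq_abs]; field_simp

lemma theta_formula {a : ℂ} (ha : 0 < a.re) (r : ℤ) {M : ℕ} (hM : 0 < M) :
    ∑' k : ℤ, cexp (-π * a * ((k : ℂ) * M + r) ^ 2) =
      1 / ((M : ℂ) ^ 2 * a) ^ (1 / 2 : ℂ) *
        ∑' n : ℤ, cexp (-π / ((M : ℂ) ^ 2 * a) * (n : ℂ) ^ 2 + 2 * π * I * r * n / M) := by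
  have ha0 : a ≠ 0 := by rintro rfl; simp at ha
  have hM0 : (M : ℂ) ≠ 0 := by exact_mod_cast hM.ne'
  have hre : 0 < ((M : ℂ) ^ 2 * a).re := by
    have : ((M : ℂ) ^ 2 * a) = (((M : ℝ) ^ 2 : ℝ) : ℂ) * a := by push_cast; ring
    rw [this, Complex.re_ofReal_mul]
    positivity
  have h := Complex.tsum_exp_neg_quadratic hre (-(a * M * r))
  have e1 : ∀ k : ℤ, cexp (-π * a * ((k : ℂ) * M + r) ^ 2) = cexp (-π * a * r ^ 2) *
      cexp (-π * ((M : ℂ) ^ 2 * a) * k ^ 2 + 2 * π * (-(a * M * r)) * k) := by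
    intro k; rw [← Complex.exp_add]; congr 1; ring
  have e2 : ∀ n : ℤ, cexp (-π / ((M : ℂ) ^ 2 * a) * (n : ℂ) ^ 2 + 2 * π * I * r * n / M) =
      cexp (-π * a * r ^ 2) * cexp (-π / ((M : ℂ) ^ 2 * a) * (n + I * (-(a * M * r))) ^ 2) := by
    intro n; rw [← Complex.exp_add]; congr 1
    field_simp
    ring_nf
    rw [I_sq]; ring
  simp_rw [e1, e2, tsum_mul_left]
  rw [h]; ring

lemma theta_lim {α : Type*} {l : Filter α} (a : α → ℂ) (r : ℤ) (M : ℕ)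
    (h : Tendsto (fun z => (1 / ((M : ℂ) ^ 2 * a z)).re) l atTop) :
    Tendsto (fun z => ∑' n : ℤ, cexp (-π / ((M : ℂ) ^ 2 * a z) * (n : ℂ) ^ 2 + 2 * π * I * r * n / M)) l (𝓝 1) := by
  have nrm : ∀ z, ∀ n : ℤ, ‖cexp (-π / ((M : ℂ) ^ 2 * a z) * (n : ℂ) ^ 2 + 2 * π * I * r * n / M)‖ =
      Real.exp (-(π * (1 / ((M : ℂ) ^ 2 * a z)).re * (n : ℝ) ^ 2)) := by
    intro z n
    rw [Complex.norm_exp]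
    congr 1
    have e : -π / ((M : ℂ) ^ 2 * a z) * (n : ℂ) ^ 2 + 2 * π * I * r * n / M =
      ((-(π * (n : ℝ) ^ 2) : ℝ) : ℂ) * (1 / ((M : ℂ) ^ 2 * a z)) + ((2 * π * r * n / M : ℝ) : ℂ) * I := by
      push_cast; ring
    rw [e, Complex.add_re, Complex.re_ofReal_mul, Complex.re_ofReal_mul]; simp
    ring
  have key := tendsto_tsum_of_dominated_convergence (𝓕 := l)
    (f := fun z (n : ℤ) => cexp (-π / ((M : ℂ) ^ 2 * a z) * (n : ℂ) ^ 2 + 2 * π * I * r * n / M))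
    (g := fun n : ℤ => if n = 0 then (1 : ℂ) else 0)
    (bound := fun n : ℤ => Real.exp (-π * ((n : ℝ) + 0) ^ 2)) (gaussZ_summable pi_pos 0) ?_ ?_
  · simpa using key
  · intro n
    by_cases hn : n = 0
    · simp [hn]
      try exact tendsto_const_nhds
    · simp only [hn, if_false]
      rw [tendsto_zero_iff_norm_tendsto_zero]
      simp_rw [nrm]
      apply Real.tendsto_exp_neg_atTop_nhds_zero.comp
      apply Tendsto.atTop_mul_const (by positivity)
      exact Tendsto.const_mul_atTop pi_pos h
  · filter_upwards [h.eventually_ge_atTop 1] with z hz n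
    rw [nrm, add_zero, neg_mul]
    apply Real.exp_le_exp.mpr
    have : 0 ≤ π * (n : ℝ) ^ 2 := by positivity
    nlinarith

/-- splitting a sum over `ℤ` by residue classes -/
lemma tsum_residues {f : ℤ → ℂ} (hf : Summable f) {M : ℕ} (hM : 0 < M) :
    ∑' n, f n = ∑ r : Fin M, ∑' k : ℤ, f (k * M + ((r : ℕ) : ℤ)) := by
  have : NeZero M := ⟨hM.ne'⟩
  rw [← (Int.divModEquiv M).symm.tsum_eq]
  have hs : Summable fun p : ℤ × Fin M => f ((Int.divModEquiv M).symm p) :=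
    (Equiv.summable_iff (Int.divModEquiv M).symm).mpr hf
  rw [hs.tsum_prod]
  simp_rw [tsum_fintype]
  rw [Summable.tsum_finsetSum]
  · rfl
  · intro r _
    exact hs.comp_injective (i := fun k : ℤ => (k, r)) (fun a b h => by simpa using h)

lemma summable_theta {a : ℂ} (ha : 0 < a.re) (u : ℝ) :
    Summable fun n : ℤ => cexp (-π * (a + u * I) * (n : ℂ) ^ 2) := by
  apply Summable.of_norm
  have : ∀ n : ℤ, ‖cexp (-π * (a + u * I) * (n : ℂ) ^ 2)‖ = Real.exp (-(π * a.re) * (n + 0) ^ 2) := by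
    intro n
    rw [Complex.norm_exp]; congr 1
    have e : -π * (a + u * I) * (n : ℂ) ^ 2 = ((-π * (n : ℝ) ^ 2 : ℝ) : ℂ) * (a + u * I) := by push_cast; ring
    rw [e, Complex.re_ofReal_mul]; simp; ring
  simp_rw [this]
  exact gaussZ_summable (by positivity) 0

lemma sqrt_real_mul {r : ℝ} (hr : 0 < r) {x : ℂ} (hx : x ≠ 0) :
    ((r : ℂ) * x) ^ (1 / 2 : ℂ) = (r : ℂ) ^ (1 / 2 : ℂ) * x ^ (1 / 2 : ℂ) := by
  have hr' : (r : ℂ) ≠ 0 := by exact_mod_cast hr.ne'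
  rw [cpow_def_of_ne_zero (mul_ne_zero hr' hx), cpow_def_of_ne_zero hr', cpow_def_of_ne_zero hx,
    Complex.log_ofReal_mul hr hx, ← Complex.exp_add, Complex.ofReal_log hr.le]
  congr 1; ring

/-- quadratic Gauss sum, Landsberg–Schaar -/
theorem landsberg {P : ℕ} (hP : P % 4 = 1) :
    ∑ r : Fin P, cexp (2 * π * I * ((r : ℕ) : ℂ) ^ 2 / P) = (Real.sqrt P : ℂ) := by
  have hP0 : 0 < P := by omega
  have hPr : (0 : ℝ) < P := by exact_mod_cast hP0
  have hPc : (P : ℂ) ≠ 0 := by exact_mod_cast hP0.ne'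
  set S := ∑ r : Fin P, cexp (2 * π * I * ((r : ℕ) : ℂ) ^ 2 / P) with hS
  let a : ℝ → ℂ := fun z => 1 / ((z : ℂ) + I * P / 2)
  let w : ℝ → ℂ := fun z => I * P / (2 * z + I * P)
  let b : ℝ → ℂ := fun z => (4 * z / P ^ 2 : ℝ) * w z
  have hden : ∀ z : ℝ, 0 < z → (2 * z + I * P : ℂ) ≠ 0 := by
    intro z hz h
    have := congrArg Complex.re h
    simp at this; linarith
  have hw0 : ∀ z : ℝ, 0 < z → w z ≠ 0 := fun z hz =>
    div_ne_zero (mul_ne_zero I_ne_zero hPc) (hden z hz)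
  have hinvb : ∀ z : ℝ, 0 < z → 1 / ((P : ℂ) ^ 2 * b z) = ((1 / (4 * z) : ℝ) : ℂ) + ((-1 / (2 * P) : ℝ) : ℂ) * I := by
    intro z hz
    have hz' : (z : ℂ) ≠ 0 := by exact_mod_cast hz.ne'
    have := hden z hz
    simp only [b, w]; push_cast
    field_simp
    ring_nf
    rw [I_sq]; ring
  have hb_re : ∀ z : ℝ, 0 < z → 0 < (b z).re := by
    intro z hz
    have h1 : ((1 : ℂ) / ((P : ℂ) ^ 2 * b z)).re = 1 / (4 * z) := by
      rw [hinvb z hz, Complex.add_re, Complex.ofReal_re, Complex.re_ofReal_mul, Complex.I_re, mul_zero, add_zero]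
    rw [one_div, Complex.inv_re] at h1
    have h2 : ((P : ℂ) ^ 2 * b z).re = (P : ℝ) ^ 2 * (b z).re := by
      rw [← Complex.re_ofReal_mul]; push_cast; rfl
    have h3 : 0 < ((P : ℂ) ^ 2 * b z).re := by
      by_contra hcon
      have h4 : ((P : ℂ) ^ 2 * b z).re / normSq ((P : ℂ) ^ 2 * b z) ≤ 0 :=
        div_nonpos_of_nonpos_of_nonneg (not_lt.mp hcon) (normSq_nonneg _)
      rw [h1] at h4
      have : 0 < 1 / (4 * z) := by positivity
      linarith
    rw [h2] at h3
    exact pos_of_mul_pos_right h3 (by positivity)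
  have hab : ∀ z : ℝ, 0 < z → a z = b z + ((-2 / P : ℝ) : ℂ) * I := by
    intro z hz
    have h1 := hden z hz
    have h2 : (z : ℂ) + I * P / 2 ≠ 0 := by
      intro h; apply h1; linear_combination 2 * h
    have h3 : a z = 2 / (2 * z + I * P) := by
      simp only [a]; rw [div_eq_div_iff h2 h1]; ring
    rw [h3]
    simp only [b, w]; push_cast
    field_simp
    ring_nf
    rw [I_sq]; ring
  have ha_re : ∀ z : ℝ, 0 < z → 0 < (a z).re := by
    intro z hz
    rw [hab z hz, Complex.add_re, Complex.re_ofReal_mul (-2 / P : ℝ) I, Complex.I_re, mul_zero, add_zero]; exact hb_re z hz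
  -- the two evaluations
  have lhs : ∀ z : ℝ, 0 < z → ∑' n : ℤ, cexp (-π * a z * (n : ℂ) ^ 2) =
      ∑ r : Fin P, cexp (2 * π * I * ((r : ℕ) : ℂ) ^ 2 / P) *
        ∑' k : ℤ, cexp (-π * b z * ((k : ℂ) * P + ((r : ℕ) : ℤ)) ^ 2) := by
    intro z hz
    have hs := summable_theta (hb_re z hz) (-2 / P)
    rw [← hab z hz] at hs
    rw [tsum_residues hs hP0]
    apply Finset.sum_congr rfl
    intro r _
    rw [← tsum_mul_left]
    congr 1; ext k
    rw [← Complex.exp_add, hab z hz, Complex.exp_eq_exp_iff_exists_int]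
    refine ⟨k * k * P + 2 * k * r, ?_⟩
    push_cast
    field_simp
    ring
  have rhs : ∀ z : ℝ, 0 < z → ∑' n : ℤ, cexp (-π * a z * (n : ℂ) ^ 2) = 1 / (a z) ^ (1 / 2 : ℂ) *
      (∑' k : ℤ, cexp (-π * z * ((k : ℂ) * (2 : ℕ) + (0 : ℤ)) ^ 2) -
        I * ∑' k : ℤ, cexp (-π * z * ((k : ℂ) * (2 : ℕ) + (1 : ℤ)) ^ 2)) := by
    intro z hz
    rw [Complex.tsum_exp_neg_mul_int_sq (ha_re z hz)]
    congr 1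
    have e : ∀ n : ℤ, cexp (-π / a z * (n : ℂ) ^ 2) = cexp (-π * ((z : ℂ) + ((P / 2 : ℝ) : ℂ) * I) * (n : ℂ) ^ 2) := by
      intro n; simp only [a]; congr 1; rw [div_div_eq_mul_div]; push_cast; ring
    simp_rw [e]
    rw [tsum_residues (summable_theta (a := (z : ℂ)) (by simpa using hz) (P / 2)) two_pos]
    rw [Fin.sum_univ_two, sub_eq_add_neg, ← neg_mul, ← tsum_mul_left]
    congr 1
    · congr 1; ext k
      rw [Complex.exp_eq_exp_iff_exists_int]
      refine ⟨-(k * k * P), ?_⟩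
      push_cast; simp; ring
    · congr 1; ext k
      have hI : -I = cexp (-(π / 2) * I) := by
        rw [neg_mul, Complex.exp_neg, Complex.exp_pi_div_two_mul_I]; simp
      rw [hI, ← Complex.exp_add, Complex.exp_eq_exp_iff_exists_int]
      obtain ⟨t, ht⟩ : ∃ t : ℕ, P = 4 * t + 1 := ⟨P / 4, by omega⟩
      refine ⟨-(k * k * P + k * P + t), ?_⟩
      push_cast; simp [ht]; ring
  have hident : ∀ z : ℝ, 0 < z → 
      ∑ r : Fin P, cexp (2 * π * I * ((r : ℕ) : ℂ) ^ 2 / P) *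
        ∑' n : ℤ, cexp (-π / ((P : ℂ) ^ 2 * b z) * (n : ℂ) ^ 2 + 2 * π * I * ((r : ℕ) : ℤ) * n / P) =
      (w z) ^ (1 / 2 : ℂ) / (a z) ^ (1 / 2 : ℂ) *
      (∑' n : ℤ, cexp (-π / (((2 : ℕ) : ℂ) ^ 2 * z) * (n : ℂ) ^ 2 + 2 * π * I * (0 : ℤ) * n / (2 : ℕ)) -
        I * ∑' n : ℤ, cexp (-π / (((2 : ℕ) : ℂ) ^ 2 * z) * (n : ℂ) ^ 2 + 2 * π * I * (1 : ℤ) * n / (2 : ℕ))) := by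
    intro z hz
    have h := (lhs z hz).symm.trans (rhs z hz)
    rw [theta_formula (by simpa using hz) 0 two_pos, theta_formula (by simpa using hz) 1 two_pos] at h
    simp_rw [theta_formula (hb_re z hz) _ hP0] at h
    have e1 : (P : ℂ) ^ 2 * b z = ((4 * z : ℝ) : ℂ) * w z := by
      simp only [b]; push_cast; field_simp
    have e2 : ((2 : ℕ) : ℂ) ^ 2 * z = ((4 * z : ℝ) : ℂ) := by push_cast; ring
    have hz4 : ((4 * z : ℝ) : ℂ) ^ (1 / 2 : ℂ) ≠ 0 := by
      rw [Complex.cpow_ne_zero_iff]; left; exact_mod_cast (by positivity)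
    have hw2 : (w z) ^ (1 / 2 : ℂ) ≠ 0 := by
      rw [Complex.cpow_ne_zero_iff]; left; exact hw0 z hz
    have e3 : ((P : ℂ) ^ 2 * b z) ^ (1 / 2 : ℂ) = ((4 * z : ℝ) : ℂ) ^ (1 / 2 : ℂ) * (w z) ^ (1 / 2 : ℂ) := by
      rw [e1, sqrt_real_mul (by positivity) (hw0 z hz)]
    rw [e3, e2] at h
    rw [e2]
    have h' := congrArg (fun t => (((4 * z : ℝ) : ℂ) ^ (1 / 2 : ℂ) * (w z) ^ (1 / 2 : ℂ)) * t) h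
    simp only [Finset.mul_sum] at h'
    rw [← Finset.sum_congr rfl (fun r _ => ?_)] at h'
    · rw [h']
      generalize (∑' n : ℤ, cexp (-π / ((4 * z : ℝ) : ℂ) * (n : ℂ) ^ 2 + 2 * π * I * (0 : ℤ) * n / (2 : ℕ))) = T0
      generalize (∑' n : ℤ, cexp (-π / ((4 * z : ℝ) : ℂ) * (n : ℂ) ^ 2 + 2 * π * I * (1 : ℤ) * n / (2 : ℕ))) = T1
      generalize (a z) ^ (1 / 2 : ℂ) = A at *
      field_simp
    · field_simp
  -- limits
  have L1 : Tendsto (fun z : ℝ => ∑ r : Fin P, cexp (2 * π * I * ((r : ℕ) : ℂ) ^ 2 / P) *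
        ∑' n : ℤ, cexp (-π / ((P : ℂ) ^ 2 * b z) * (n : ℂ) ^ 2 + 2 * π * I * ((r : ℕ) : ℤ) * n / P))
        (𝓝[>] 0) (𝓝 S) := by
    have : S = ∑ r : Fin P, cexp (2 * π * I * ((r : ℕ) : ℂ) ^ 2 / P) * 1 := by simp [hS]
    rw [this]
    apply tendsto_finsetSum
    intro r _
    apply Tendsto.const_mul
    apply theta_lim
    have : (fun z : ℝ => 1 / (4 * z)) =ᶠ[𝓝[>] 0] fun z => (1 / ((P : ℂ) ^ 2 * b z)).re := by
      filter_upwards [self_mem_nhdsWithin] with z hz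
      rw [hinvb z hz, Complex.add_re, Complex.ofReal_re, Complex.re_ofReal_mul, Complex.I_re, mul_zero, add_zero]
    apply Tendsto.congr' this
    have h4 : (fun z : ℝ => 1 / (4 * z)) = fun z : ℝ => (1 / 4) * z⁻¹ := by
      ext z; rw [one_div, mul_inv]; ring
    rw [h4]
    exact Tendsto.const_mul_atTop (by norm_num) tendsto_inv_nhdsGT_zero
  have L2 : ∀ r : ℤ, Tendsto (fun z : ℝ => ∑' n : ℤ, cexp (-π / (((2 : ℕ) : ℂ) ^ 2 * z) * (n : ℂ) ^ 2 + 2 * π * I * r * n / (2 : ℕ)))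
      (𝓝[>] 0) (𝓝 1) := by
    intro r
    apply theta_lim (fun z : ℝ => (z : ℂ)) r 2
    have h4 : (fun z : ℝ => (1 / (((2 : ℕ) : ℂ) ^ 2 * z)).re) = fun z : ℝ => (1 / 4) * z⁻¹ := by
      ext z
      have : (1 / (((2 : ℕ) : ℂ) ^ 2 * z)) = (((1 / 4) * z⁻¹ : ℝ) : ℂ) := by
        push_cast; rw [one_div, mul_inv]; norm_num
      rw [this, Complex.ofReal_re]
    rw [h4]
    exact Tendsto.const_mul_atTop (by norm_num) tendsto_inv_nhdsGT_zero
  have L3 : Tendsto (fun z : ℝ => (w z) ^ (1 / 2 : ℂ)) (𝓝[>] 0) (𝓝 1) := by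
    have hc : ContinuousAt (fun z : ℝ => (w z) ^ (1 / 2 : ℂ)) 0 := by
      have hw1 : w 0 = 1 := by
        simp only [w]; simp [hPc]
      apply ContinuousAt.cpow
      · apply ContinuousAt.div
        · fun_prop
        · fun_prop
        · simp [hPc]
      · fun_prop
      · rw [hw1]; simp
    have hw1 : (w 0) ^ (1 / 2 : ℂ) = 1 := by
      simp only [w]; simp [hPc]
    have := hc.tendsto
    rw [hw1] at this
    exact this.mono_left nhdsWithin_le_nhds
  have ha0 : a 0 = ((2 / P : ℝ) : ℂ) * (-I) := by
    simp only [a]; push_cast; simp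
    field_simp
    rw [I_sq]; ring
  have L4 : Tendsto (fun z : ℝ => (a z) ^ (1 / 2 : ℂ)) (𝓝[>] 0) (𝓝 (((2 / P : ℝ) : ℂ) ^ (1 / 2 : ℂ) * (-I) ^ (1 / 2 : ℂ))) := by
    have hc : ContinuousAt (fun z : ℝ => (a z) ^ (1 / 2 : ℂ)) 0 := by
      apply ContinuousAt.cpow
      · apply ContinuousAt.div
        · fun_prop
        · fun_prop
        · simp [hPc]
      · fun_prop
      · rw [ha0, Complex.mem_slitPlane_iff]; right
        rw [Complex.im_ofReal_mul]; simp; omega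
    have := hc.tendsto
    rw [ha0, sqrt_real_mul (by positivity) (by simp)] at this
    exact this.mono_left nhdsWithin_le_nhds
  have hI : (-I) ^ (1 / 2 : ℂ) = (1 - I) / (Real.sqrt 2 : ℂ) := by
    rw [cpow_def_of_ne_zero (by simp), Complex.log_neg_I]
    have : -(π / 2) * I * (1 / 2) = ((-(π / 4) : ℝ) : ℂ) * I := by push_cast; ring
    rw [this, Complex.exp_mul_I, ← Complex.ofReal_cos, ← Complex.ofReal_sin, Real.cos_neg, Real.sin_neg,
      Real.cos_pi_div_four, Real.sin_pi_div_four]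
    have h2 : (Real.sqrt 2 : ℂ) ^ 2 = 2 := by
      rw [← Complex.ofReal_pow, Real.sq_sqrt (by norm_num)]; simp
    have h20 : (Real.sqrt 2 : ℂ) ≠ 0 := by
      intro h; rw [h] at h2; norm_num at h2
    field_simp
    push_cast
    linear_combination (1 / 2 : ℂ) * (1 - I) * h2
  have h2P : ((2 / P : ℝ) : ℂ) ^ (1 / 2 : ℂ) = (Real.sqrt 2 : ℂ) / (Real.sqrt P : ℂ) := by
    have : (1 / 2 : ℂ) = ((1 / 2 : ℝ) : ℂ) := by push_cast; rfl
    rw [this, ← Complex.ofReal_cpow (by positivity), ← Real.sqrt_eq_rpow, Real.sqrt_div (by norm_num)]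
    push_cast; rfl
  have h1I : (1 - I : ℂ) ≠ 0 := by
    intro h; have := congrArg Complex.re h; simp at this
  have hs2 : (Real.sqrt 2 : ℂ) ≠ 0 := by exact_mod_cast (Real.sqrt_pos.mpr two_pos).ne'
  have hsP : (Real.sqrt P : ℂ) ≠ 0 := by exact_mod_cast (Real.sqrt_pos.mpr hPr).ne'
  have hval : ((2 / P : ℝ) : ℂ) ^ (1 / 2 : ℂ) * (-I) ^ (1 / 2 : ℂ) = (1 - I) / (Real.sqrt P : ℂ) := by
    rw [hI, h2P]; field_simp
  rw [hval] at L4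
  have L5 := (L3.div L4 (div_ne_zero h1I hsP)).mul ((L2 0).sub ((L2 1).const_mul I))
  have L6 : Tendsto (fun z : ℝ => ∑ r : Fin P, cexp (2 * π * I * ((r : ℕ) : ℂ) ^ 2 / P) *
        ∑' n : ℤ, cexp (-π / ((P : ℂ) ^ 2 * b z) * (n : ℂ) ^ 2 + 2 * π * I * ((r : ℕ) : ℤ) * n / P))
        (𝓝[>] 0) (𝓝 (1 / ((1 - I) / (Real.sqrt P : ℂ)) * (1 - I * 1))) := by
    apply L5.congr'
    filter_upwards [self_mem_nhdsWithin] with z hz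
    exact (hident z hz).symm
  have := tendsto_nhds_unique L1 L6
  rw [this]
  field_simp

end LS
end GH

namespace GH

variable {χ : GI → GI → ℤ}

lemma eT_eq (z : ℂ) : eT z = cexp (2 * π * I * (z.im : ℂ)) := by
  unfold eT
  congr 2
  rw [← sub_div, Complex.sub_conj]
  push_cast
  field_simp

lemma eT_add (z w : ℂ) : eT (z + w) = eT z * eT w := by
  rw [eT_eq, eT_eq, eT_eq, ← Complex.exp_add]
  congr 1; push_cast [Complex.add_im]; ring

lemma eT_int (z : GI) : eT (GaussianInt.toComplex z) = 1 := by
  rw [eT_eq, ← GaussianInt.intCast_im, Complex.exp_eq_one_iff]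
  exact ⟨z.im, by push_cast; ring⟩

lemma eT_zero : eT 0 = 1 := by rw [eT_eq]; simp

lemma norm_eT (z : ℂ) : ‖eT z‖ = 1 := by
  rw [eT_eq, Complex.norm_exp]; simp

section QC
variable (P : ℕ) [Fact P.Prime]

def qc (x : ZMod P) : ℂ := ((quadraticChar (ZMod P) x : ℤ) : ℂ)

def qg : ℂ := ∑ x : ZMod P, qc P x * ZMod.stdAddChar x

lemma qc_mul (x y : ZMod P) : qc P (x * y) = qc P x * qc P y := by
  unfold qc; rw [map_mul, Int.cast_mul]

lemma qc_zero : qc P 0 = 0 := by simp [qc]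

lemma qc_sq {x : ZMod P} (hx : x ≠ 0) : qc P x * qc P x = 1 := by
  have := quadraticChar_sq_one hx
  unfold qc; rw [← Int.cast_mul, ← sq, this]; simp

lemma qc_inv (x : ZMod P) : qc P x⁻¹ = qc P x := by
  by_cases hx : x = 0
  · simp [hx]
  · have h1 : qc P x⁻¹ * qc P x = 1 := by
      rw [← qc_mul, inv_mul_cancel₀ hx]; simp [qc]
    calc qc P x⁻¹ = qc P x⁻¹ * (qc P x * qc P x) := by rw [qc_sq P hx, mul_one]
      _ = qc P x := by rw [← mul_assoc, h1, one_mul]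

lemma ring_ch (hP : P ≠ 2) : ringChar (ZMod P) ≠ 2 := by rwa [ZMod.ringChar_zmod_n]

lemma qc_sum (hP : P ≠ 2) : ∑ x : ZMod P, qc P x = 0 := by
  have := quadraticChar_sum_zero (ring_ch P hP)
  unfold qc; exact_mod_cast this

lemma qg_shift (hP : P ≠ 2) (t : ZMod P) :
    ∑ x : ZMod P, qc P x * ZMod.stdAddChar (t * x) = qc P t * qg P := by
  by_cases ht : t = 0
  · simp [ht, qc_zero, qc_sum P hP]
  · rw [qg, Finset.mul_sum]
    rw [← Equiv.sum_comp (Equiv.mulLeft₀ t ht) (fun x => qc P t * (qc P x * ZMod.stdAddChar x))]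
    apply Finset.sum_congr rfl
    intro x _
    change _ = qc P t * (qc P (t * x) * ZMod.stdAddChar (t * x))
    rw [qc_mul]
    linear_combination (-qc P x * ZMod.stdAddChar (t * x)) * qc_sq P ht

lemma add_sum : ∀ t : ZMod P, t ≠ 0 → ∑ x : ZMod P, (ZMod.stdAddChar (t * x) : ℂ) = 0 := by
  intro t ht
  have h := AddChar.sum_eq_zero_of_ne_one ((ZMod.isPrimitive_stdAddChar P) ht)
  simpa [AddChar.mulShift_apply] using h

lemma sq_sum (hP : P ≠ 2) {t : ZMod P} (ht : t ≠ 0) :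
    ∑ x : ZMod P, (ZMod.stdAddChar (t * x ^ 2) : ℂ) = qc P t * qg P := by
  rw [← qg_shift P hP]
  have h1 : ∑ x : ZMod P, (ZMod.stdAddChar (t * x ^ 2) : ℂ) =
      ∑ a : ZMod P, ∑ x ∈ Finset.univ.filter (fun x : ZMod P => x ^ 2 = a), (ZMod.stdAddChar (t * x ^ 2) : ℂ) :=
    (Finset.sum_fiberwise _ _ _).symm
  rw [h1]
  have h2 : ∀ a : ZMod P, ∑ x ∈ Finset.univ.filter (fun x : ZMod P => x ^ 2 = a), (ZMod.stdAddChar (t * x ^ 2) : ℂ)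
      = (qc P a + 1) * ZMod.stdAddChar (t * a) := by
    intro a
    have : ∀ x ∈ Finset.univ.filter (fun x : ZMod P => x ^ 2 = a), (ZMod.stdAddChar (t * x ^ 2) : ℂ) = ZMod.stdAddChar (t * a) := by
      intro x hx
      rw [(Finset.mem_filter.mp hx).2]
    rw [Finset.sum_congr rfl this, Finset.sum_const, nsmul_eq_mul]
    congr 1
    have h := quadraticChar_card_sqrts (ring_ch P hP) a
    have e : (Set.toFinset {x : ZMod P | x ^ 2 = a}) = Finset.univ.filter (fun x : ZMod P => x ^ 2 = a) := by
      ext x; simp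
    unfold qc
    rw [← e]
    have h' := congrArg (Int.cast : ℤ → ℂ) h
    push_cast at h'
    exact h'
  rw [Finset.sum_congr rfl (fun a _ => h2 a)]
  simp_rw [add_mul, one_mul]
  rw [Finset.sum_add_distrib, add_sum P t ht, add_zero]

lemma qg_sq (hP : P ≠ 2) : qg P * qg P = qc P (-1) * P := by
  have h := gaussSum_sq (χ := (quadraticChar (ZMod P)).ringHomComp (Int.castRingHom ℂ))
    (ψ := ZMod.stdAddChar) ?_ ?_ (ZMod.isPrimitive_stdAddChar P)
  · rw [← sq]
    simpa [gaussSum, qg, qc, ZMod.card] using h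
  · intro h
    apply quadraticChar_ne_one (ring_ch P hP)
    ext a
    have := congrArg (fun f => f (a : ZMod P)) h
    simp only [MulChar.ringHomComp_apply, MulChar.one_apply_coe, eq_intCast] at this
    rw [MulChar.one_apply_coe]
    exact_mod_cast this
  · intro a
    rcases quadraticChar_isQuadratic (ZMod P) a with h | h | h <;> simp [MulChar.ringHomComp_apply, h]

lemma qg_ne (hP : P ≠ 2) : qg P ≠ 0 := by
  intro h
  have h1 := qg_sq P hP
  rw [h, zero_mul] at h1
  have h2 : qc P (-1) ≠ 0 := by
    intro h; have := qc_sq P (x := -1) (by simp); rw [h] at this; simp at this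
  have h3 : (P : ℂ) ≠ 0 := by exact_mod_cast (Fact.out : P.Prime).ne_zero
  exact mul_ne_zero h2 h3 h1.symm

/-- two-dimensional Gauss sum for the norm form -/
lemma norm_sum (hP : P ≠ 2) (hm : qc P (-1) = -1) (c d : ZMod P) :
    ∑ x : ZMod P, ∑ y : ZMod P, qc P (x ^ 2 + y ^ 2) * ZMod.stdAddChar (c * x + d * y) =
      qc P (c ^ 2 + d ^ 2) * P := by
  have hg := qg_ne P hP
  have h2 : (2 : ZMod P) ≠ 0 := by
    intro h
    have : ((2 : ℕ) : ZMod P) = 0 := by exact_mod_cast h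
    rw [ZMod.natCast_eq_zero_iff] at this
    exact hP ((Nat.prime_dvd_prime_iff_eq Fact.out Nat.prime_two).mp this)
  apply mul_right_cancel₀ hg
  -- expand the quadratic character by a Gauss sum
  have e1 : (∑ x : ZMod P, ∑ y : ZMod P, qc P (x ^ 2 + y ^ 2) * ZMod.stdAddChar (c * x + d * y)) * qg P =
      ∑ t : ZMod P, qc P t * ((∑ x : ZMod P, ZMod.stdAddChar (t * x ^ 2 + c * x)) *
        (∑ y : ZMod P, ZMod.stdAddChar (t * y ^ 2 + d * y))) := by
    rw [Finset.sum_mul]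
    simp_rw [Finset.sum_mul_sum, Finset.mul_sum]
    rw [Finset.sum_comm (γ := ZMod P) (s := Finset.univ) (t := Finset.univ)]
    apply Finset.sum_congr rfl
    intro x _
    rw [Finset.sum_mul]
    rw [Finset.sum_comm (γ := ZMod P) (s := Finset.univ) (t := Finset.univ)]
    apply Finset.sum_congr rfl
    intro y _
    have : qc P (x ^ 2 + y ^ 2) * ZMod.stdAddChar (c * x + d * y) * qg P =
        ZMod.stdAddChar (c * x + d * y) * (qc P (x ^ 2 + y ^ 2) * qg P) := by ring
    rw [this, ← qg_shift P hP, Finset.mul_sum]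
    apply Finset.sum_congr rfl
    intro t _
    have : (ZMod.stdAddChar (t * x ^ 2 + c * x) : ℂ) * ZMod.stdAddChar (t * y ^ 2 + d * y) =
        ZMod.stdAddChar (c * x + d * y) * ZMod.stdAddChar ((x ^ 2 + y ^ 2) * t) := by
      rw [← AddChar.map_add_eq_mul, ← AddChar.map_add_eq_mul]; congr 1; ring
    rw [this]; ring
  have e2 : ∀ t : ZMod P, t ≠ 0 → ∀ c : ZMod P, ∑ x : ZMod P, (ZMod.stdAddChar (t * x ^ 2 + c * x) : ℂ) =
      ZMod.stdAddChar (-(c ^ 2 / 4 * t⁻¹)) * (qc P t * qg P) := by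
    intro t ht c
    have h4 : (4 : ZMod P) ≠ 0 := by
      have : (4 : ZMod P) = 2 * 2 := by norm_num
      rw [this]; exact mul_ne_zero h2 h2
    rw [← sq_sum P hP ht, Finset.mul_sum]
    rw [← Equiv.sum_comp (Equiv.addRight (c / (2 * t))) (fun x => (ZMod.stdAddChar (-(c ^ 2 / 4 * t⁻¹)) : ℂ) * ZMod.stdAddChar (t * x ^ 2))]
    apply Finset.sum_congr rfl
    intro x _
    rw [← AddChar.map_add_eq_mul]; congr 1
    simp only [Equiv.coe_addRight]
    field_simp
    ring
  rw [e1]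
  have e3 : ∀ t : ZMod P, qc P t * ((∑ x : ZMod P, (ZMod.stdAddChar (t * x ^ 2 + c * x) : ℂ)) *
        (∑ y : ZMod P, (ZMod.stdAddChar (t * y ^ 2 + d * y) : ℂ))) =
        (qc P t⁻¹ * ZMod.stdAddChar (-((c ^ 2 + d ^ 2) / 4) * t⁻¹)) * (qg P * qg P) := by
    intro t
    by_cases ht : t = 0
    · simp [ht, qc_zero]
    · rw [e2 t ht, e2 t ht, qc_inv]
      have : (ZMod.stdAddChar (-((c ^ 2 + d ^ 2) / 4) * t⁻¹) : ℂ) =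
        ZMod.stdAddChar (-(c ^ 2 / 4 * t⁻¹)) * ZMod.stdAddChar (-(d ^ 2 / 4 * t⁻¹)) := by
        rw [← AddChar.map_add_eq_mul]; congr 1; ring
      rw [this]
      linear_combination (qc P t * (ZMod.stdAddChar (-(c ^ 2 / 4 * t⁻¹)) * ZMod.stdAddChar (-(d ^ 2 / 4 * t⁻¹))) * (qg P * qg P)) * qc_sq P ht
  rw [Finset.sum_congr rfl (fun t _ => e3 t), ← Finset.sum_mul]
  have e4 : ∑ t : ZMod P, (qc P t⁻¹ * ZMod.stdAddChar (-((c ^ 2 + d ^ 2) / 4) * t⁻¹)) =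
      ∑ t : ZMod P, (qc P t * ZMod.stdAddChar (-((c ^ 2 + d ^ 2) / 4) * t)) :=
    Equiv.sum_comp (Equiv.inv (ZMod P)) (fun t => qc P t * ZMod.stdAddChar (-((c ^ 2 + d ^ 2) / 4) * t))
  rw [e4, qg_shift P hP, qg_sq P hP, hm]
  have e5 : qc P (-((c ^ 2 + d ^ 2) / 4)) = - qc P (c ^ 2 + d ^ 2) := by
    have : -((c ^ 2 + d ^ 2) / 4) = (-1) * ((c ^ 2 + d ^ 2) * (2⁻¹ * 2⁻¹)) := by
      have h4 : (4 : ZMod P) = 2 * 2 := by norm_num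
      rw [h4]; field_simp
    rw [this, qc_mul, qc_mul, qc_mul, hm, qc_sq P (inv_ne_zero h2)]; ring
  rw [e5]; ring

lemma jac_qc (x : ℤ) : ((jacobiSym x P : ℤ) : ℂ) = qc P (x : ZMod P) := by
  rw [← jacobiSym.legendreSym.to_jacobiSym]; rfl

lemma qg_val (h : P % 4 = 1) : qg P = (Real.sqrt P : ℂ) := by
  have hP : P ≠ 2 := by rintro rfl; omega
  have h1 := sq_sum P hP (t := 1) one_ne_zero
  have : qc P 1 = 1 := by simp [qc]
  rw [this, one_mul] at h1
  rw [← h1, ← landsberg h]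
  have hne : NeZero P := ⟨(Fact.out : P.Prime).ne_zero⟩
  have hb : Function.Bijective (fun r : Fin P => (((r : ℕ) : ℤ) : ZMod P)) := by
    rw [Fintype.bijective_iff_injective_and_card]
    refine ⟨fun a b hab => ?_, by simp [ZMod.card]⟩
    simp only [Int.cast_natCast] at hab
    rw [ZMod.natCast_eq_natCast_iff', Nat.mod_eq_of_lt a.2, Nat.mod_eq_of_lt b.2] at hab
    exact Fin.ext hab
  rw [← hb.sum_comp]
  apply Finset.sum_congr rfl
  intro r _
  rw [one_mul, ← Int.cast_pow, ZMod.stdAddChar_coe]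
  push_cast; rfl

end QC
end GH

namespace GH

variable {χ : GI → GI → ℤ}

/-- the embedding -/
abbrev tc (z : GI) : ℂ := GaussianInt.toComplex z

lemma tc_re (z : GI) : (tc z).re = z.re := (GaussianInt.intCast_re z).symm
lemma tc_im (z : GI) : (tc z).im = z.im := (GaussianInt.intCast_im z).symm

lemma normSq_tc (z : GI) : normSq (tc z) = Nm z := by
  rw [Nm_eq, normSq_apply, tc_re, tc_im]; ring

lemma tc_ne {z : GI} (h : z ≠ 0) : tc z ≠ 0 := by
  intro h'; exact h (GaussianInt.toComplex_eq_zero.mp h')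

/-- complete residue system -/
def IsCRS (p : GI) {J : Type} (r : J → GI) : Prop := ∀ z, ∃! j, p ∣ z - r j

lemma eT_mul_div (r m p : GI) (hp : p ≠ 0) : eT (tc r * tc m / tc p) =
    cexp (2 * π * I * (((r * m * star p).im : ℤ) : ℂ) / ((p.norm : ℤ) : ℂ)) := by
  rw [eT_eq]
  have h : tc r * tc m / tc p = tc (r * m * star p) * (((Nm p)⁻¹ : ℝ) : ℂ) := by
    have h1 : tc (star p) = (starRingEnd ℂ) (tc p) := GaussianInt.toComplex_star p
    have h2 : tc p * (starRingEnd ℂ) (tc p) = ((Nm p : ℝ) : ℂ) := by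
      rw [Complex.mul_conj, normSq_tc]
    have h0 : tc (r * m * star p) = tc r * tc m * tc (star p) := by
      simp only [tc, map_mul]
    rw [h0, h1, Complex.ofReal_inv, ← h2]
    have := tc_ne hp
    have h3 : (starRingEnd ℂ) (tc p) ≠ 0 := by simpa using this
    field_simp
  rw [h, Complex.im_mul_ofReal, tc_im]
  congr 1
  unfold Nm
  push_cast; ring

lemma gauss_split (hχ : IsQuadSym χ) {p : GI} {P : ℕ} (hp : Split p P) :
    ∃ (J : Type) (_ : Fintype J) (r : J → GI), IsCRS p r ∧ ∀ m,
      ∑ j, (χ (r j) p : ℂ) * eT (tc (r j) * tc m / tc p) =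
        χ m p * χ ig p * (Real.sqrt (Nm p) : ℂ) := by
  have : Fact P.Prime := ⟨hp.prime⟩
  have hne : NeZero P := ⟨hp.prime.ne_zero⟩
  have hP2 : P ≠ 2 := by have := hp.mod4; rintro rfl; omega
  refine ⟨ZMod P, inferInstance, fun x => ((x.val : ℤ) : GI), ?_, ?_⟩
  · intro z
    have h0 : ((p.re : ℤ) : ZMod P) ≠ 0 := by
      rw [Ne, ZMod.intCast_zmod_eq_zero_iff_dvd]; exact split_coprime_re hp
    have key : ∀ x : ZMod P, p ∣ z - ((x.val : ℤ) : GI) ↔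
        ((p.re : ℤ) : ZMod P) * x = ((p.re * z.re + p.im * z.im : ℤ) : ZMod P) := by
      intro x
      have hcop : p ∣ (p.re : GI) * (z - ((x.val : ℤ) : GI)) ↔ p ∣ z - ((x.val : ℤ) : GI) := by
        constructor
        · intro h
          rcases hp.pp.prime.dvd_or_dvd h with h | h
          · rw [split_dvd_int hp] at h; exact absurd h (split_coprime_re hp)
          · exact h
        · exact fun h => Dvd.dvd.mul_left h _
      rw [← hcop]
      have e : (p.re : GI) * (z - ((x.val : ℤ) : GI)) =
        ((p.re : GI) * z - ((p.re * z.re + p.im * z.im : ℤ) : GI)) +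
          (((p.re * z.re + p.im * z.im) - p.re * x.val : ℤ) : GI) := by push_cast; ring
      rw [e, dvd_add_right (split_red z), split_dvd_int hp, ← ZMod.intCast_zmod_eq_zero_iff_dvd]
      push_cast
      rw [ZMod.natCast_zmod_val, sub_eq_zero]
      exact eq_comm
    refine ⟨((p.re : ℤ) : ZMod P)⁻¹ * ((p.re * z.re + p.im * z.im : ℤ) : ZMod P), ?_, ?_⟩
    · simp only [key]; field_simp
    · intro y hy
      simp only [key] at hy
      rw [← hy]; field_simp
  · intro m
    have h1 : ∀ x : ZMod P, (χ ((x.val : ℤ) : GI) p : ℂ) * eT (tc ((x.val : ℤ) : GI) * tc m / tc p) =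
        qc P x * ZMod.stdAddChar (((m.im * p.re - m.re * p.im : ℤ) : ZMod P) * x) := by
      intro x
      rw [split_chi_int hχ hp, jac_qc, eT_mul_div _ _ _ hp.pp.prime.ne_zero, hp.norm]
      congr 1
      · simp
      · have : ((m.im * p.re - m.re * p.im : ℤ) : ZMod P) * x =
            (((m.im * p.re - m.re * p.im) * x.val : ℤ) : ZMod P) := by
          push_cast; rw [ZMod.natCast_zmod_val]
        rw [this, ZMod.stdAddChar_coe]
        congr 3
        have : (((x.val : ℤ) : GI) * m * star p).im = (m.im * p.re - m.re * p.im) * x.val := by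
          simp only [Zsqrtd.im_mul, Zsqrtd.re_mul, Zsqrtd.re_intCast, Zsqrtd.im_intCast, Zsqrtd.re_star, Zsqrtd.im_star]; ring
        rw [this]
    rw [Finset.sum_congr rfl (fun x _ => h1 x), qg_shift P hP2, qg_val P hp.mod4]
    have h2 : (χ m p : ℂ) * χ ig p = qc P ((m.im * p.re - m.re * p.im : ℤ) : ZMod P) := by
      rw [← Int.cast_mul, mul_comm, ← chi_mul_prime hχ hp.pp, split_chi hχ hp, jac_qc]
      have e : (p.re * (ig * m).re + p.im * (ig * m).im) = -1 * (m.im * p.re - m.re * p.im) := by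
        simp [ig]; ring
      rw [e]
      push_cast
      rw [qc_mul]
      have : qc P (-1) = 1 := by
        have : ((-1 : ℤ) : ZMod P) = -1 := by simp
        rw [← this, ← jac_qc, jacobiSym.at_neg_one (by have := hp.mod4; rw [Nat.odd_iff]; omega),
          ZMod.χ₄_nat_one_mod_four hp.mod4]; simp
      rw [this, one_mul]
    rw [h2]
    have : Nm p = (P : ℝ) := by unfold Nm; rw [hp.norm]; simp
    rw [this]

lemma gauss_inert (hχ : IsQuadSym χ) {p : GI} {P : ℕ} (hp : Inert p P) :
    ∃ (J : Type) (_ : Fintype J) (r : J → GI), IsCRS p r ∧ ∀ m,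
      ∑ j, (χ (r j) p : ℂ) * eT (tc (r j) * tc m / tc p) =
        χ m p * χ ig p * (Real.sqrt (Nm p) : ℂ) := by
  have : Fact P.Prime := ⟨hp.prime⟩
  have hne : NeZero P := ⟨hp.prime.ne_zero⟩
  have hP2 : P ≠ 2 := by have := hp.mod4; rintro rfl; omega
  refine ⟨ZMod P × ZMod P, inferInstance, fun x => ⟨(x.1.val : ℤ), (x.2.val : ℤ)⟩, ?_, ?_⟩
  · intro z
    have key : ∀ x : ZMod P × ZMod P, p ∣ z - (⟨(x.1.val : ℤ), (x.2.val : ℤ)⟩ : GI) ↔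
        x = ((z.re : ZMod P), (z.im : ZMod P)) := by
      intro x
      have : ((P : ℕ) : GI) = ((P : ℤ) : GI) := by push_cast; rfl
      rw [hp.eq, neg_dvd, this, Zsqrtd.intCast_dvd]
      simp only [Zsqrtd.re_sub, Zsqrtd.im_sub]
      rw [← ZMod.intCast_zmod_eq_zero_iff_dvd, ← ZMod.intCast_zmod_eq_zero_iff_dvd]
      push_cast
      rw [ZMod.natCast_zmod_val, ZMod.natCast_zmod_val, sub_eq_zero, sub_eq_zero, Prod.ext_iff]
      constructor
      · rintro ⟨h1, h2⟩; exact ⟨h1.symm, h2.symm⟩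
      · rintro ⟨h1, h2⟩; exact ⟨h1.symm, h2.symm⟩
    refine ⟨((z.re : ZMod P), (z.im : ZMod P)), ?_, ?_⟩
    · exact (key _).mpr rfl
    · intro y hy
      exact (key y).mp hy
  · intro m
    have hm1 : qc P (-1) = -1 := by
      have : ((-1 : ℤ) : ZMod P) = -1 := by simp
      rw [← this, ← jac_qc, jacobiSym.at_neg_one (by have := hp.mod4; rw [Nat.odd_iff]; omega),
          ZMod.χ₄_nat_three_mod_four hp.mod4]; simp
    have h1 : ∀ x : ZMod P × ZMod P, (χ (⟨(x.1.val : ℤ), (x.2.val : ℤ)⟩ : GI) p : ℂ) *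
        eT (tc (⟨(x.1.val : ℤ), (x.2.val : ℤ)⟩ : GI) * tc m / tc p) =
        qc P (x.1 ^ 2 + x.2 ^ 2) * ZMod.stdAddChar (((-m.im : ℤ) : ZMod P) * x.1 + ((-m.re : ℤ) : ZMod P) * x.2) := by
      intro x
      rw [inert_chi hχ hp, jac_qc, eT_mul_div _ _ _ hp.pp.prime.ne_zero, inert_norm hp]
      congr 1
      · rw [norm_eq]; push_cast
        rw [ZMod.natCast_zmod_val, ZMod.natCast_zmod_val]
        congr 1; ring
      · have : ((-m.im : ℤ) : ZMod P) * x.1 + ((-m.re : ℤ) : ZMod P) * x.2 =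
            (((-m.im) * x.1.val + (-m.re) * x.2.val : ℤ) : ZMod P) := by
          push_cast; rw [ZMod.natCast_zmod_val, ZMod.natCast_zmod_val]
        rw [this, ZMod.stdAddChar_coe]
        congr 1
        have hPc : (P : ℂ) ≠ 0 := by exact_mod_cast hp.prime.ne_zero
        have e : ((⟨(x.1.val : ℤ), (x.2.val : ℤ)⟩ : GI) * m * star p).im =
            -(P : ℤ) * (x.1.val * m.im + x.2.val * m.re) := by
          rw [hp.eq]; simp; ring
        rw [e]; push_cast
        field_simp
        ring
    rw [Finset.sum_congr rfl (fun x _ => h1 x), Fintype.sum_prod_type]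
    simp only
    rw [norm_sum P hP2 hm1]
    have hig : χ ig p = 1 := by
      rw [inert_chi hχ hp]
      have : (ig : GI).norm = 1 := by rw [norm_eq]; simp [ig]
      rw [this, jacobiSym.one_left]
    have hmc : (χ m p : ℂ) = qc P (((-m.im : ℤ) : ZMod P) ^ 2 + ((-m.re : ℤ) : ZMod P) ^ 2) := by
      rw [inert_chi hχ hp, jac_qc, norm_eq]
      congr 1; push_cast; ring
    rw [hmc, hig]
    have : Nm p = (P : ℝ) ^ 2 := by unfold Nm; rw [inert_norm hp]; simp
    rw [this, Real.sqrt_sq (by positivity)]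
    push_cast; ring

theorem gauss_prime (hχ : IsQuadSym χ) {p : GI} (hp : PPrime p) :
    ∃ (J : Type) (_ : Fintype J) (r : J → GI), IsCRS p r ∧ ∀ m,
      ∑ j, (χ (r j) p : ℂ) * eT (tc (r j) * tc m / tc p) =
        χ m p * χ ig p * (Real.sqrt (Nm p) : ℂ) := by
  rcases pprime_classify hp with ⟨P, h⟩ | ⟨P, h⟩
  · exact gauss_split hχ h
  · exact gauss_inert hχ h

/-- existence of finite residue systems -/
lemma exists_crs {m : GI} (hm : m ≠ 0) : ∃ (J : Type) (_ : Fintype J) (r : J → GI), IsCRS m r ∧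
    (Fintype.card J : ℝ) ≤ (Nm m) ^ 2 := by
  set K := m.norm.toNat with hK
  have hpos := norm_pos' hm
  have hK0 : 0 < K := by omega
  let f : Fin K × Fin K → GI ⧸ Ideal.span {m} := fun x =>
    Ideal.Quotient.mk _ (⟨((x.1 : ℕ) : ℤ), ((x.2 : ℕ) : ℤ)⟩ : GI)
  have hf : Function.Surjective f := by
    intro y
    obtain ⟨z, rfl⟩ := Ideal.Quotient.mk_surjective y
    have hKz : (K : ℤ) = m.norm := by omega
    have b1 : (z.re % K).toNat < K := by
      have := Int.emod_lt_of_pos z.re (by omega : (0 : ℤ) < K)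
      have := Int.emod_nonneg z.re (by omega : (K : ℤ) ≠ 0)
      omega
    have b2 : (z.im % K).toNat < K := by
      have := Int.emod_lt_of_pos z.im (by omega : (0 : ℤ) < K)
      have := Int.emod_nonneg z.im (by omega : (K : ℤ) ≠ 0)
      omega
    refine ⟨(⟨_, b1⟩, ⟨_, b2⟩), ?_⟩
    simp only [f]
    rw [Ideal.Quotient.mk_eq_mk_iff_sub_mem, Ideal.mem_span_singleton]
    have h1 : m ∣ ((K : ℤ) : GI) := by
      rw [hKz, Zsqrtd.norm_eq_mul_conj]; exact dvd_mul_right _ _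
    refine h1.trans ?_
    rw [Zsqrtd.intCast_dvd]
    have a1 := Int.emod_nonneg z.im (by omega : (K : ℤ) ≠ 0)
    have a2 := Int.emod_nonneg z.re (by omega : (K : ℤ) ≠ 0)
    simp only [Zsqrtd.re_sub, Zsqrtd.im_sub]
    rw [Int.toNat_of_nonneg a1, Int.toNat_of_nonneg a2]
    exact ⟨⟨-(z.re / K), by have := Int.mul_ediv_add_emod z.re K; linarith⟩,
      ⟨-(z.im / K), by have := Int.mul_ediv_add_emod z.im K; linarith⟩⟩
  have hfin : Finite (GI ⧸ Ideal.span {m}) := Finite.of_surjective f hf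
  refine ⟨GI ⧸ Ideal.span {m}, Fintype.ofFinite _, fun j => Quotient.out j, ?_, ?_⟩
  · intro z
    refine ⟨Ideal.Quotient.mk _ z, ?_, ?_⟩
    · simp only
      rw [← Ideal.mem_span_singleton, ← Ideal.Quotient.mk_eq_mk_iff_sub_mem]
      exact (Ideal.Quotient.mk_out _).symm
    · intro y hy
      simp only at hy
      rw [← Ideal.mem_span_singleton, ← Ideal.Quotient.mk_eq_mk_iff_sub_mem, Ideal.Quotient.mk_out] at hy
      exact hy.symm
  · have h1 := @Fintype.card_le_of_surjective _ _ _ (Fintype.ofFinite _) f hf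
    have h2 : (K : ℝ) = Nm m := by
      unfold Nm; rw [← Int.cast_natCast]; congr 1; omega
    rw [← h2]
    have : Fintype.card (Fin K × Fin K) = K ^ 2 := by simp [sq]
    rw [this] at h1
    exact_mod_cast h1

end GH

namespace GH

variable {χ : GI → GI → ℤ}

def giEquiv : ℤ × ℤ ≃ GI where
  toFun x := ⟨x.1, x.2⟩
  invFun z := (z.re, z.im)
  left_inv _ := rfl
  right_inv _ := rfl

lemma gauss_summable {c : ℝ} (hc : 0 < c) (b : ℂ) :
    Summable fun m : GI => Real.exp (-c * normSq (tc m + b)) := by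
  rw [← giEquiv.summable_iff]
  have h := Summable.mul_of_nonneg (gaussZ_summable hc b.re) (gaussZ_summable hc b.im)
    (fun _ => (Real.exp_pos _).le) (fun _ => (Real.exp_pos _).le)
  convert h using 1
  ext x
  simp only [Function.comp]
  rw [← Real.exp_add]
  congr 1
  rw [normSq_apply, Complex.add_re, Complex.add_im, tc_re, tc_im]
  simp only [giEquiv, Equiv.coe_fn_mk]
  ring

/-- one-dimensional Poisson for Gaussians -/
lemma poisson1 {t : ℝ} (ht : 0 < t) (α β : ℝ) :
    ∑' x : ℤ, cexp (2 * π * I * α * x - π * t * (x + β) ^ 2) =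
      (1 / (Real.sqrt t : ℂ)) * ∑' n : ℤ, cexp (-π * (n - α) ^ 2 / t + 2 * π * I * β * (n - α)) := by
  have ht' : (t : ℂ) ≠ 0 := by exact_mod_cast ht.ne'
  have h := Complex.tsum_exp_neg_quadratic (a := (t : ℂ)) (by simpa using ht) (I * α - t * β)
  have e1 : ∀ x : ℤ, cexp (2 * π * I * α * x - π * t * (x + β) ^ 2) =
      cexp (-π * t * β ^ 2) * cexp (-π * t * x ^ 2 + 2 * π * (I * α - t * β) * x) := by
    intro x; rw [← Complex.exp_add]; congr 1; ring
  simp_rw [e1]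
  rw [tsum_mul_left, h]
  have e2 : (t : ℂ) ^ (1 / 2 : ℂ) = (Real.sqrt t : ℂ) := by
    have : (1 / 2 : ℂ) = ((1 / 2 : ℝ) : ℂ) := by push_cast; rfl
    rw [this, ← Complex.ofReal_cpow ht.le, ← Real.sqrt_eq_rpow]
  rw [e2, mul_left_comm, ← tsum_mul_left]
  congr 2; ext n
  rw [← Complex.exp_add]; congr 1
  field_simp
  ring_nf
  simp only [I_sq, I_pow_four, I_pow_three]
  ring_nf

lemma poisson1_summable {t : ℝ} (ht : 0 < t) (α β : ℝ) :
    Summable fun x : ℤ => ‖cexp (2 * π * I * α * x - π * t * (x + β) ^ 2)‖ := by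
  have h := gaussZ_summable (c := π * t) (by positivity) β
  convert h using 1
  ext x
  rw [Complex.norm_exp]; congr 1
  have : 2 * π * I * α * x - π * t * ((x : ℂ) + β) ^ 2 =
    ((2 * π * α * x : ℝ) : ℂ) * I + ((-(π * t) * (x + β) ^ 2 : ℝ) : ℂ) := by push_cast; ring
  rw [this, Complex.add_re, Complex.ofReal_re, Complex.re_ofReal_mul]; simp

lemma poisson1_summable' {t : ℝ} (ht : 0 < t) (α β : ℝ) :
    Summable fun n : ℤ => ‖cexp (-π * (n - α) ^ 2 / t + 2 * π * I * β * (n - α))‖ := by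
  have h := gaussZ_summable (c := π / t) (by positivity) (-α)
  convert h using 1
  ext x
  rw [Complex.norm_exp]; congr 1
  have : -π * ((x : ℂ) - α) ^ 2 / t + 2 * π * I * β * (x - α) =
    ((2 * π * β * (x - α) : ℝ) : ℂ) * I + ((-(π / t) * (x + -α) ^ 2 : ℝ) : ℂ) := by push_cast; ring
  rw [this, Complex.add_re, Complex.ofReal_re, Complex.re_ofReal_mul]; simp

def Tsum (χ : GI → GI → ℤ) (n : GI) (a b : ℂ) (t : ℝ) : ℂ :=
  ∑' m : GI, (χ m n : ℂ) * eT (a * tc m) * (Real.exp (-π * t * normSq (tc m + b)) : ℂ)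

def Usum (χ : GI → GI → ℤ) (n : GI) (a b : ℂ) (t : ℝ) : ℂ :=
  ∑' k : GI, (χ k n : ℂ) * eT (-(b * (tc k / tc n + a))) * (Real.exp (-π / t * normSq (tc k / tc n + a)) : ℂ)

def dualEquiv : ℤ × ℤ ≃ GI where
  toFun x := ⟨-x.2, -x.1⟩
  invFun z := (-z.im, -z.re)
  left_inv _ := by simp
  right_inv _ := by simp

lemma poisson_one (hχ : IsQuadSym χ) (a b : ℂ) {t : ℝ} (ht : 0 < t) :
    Tsum χ 1 a b t = (1 / (t : ℂ)) * Usum χ 1 a b t := by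
  unfold Tsum Usum
  rw [← giEquiv.tsum_eq, ← dualEquiv.tsum_eq]
  have e1 : ∀ x : ℤ × ℤ, (χ (giEquiv x) 1 : ℂ) * eT (a * tc (giEquiv x)) *
      (Real.exp (-π * t * normSq (tc (giEquiv x) + b)) : ℂ) =
      cexp (2 * π * I * a.im * x.1 - π * t * (x.1 + b.re) ^ 2) *
      cexp (2 * π * I * a.re * x.2 - π * t * (x.2 + b.im) ^ 2) := by
    intro x
    rw [chi_den_one hχ, eT_eq, Complex.ofReal_exp, Int.cast_one, one_mul, ← Complex.exp_add, ← Complex.exp_add]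
    congr 1
    rw [normSq_apply, Complex.add_re, Complex.add_im, Complex.mul_im, tc_re, tc_im]
    simp only [giEquiv, Equiv.coe_fn_mk]
    push_cast; ring
  have e2 : ∀ x : ℤ × ℤ, (χ (dualEquiv x) 1 : ℂ) * eT (-(b * (tc (dualEquiv x) / tc 1 + a))) *
      (Real.exp (-π / t * normSq (tc (dualEquiv x) / tc 1 + a)) : ℂ) =
      cexp (-π * (x.1 - a.im) ^ 2 / t + 2 * π * I * b.re * (x.1 - a.im)) *
      cexp (-π * (x.2 - a.re) ^ 2 / t + 2 * π * I * b.im * (x.2 - a.re)) := by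
    intro x
    have : tc 1 = 1 := by simp [tc]
    rw [chi_den_one hχ, eT_eq, Complex.ofReal_exp, Int.cast_one, one_mul, ← Complex.exp_add, ← Complex.exp_add, this,
      div_one]
    congr 1
    rw [normSq_apply, Complex.add_re, Complex.add_im, Complex.neg_im, Complex.mul_im, Complex.add_im, Complex.add_re, tc_re, tc_im]
    simp only [dualEquiv, Equiv.coe_fn_mk]
    push_cast; ring
  simp_rw [e1, e2]
  rw [← tsum_mul_tsum_of_summable_norm (poisson1_summable ht _ _) (poisson1_summable ht _ _),
    ← tsum_mul_tsum_of_summable_norm (poisson1_summable' ht _ _) (poisson1_summable' ht _ _),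
    poisson1 ht, poisson1 ht]
  have : (t : ℂ) = (Real.sqrt t : ℂ) * (Real.sqrt t : ℂ) := by
    rw [← Complex.ofReal_mul, Real.mul_self_sqrt ht.le]
  have h1 : 1 / (t : ℂ) = (1 / (Real.sqrt t : ℂ)) * (1 / (Real.sqrt t : ℂ)) := by
    rw [one_div_mul_one_div, ← this]
  rw [h1]
  exact mul_mul_mul_comm _ _ _ _

lemma T_summable (hχ : IsQuadSym χ) {n : GI} (hn : IsPrimary n) (a b : ℂ) {t : ℝ} (ht : 0 < t) :
    Summable fun m : GI => (χ m n : ℂ) * eT (a * tc m) * (Real.exp (-π * t * normSq (tc m + b)) : ℂ) := by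
  apply Summable.of_norm_bounded (gauss_summable (c := π * t) (by positivity) b)
  intro m
  rw [norm_mul, norm_mul, norm_eT, mul_one, Complex.norm_real, Real.norm_eq_abs, abs_of_pos (Real.exp_pos _)]
  have h := chi_norm_le hχ hn m
  have h2 := (Real.exp_pos (-π * t * normSq (tc m + b))).le
  calc _ ≤ 1 * Real.exp (-π * t * normSq (tc m + b)) := by gcongr
    _ = _ := by rw [one_mul]; congr 1; ring

lemma U_summable (hχ : IsQuadSym χ) {n : GI} (hn : IsPrimary n) (a b : ℂ) {t : ℝ} (ht : 0 < t) :
    Summable fun k : GI => (χ k n : ℂ) * eT (-(b * (tc k / tc n + a))) *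
      (Real.exp (-π / t * normSq (tc k / tc n + a)) : ℂ) := by
  have hN := Nm_pos (primary_ne_zero hn)
  have hn0 := tc_ne (primary_ne_zero hn)
  apply Summable.of_norm_bounded (gauss_summable (c := π / t / Nm n) (by positivity) (a * tc n))
  intro k
  rw [norm_mul, norm_mul, norm_eT, mul_one, Complex.norm_real, Real.norm_eq_abs, abs_of_pos (Real.exp_pos _)]
  have h := chi_norm_le hχ hn k
  calc _ ≤ 1 * Real.exp (-π / t * normSq (tc k / tc n + a)) := by gcongr
    _ = _ := by
      rw [one_mul]; congr 1
      have : tc k + a * tc n = (tc k / tc n + a) * tc n := by field_simp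
      rw [this, map_mul, normSq_tc]
      field_simp

/-- the bijection `(j, k) ↦ k p + r_j n` -/
lemma crs_bij {p n : GI} {J : Type} {r : J → GI} (hr : IsCRS p r) (hp : p ≠ 0) (h : IsCoprime p n) :
    Function.Bijective (fun x : J × GI => x.2 * p + r x.1 * n) := by
  constructor
  · rintro ⟨j, k⟩ ⟨j', k'⟩ hh
    simp only at hh
    have h1 : p ∣ (r j - r j') * n := ⟨k' - k, by linear_combination hh⟩
    have h2 : p ∣ r j - r j' := h.dvd_of_dvd_mul_right h1
    have hj : j = j' := (hr (r j)).unique (by simp) h2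
    subst hj
    have : k * p = k' * p := by linear_combination hh
    rw [mul_right_cancel₀ hp this]
  · intro K
    obtain ⟨u, v, huv⟩ := h
    obtain ⟨j, hj, _⟩ := hr (K * v)
    obtain ⟨q, hq⟩ := hj
    refine ⟨(j, q * n + K * u), ?_⟩
    simp only
    linear_combination K * huv - n * hq

theorem poisson (hχ : IsQuadSym χ) {n : GI} (hn : IsPrimary n) (hsq : Squarefree n) :
    ∀ (a b : ℂ) {t : ℝ}, 0 < t →
    Tsum χ n a b t = ((χ ig n : ℂ) / (Real.sqrt (Nm n) : ℂ)) * (1 / (t : ℂ)) * Usum χ n a b t := by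
  revert hsq
  revert hn
  refine prim_induct (motive := fun n => Squarefree n → ∀ (a b : ℂ) {t : ℝ}, 0 < t →
    Tsum χ n a b t = ((χ ig n : ℂ) / (Real.sqrt (Nm n) : ℂ)) * (1 / (t : ℂ)) * Usum χ n a b t) ?_ ?_ n
  · intro _ a b t ht
    rw [poisson_one hχ a b ht, chi_den_one hχ, Nm_one]; simp
  · intro p n hp hn ih hsq a b t ht
    have hsn : Squarefree n := hsq.of_mul_right
    have hnd : ¬ p ∣ n := by
      intro h
      have := hsq p (mul_dvd_mul_left p h)
      exact hp.prime.not_isUnit this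
    have hcop : IsCoprime p n := (Irreducible.coprime_iff_not_dvd hp.prime.irreducible).mpr hnd
    obtain ⟨J, hJ, r, hr, hG⟩ := gauss_prime hχ hp
    have hp0 := hp.prime.ne_zero
    have hNp := Nm_pos hp0
    have hNn := Nm_pos (primary_ne_zero hn)
    have hpc := tc_ne hp0
    have hnc := tc_ne (primary_ne_zero hn)
    set g : ℂ := (Real.sqrt (Nm p) : ℂ) with hg
    have hg0 : g ≠ 0 := by rw [hg]; exact_mod_cast (Real.sqrt_pos.mpr hNp).ne'
    have hgn : (Real.sqrt (Nm n) : ℂ) ≠ 0 := by exact_mod_cast (Real.sqrt_pos.mpr hNn).ne'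
    have hig : (χ ig p : ℂ) * χ ig p = 1 := by
      rw [← Int.cast_mul, chi_unit_sq hχ hp.prim]
      · simp
      · exact isUnit_iff_exists_inv.mpr ⟨⟨0, -1⟩, by ext <;> simp [ig]⟩
    -- expand
    have s1 : Tsum χ (p * n) a b t = ((χ ig p : ℂ) / g) * ∑ j, (χ (r j) p : ℂ) * Tsum χ n (a + tc (r j) / tc p) b t := by
      unfold Tsum
      simp_rw [← tsum_mul_left]
      rw [← Summable.tsum_finsetSum (fun j _ => (T_summable hχ hn _ b ht).mul_left _), ← tsum_mul_left]
      congr 1; ext m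
      have e : ∀ j, (χ (r j) p : ℂ) * ((χ m n : ℂ) * eT ((a + tc (r j) / tc p) * tc m) * (Real.exp (-π * t * normSq (tc m + b)) : ℂ))
        = ((χ m n : ℂ) * eT (a * tc m) * (Real.exp (-π * t * normSq (tc m + b)) : ℂ)) * ((χ (r j) p : ℂ) * eT (tc (r j) * tc m / tc p)) := by
        intro j
        have : (a + tc (r j) / tc p) * tc m = a * tc m + tc (r j) * tc m / tc p := by ring
        rw [this, eT_add]; ring
      rw [Finset.sum_congr rfl (fun j _ => e j), ← Finset.mul_sum, hG, chi_den_mul hχ m hp.prim hn]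
      generalize (Real.exp (-π * t * normSq (tc m + b)) : ℂ) = E
      push_cast
      field_simp
      linear_combination (-((χ m n : ℂ) * χ m p * eT (a * tc m) * E)) * hig
    have s2 : Usum χ (p * n) a b t = ∑ j, (χ (r j) p : ℂ) * Usum χ n (a + tc (r j) / tc p) b t := by
      unfold Usum
      have hb := crs_bij hr hp0 hcop
      have hsum := U_summable hχ (primary_mul hp.prim hn) a b ht
      have hsum' := (Equiv.ofBijective _ hb).summable_iff.mpr hsum
      simp only [Function.comp_def] at hsum'
      rw [← (Equiv.ofBijective _ hb).tsum_eq, Summable.tsum_prod hsum', tsum_fintype]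
      apply Finset.sum_congr rfl
      intro j _
      rw [← tsum_mul_left]
      congr 1; ext k
      simp only [Equiv.ofBijective_apply]
      have e1 : tc (k * p + r j * n) / tc (p * n) + a = tc k / tc n + (a + tc (r j) / tc p) := by
        simp only [tc, map_add, map_mul]
        change (tc k * tc p + tc (r j) * tc n) / (tc p * tc n) + a = tc k / tc n + (a + tc (r j) / tc p)
        field_simp; ring
      have e2 : χ (k * p + r j * n) (p * n) = χ (r j) p * χ k n := by
        rw [chi_den_mul hχ _ hp.prim hn, chi_per hχ hp.prim (a := k * p + r j * n) (b := r j * n) ⟨k, by ring⟩,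
          chi_per hχ hn (a := k * p + r j * n) (b := k * p) ⟨r j, by ring⟩, chi_mul hχ _ _ hp.prim, chi_mul hχ _ _ hn,
          recip hχ hn hp.prim]
        have h := chi_sq hχ hn hcop
        linear_combination χ (r j) p * χ k n * h
      rw [e1, e2]; push_cast; ring
    rw [s1, s2, chi_den_mul hχ _ hp.prim hn, Nm_mul, Real.sqrt_mul hNp.le]
    simp_rw [ih hsn _ b ht]
    rw [Finset.mul_sum, Finset.mul_sum]
    apply Finset.sum_congr rfl
    intro j _
    push_cast
    rw [← hg]
    field_simp

end GH

namespace GH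

variable {χ : GI → GI → ℤ}

/-- primary Gaussian integers -/
abbrev Prm := {n : GI // IsPrimary n}

lemma summable_Nm {s : ℝ} (hs : 1 < s) : Summable fun k : GI => (Nm k) ^ (-s) := by
  have h := EisensteinSeries.summable_one_div_norm_rpow (k := 2 * s) (by linarith)
  rw [← giEquiv.summable_iff, ← (finTwoArrowEquiv ℤ).summable_iff]
  refine Summable.of_nonneg_of_le (fun x => ?_) (fun x => ?_) h
  · exact Real.rpow_nonneg (Nm_nonneg _) _
  · simp only [Function.comp]
    have hle : ‖x‖ ^ 2 ≤ Nm (giEquiv (finTwoArrowEquiv ℤ x)) := by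
      rw [Nm_eq]
      change _ ≤ ((x 0 : ℤ) : ℝ) ^ 2 + ((x 1 : ℤ) : ℝ) ^ 2
      have h0 : ‖x‖ = max |(x 0 : ℝ)| |(x 1 : ℝ)| := by
        rw [EisensteinSeries.norm_eq_max_natAbs]
        push_cast [Nat.cast_natAbs]
        rfl
      rw [h0]
      rcases max_cases |(x 0 : ℝ)| |(x 1 : ℝ)| with ⟨h, _⟩ | ⟨h, _⟩ <;> rw [h, sq_abs] <;> nlinarith [sq_nonneg (x 0 : ℝ), sq_nonneg (x 1 : ℝ)]
    by_cases hx : x = 0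
    · subst hx
      have : Nm (giEquiv (finTwoArrowEquiv ℤ 0)) = 0 := by
        rw [Nm_eq]; simp [giEquiv]
      rw [this, norm_zero, Real.zero_rpow (by linarith), Real.zero_rpow (by linarith)]
    · have hpos : 0 < ‖x‖ := norm_pos_iff.mpr hx
      have : ‖x‖ ^ (-(2 * s)) = (‖x‖ ^ 2) ^ (-s) := by
        rw [← Real.rpow_natCast, ← Real.rpow_mul hpos.le]; congr 1; push_cast; ring
      rw [this]
      exact Real.rpow_le_rpow_of_nonpos (by positivity) hle (by linarith)

lemma summable_Nm_prm {s : ℝ} (hs : 1 < s) : Summable fun k : Prm => (Nm k.1) ^ (-s) :=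
  (summable_Nm hs).comp_injective Subtype.val_injective

lemma summable_Nm_pow {j : ℕ} (hj : 2 ≤ j) : Summable fun k : GI => ((Nm k) ^ j)⁻¹ := by
  have h := summable_Nm (s := j) (by exact_mod_cast hj)
  refine h.congr (fun k => ?_)
  rw [Real.rpow_neg (Nm_nonneg _), Real.rpow_natCast]

lemma summable_Nm_pow_prm {j : ℕ} (hj : 2 ≤ j) : Summable fun k : Prm => ((Nm k.1) ^ j)⁻¹ :=
  (summable_Nm_pow hj).comp_injective Subtype.val_injective

/-! ### primary divisors and Möbius -/

lemma finite_Nm_le (x : ℝ) : {z : GI | Nm z ≤ x}.Finite := by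
  by_contra hinf
  have h := (summable_Nm_pow (j := 2) le_rfl).tendsto_cofinite_zero
  have h2 : ∀ᶠ z in cofinite, ((Nm z) ^ 2)⁻¹ < (((|x| + 1)) ^ 2)⁻¹ :=
    h.eventually (gt_mem_nhds (by positivity))
  have h4 : ∀ᶠ z : GI in cofinite, z ≠ 0 := by
    rw [Filter.eventually_cofinite]; simp
  have h3 := h2.and h4
  rw [Filter.eventually_cofinite] at h3
  apply hinf
  refine h3.subset ?_
  rintro z hz ⟨hz', hz0⟩
  have hz : Nm z ≤ x := hz
  have hpos := Nm_pos hz0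
  rw [inv_lt_inv₀ (by positivity) (by positivity)] at hz'
  have := lt_of_pow_lt_pow_left₀ 2 hpos.le hz'
  linarith [le_abs_self x]

lemma Nm_le_of_dvd {d n : GI} (hn : n ≠ 0) (h : d ∣ n) : Nm d ≤ Nm n := by
  obtain ⟨c, rfl⟩ := h
  rw [Nm_mul]
  have hc : c ≠ 0 := right_ne_zero_of_mul hn
  nlinarith [one_le_Nm hc, Nm_nonneg d]

lemma pdiv_finite {n : GI} (hn : n ≠ 0) : {d : Prm | d.1 ∣ n}.Finite := by
  apply Set.Finite.of_finite_image _ (Subtype.val_injective.injOn)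
  refine (finite_Nm_le (Nm n)).subset ?_
  rintro _ ⟨d, hd, rfl⟩
  exact Nm_le_of_dvd hn hd

/-- the finset of primary divisors -/
def pdiv (n : GI) : Finset Prm := if hn : n ≠ 0 then (pdiv_finite hn).toFinset else ∅

lemma mem_pdiv {n : GI} (hn : n ≠ 0) (d : Prm) : d ∈ pdiv n ↔ d.1 ∣ n := by
  unfold pdiv; rw [dif_pos hn]; simp

/-- Möbius function -/
def mu (d : GI) : ℤ :=
  if Squarefree d then (-1) ^ (UniqueFactorizationMonoid.factors d).card else 0

lemma mu_abs (d : GI) : |mu d| ≤ 1 := by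
  unfold mu; split_ifs
  · rw [abs_pow]; simp
  · simp

lemma mu_one : mu 1 = 1 := by
  unfold mu; simp

lemma mu_prime_mul {p d : GI} (hp : Prime p) (hd : d ≠ 0) (h : ¬ p ∣ d) : mu (p * d) = - mu d := by
  have hcop : IsRelPrime p d := (hp.irreducible.isRelPrime_iff_not_dvd).mpr h
  have e : Squarefree (p * d) ↔ Squarefree d := by
    rw [squarefree_mul_iff]
    exact ⟨fun h => h.2.2, fun h => ⟨hcop, hp.irreducible.squarefree, h⟩⟩
  unfold mu
  rw [if_congr e rfl rfl]
  split_ifs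
  · have h1 := UniqueFactorizationMonoid.factors_mul hp.ne_zero hd
    have h2 := prime_factors_irreducible hp.irreducible ⟨UniqueFactorizationMonoid.prime_of_factor, UniqueFactorizationMonoid.factors_prod hp.ne_zero⟩
    obtain ⟨q, hq, hpq⟩ := h2
    have := Multiset.card_eq_card_of_rel h1
    rw [this, Multiset.card_add, hpq, Multiset.card_singleton, pow_add]; ring
  · simp

lemma mu_sq_dvd {p d : GI} (hp : Prime p) (h : p * p ∣ d) : mu d = 0 := by
  unfold mu
  rw [if_neg]
  intro hs
  exact hp.not_isUnit (hs p h)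

theorem sum_mu {g : GI} (hg : IsPrimary g) : ∑ d ∈ pdiv g, mu d.1 = if g = 1 then 1 else 0 := by
  revert hg
  refine prim_induct (motive := fun g => ∑ d ∈ pdiv g, mu d.1 = if g = 1 then 1 else 0) ?_ ?_ g
  · rw [if_pos rfl]
    have : pdiv 1 = {⟨1, primary_one⟩} := by
      ext d
      rw [mem_pdiv one_ne_zero, Finset.mem_singleton]
      constructor
      · intro h
        exact Subtype.ext (primary_unit (isUnit_of_dvd_one h) d.2)
      · rintro rfl; exact dvd_rfl
    rw [this, Finset.sum_singleton]; exact mu_one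
  · intro p m hp hm ih
    have hm0 := primary_ne_zero hm
    have hp0 := hp.prime.ne_zero
    have hpm : p * m ≠ 0 := mul_ne_zero hp0 hm0
    rw [if_neg (fun h => hp.prime.not_isUnit (IsUnit.of_mul_eq_one _ h))]
    have hinj : Function.Injective (fun d : Prm => (⟨p * d.1, primary_mul hp.prim d.2⟩ : Prm)) := by
      intro a b hab
      apply Subtype.ext
      exact mul_left_cancel₀ hp0 (congrArg Subtype.val hab)
    by_cases hdvd : p ∣ m
    · have hsub : pdiv m ⊆ pdiv (p * m) := by
        intro d hd
        rw [mem_pdiv hm0] at hd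
        rw [mem_pdiv hpm]; exact hd.mul_left _
      rw [← Finset.sum_subset hsub, ih, if_neg]
      · rintro rfl; exact hp.prime.not_isUnit (isUnit_of_dvd_one hdvd)
      · intro d hd hd'
        rw [mem_pdiv hpm] at hd
        rw [mem_pdiv hm0] at hd'
        apply mu_sq_dvd hp.prime
        obtain ⟨c, hc⟩ := hd
        have hpc : ¬ p ∣ c := by
          rintro ⟨e, rfl⟩
          apply hd'
          refine ⟨e, mul_left_cancel₀ hp0 ?_⟩
          rw [hc]; ring
        have : p * p ∣ d.1 * c := by
          rw [← hc]; exact mul_dvd_mul_left p hdvd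
        have hcop : IsCoprime (p * p) c := by
          have := (Irreducible.coprime_iff_not_dvd hp.prime.irreducible).mpr hpc
          exact IsCoprime.mul_left this this
        exact hcop.dvd_of_dvd_mul_right this
    · have hun : pdiv (p * m) = pdiv m ∪ (pdiv m).image (fun d : Prm => (⟨p * d.1, primary_mul hp.prim d.2⟩ : Prm)) := by
        ext d
        rw [Finset.mem_union, mem_pdiv hpm, mem_pdiv hm0, Finset.mem_image]
        constructor
        · intro h
          by_cases hpd : p ∣ d.1
          · right
            obtain ⟨e, he⟩ := hpd
            have hepr : IsPrimary e := primary_of_mul hp.prim (he ▸ d.2)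
            refine ⟨⟨e, hepr⟩, ?_, Subtype.ext he.symm⟩
            rw [mem_pdiv hm0]
            rw [he] at h
            exact (mul_dvd_mul_iff_left hp0).mp h
          · left
            have := (Irreducible.coprime_iff_not_dvd hp.prime.irreducible).mpr hpd
            exact this.symm.dvd_of_dvd_mul_left h
        · rintro (h | ⟨e, he, rfl⟩)
          · exact h.mul_left _
          · rw [mem_pdiv hm0] at he
            exact mul_dvd_mul_left p he
      rw [hun, Finset.sum_union, Finset.sum_image (fun a _ b _ h => hinj h), ← Finset.sum_add_distrib]
      · apply Finset.sum_eq_zero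
        intro d hd
        rw [mem_pdiv hm0] at hd
        rw [mu_prime_mul hp.prime (primary_ne_zero d.2) (fun h => hdvd (h.trans hd))]; ring
      · rw [Finset.disjoint_left]
        intro d hd hd'
        rw [mem_pdiv hm0] at hd
        rw [Finset.mem_image] at hd'
        obtain ⟨e, he, rfl⟩ := hd'
        exact hdvd ((dvd_mul_right p e.1).trans hd)

/-! ### squarefree decomposition -/

lemma sq_dvd_sqfree {n e l : GI} (hn : Squarefree n) (hl : l ≠ 0) (h : e ^ 2 ∣ n * l ^ 2) : e ∣ l := by
  obtain ⟨g, hg⟩ : ∃ g, g = EuclideanDomain.gcd e l := ⟨_, rfl⟩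
  have hg0 : g ≠ 0 := by
    rw [hg]; intro h0; exact hl (EuclideanDomain.gcd_eq_zero_iff.mp h0).2
  obtain ⟨e', he⟩ : g ∣ e := hg ▸ EuclideanDomain.gcd_dvd_left e l
  obtain ⟨l', hl'⟩ : g ∣ l := hg ▸ EuclideanDomain.gcd_dvd_right e l
  have hcop : IsCoprime e' l' := by
    have hb := EuclideanDomain.gcd_eq_gcd_ab e l
    rw [← hg] at hb
    refine ⟨EuclideanDomain.gcdA e l, EuclideanDomain.gcdB e l, ?_⟩
    apply mul_left_cancel₀ hg0
    linear_combination -(EuclideanDomain.gcdA e l) * he - (EuclideanDomain.gcdB e l) * hl' - hb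
  rw [he, hl'] at h
  have h1 : e' ^ 2 ∣ n * l' ^ 2 := by
    have : g ^ 2 * e' ^ 2 ∣ g ^ 2 * (n * l' ^ 2) := by convert h using 1 <;> ring
    exact (mul_dvd_mul_iff_left (pow_ne_zero 2 hg0)).mp this
  have h2 : e' ^ 2 ∣ n := (IsCoprime.pow hcop).dvd_of_dvd_mul_right h1
  have h3 : IsUnit e' := hn e' (by rwa [← sq])
  rw [he, hl']
  exact mul_dvd_mul_left g (h3.dvd)

lemma exists_decomp {n : GI} (hn : IsPrimary n) : ∃ a l : GI, IsPrimary a ∧ Squarefree a ∧ IsPrimary l ∧ n = a * l ^ 2 := by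
  revert hn
  refine prim_induct (motive := fun n => ∃ a l : GI, IsPrimary a ∧ Squarefree a ∧ IsPrimary l ∧ n = a * l ^ 2) ?_ ?_ n
  · exact ⟨1, 1, primary_one, squarefree_one, primary_one, by ring⟩
  · rintro p m hp hm ⟨a, l, ha, hsa, hl, rfl⟩
    by_cases h : p ∣ a
    · obtain ⟨b, rfl⟩ := h
      exact ⟨b, p * l, primary_of_mul hp.prim ha, hsa.of_mul_right, primary_mul hp.prim hl, by ring⟩
    · refine ⟨p * a, l, primary_mul hp.prim ha, ?_, hl, by ring⟩
      rw [squarefree_mul_iff]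
      exact ⟨(hp.prime.irreducible.isRelPrime_iff_not_dvd).mpr h, hp.prime.irreducible.squarefree, hsa⟩

/-- squarefree primary elements -/
abbrev SqP := {n : GI // IsPrimary n ∧ Squarefree n}

lemma decomp_bij : Function.Bijective (fun x : SqP × Prm =>
    (⟨x.1.1 * x.2.1 ^ 2, by rw [sq]; exact primary_mul x.1.2.1 (primary_mul x.2.2 x.2.2)⟩ : Prm)) := by
  constructor
  · rintro ⟨⟨a, ha, hsa⟩, ⟨l, hl⟩⟩ ⟨⟨a', ha', hsa'⟩, ⟨l', hl'⟩⟩ h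
    have h : a * l ^ 2 = a' * l' ^ 2 := congrArg Subtype.val h
    have h1 : l ∣ l' := sq_dvd_sqfree hsa' (primary_ne_zero hl') ⟨a, by rw [← h]; ring⟩
    have h2 : l' ∣ l := sq_dvd_sqfree hsa (primary_ne_zero hl) ⟨a', by rw [h]; ring⟩
    have h3 : l = l' := primary_assoc hl hl' (associated_of_dvd_dvd h1 h2)
    subst h3
    have : a = a' := mul_right_cancel₀ (pow_ne_zero 2 (primary_ne_zero hl)) h
    subst this
    rfl
  · rintro ⟨n, hn⟩
    obtain ⟨a, l, ha, hsa, hl, rfl⟩ := exists_decomp hn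
    exact ⟨(⟨a, ha, hsa⟩, ⟨l, hl⟩), rfl⟩

def decompE : SqP × Prm ≃ Prm := Equiv.ofBijective _ decomp_bij

lemma decompE_val (x : SqP × Prm) : (decompE x).1 = x.1.1 * x.2.1 ^ 2 := rfl

/-- squarefree indicator through Möbius -/
lemma sqfree_ind {n : GI} (hn : IsPrimary n) :
    ∑ e ∈ pdiv n, (if e.1 ^ 2 ∣ n then mu e.1 else 0) = if Squarefree n then 1 else 0 := by
  obtain ⟨a, l, ha, hsa, hl, rfl⟩ := exists_decomp hn
  have hl0 := primary_ne_zero hl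
  have hn0 := primary_ne_zero hn
  rw [← Finset.sum_filter]
  have : (pdiv (a * l ^ 2)).filter (fun e => e.1 ^ 2 ∣ a * l ^ 2) = pdiv l := by
    ext e
    rw [Finset.mem_filter, mem_pdiv hn0, mem_pdiv hl0]
    constructor
    · rintro ⟨_, h⟩; exact sq_dvd_sqfree hsa hl0 h
    · intro h
      exact ⟨(h.trans (dvd_pow_self l two_ne_zero)).mul_left _, (pow_dvd_pow_of_dvd h 2).mul_left _⟩
  rw [this, sum_mu hl]
  congr 1
  apply propext
  constructor
  · rintro rfl; simpa using hsa
  · intro h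
    exact primary_unit (h l ⟨a, by ring⟩) hl

/-- coprimality indicator through Möbius -/
lemma coprime_ind {l m : GI} (hl : IsPrimary l) (hm : IsPrimary m) :
    ∑ d ∈ pdiv l, (if d.1 ∣ m then mu d.1 else 0) = if IsCoprime l m then 1 else 0 := by
  have hl0 := primary_ne_zero hl
  obtain ⟨u, hu, hg⟩ := exists_primary_assoc (z := EuclideanDomain.gcd l m)
    (odd_of_dvd (EuclideanDomain.gcd_dvd_left l m) (primary_odd hl))
  have hg0 := primary_ne_zero hg
  rw [← Finset.sum_filter]
  have hass : Associated (EuclideanDomain.gcd l m) (EuclideanDomain.gcd l m * u) := ⟨hu.unit, rfl⟩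
  have : (pdiv l).filter (fun e => e.1 ∣ m) = pdiv (EuclideanDomain.gcd l m * u) := by
    ext e
    rw [Finset.mem_filter, mem_pdiv hl0, mem_pdiv hg0, ← hass.dvd_iff_dvd_right]
    constructor
    · rintro ⟨h1, h2⟩; exact EuclideanDomain.dvd_gcd h1 h2
    · intro h
      exact ⟨h.trans (EuclideanDomain.gcd_dvd_left l m), h.trans (EuclideanDomain.gcd_dvd_right l m)⟩
  rw [this, sum_mu hg]
  congr 1
  apply propext
  rw [← EuclideanDomain.gcd_isUnit_iff, hass.isUnit_iff]
  constructor
  · intro h; rw [h]; exact isUnit_one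
  · intro h; exact primary_unit h hg

end GH

namespace GH

variable {χ : GI → GI → ℤ}

/-- the smoothing function `e^{-x} - 4 e^{-4x}` -/
def phi (x : ℝ) : ℝ := Real.exp (-x) - 4 * Real.exp (-(4 * x))

/-- the dual function -/
def Ef (x : ℝ) : ℝ := Real.exp (-(π ^ 2 / 8 * x)) - Real.exp (-(π ^ 2 / 32 * x))

lemma exp_neg_le (A : ℕ) {x : ℝ} (hx : 0 < x) : Real.exp (-x) ≤ A.factorial * (x ^ A)⁻¹ := by
  have h := Real.pow_div_factorial_le_exp x hx.le A
  have hf : (0 : ℝ) < A.factorial := by exact_mod_cast A.factorial_pos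
  rw [Real.exp_neg, ← div_eq_mul_inv, inv_le_comm₀ (Real.exp_pos _) (by positivity), inv_div]
  exact h

lemma phi_le_exp {x : ℝ} (hx : 0 ≤ x) : |phi x| ≤ 5 * Real.exp (-x) := by
  unfold phi
  have h1 : Real.exp (-(4 * x)) ≤ Real.exp (-x) := Real.exp_le_exp.mpr (by linarith)
  have h2 := Real.exp_pos (-(4 * x))
  have h3 := Real.exp_pos (-x)
  rw [abs_le]; constructor <;> linarith

lemma phi_le (A : ℕ) {x : ℝ} (hx : 0 < x) : |phi x| ≤ 5 * A.factorial * (x ^ A)⁻¹ := by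
  have := phi_le_exp hx.le
  have := exp_neg_le A hx
  linarith

lemma eight_le_pi_sq : 8 ≤ π ^ 2 := by nlinarith [Real.pi_gt_three]

lemma Ef_le_exp {x : ℝ} (hx : 0 ≤ x) : |Ef x| ≤ Real.exp (-(x / 4)) := by
  unfold Ef
  have h8 := eight_le_pi_sq
  have h1 : Real.exp (-(π ^ 2 / 8 * x)) ≤ Real.exp (-(x / 4)) := Real.exp_le_exp.mpr (by nlinarith)
  have h2 : Real.exp (-(π ^ 2 / 32 * x)) ≤ Real.exp (-(x / 4)) := Real.exp_le_exp.mpr (by nlinarith)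
  have h3 := Real.exp_pos (-(π ^ 2 / 8 * x))
  have h4 := Real.exp_pos (-(π ^ 2 / 32 * x))
  rw [abs_le]; constructor <;> linarith

lemma Ef_zero : Ef 0 = 0 := by simp [Ef]

lemma Ef_le (A : ℕ) {x : ℝ} (hx : 0 < x) : |Ef x| ≤ 4 ^ A * A.factorial * (x ^ A)⁻¹ := by
  have h1 := Ef_le_exp hx.le
  have h2 := exp_neg_le A (x := x / 4) (by positivity)
  refine (h1.trans h2).trans (le_of_eq ?_)
  rw [div_pow, inv_div]; field_simp

/-- `Λ = (1+i)^3` parametrization of primary elements -/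
lemma prm_bij {n : GI} (hn : IsPrimary n) : Function.Bijective (fun y : GI =>
    (⟨n + ωg ^ 3 * y, by
      unfold IsPrimary at *
      have : n + ωg ^ 3 * y - 1 = (n - 1) + ωg ^ 3 * y := by ring
      rw [this]; exact dvd_add hn (dvd_mul_right _ _)⟩ : Prm)) := by
  have hω : (ωg ^ 3 : GI) ≠ 0 := by rw [omega_cube]; decide
  constructor
  · intro a b hab
    have : n + ωg ^ 3 * a = n + ωg ^ 3 * b := congrArg Subtype.val hab
    exact mul_left_cancel₀ hω (add_left_cancel this)
  · rintro ⟨m, hm⟩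
    have : ωg ^ 3 ∣ m - n := by
      have : m - n = (m - 1) - (n - 1) := by ring
      rw [this]; exact dvd_sub hm hn
    obtain ⟨y, hy⟩ := this
    exact ⟨y, Subtype.ext (by change n + ωg ^ 3 * y = m; rw [← hy]; ring)⟩

def prmE {n : GI} (hn : IsPrimary n) : GI ≃ Prm := Equiv.ofBijective _ (prm_bij hn)

lemma prmE_val {n : GI} (hn : IsPrimary n) (y : GI) : (prmE hn y).1 = n + ωg ^ 3 * y := rfl

/-- `Λ` as a complex number -/
def Lam : ℂ := tc (ωg ^ 3)

lemma Nm_Lam : Nm (ωg ^ 3) = 8 := by rw [omega_cube, Nm_eq]; norm_num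

lemma Lam_ne : Lam ≠ 0 := tc_ne (by rw [omega_cube]; decide)

lemma normSq_Lam : normSq Lam = 8 := by rw [Lam, normSq_tc, Nm_Lam]

lemma coprime_omega {n : GI} (hn : IsPrimary n) : IsCoprime ωg n := by
  obtain ⟨y, hy⟩ : ωg ^ 3 ∣ n - 1 := hn
  exact ⟨-(ωg ^ 2 * y), 1, by linear_combination hy⟩

/-- the character on the dual side -/
def psi (k : GI) : ℂ := eT (-(tc k / Lam))

lemma norm_psi (k : GI) : ‖psi k‖ = 1 := norm_eT _

def Bf (χ : GI → GI → ℤ) (n : GI) (v : ℝ) : ℂ := ∑' m : Prm, (χ m.1 n : ℂ) * (phi (v * Nm m.1) : ℂ)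

lemma exp_sum_eq (hχ : IsQuadSym χ) {n : GI} (hn : IsPrimary n) {v : ℝ} (hv : 0 < v) (m : GI) :
    (χ (prmE hn m).1 n : ℂ) * (Real.exp (-(v * Nm (prmE hn m).1)) : ℂ) =
      (χ ωg n : ℂ) * ((χ m n : ℂ) * eT (0 * tc m) *
        (Real.exp (-π * (8 * v / π) * normSq (tc m + tc n / Lam)) : ℂ)) := by
  have h1 : χ (prmE hn m).1 n = χ ωg n * χ m n := by
    rw [prmE_val, chi_per hχ hn (b := ωg ^ 3 * m) ⟨1, by ring⟩, chi_mul hχ _ _ hn]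
    have : ωg ^ 3 = ωg * ωg * ωg := by ring
    rw [this, chi_mul hχ _ _ hn, chi_mul hχ _ _ hn, chi_sq hχ hn (coprime_omega hn), one_mul]
  have h2 : -π * (8 * v / π) * normSq (tc m + tc n / Lam) = -(v * Nm (prmE hn m).1) := by
    have : tc (prmE hn m).1 = Lam * (tc m + tc n / Lam) := by
      rw [prmE_val, Lam]
      have := Lam_ne
      rw [Lam] at this
      simp only [tc, map_add, map_mul]
      field_simp
      ring
    rw [← normSq_tc (prmE hn m).1, this, normSq_mul, normSq_Lam]
    field_simp
  rw [h1, h2]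
  simp only [zero_mul, eT_zero]
  push_cast; ring

lemma exp_summable (hχ : IsQuadSym χ) {n : GI} (hn : IsPrimary n) {v : ℝ} (hv : 0 < v) :
    Summable fun m : Prm => (χ m.1 n : ℂ) * (Real.exp (-(v * Nm m.1)) : ℂ) := by
  rw [← (prmE hn).summable_iff]
  simp only [Function.comp_def]
  simp_rw [exp_sum_eq hχ hn hv]
  exact (T_summable hχ hn 0 _ (by positivity)).mul_left _

lemma exp_formula (hχ : IsQuadSym χ) {n : GI} (hn : IsPrimary n) (hsq : Squarefree n) {v : ℝ} (hv : 0 < v) :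
    HasSum (fun k : GI => (π / (8 * v * Real.sqrt (Nm n)) : ℂ) * ((χ (ig * ωg * k) n : ℂ) * psi k *
      (Real.exp (-(π ^ 2 / 8 * (Nm k / (v * Nm n)))) : ℂ)))
      (∑' m : Prm, (χ m.1 n : ℂ) * (Real.exp (-(v * Nm m.1)) : ℂ)) := by
  have hN := Nm_pos (primary_ne_zero hn)
  have hn0 := tc_ne (primary_ne_zero hn)
  have hv' : (v : ℂ) ≠ 0 := by exact_mod_cast hv.ne'
  have hpi : (π : ℂ) ≠ 0 := by exact_mod_cast Real.pi_ne_zero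
  have e1 : ∑' m : Prm, (χ m.1 n : ℂ) * (Real.exp (-(v * Nm m.1)) : ℂ) =
      (χ ωg n : ℂ) * Tsum χ n 0 (tc n / Lam) (8 * v / π) := by
    rw [← (prmE hn).tsum_eq]
    simp_rw [exp_sum_eq hχ hn hv]
    rw [tsum_mul_left]; rfl
  rw [e1, poisson hχ hn hsq 0 _ (by positivity)]
  have hs := (U_summable hχ hn 0 (tc n / Lam) (t := 8 * v / π) (by positivity)).hasSum
  have hs2 := hs.mul_left ((χ ωg n : ℂ) * (((χ ig n : ℂ) / (Real.sqrt (Nm n) : ℂ)) * (1 / ((8 * v / π : ℝ) : ℂ))))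
  unfold Usum
  rw [mul_assoc (χ ωg n : ℂ)] at hs2
  refine hs2.congr_fun (fun k => ?_)
  have h3 : -π / (8 * v / π) * normSq (tc k / tc n + 0) = -(π ^ 2 / 8 * (Nm k / (v * Nm n))) := by
    rw [add_zero, normSq_div, normSq_tc, normSq_tc]; field_simp
  have h4 : -(tc n / Lam * (tc k / tc n + 0)) = -(tc k / Lam) := by
    have := Lam_ne
    field_simp; ring
  rw [h3, h4, chi_mul hχ _ _ hn, chi_mul hχ _ _ hn]
  unfold psi
  push_cast
  have hsN : ((Real.sqrt (Nm n) : ℝ) : ℂ) ≠ 0 := by exact_mod_cast (Real.sqrt_pos.mpr hN).ne'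
  field_simp

theorem B_formula (hχ : IsQuadSym χ) {n : GI} (hn : IsPrimary n) (hsq : Squarefree n) {v : ℝ} (hv : 0 < v) :
    HasSum (fun k : GI => (π / (8 * v * Real.sqrt (Nm n)) : ℂ) * ((χ (ig * ωg * k) n : ℂ) * psi k *
      (Ef (Nm k / (v * Nm n)) : ℂ))) (Bf χ n v) := by
  have hN := Nm_pos (primary_ne_zero hn)
  have hv4 : 0 < 4 * v := by positivity
  have h1 := exp_formula hχ hn hsq hv
  have h2 := (exp_formula hχ hn hsq hv4).mul_left 4
  have e : Bf χ n v = (∑' m : Prm, (χ m.1 n : ℂ) * (Real.exp (-(v * Nm m.1)) : ℂ)) -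
      4 * (∑' m : Prm, (χ m.1 n : ℂ) * (Real.exp (-(4 * v * Nm m.1)) : ℂ)) := by
    rw [← tsum_mul_left, ← Summable.tsum_sub (exp_summable hχ hn hv) ((exp_summable hχ hn hv4).mul_left 4)]
    unfold Bf phi
    congr 1; ext m
    rw [mul_assoc 4 v]
    push_cast; ring
  rw [e]
  refine (h1.sub h2).congr_fun ?_
  intro k
  have hv' : (v : ℂ) ≠ 0 := by exact_mod_cast hv.ne'
  have h3 : -(π ^ 2 / 8 * (Nm k / (4 * v * Nm n))) = -(π ^ 2 / 32 * (Nm k / (v * Nm n))) := by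
    field_simp; ring
  have hsN : ((Real.sqrt (Nm n) : ℝ) : ℂ) ≠ 0 := by exact_mod_cast (Real.sqrt_pos.mpr hN).ne'
  rw [h3]
  unfold Ef
  push_cast
  field_simp

lemma B_term_bound (hχ : IsQuadSym χ) (A : ℕ) (hA : 1 ≤ A) {n : GI} (hn : IsPrimary n) {v : ℝ} (hv : 0 < v) (k κ : GI) :
    ‖(π / (8 * v * Real.sqrt (Nm n)) : ℂ) * ((χ κ n : ℂ) * psi k * (Ef (Nm k / (v * Nm n)) : ℂ))‖ ≤
      (4 ^ A * A.factorial * v ^ (A - 1) * Nm n ^ A) * (Nm k ^ A)⁻¹ := by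
  have hN := one_le_Nm (primary_ne_zero hn)
  have hN0 : 0 < Nm n := by linarith
  by_cases hk : k = 0
  · subst hk
    rw [Nm_zero, zero_div, Ef_zero]
    simp only [Complex.ofReal_zero, mul_zero, norm_zero]
    positivity
  have hk0 := Nm_pos hk
  rw [norm_mul, norm_mul, norm_mul, norm_psi, mul_one, Complex.norm_real, Real.norm_eq_abs]
  have h1 : ‖(π / (8 * v * Real.sqrt (Nm n)) : ℂ)‖ ≤ v⁻¹ := by
    have : (π / (8 * v * Real.sqrt (Nm n)) : ℂ) = ((π / (8 * v * Real.sqrt (Nm n)) : ℝ) : ℂ) := by push_cast; rfl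
    rw [this, Complex.norm_real, Real.norm_eq_abs, abs_of_pos (by positivity), div_le_iff₀ (by positivity)]
    have : v⁻¹ * (8 * v * Real.sqrt (Nm n)) = 8 * Real.sqrt (Nm n) := by field_simp
    rw [this]
    have : 1 ≤ Real.sqrt (Nm n) := by rw [Real.one_le_sqrt]; exact hN
    linarith [Real.pi_le_four]
  have h2 := Ef_le A (x := Nm k / (v * Nm n)) (by positivity)
  have h3 := chi_norm_le hχ hn κ
  calc _ ≤ v⁻¹ * (1 * (4 ^ A * A.factorial * ((Nm k / (v * Nm n)) ^ A)⁻¹)) := by gcongr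
    _ = _ := by
      obtain ⟨B, rfl⟩ : ∃ B, A = B + 1 := ⟨A - 1, by omega⟩
      rw [Nat.add_sub_cancel, div_pow, inv_div, mul_pow, pow_succ v]
      field_simp

lemma B_bound (hχ : IsQuadSym χ) : ∃ C : ℝ, 0 < C ∧ ∀ n : GI, IsPrimary n → Squarefree n → ∀ v : ℝ, 0 < v →
    ‖Bf χ n v‖ ≤ C * v * Nm n ^ 2 := by
  refine ⟨32 * (∑' k : GI, (Nm k ^ 2)⁻¹) + 1, by positivity, ?_⟩
  intro n hn hsq v hv
  have hs := (summable_Nm_pow (j := 2) le_rfl)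
  have h := tsum_of_norm_bounded (hs.hasSum.mul_left (4 ^ 2 * Nat.factorial 2 * v ^ (2 - 1) * Nm n ^ 2))
    (fun k => B_term_bound hχ 2 (by norm_num) hn hv k (ig * ωg * k))
  rw [(B_formula hχ hn hsq hv).tsum_eq] at h
  refine h.trans ?_
  have : (0 : ℝ) ≤ v * Nm n ^ 2 := by positivity
  norm_num [Nat.factorial]
  nlinarith

/-! ### the sums `D_n` -/

def Df (χ : GI → GI → ℤ) (n : GI) (u : ℝ) : ℂ := ∑' m : Prm, (χ m.1 n : ℂ) * (phi (u * Nm m.1) : ℂ)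

lemma phi_term_le (hχ : IsQuadSym χ) {n : GI} (hn : IsPrimary n) {u : ℝ} (hu : 0 < u) (m : Prm) (κ : GI) :
    ‖(χ κ n : ℂ) * (phi (u * Nm m.1) : ℂ)‖ ≤ 10 * (u ^ 2)⁻¹ * (Nm m.1 ^ 2)⁻¹ := by
  have hm := Nm_pos (primary_ne_zero m.2)
  rw [norm_mul, Complex.norm_real, Real.norm_eq_abs]
  have h1 := chi_norm_le hχ hn κ
  have h2 := phi_le 2 (x := u * Nm m.1) (by positivity)
  calc _ ≤ 1 * (5 * (Nat.factorial 2 : ℕ) * ((u * Nm m.1) ^ 2)⁻¹) := by gcongr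
    _ = _ := by norm_num [Nat.factorial]; rw [mul_pow]; field_simp

lemma D_summable (hχ : IsQuadSym χ) {n : GI} (hn : IsPrimary n) {u : ℝ} (hu : 0 < u) :
    Summable fun m : Prm => (χ m.1 n : ℂ) * (phi (u * Nm m.1) : ℂ) :=
  Summable.of_norm_bounded ((summable_Nm_pow_prm (j := 2) le_rfl).mul_left (10 * (u ^ 2)⁻¹))
    (fun m => phi_term_le hχ hn hu m _)

lemma D_bound_inf (hχ : IsQuadSym χ) : ∃ C : ℝ, 0 < C ∧ ∀ n : GI, IsPrimary n → ∀ u : ℝ, 0 < u →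
    ‖Df χ n u‖ ≤ C * (u ^ 2)⁻¹ := by
  refine ⟨10 * (∑' k : Prm, (Nm k.1 ^ 2)⁻¹) + 1, by positivity, ?_⟩
  intro n hn u hu
  have hs := (summable_Nm_pow_prm (j := 2) le_rfl)
  have h := tsum_of_norm_bounded (hs.hasSum.mul_left (10 * (u ^ 2)⁻¹))
    (fun m => phi_term_le hχ hn hu m m.1)
  refine h.trans ?_
  have : (0 : ℝ) ≤ (u ^ 2)⁻¹ := by positivity
  nlinarith

theorem D_eq (hχ : IsQuadSym χ) {a l : GI} (ha : IsPrimary a) (hl : IsPrimary l)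
    {u : ℝ} (hu : 0 < u) : Df χ (a * l ^ 2) u =
      ∑ d ∈ pdiv l, ((mu d.1 : ℂ) * (χ d.1 a : ℂ)) * Bf χ a (u * Nm d.1) := by
  have hl0 := primary_ne_zero hl
  have h1 : ∀ m : Prm, (χ m.1 (a * l ^ 2) : ℂ) * (phi (u * Nm m.1) : ℂ) =
      ∑ d ∈ pdiv l, (if d.1 ∣ m.1 then (mu d.1 : ℂ) * ((χ m.1 a : ℂ) * (phi (u * Nm m.1) : ℂ)) else 0) := by
    intro m
    have h := coprime_ind hl m.2
    have e : χ m.1 (a * l ^ 2) = χ m.1 a * ∑ d ∈ pdiv l, (if d.1 ∣ m.1 then mu d.1 else 0) := by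
      rw [h, chi_den_mul hχ _ ha (by rw [sq]; exact primary_mul hl hl), sq, chi_den_mul hχ _ hl hl]
      rcases chi_cases hχ hl m.1 with ⟨hz, p, hp, hpl, hpm⟩ | ⟨hz, hc⟩
      · rw [hz, if_neg]; ring
        intro hc; exact hp.prime.not_isUnit (hc.isUnit_of_dvd' hpl hpm)
      · rw [if_pos hc.symm]
        rcases hz with hz | hz <;> rw [hz] <;> ring
    rw [e]
    push_cast
    rw [Finset.mul_sum, Finset.sum_mul]
    apply Finset.sum_congr rfl
    intro d _
    split_ifs <;> push_cast <;> ring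
  unfold Df
  simp_rw [h1]
  rw [Summable.tsum_finsetSum]
  · apply Finset.sum_congr rfl
    intro d _
    have hinj : Function.Injective (fun m : Prm => (⟨d.1 * m.1, primary_mul d.2 m.2⟩ : Prm)) := by
      intro x y hxy
      exact Subtype.ext (mul_left_cancel₀ (primary_ne_zero d.2) (congrArg Subtype.val hxy))
    rw [← hinj.tsum_eq]
    · unfold Bf
      rw [← tsum_mul_left]
      congr 1; ext m
      rw [if_pos (dvd_mul_right _ _), chi_mul hχ _ _ ha, Nm_mul]
      rw [mul_assoc u]
      push_cast; ring
    · intro m hm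
      simp only [Function.mem_support, ne_eq, ite_eq_right_iff, not_forall] at hm
      obtain ⟨⟨c, hc⟩, _⟩ := hm
      have : IsPrimary c := primary_of_mul d.2 (hc ▸ m.2)
      exact ⟨⟨c, this⟩, Subtype.ext hc.symm⟩
  · intro d _
    refine Summable.of_norm_bounded (((D_summable hχ ha hu).norm).mul_left |(mu d.1 : ℝ)|) ?_
    intro m
    split_ifs
    · rw [norm_mul]; simp
    · rw [norm_zero]; positivity

lemma D_bound_zero (hχ : IsQuadSym χ) : ∃ C : ℝ, 0 < C ∧ ∀ n : GI, IsPrimary n → ∀ u : ℝ, 0 < u →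
    ‖Df χ n u‖ ≤ C * u * Nm n ^ 2 := by
  obtain ⟨C, hC, h⟩ := B_bound hχ
  have hs := (summable_Nm_pow_prm (j := 2) le_rfl)
  refine ⟨C * (∑' k : Prm, (Nm k.1 ^ 2)⁻¹) + 1, by positivity, ?_⟩
  intro n hn u hu
  obtain ⟨a, l, ha, hsa, hl, rfl⟩ := exists_decomp hn
  rw [D_eq hχ ha hl hu]
  have hl0 := primary_ne_zero hl
  have hla := one_le_Nm hl0
  have haa := one_le_Nm (primary_ne_zero ha)
  have hb : ∀ d ∈ pdiv l, ‖((mu d.1 : ℂ) * (χ d.1 a : ℂ)) * Bf χ a (u * Nm d.1)‖ ≤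
      (C * u * Nm a ^ 2 * Nm l ^ 3) * (Nm d.1 ^ 2)⁻¹ := by
    intro d hd
    rw [mem_pdiv hl0] at hd
    have hd1 := Nm_le_of_dvd hl0 hd
    have hd0 := Nm_pos (primary_ne_zero d.2)
    have h1 := h a ha hsa (u * Nm d.1) (by positivity)
    have h2 := chi_norm_le hχ ha d.1
    have h3 : ‖(mu d.1 : ℂ)‖ ≤ 1 := by rw [Complex.norm_intCast]; exact_mod_cast mu_abs d.1
    rw [norm_mul, norm_mul]
    calc _ ≤ (1 * 1) * (C * (u * Nm d.1) * Nm a ^ 2) := by gcongr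
      _ = (C * u * Nm a ^ 2 * Nm d.1 ^ 3) * (Nm d.1 ^ 2)⁻¹ := by field_simp
      _ ≤ _ := by gcongr
  refine (norm_sum_le_of_le _ hb).trans ?_
  rw [← Finset.mul_sum]
  have h4 := hs.sum_le_tsum (pdiv l) (fun d _ => by positivity)
  have h5 : Nm (a * l ^ 2) ^ 2 = Nm a ^ 2 * Nm l ^ 4 := by rw [Nm_mul, Nm_pow]; ring
  rw [h5]
  have h6 : Nm l ^ 3 ≤ Nm l ^ 4 := pow_le_pow_right₀ hla (by norm_num)
  have h8 : C * u * Nm a ^ 2 * Nm l ^ 3 ≤ C * u * Nm a ^ 2 * Nm l ^ 4 := mul_le_mul_of_nonneg_left h6 (by positivity)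
  refine (mul_le_mul h8 h4 (Finset.sum_nonneg (fun d _ => by positivity)) (by positivity)).trans ?_
  have h7 : 0 ≤ u * (Nm a ^ 2 * Nm l ^ 4) := by positivity
  generalize (∑' k : Prm, (Nm k.1 ^ 2)⁻¹) = S
  linear_combination h7

end GH

namespace GH

variable {χ : GI → GI → ℤ}

open MeasureTheory Set in
/-- continuity of `D_n` -/
lemma D_contOn (hχ : IsQuadSym χ) {n : GI} (hn : IsPrimary n) : ContinuousOn (Df χ n) (Set.Ioi 0) := by
  intro u hu
  have hu : 0 < u := hu
  have h : ContinuousOn (Df χ n) (Set.Ioi (u / 2)) := by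
    unfold Df
    refine continuousOn_tsum (u := fun m : Prm => 10 * ((u / 2) ^ 2)⁻¹ * (Nm m.1 ^ 2)⁻¹) ?_ ?_ ?_
    · intro m
      apply Continuous.continuousOn
      unfold phi
      fun_prop
    · exact (summable_Nm_pow_prm (j := 2) le_rfl).mul_left _
    · intro m v hv
      have hv : u / 2 < v := hv
      refine (phi_term_le hχ hn (by linarith) m _).trans ?_
      have := Nm_nonneg m.1
      gcongr
  exact (h.continuousAt (Ioi_mem_nhds (by linarith))).continuousWithinAt

/-- the integrable majorant -/
def kf (u : ℝ) : ℝ := u ^ (-(1 / 2) : ℝ) * min u (u ^ 2)⁻¹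

open MeasureTheory Set in
lemma kf_integrable : IntegrableOn kf (Ioi 0) := by
  have hu : Ioi (0 : ℝ) = Ioc 0 1 ∪ Ioi 1 := (Ioc_union_Ioi_eq_Ioi zero_le_one).symm
  have hmeas : ∀ s : Set ℝ, AEStronglyMeasurable kf (volume.restrict s) := by
    intro s
    apply Measurable.aestronglyMeasurable
    unfold kf
    fun_prop
  rw [hu]
  refine IntegrableOn.union ?_ ?_
  · have h : IntegrableOn (fun u : ℝ => u ^ (-(1 / 2) : ℝ)) (Ioc 0 1) :=
      (intervalIntegrable_iff_integrableOn_Ioc_of_le zero_le_one).mp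
        (intervalIntegral.intervalIntegrable_rpow' (by norm_num))
    refine Integrable.mono' h (hmeas _) ?_
    filter_upwards [ae_restrict_mem measurableSet_Ioc] with u hu
    have hu0 : 0 < u := hu.1
    unfold kf
    have h1 : 0 ≤ min u (u ^ 2)⁻¹ := le_min hu0.le (by positivity)
    have h2 : min u (u ^ 2)⁻¹ ≤ 1 := (min_le_left _ _).trans hu.2
    have h3 : 0 ≤ u ^ (-(1 / 2) : ℝ) := Real.rpow_nonneg hu0.le _
    rw [Real.norm_eq_abs, abs_of_nonneg (by positivity)]
    nlinarith
  · have h : IntegrableOn (fun u : ℝ => u ^ (-2 : ℝ)) (Ioi 1) :=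
      integrableOn_Ioi_rpow_of_lt (by norm_num) zero_lt_one
    refine Integrable.mono' h (hmeas _) ?_
    filter_upwards [ae_restrict_mem measurableSet_Ioi] with u hu
    have hu1 : 1 < u := hu
    have hu0 : 0 < u := by linarith
    unfold kf
    have h1 : 0 ≤ min u (u ^ 2)⁻¹ := le_min hu0.le (by positivity)
    have h2 : min u (u ^ 2)⁻¹ ≤ (u ^ 2)⁻¹ := min_le_right _ _
    have h3 : 0 ≤ u ^ (-(1 / 2) : ℝ) := Real.rpow_nonneg hu0.le _
    have h4 : u ^ (-(1 / 2) : ℝ) ≤ 1 := Real.rpow_le_one_of_one_le_of_nonpos hu1.le (by norm_num)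
    rw [Real.norm_eq_abs, abs_of_nonneg (by positivity)]
    have h5 : u ^ (-2 : ℝ) = (u ^ 2)⁻¹ := by rw [Real.rpow_neg hu0.le, Real.rpow_ofNat]
    rw [h5]
    nlinarith

lemma D_bound (hχ : IsQuadSym χ) : ∃ C : ℝ, 0 < C ∧ ∀ n : GI, IsPrimary n → ∀ u : ℝ, 0 < u →
    ‖Df χ n u‖ ≤ C * Nm n ^ 2 * min u (u ^ 2)⁻¹ := by
  obtain ⟨C1, h1, H1⟩ := D_bound_zero hχ
  obtain ⟨C2, h2, H2⟩ := D_bound_inf hχ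
  refine ⟨max C1 C2, lt_max_of_lt_left h1, ?_⟩
  intro n hn u hu
  have hN := one_le_Nm (primary_ne_zero hn)
  have hN2 : 1 ≤ Nm n ^ 2 := one_le_pow₀ hN
  rcases min_cases u (u ^ 2)⁻¹ with ⟨h, _⟩ | ⟨h, _⟩ <;> rw [h]
  · refine (H1 n hn u hu).trans ?_
    have := le_max_left C1 C2
    calc C1 * u * Nm n ^ 2 = C1 * Nm n ^ 2 * u := by ring
      _ ≤ _ := by gcongr
  · refine (H2 n hn u hu).trans ?_
    have := le_max_right C1 C2
    have h3 : C2 ≤ max C1 C2 * Nm n ^ 2 := by nlinarith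
    gcongr

lemma D_term_bound {C N u : ℝ} {D : ℂ} (hu : 0 < u) (h : ‖D‖ ≤ C * N ^ 2 * min u (u ^ 2)⁻¹) :
    ‖((u ^ (-(1 / 2) : ℝ) : ℝ) : ℂ) * D‖ ≤ C * N ^ 2 * kf u := by
  rw [norm_mul, Complex.norm_real, Real.norm_eq_abs, abs_of_nonneg (Real.rpow_nonneg hu.le _)]
  unfold kf
  have := mul_le_mul_of_nonneg_left h (Real.rpow_nonneg hu.le (-(1 / 2) : ℝ))
  linarith

open MeasureTheory Set in
lemma D_aesm (hχ : IsQuadSym χ) {n : GI} (hn : IsPrimary n) :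
    AEStronglyMeasurable (fun u => ((u ^ (-(1 / 2) : ℝ) : ℝ) : ℂ) * Df χ n u) (volume.restrict (Ioi 0)) := by
  apply AEStronglyMeasurable.mul
  · apply Measurable.aestronglyMeasurable
    fun_prop
  · exact (D_contOn hχ hn).aestronglyMeasurable measurableSet_Ioi

open MeasureTheory Set in
lemma D_integrable (hχ : IsQuadSym χ) {n : GI} (hn : IsPrimary n) :
    IntegrableOn (fun u => ((u ^ (-(1 / 2) : ℝ) : ℝ) : ℂ) * Df χ n u) (Ioi 0) := by
  obtain ⟨C, hC, h⟩ := D_bound hχ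
  refine Integrable.mono' (kf_integrable.const_mul (C * Nm n ^ 2)) (D_aesm hχ hn) ?_
  filter_upwards [ae_restrict_mem measurableSet_Ioi] with u hu
  exact D_term_bound hu (h n hn u hu)

open MeasureTheory Set in
lemma mellin_half (f : ℝ → ℂ) : mellin f (1 / 2) = ∫ u in Ioi 0, ((u ^ (-(1 / 2) : ℝ) : ℝ) : ℂ) * f u := by
  unfold mellin
  apply setIntegral_congr_fun measurableSet_Ioi
  intro u hu
  have hu : 0 < u := hu
  simp only [smul_eq_mul]
  rw [Complex.ofReal_cpow hu.le]
  congr 2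
  push_cast; norm_num

lemma chi_omega_sq (hχ : IsQuadSym χ) {n m : GI} (hn : IsPrimary n) (hm : IsPrimary m) :
    χ (ωg ^ 2 * n) m = χ m n := by
  rw [chi_mul hχ _ _ hm, sq, chi_mul hχ _ _ hm, chi_sq hχ hm (coprime_omega hm), one_mul, recip hχ hn hm]

instance gi_countable : Countable GI := giEquiv.symm.injective.countable

lemma mellin_D (hχ : IsQuadSym χ) {L : ℂ → GI → ℂ} (hL : IsHeckeL χ L) {n : GI} (hn : IsPrimary n)
    {s : ℂ} (hs : 1 < s.re) :
    mellin (Df χ n) s = Complex.Gamma s * (1 - 4 * (4 : ℂ) ^ (-s)) * L s (ωg ^ 2 * n) := by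
  have hpos : ∀ m : Prm, 0 < Nm m.1 := fun m => Nm_pos (primary_ne_zero m.2)
  have key := hasSum_mellin (ι := Prm ⊕ Prm)
    (a := Sum.elim (fun m => (χ m.1 n : ℂ)) (fun m => -4 * (χ m.1 n : ℂ)))
    (p := Sum.elim (fun m => Nm m.1) (fun m => 4 * Nm m.1)) (F := Df χ n) (s := s)
    (by rintro (m | m) <;> right <;> simp [hpos m]) (by linarith) ?_ ?_
  · have hsum : Summable fun m : Prm => (χ m.1 n : ℂ) / (Nm m.1 : ℂ) ^ s := by
      refine Summable.of_norm_bounded (summable_Nm_prm hs) ?_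
      intro m
      rw [norm_div, Complex.norm_cpow_eq_rpow_re_of_pos (hpos m), Real.rpow_neg (hpos m).le, div_eq_mul_inv]
      have := Real.rpow_nonneg (hpos m).le s.re
      have := chi_norm_le hχ hn m.1
      nlinarith [inv_nonneg.mpr (Real.rpow_nonneg (hpos m).le s.re)]
    have hL' : L s (ωg ^ 2 * n) = ∑' m : Prm, (χ m.1 n : ℂ) / (Nm m.1 : ℂ) ^ s := by
      rw [hL.1 _ _ hs]
      congr 1; ext m
      rw [chi_omega_sq hχ hn m.2]
    have h1 := hsum.hasSum
    rw [← hL'] at h1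
    have h2 := HasSum.sum (f := fun i : Prm ⊕ Prm => Complex.Gamma s *
      (Sum.elim (fun m : Prm => (χ m.1 n : ℂ)) (fun m : Prm => -4 * (χ m.1 n : ℂ)) i) /
      ((Sum.elim (fun m : Prm => Nm m.1) (fun m : Prm => 4 * Nm m.1) i : ℝ) : ℂ) ^ s)
      (a := Complex.Gamma s * L s (ωg ^ 2 * n)) (b := Complex.Gamma s * (-4 * (4 : ℂ) ^ (-s)) * L s (ωg ^ 2 * n)) ?_ ?_
    · rw [key.unique h2]; ring
    · refine (h1.mul_left (Complex.Gamma s)).congr_fun ?_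
      intro m
      simp only [Function.comp, Sum.elim_inl]; ring
    · refine (h1.mul_left (Complex.Gamma s * (-4 * (4 : ℂ) ^ (-s)))).congr_fun ?_
      intro m
      simp only [Function.comp, Sum.elim_inr]
      rw [Complex.ofReal_mul, Complex.mul_cpow_ofReal_nonneg (by norm_num) (hpos m).le, Complex.cpow_neg]
      push_cast
      field_simp
  · intro t ht
    have ht : 0 < t := ht
    have h1 := (exp_summable hχ hn ht)
    have h2 := (exp_summable hχ hn (v := 4 * t) (by positivity)).mul_left (-4)
    have e : Df χ n t = (∑' m : Prm, (χ m.1 n : ℂ) * (Real.exp (-(t * Nm m.1)) : ℂ)) +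
      ∑' m : Prm, (-4) * ((χ m.1 n : ℂ) * (Real.exp (-(4 * t * Nm m.1)) : ℂ)) := by
      rw [← Summable.tsum_add h1 h2]
      unfold Df phi
      congr 1; ext m
      rw [mul_assoc 4 t]
      push_cast; ring
    rw [e]
    refine HasSum.sum ?_ ?_
    · refine h1.hasSum.congr_fun ?_
      intro m
      simp only [Function.comp, Sum.elim_inl]
      rw [show -Nm m.1 * t = -(t * Nm m.1) by ring]
    · refine h2.hasSum.congr_fun ?_
      intro m
      simp only [Function.comp, Sum.elim_inr]
      rw [show -(4 * Nm m.1) * t = -(4 * t * Nm m.1) by ring]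
      ring
  · have h0 : Summable fun m : Prm => ‖(χ m.1 n : ℂ)‖ / Nm m.1 ^ s.re := by
      refine Summable.of_nonneg_of_le (fun m => div_nonneg (norm_nonneg _) (Real.rpow_nonneg (hpos m).le _)) (fun m => ?_) (summable_Nm_prm hs)
      rw [Real.rpow_neg (hpos m).le, div_eq_mul_inv]
      have := chi_norm_le hχ hn m.1
      nlinarith [inv_nonneg.mpr (Real.rpow_nonneg (hpos m).le s.re)]
    refine Summable.sum _ ?_ ?_
    · exact h0
    · refine (h0.mul_left (4 * (4 ^ s.re)⁻¹)).congr ?_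
      intro m
      simp only [Function.comp, Sum.elim_inr]
      rw [norm_mul, Real.mul_rpow (by norm_num) (hpos m).le]
      simp only [norm_neg, Complex.norm_ofNat]
      field_simp

open MeasureTheory Set in
theorem L_half (hχ : IsQuadSym χ) {L : ℂ → GI → ℂ} (hL : IsHeckeL χ L) {n : GI} (hn : IsPrimary n) :
    -(Real.sqrt π : ℂ) * L (1 / 2) (ωg ^ 2 * n) =
      ∫ u in Ioi 0, ((u ^ (-(1 / 2) : ℝ) : ℝ) : ℂ) * Df χ n u := by
  rw [← mellin_half]
  set U : Set ℂ := {s | 1 / 4 < s.re} ∩ ({s | s.re < 2} ∩ {s | s.re - s.im < 3 / 4}) with hU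
  have hUo : IsOpen U := by
    refine (isOpen_lt continuous_const Complex.continuous_re).inter
      ((isOpen_lt Complex.continuous_re continuous_const).inter
        (isOpen_lt (Complex.continuous_re.sub Complex.continuous_im) continuous_const))
  have hUc : Convex ℝ U := by
    refine (convex_halfSpace_gt (IsLinearMap.mk Complex.add_re (fun c x => by simp)) _).inter
      ((convex_halfSpace_lt (IsLinearMap.mk Complex.add_re (fun c x => by simp)) _).inter
        (convex_halfSpace_lt (f := fun s : ℂ => s.re - s.im) (IsLinearMap.mk (fun x y => by simp; ring) (fun c x => by simp; ring)) _))
  obtain ⟨C, hC, hD⟩ := D_bound hχ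
  have hloc : LocallyIntegrableOn (Df χ n) (Ioi 0) := (D_contOn hχ hn).locallyIntegrableOn measurableSet_Ioi
  have htop : (Df χ n) =O[atTop] (fun u : ℝ => u ^ (-(2 : ℝ))) := by
    refine Asymptotics.IsBigO.of_bound (C * Nm n ^ 2) ?_
    filter_upwards [eventually_gt_atTop 0] with u hu
    refine (hD n hn u hu).trans ?_
    rw [Real.rpow_neg hu.le, Real.rpow_ofNat, Real.norm_eq_abs, abs_of_pos (by positivity)]
    have := min_le_right u (u ^ 2)⁻¹
    gcongr
  have hbot : (Df χ n) =O[𝓝[>] 0] (fun u : ℝ => u ^ (-(-1 : ℝ))) := by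
    refine Asymptotics.IsBigO.of_bound (C * Nm n ^ 2) ?_
    filter_upwards [self_mem_nhdsWithin] with u hu
    have hu : 0 < u := hu
    refine (hD n hn u hu).trans ?_
    rw [neg_neg, Real.rpow_one, Real.norm_eq_abs, abs_of_pos hu]
    have := min_le_left u (u ^ 2)⁻¹
    gcongr
  have hf : DifferentiableOn ℂ (mellin (Df χ n)) U := by
    intro s hs
    have h1 : 1 / 4 < s.re := hs.1
    have h2 : s.re < 2 := hs.2.1
    exact (mellin_differentiableAt_of_isBigO_rpow hloc htop h2 hbot (by linarith)).differentiableWithinAt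
  have hg : DifferentiableOn ℂ (fun s => Complex.Gamma s * (1 - 4 * (4 : ℂ) ^ (-s)) * L s (ωg ^ 2 * n)) U := by
    intro s hs
    have h1 : 1 / 4 < s.re := hs.1
    have h3 : s.re - s.im < 3 / 4 := hs.2.2
    have hs1 : s ≠ 1 := by rintro rfl; norm_num at h3
    have hL1 : DifferentiableAt ℂ (fun s => L s (ωg ^ 2 * n)) s :=
      (hL.2 _).differentiableAt (isOpen_ne.mem_nhds hs1)
    have hG : DifferentiableAt ℂ Complex.Gamma s := Complex.differentiableAt_Gamma s (by
      intro m hm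
      rw [hm] at h1
      simp at h1
      have : (0 : ℝ) ≤ m := Nat.cast_nonneg m
      linarith)
    have h4 : DifferentiableAt ℂ (fun s : ℂ => (4 : ℂ) ^ (-s)) s :=
      (differentiableAt_id.neg).const_cpow (Or.inl (by norm_num))
    exact ((hG.mul ((differentiableAt_const _).sub ((differentiableAt_const _).mul h4))).mul hL1).differentiableWithinAt
  have hz : (⟨3 / 2, 2⟩ : ℂ) ∈ U := by
    refine ⟨?_, ?_, ?_⟩
    · change (1 / 4 : ℝ) < 3 / 2; norm_num
    · change (3 / 2 : ℝ) < 2; norm_num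
    · change (3 / 2 : ℝ) - 2 < 3 / 4; norm_num
  have heq := (hf.analyticOnNhd hUo).eqOn_of_preconnected_of_eventuallyEq (hg.analyticOnNhd hUo) hUc.isPreconnected hz (by
    have : {s : ℂ | 1 < s.re} ∈ 𝓝 (⟨3 / 2, 2⟩ : ℂ) :=
      (isOpen_lt continuous_const Complex.continuous_re).mem_nhds (by change (1 : ℝ) < 3 / 2; norm_num)
    filter_upwards [this] with s hs
    exact mellin_D hχ hL hn hs)
  have hh : (1 / 2 : ℂ) ∈ U := by
    refine ⟨?_, ?_, ?_⟩
    · change (1 / 4 : ℝ) < (1 / 2 : ℂ).re; norm_num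
    · change (1 / 2 : ℂ).re < 2; norm_num
    · change (1 / 2 : ℂ).re - (1 / 2 : ℂ).im < 3 / 4; norm_num
  rw [heq hh]
  simp only
  have h5 : (4 : ℂ) ^ (-(1 / 2) : ℂ) = 1 / 2 := by
    rw [Complex.cpow_neg, show (4 : ℂ) = ((2 : ℕ) : ℂ) ^ 2 by norm_num, ← Complex.cpow_nat_mul']
    · norm_num
    · simp [Real.pi_pos]
    · simp [Real.pi_pos.le]
  rw [h5, Complex.Gamma_one_half_eq, Real.sqrt_eq_rpow, Complex.ofReal_cpow Real.pi_pos.le]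
  push_cast
  ring

open MeasureTheory Set in
lemma L_bound (hχ : IsQuadSym χ) {L : ℂ → GI → ℂ} (hL : IsHeckeL χ L) : ∃ C : ℝ, 0 < C ∧ ∀ n : GI, IsPrimary n →
    ‖L (1 / 2) (ωg ^ 2 * n)‖ ≤ C * Nm n ^ 2 := by
  obtain ⟨C, hC, hD⟩ := D_bound hχ
  have hk : 0 ≤ ∫ u in Ioi 0, kf u := by
    apply setIntegral_nonneg measurableSet_Ioi
    intro u hu
    have hu : 0 < u := hu
    exact mul_nonneg (Real.rpow_nonneg hu.le _) (le_min hu.le (by positivity))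
  refine ⟨C * (∫ u in Ioi 0, kf u) + 1, by positivity, ?_⟩
  intro n hn
  have h1 := congrArg norm (L_half hχ hL hn)
  rw [norm_mul, norm_neg, Complex.norm_real, Real.norm_eq_abs, abs_of_nonneg (Real.sqrt_nonneg _)] at h1
  have h2 : ‖∫ u in Ioi 0, ((u ^ (-(1 / 2) : ℝ) : ℝ) : ℂ) * Df χ n u‖ ≤ ∫ u in Ioi 0, C * Nm n ^ 2 * kf u := by
    apply norm_integral_le_of_norm_le (kf_integrable.const_mul _)
    filter_upwards [ae_restrict_mem measurableSet_Ioi] with u hu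
    exact D_term_bound hu (hD n hn u hu)
  rw [← h1, integral_const_mul] at h2
  have h3 : 1 ≤ Real.sqrt π := by rw [Real.one_le_sqrt]; linarith [Real.pi_gt_three]
  have h4 := norm_nonneg (L (1 / 2) (ωg ^ 2 * n))
  have h5 : 0 ≤ Nm n ^ 2 := by positivity
  nlinarith

end GH

namespace GH

/-! ### smooth lattice point counting -/

open MeasureTheory FourierTransform

lemma schwartz_decay (w : SchwartzMap ℝ ℝ) (N : ℕ) : ∃ C : ℝ, 0 < C ∧ ∀ t : ℝ, |w t| * (1 + |t|) ^ N ≤ C := by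
  refine ⟨2 ^ N * (Finset.Iic (N, 0)).sup (fun m => SchwartzMap.seminorm ℝ m.1 m.2) w + 1, ?_, ?_⟩
  · have : 0 ≤ (Finset.Iic (N, 0)).sup (fun m => SchwartzMap.seminorm ℝ m.1 m.2) w := apply_nonneg _ _
    positivity
  · intro t
    have h := SchwartzMap.one_add_le_sup_seminorm_apply (𝕜 := ℝ) (m := (N, 0)) (k := N) (n := 0) le_rfl le_rfl w t
    rw [norm_iteratedFDeriv_zero, Real.norm_eq_abs, Real.norm_eq_abs] at h
    linarith

/-- the functions `x^i w(x²+y²)` -/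
def hf (w : SchwartzMap ℝ ℝ) (i : ℕ) (y x : ℝ) : ℂ := ((x ^ i * w (x ^ 2 + y ^ 2) : ℝ) : ℂ)

lemma hf_bound (w : SchwartzMap ℝ ℝ) (i : ℕ) : ∃ C : ℝ, 0 < C ∧ ∀ x y : ℝ,
    ‖hf w i y x‖ ≤ C * (1 + y ^ 2)⁻¹ * (1 + x ^ 2)⁻¹ := by
  obtain ⟨C, hC, h⟩ := schwartz_decay w (i + 2)
  refine ⟨C, hC, fun x y => ?_⟩
  have h1 := h (x ^ 2 + y ^ 2)
  rw [abs_of_nonneg (by positivity : 0 ≤ x ^ 2 + y ^ 2)] at h1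
  unfold hf
  rw [Complex.norm_real, Real.norm_eq_abs, abs_mul, abs_pow]
  have h2 : |x| ^ i ≤ (1 + (x ^ 2 + y ^ 2)) ^ i := by
    apply pow_le_pow_left₀ (abs_nonneg _)
    nlinarith [sq_abs x, sq_nonneg (|x| - 1), sq_nonneg y]
  have h3 : (1 + y ^ 2) * (1 + x ^ 2) ≤ (1 + (x ^ 2 + y ^ 2)) ^ 2 := by
    nlinarith [sq_nonneg x, sq_nonneg y, mul_nonneg (sq_nonneg x) (sq_nonneg y), sq_nonneg (x ^ 2), sq_nonneg (y ^ 2)]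
  rw [mul_assoc, ← mul_inv, ← div_eq_mul_inv, le_div_iff₀ (by positivity)]
  calc |x| ^ i * |w (x ^ 2 + y ^ 2)| * ((1 + y ^ 2) * (1 + x ^ 2))
      ≤ (1 + (x ^ 2 + y ^ 2)) ^ i * |w (x ^ 2 + y ^ 2)| * (1 + (x ^ 2 + y ^ 2)) ^ 2 := by gcongr
    _ = |w (x ^ 2 + y ^ 2)| * (1 + (x ^ 2 + y ^ 2)) ^ (i + 2) := by ring
    _ ≤ C := h1

lemma hf_cont (w : SchwartzMap ℝ ℝ) (i : ℕ) (y : ℝ) : Continuous (hf w i y) := by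
  unfold hf
  have := w.continuous
  fun_prop

lemma hf_integrable (w : SchwartzMap ℝ ℝ) (i : ℕ) (y : ℝ) : Integrable (hf w i y) := by
  obtain ⟨C, hC, h⟩ := hf_bound w i
  refine Integrable.mono' (integrable_inv_one_add_sq.const_mul (C * (1 + y ^ 2)⁻¹)) (hf_cont w i y).aestronglyMeasurable ?_
  exact Eventually.of_forall (fun x => h x y)

lemma fourier_norm_le {f : ℝ → ℂ} {K : ℝ} (h : ∀ x, ‖f x‖ ≤ K * (1 + x ^ 2)⁻¹) (ξ : ℝ) :
    ‖𝓕 f ξ‖ ≤ K * π := by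
  rw [Real.fourier_real_eq]
  have := norm_integral_le_of_norm_le (f := fun v : ℝ => Real.fourierChar (-(v * ξ)) • f v) (integrable_inv_one_add_sq.const_mul K)
    (Eventually.of_forall (fun x => by rw [Circle.norm_smul]; exact h x))
  rwa [integral_const_mul, integral_univ_inv_one_add_sq] at this

lemma hf_deriv (w : SchwartzMap ℝ ℝ) (i : ℕ) (y x : ℝ) :
    HasDerivAt (hf w i y) ((i : ℂ) * hf w (i - 1) y x + 2 * hf (SchwartzMap.derivCLM ℝ ℝ w) (i + 1) y x) x := by
  have h1 : HasDerivAt w (deriv w (x ^ 2 + y ^ 2)) (x ^ 2 + y ^ 2) := (w.differentiableAt).hasDerivAt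
  have h2 : HasDerivAt (fun x : ℝ => x ^ 2 + y ^ 2) (2 * x) x := by
    simpa using ((hasDerivAt_pow 2 x).add_const (y ^ 2))
  have h3 := (hasDerivAt_pow i x).mul (h1.comp x h2)
  have h4 := h3.ofReal_comp
  refine HasDerivAt.congr_deriv (f := hf w i y) h4 ?_
  unfold hf
  rw [SchwartzMap.derivCLM_apply]
  simp only [Function.comp]
  push_cast
  ring

lemma char_integrable {f : ℝ → ℂ} (h : Integrable f) (ξ : ℝ) :
    Integrable (fun v => ((Real.fourierChar (-(v * ξ)) : Circle) : ℂ) * f v) := by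
  refine h.mono ?_ (Eventually.of_forall (fun v => by rw [norm_mul, Circle.norm_coe, one_mul]))
  refine (Continuous.aestronglyMeasurable ?_).mul h.aestronglyMeasurable
  have := Real.continuous_fourierChar
  fun_prop

theorem hf_fourier (A : ℕ) : ∀ (w : SchwartzMap ℝ ℝ) (i : ℕ), ∃ C : ℝ, 0 < C ∧ ∀ y ξ : ℝ,
    |ξ| ^ A * ‖𝓕 (hf w i y) ξ‖ ≤ C * (1 + y ^ 2)⁻¹ := by
  induction A with
  | zero =>
    intro w i
    obtain ⟨C, hC, h⟩ := hf_bound w i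
    refine ⟨C * π, by positivity, fun y ξ => ?_⟩
    rw [pow_zero, one_mul]
    refine (fourier_norm_le (fun x => h x y) ξ).trans (le_of_eq (by ring))
  | succ A ih =>
    intro w i
    obtain ⟨C1, hC1, h1⟩ := ih w (i - 1)
    obtain ⟨C2, hC2, h2⟩ := ih (SchwartzMap.derivCLM ℝ ℝ w) (i + 1)
    refine ⟨i * C1 + 2 * C2, by positivity, fun y ξ => ?_⟩
    have hd : deriv (hf w i y) = fun x => (i : ℂ) * hf w (i - 1) y x + 2 * hf (SchwartzMap.derivCLM ℝ ℝ w) (i + 1) y x := by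
      ext x; exact (hf_deriv w i y x).deriv
    have i1 := (hf_integrable w (i - 1) y).const_mul (i : ℂ)
    have i2 := (hf_integrable (SchwartzMap.derivCLM ℝ ℝ w) (i + 1) y).const_mul (2 : ℂ)
    have hF := congrFun (Real.fourier_deriv (hf_integrable w i y) (fun x => (hf_deriv w i y x).differentiableAt)
      (by rw [hd]; exact i1.add i2)) ξ
    have hF2 : 𝓕 (deriv (hf w i y)) ξ = (i : ℂ) * 𝓕 (hf w (i - 1) y) ξ + 2 * 𝓕 (hf (SchwartzMap.derivCLM ℝ ℝ w) (i + 1) y) ξ := by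
      rw [hd]
      simp only [Real.fourier_real_eq, Circle.smul_def, smul_eq_mul]
      rw [← integral_const_mul, ← integral_const_mul, ← integral_add]
      · congr 1; ext v; ring
      · exact (char_integrable (hf_integrable w (i - 1) y) ξ).const_mul _
      · exact (char_integrable (hf_integrable (SchwartzMap.derivCLM ℝ ℝ w) (i + 1) y) ξ).const_mul _
    rw [hF2] at hF
    have hF3 := congrArg norm hF
    rw [norm_smul] at hF3
    have hn : ‖(2 * π * I * ξ : ℂ)‖ = 2 * π * |ξ| := by
      simp [abs_of_pos Real.pi_pos]
    rw [hn] at hF3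
    have hle : 2 * π * |ξ| * ‖𝓕 (hf w i y) ξ‖ ≤ i * ‖𝓕 (hf w (i - 1) y) ξ‖ + 2 * ‖𝓕 (hf (SchwartzMap.derivCLM ℝ ℝ w) (i + 1) y) ξ‖ := by
      rw [← hF3]
      refine (norm_add_le _ _).trans (le_of_eq ?_)
      rw [norm_mul, norm_mul]; simp
    have e1 := h1 y ξ
    have e2 := h2 y ξ
    have hpos : 0 ≤ |ξ| ^ A := by positivity
    have e3 := mul_le_mul_of_nonneg_left hle hpos
    have e4 : |ξ| ^ A * (|ξ| * ‖𝓕 (hf w i y) ξ‖) ≤ |ξ| ^ A * (2 * π * |ξ| * ‖𝓕 (hf w i y) ξ‖) := by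
      apply mul_le_mul_of_nonneg_left _ hpos
      have : 0 ≤ |ξ| * ‖𝓕 (hf w i y) ξ‖ := by positivity
      nlinarith [Real.pi_gt_three]
    have e5 : (i : ℝ) * (|ξ| ^ A * ‖𝓕 (hf w (i - 1) y) ξ‖) ≤ i * (C1 * (1 + y ^ 2)⁻¹) := by gcongr
    calc |ξ| ^ (A + 1) * ‖𝓕 (hf w i y) ξ‖ = |ξ| ^ A * (|ξ| * ‖𝓕 (hf w i y) ξ‖) := by ring
      _ ≤ _ := e4
      _ ≤ _ := e3
      _ = (i : ℝ) * (|ξ| ^ A * ‖𝓕 (hf w (i - 1) y) ξ‖) + 2 * (|ξ| ^ A * ‖𝓕 (hf (SchwartzMap.derivCLM ℝ ℝ w) (i + 1) y) ξ‖) := by ring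
      _ ≤ i * (C1 * (1 + y ^ 2)⁻¹) + 2 * (C2 * (1 + y ^ 2)⁻¹) := by linarith
      _ = _ := by ring

/-- uniform bound for `∑ 1/(1+((b+j)/R)²)` -/
lemma inv_sq_sum : ∃ C : ℝ, 0 < C ∧ ∀ (b R : ℝ), 0 < R →
    Summable (fun j : ℤ => (1 + ((b + j) / R) ^ 2)⁻¹) ∧
    ∑' j : ℤ, (1 + ((b + j) / R) ^ 2)⁻¹ ≤ C * (1 + R ^ 2) := by
  have hs : Summable (fun j : ℤ => (1 + (j : ℝ) ^ 2)⁻¹) := by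
    have h1 := (Real.summable_one_div_int_pow (p := 2)).mpr (by norm_num)
    refine Summable.of_norm_bounded_eventually h1 ?_
    have h4 : ∀ᶠ j : ℤ in cofinite, j ≠ 0 := by
      rw [Filter.eventually_cofinite]; simp
    filter_upwards [h4] with j hj
    have : 0 < (j : ℝ) ^ 2 := by positivity
    rw [Real.norm_eq_abs, abs_of_pos (by positivity), one_div]
    exact inv_anti₀ this (by linarith)
  refine ⟨3 * ∑' j : ℤ, (1 + (j : ℝ) ^ 2)⁻¹ + 1, by positivity, ?_⟩
  intro b R hR
  have hb : ∀ j : ℤ, (1 + ((Int.fract b + j) / R) ^ 2)⁻¹ ≤ 3 * (1 + R ^ 2) * (1 + (j : ℝ) ^ 2)⁻¹ := by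
    intro j
    have hf0 := Int.fract_nonneg b
    have hf1 := (Int.fract_lt_one b).le
    rw [← div_eq_mul_inv, le_div_iff₀ (by positivity), inv_mul_le_iff₀ (by positivity), div_pow]
    have h1 : (1 + (j : ℝ) ^ 2) ≤ 3 * (1 + (Int.fract b + j) ^ 2) := by
      nlinarith [sq_nonneg ((Int.fract b + j) + Int.fract b), sq_nonneg (Int.fract b + j), mul_nonneg (sub_nonneg.mpr hf1) (add_nonneg zero_le_one hf0)]
    have h2 : (1 + (Int.fract b + j) ^ 2) ≤ (1 + (Int.fract b + j) ^ 2 / R ^ 2) * (1 + R ^ 2) := by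
      have : (Int.fract b + j) ^ 2 / R ^ 2 * R ^ 2 = (Int.fract b + j) ^ 2 := by field_simp
      have h0 : 0 ≤ (Int.fract b + j) ^ 2 / R ^ 2 := by positivity
      nlinarith [sq_nonneg R]
    nlinarith
  have hsum : Summable (fun j : ℤ => (1 + ((Int.fract b + j) / R) ^ 2)⁻¹) :=
    Summable.of_nonneg_of_le (fun j => by positivity) hb (hs.mul_left _)
  have heq : (fun j : ℤ => (1 + ((b + j) / R) ^ 2)⁻¹) =
      (fun j : ℤ => (1 + ((Int.fract b + j) / R) ^ 2)⁻¹) ∘ (Equiv.addRight ⌊b⌋) := by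
    ext j
    simp only [Function.comp, Equiv.coe_addRight]
    have : Int.fract b + ((j + ⌊b⌋ : ℤ) : ℝ) = b + j := by
      push_cast; linarith [Int.fract_add_floor b]
    rw [this]
  constructor
  · rw [heq, Equiv.summable_iff]; exact hsum
  · rw [heq]
    have := (Equiv.addRight ⌊b⌋).tsum_eq (fun j : ℤ => (1 + ((Int.fract b + j) / R) ^ 2)⁻¹)
    simp only [Function.comp_def]
    rw [this]
    have h5 := hsum.tsum_le_tsum hb (hs.mul_left _)
    rw [tsum_mul_left] at h5
    nlinarith [sq_nonneg R]

lemma hf_scale_fourier (w : SchwartzMap ℝ ℝ) (y : ℝ) {R : ℝ} (hR : 0 < R) (k : ℝ) :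
    𝓕 (fun x => hf w 0 y (x / R)) k = R * 𝓕 (hf w 0 y) (R * k) := by
  simp only [Real.fourier_real_eq, Circle.smul_def, smul_eq_mul]
  have h := Measure.integral_comp_div (fun u : ℝ => ((Real.fourierChar (-(u * (R * k))) : Circle) : ℂ) * hf w 0 y u) R
  rw [abs_of_pos hR, Complex.real_smul] at h
  rw [← h]
  congr 1; ext v
  congr 4
  field_simp

theorem line_sum (w : SchwartzMap ℝ ℝ) (A : ℕ) (hA : 2 ≤ A) : ∃ C : ℝ, 0 < C ∧ ∀ (b y R : ℝ), 0 < R →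
    ‖∑' j : ℤ, hf w 0 y ((b + j) / R) - R * ∫ x, hf w 0 y x‖ ≤ C * (R * (R ^ A)⁻¹) * (1 + y ^ 2)⁻¹ := by
  obtain ⟨C, hC, h⟩ := hf_fourier A w 0
  obtain ⟨C0, hC0, h0⟩ := hf_bound w 0
  have hs : Summable (fun j : ℤ => (|(j : ℝ)| ^ A)⁻¹) := by
    have h1 := (Real.summable_one_div_int_pow (p := A)).mpr (by omega)
    refine h1.norm.congr ?_
    intro j
    rw [Real.norm_eq_abs, abs_div, abs_pow, abs_one, one_div]
  refine ⟨C * (∑' j : ℤ, (|(j : ℝ)| ^ A)⁻¹) + 1, by positivity, ?_⟩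
  intro b y R hR
  set f : ℝ → ℂ := fun x => hf w 0 y (x / R) with hfdef
  have hfc : Continuous f := (hf_cont w 0 y).comp (by fun_prop)
  have hO : f =O[cocompact ℝ] fun x : ℝ => |x| ^ (-(2 : ℝ)) := by
    refine Asymptotics.IsBigO.of_bound (C0 * R ^ 2) ?_
    have : ∀ᶠ x : ℝ in cocompact ℝ, x ≠ 0 := isCompact_singleton.compl_mem_cocompact
    filter_upwards [this] with x hx
    have hx2 : 0 < x ^ 2 := by positivity
    rw [Real.norm_eq_abs, Real.rpow_neg (abs_nonneg _), Real.rpow_ofNat, sq_abs, abs_of_pos (by positivity)]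
    refine (h0 (x / R) y).trans ?_
    have e1 : (1 + y ^ 2)⁻¹ ≤ 1 := inv_le_one_of_one_le₀ (by nlinarith [sq_nonneg y])
    have e2 : (1 + (x / R) ^ 2)⁻¹ ≤ R ^ 2 * (x ^ 2)⁻¹ := by
      have e3 : R ^ 2 * (x ^ 2)⁻¹ = ((x / R) ^ 2)⁻¹ := by rw [div_pow, inv_div, div_eq_mul_inv]
      rw [e3]
      exact inv_anti₀ (by positivity) (by linarith)
    calc _ ≤ C0 * 1 * (R ^ 2 * (x ^ 2)⁻¹) := by gcongr
      _ = _ := by ring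
  set K : ℝ := C * (R * (R ^ A)⁻¹) * (1 + y ^ 2)⁻¹ with hK
  have hb : ∀ n : ℤ, n ≠ 0 → ‖𝓕 f n‖ ≤ K * (|(n : ℝ)| ^ A)⁻¹ := by
    intro n hn
    have hn' : 0 < |(n : ℝ)| := by positivity
    rw [hfdef, hf_scale_fourier w y hR, norm_mul, Complex.norm_real, Real.norm_eq_abs, abs_of_pos hR]
    have h1 := h y (R * n)
    rw [abs_mul, abs_of_pos hR, mul_pow] at h1
    rw [hK]
    rw [← le_div_iff₀' (by positivity)] at h1
    calc _ ≤ R * (C * (1 + y ^ 2)⁻¹ / (R ^ A * |(n : ℝ)| ^ A)) := by gcongr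
      _ = _ := by field_simp
  have hK0 : 0 ≤ K := by positivity
  have hsF : Summable fun n : ℤ => 𝓕 f n := by
    refine Summable.of_norm_bounded_eventually (hs.mul_left K) ?_
    have h4 : ∀ᶠ j : ℤ in cofinite, j ≠ 0 := by
      rw [Filter.eventually_cofinite]; simp
    filter_upwards [h4] with n hn using hb n hn
  have hP := Real.tsum_eq_tsum_fourier_of_rpow_decay_of_summable hfc (by norm_num : (1 : ℝ) < 2) hO hsF b
  have hfn : ∀ n : ℤ, ‖(fourier n (b : UnitAddCircle) : ℂ)‖ = 1 := by
    intro n; rw [fourier_apply, Circle.norm_coe]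
  have hsFe : Summable fun n : ℤ => 𝓕 f n * fourier n (b : UnitAddCircle) := by
    refine Summable.of_norm_bounded hsF.norm (fun n => ?_)
    rw [norm_mul, hfn, mul_one]
  have hF0 : 𝓕 f (0 : ℤ) * fourier 0 (b : UnitAddCircle) = R * ∫ x, hf w 0 y x := by
    rw [hfdef, hf_scale_fourier w y hR, Real.fourier_real_eq]
    simp
  have hsplit := hsFe.tsum_eq_add_tsum_ite 0
  rw [hF0] at hsplit
  change ‖∑' j : ℤ, f (b + j) - _‖ ≤ _
  rw [hP, hsplit, add_sub_cancel_left]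
  have := tsum_of_norm_bounded (f := fun n : ℤ => if n = 0 then 0 else 𝓕 f n * fourier n (b : UnitAddCircle)) (hs.hasSum.mul_left K) (fun n => by
    split_ifs with hn
    · rw [norm_zero]; positivity
    · rw [norm_mul, hfn, mul_one]
      exact hb n hn)
  refine this.trans ?_
  rw [hK]
  have h9 : 0 ≤ R * (R ^ A)⁻¹ * (1 + y ^ 2)⁻¹ := by positivity
  generalize (∑' j : ℤ, (|(j : ℝ)| ^ A)⁻¹) = S
  linear_combination h9

end GH

namespace GH

open MeasureTheory FourierTransform

lemma hf_symm (w : SchwartzMap ℝ ℝ) (x y : ℝ) : hf w 0 y x = hf w 0 x y := by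
  unfold hf; rw [add_comm]; simp

lemma hf_prod_integrable (w : SchwartzMap ℝ ℝ) : Integrable (fun p : ℝ × ℝ => hf w 0 p.1 p.2) (volume.prod volume) := by
  obtain ⟨C, hC, h⟩ := hf_bound w 0
  have h1 := (integrable_inv_one_add_sq.mul_prod integrable_inv_one_add_sq).const_mul C
  refine Integrable.mono' h1 ?_ (Eventually.of_forall (fun p => ?_))
  · refine Continuous.aestronglyMeasurable ?_
    unfold hf
    have := w.continuous
    fun_prop
  · refine (h p.2 p.1).trans (le_of_eq (by ring))

lemma hf_int_integrable (w : SchwartzMap ℝ ℝ) : Integrable (fun x : ℝ => ∫ y, hf w 0 x y) := by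
  exact (hf_prod_integrable w).integral_prod_left

/-- the plane integral -/
def cw (w : SchwartzMap ℝ ℝ) : ℂ := ∫ x : ℝ, ∫ y : ℝ, hf w 0 x y

lemma hf_sum (w : SchwartzMap ℝ ℝ) : ∃ C : ℝ, 0 < C ∧ ∀ (b R : ℝ), 0 < R → ∀ y : ℝ,
    Summable (fun j : ℤ => hf w 0 y ((b + j) / R)) := by
  obtain ⟨C0, hC0, h0⟩ := hf_bound w 0
  obtain ⟨C1, hC1, h1⟩ := inv_sq_sum
  refine ⟨1, one_pos, fun b R hR y => ?_⟩
  exact Summable.of_norm_bounded ((h1 b R hR).1.mul_left (C0 * (1 + y ^ 2)⁻¹)) (fun j => h0 _ _)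

/-- summing the line integrals -/
lemma int_sum (w : SchwartzMap ℝ ℝ) (A : ℕ) (hA : 2 ≤ A) : ∃ C : ℝ, 0 < C ∧ ∀ (b R : ℝ), 0 < R →
    ‖(∑' j : ℤ, ∫ x, hf w 0 ((b + j) / R) x) - R * cw w‖ ≤ C * (R * (R ^ A)⁻¹) := by
  obtain ⟨C, hC, h⟩ := line_sum w A hA
  obtain ⟨C0, hC0, h0⟩ := hf_bound w 0
  obtain ⟨C1, hC1, h1⟩ := inv_sq_sum
  refine ⟨C * π, by positivity, fun b R hR => ?_⟩
  have hsw := hasSum_integral_of_summable_integral_norm (μ := volume) (F := fun (j : ℤ) (x : ℝ) => hf w 0 ((b + j) / R) x)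
    (fun j => hf_integrable w 0 _) (by
      refine Summable.of_nonneg_of_le (fun j => integral_nonneg (fun x => norm_nonneg _)) (fun j => ?_)
        ((h1 b R hR).1.mul_left (C0 * π))
      have h3 : ∫ x, ‖hf w 0 ((b + j) / R) x‖ ≤ ∫ x : ℝ, C0 * (1 + ((b + j) / R) ^ 2)⁻¹ * (1 + x ^ 2)⁻¹ :=
        integral_mono (hf_integrable w 0 _).norm (integrable_inv_one_add_sq.const_mul _) (fun x => h0 x _)
      rw [integral_const_mul, integral_univ_inv_one_add_sq] at h3
      linarith)
  rw [hsw.tsum_eq]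
  have hdom : Integrable (fun x : ℝ => C * (R * (R ^ A)⁻¹) * (1 + x ^ 2)⁻¹) := integrable_inv_one_add_sq.const_mul _
  have hb : ∀ x : ℝ, ‖(∑' j : ℤ, hf w 0 ((b + j) / R) x) - R * ∫ y, hf w 0 x y‖ ≤ C * (R * (R ^ A)⁻¹) * (1 + x ^ 2)⁻¹ := by
    intro x
    have := h b x R hR
    simp only [fun j : ℤ => hf_symm w x ((b + j) / R)]
    exact this
  have hI1 : Integrable (fun x : ℝ => R * ∫ y, hf w 0 x y) := (hf_int_integrable w).const_mul (R : ℂ)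
  have hI2 : Integrable (fun x : ℝ => (∑' j : ℤ, hf w 0 ((b + j) / R) x)) := by
    have hm : AEStronglyMeasurable (fun x : ℝ => (∑' j : ℤ, hf w 0 ((b + j) / R) x)) := by
      refine Continuous.aestronglyMeasurable ?_
      refine continuous_tsum (fun j => hf_cont w 0 _) ((h1 b R hR).1.mul_left C0) (fun j x => ?_)
      refine (h0 x _).trans ?_
      have e1 : (1 + x ^ 2)⁻¹ ≤ 1 := inv_le_one_of_one_le₀ (by nlinarith [sq_nonneg x])
      have : 0 ≤ C0 * (1 + ((b + j) / R) ^ 2)⁻¹ := by positivity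
      nlinarith
    have h3 : Integrable (fun x : ℝ => (∑' j : ℤ, hf w 0 ((b + j) / R) x) - R * ∫ y, hf w 0 x y) :=
      Integrable.mono' hdom (hm.sub hI1.aestronglyMeasurable) (Eventually.of_forall hb)
    have := h3.add hI1
    refine this.congr (Eventually.of_forall (fun x => ?_))
    simp
  unfold cw
  rw [← integral_const_mul, ← integral_sub hI2 hI1]
  refine (norm_integral_le_of_norm_le hdom (Eventually.of_forall hb)).trans ?_
  rw [integral_const_mul, integral_univ_inv_one_add_sq]
  exact le_of_eq (by ring)

theorem plane_sum (w : SchwartzMap ℝ ℝ) (A : ℕ) (hA : 2 ≤ A) : ∃ C : ℝ, 0 < C ∧ ∀ (b1 b2 R : ℝ), 0 < R →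
    Summable (fun p : ℤ × ℤ => hf w 0 ((b2 + p.2) / R) ((b1 + p.1) / R)) ∧
    ‖∑' p : ℤ × ℤ, hf w 0 ((b2 + p.2) / R) ((b1 + p.1) / R) - R ^ 2 * cw w‖ ≤ C * (R ^ A)⁻¹ * (1 + R ^ 2) ^ 2 := by
  obtain ⟨C, hC, h⟩ := line_sum w A hA
  obtain ⟨C2, hC2, h2⟩ := int_sum w A hA
  obtain ⟨C0, hC0, h0⟩ := hf_bound w 0
  obtain ⟨C1, hC1, h1⟩ := inv_sq_sum
  refine ⟨C * C1 + C2, by positivity, fun b1 b2 R hR => ?_⟩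
  have hs : Summable (fun p : ℤ × ℤ => hf w 0 ((b2 + p.2) / R) ((b1 + p.1) / R)) := by
    have h3 := ((h1 b1 R hR).1.mul_of_nonneg (h1 b2 R hR).1 (fun j => by positivity) (fun j => by positivity)).mul_left C0
    refine Summable.of_norm_bounded h3 (fun p => ?_)
    refine (h0 _ _).trans (le_of_eq (by ring))
  refine ⟨hs, ?_⟩
  have hs' : Summable (fun p : ℤ × ℤ => hf w 0 ((b2 + p.1) / R) ((b1 + p.2) / R)) := by
    have := (Equiv.prodComm ℤ ℤ).summable_iff.mpr hs
    exact this
  have e1 : ∑' p : ℤ × ℤ, hf w 0 ((b2 + p.2) / R) ((b1 + p.1) / R) =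
      ∑' j : ℤ, ∑' i : ℤ, hf w 0 ((b2 + j) / R) ((b1 + i) / R) := by
    rw [← hs'.tsum_prod]
    exact ((Equiv.prodComm ℤ ℤ).tsum_eq (fun p : ℤ × ℤ => hf w 0 ((b2 + p.2) / R) ((b1 + p.1) / R))).symm
  rw [e1]
  have hsj := hs'.prod
  have hle : ∀ j : ℤ, ‖(∑' i : ℤ, hf w 0 ((b2 + j) / R) ((b1 + i) / R)) - R * ∫ x, hf w 0 ((b2 + j) / R) x‖
      ≤ C * (R * (R ^ A)⁻¹) * (1 + ((b2 + j) / R) ^ 2)⁻¹ := fun j => h b1 _ R hR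
  have hd := (h1 b2 R hR).1.mul_left (C * (R * (R ^ A)⁻¹))
  have hsd : Summable (fun j : ℤ => (∑' i : ℤ, hf w 0 ((b2 + j) / R) ((b1 + i) / R)) - R * ∫ x, hf w 0 ((b2 + j) / R) x) :=
    Summable.of_norm_bounded hd hle
  have hsi : Summable (fun j : ℤ => (R : ℂ) * ∫ x, hf w 0 ((b2 + j) / R) x) := by
    have := hsj.sub hsd
    refine this.congr (fun j => ?_)
    simp
  have e2 := hsj.tsum_sub hsi
  have e3 := tsum_of_norm_bounded hd.hasSum hle
  rw [e2, tsum_mul_left, tsum_mul_left] at e3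
  have e4 := h2 b2 R hR
  have e5 : ‖(R : ℂ) * ((∑' j : ℤ, ∫ x, hf w 0 ((b2 + j) / R) x) - R * cw w)‖ ≤ R * (C2 * (R * (R ^ A)⁻¹)) := by
    rw [norm_mul, Complex.norm_real, Real.norm_eq_abs, abs_of_pos hR]
    gcongr
  have e6 := (h1 b2 R hR).2
  generalize (∑' j : ℤ, ∑' i : ℤ, hf w 0 ((b2 + j) / R) ((b1 + i) / R)) = S at *
  generalize (∑' j : ℤ, ∫ x, hf w 0 ((b2 + j) / R) x) = T at *
  generalize (∑' j : ℤ, (1 + ((b2 + j) / R) ^ 2)⁻¹) = U at *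
  have e7 : S - R ^ 2 * cw w = (S - R * T) + R * (T - R * cw w) := by ring
  rw [e7]
  refine (norm_add_le _ _).trans ((add_le_add e3 e5).trans ?_)
  have hq : 0 < (R ^ A)⁻¹ := by positivity
  generalize (R ^ A)⁻¹ = q at *
  have f1 : C * (R * q) * U ≤ C * (R * q) * (C1 * (1 + R ^ 2)) := by gcongr
  have f2 : R ≤ 1 + R ^ 2 := by nlinarith [sq_nonneg (R - 1)]
  have f3 : C * (R * q) * (C1 * (1 + R ^ 2)) ≤ C * ((1 + R ^ 2) * q) * (C1 * (1 + R ^ 2)) := by gcongr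
  have f4 : R * (C2 * (R * q)) ≤ C2 * q * (1 + R ^ 2) ^ 2 := by
    have : R * R ≤ (1 + R ^ 2) * (1 + R ^ 2) := by gcongr
    calc R * (C2 * (R * q)) = C2 * q * (R * R) := by ring
      _ ≤ C2 * q * ((1 + R ^ 2) * (1 + R ^ 2)) := by gcongr
      _ = _ := by ring
  linarith

end GH

namespace GH

variable {χ : GI → GI → ℤ}

theorem lattice_sum (w : SchwartzMap ℝ ℝ) (A : ℕ) (hA : 1 ≤ A) : ∃ C : ℝ, 0 < C ∧ ∀ (b : ℂ) (Y : ℝ), 0 < Y →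
    Summable (fun z : GI => ((w (normSq (tc z + b) / Y) : ℝ) : ℂ)) ∧
    ‖∑' z : GI, ((w (normSq (tc z + b) / Y) : ℝ) : ℂ) - Y * cw w‖ ≤ C * (Y ^ A)⁻¹ * (1 + Y) ^ 2 := by
  obtain ⟨C, hC, h⟩ := plane_sum w (2 * A) (by omega)
  refine ⟨C, hC, fun b Y hY => ?_⟩
  obtain ⟨h1, h2⟩ := h b.re b.im (√Y) (Real.sqrt_pos.mpr hY)
  have hY2 : √Y ^ 2 = Y := Real.sq_sqrt hY.le
  have hc : (√Y : ℂ) ^ 2 = Y := by exact_mod_cast hY2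
  rw [pow_mul, hY2, hc] at h2
  have e : ∀ p : ℤ × ℤ, hf w 0 ((b.im + p.2) / √Y) ((b.re + p.1) / √Y) = ((w (normSq (tc (giEquiv p) + b) / Y) : ℝ) : ℂ) := by
    intro p
    unfold hf
    rw [normSq_apply, Complex.add_re, Complex.add_im, tc_re, tc_im]
    simp only [giEquiv, Equiv.coe_fn_mk, pow_zero, one_mul, div_pow, hY2]
    congr 2
    ring
  simp only [e] at h1 h2
  constructor
  · rw [← giEquiv.summable_iff]; exact h1
  · rw [← giEquiv.tsum_eq]; exact h2

/-- the character sum over primary `n` -/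
def Wm (χ : GI → GI → ℤ) (w : SchwartzMap ℝ ℝ) (m : GI) (X : ℝ) : ℂ :=
  ∑' n : Prm, (χ m n.1 : ℂ) * ((w (Nm n.1 / X) : ℝ) : ℂ)

lemma w_prm_summable (w : SchwartzMap ℝ ℝ) {X : ℝ} (hX : 0 < X) (j : ℕ) :
    Summable (fun n : Prm => Nm n.1 ^ j * |w (Nm n.1 / X)|) := by
  obtain ⟨C, hC, h⟩ := schwartz_decay w (j + 2)
  refine Summable.of_nonneg_of_le (fun n => ?_) (fun n => ?_) ((summable_Nm_pow_prm (j := 2) le_rfl).mul_left (C * X ^ (j + 2)))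
  · have := Nm_nonneg n.1; positivity
  have hn := Nm_pos (primary_ne_zero n.2)
  have h1 := h (Nm n.1 / X)
  rw [abs_of_pos (by positivity : 0 < Nm n.1 / X)] at h1
  rw [← div_eq_mul_inv, le_div_iff₀ (by positivity)]
  have h2 : Nm n.1 ≤ X * (1 + Nm n.1 / X) := by
    have : X * (1 + Nm n.1 / X) = X + Nm n.1 := by field_simp
    linarith
  calc Nm n.1 ^ j * |w (Nm n.1 / X)| * Nm n.1 ^ 2 = |w (Nm n.1 / X)| * Nm n.1 ^ (j + 2) := by ring
    _ ≤ |w (Nm n.1 / X)| * (X * (1 + Nm n.1 / X)) ^ (j + 2) := by gcongr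
    _ = |w (Nm n.1 / X)| * (1 + Nm n.1 / X) ^ (j + 2) * X ^ (j + 2) := by rw [mul_pow]; ring
    _ ≤ C * X ^ (j + 2) := by gcongr

theorem Wm_asymp (hχ : IsQuadSym χ) (w : SchwartzMap ℝ ℝ) (A : ℕ) (hA : 1 ≤ A) : ∃ C : ℝ, 0 < C ∧
    ∀ m : GI, IsPrimary m → ∃ c : ℂ, ∀ X : ℝ, 0 < X →
    ‖Wm χ w m X - X * c‖ ≤ C * Nm m ^ 2 * ((X / (8 * Nm m)) ^ A)⁻¹ * (1 + X / (8 * Nm m)) ^ 2 := by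
  obtain ⟨C, hC, h⟩ := lattice_sum w A hA
  refine ⟨C, hC, fun m hm => ?_⟩
  have hm0 := primary_ne_zero hm
  have hmN := Nm_pos hm0
  obtain ⟨J, hJ, r, hr, hcard⟩ := exists_crs hm0
  refine ⟨∑ j : J, (χ (ωg ^ 3 * r j) m : ℂ) * (cw w / (8 * Nm m)), fun X hX => ?_⟩
  set Y := X / (8 * Nm m) with hY
  have hY0 : 0 < Y := by positivity
  have hb := crs_bij hr hm0 (isCoprime_one_right)
  let e := (Equiv.ofBijective _ hb).trans (prmE hm)
  have ht : ∀ x : J × GI, (χ m (e x).1 : ℂ) * ((w (Nm (e x).1 / X) : ℝ) : ℂ) =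
      (χ (ωg ^ 3 * r x.1) m : ℂ) * ((w (normSq (tc x.2 + ((tc m + Lam * tc (r x.1)) / (Lam * tc m))) / Y) : ℝ) : ℂ) := by
    intro x
    have hx : (e x).1 = m + ωg ^ 3 * (x.2 * m + r x.1 * 1) := rfl
    congr 2
    · rw [recip hχ hm (e x).2, hx]
      exact chi_per hχ hm (a := m + ωg ^ 3 * (x.2 * m + r x.1 * 1)) (b := ωg ^ 3 * r x.1) ⟨1 + ωg ^ 3 * x.2, by ring⟩
    · congr 1
      have hL := Lam_ne
      have hmc := tc_ne hm0
      have h1 : tc (e x).1 = (Lam * tc m) * (tc x.2 + ((tc m + Lam * tc (r x.1)) / (Lam * tc m))) := by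
        rw [mul_add, mul_div_cancel₀ _ (mul_ne_zero hL hmc), hx, Lam]
        simp only [tc, map_add, map_mul, map_one]
        ring
      rw [← normSq_tc (e x).1, h1, normSq_mul, normSq_mul, normSq_Lam, normSq_tc m, hY]
      field_simp
  have hs : ∀ j : J, Summable (fun z : GI => (χ (ωg ^ 3 * r j) m : ℂ) * ((w (normSq (tc z + ((tc m + Lam * tc (r j)) / (Lam * tc m))) / Y) : ℝ) : ℂ)) :=
    fun j => (h _ Y hY0).1.mul_left _
  have hsum : Summable (fun n : Prm => (χ m n.1 : ℂ) * ((w (Nm n.1 / X) : ℝ) : ℂ)) := by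
    refine Summable.of_norm_bounded (w_prm_summable w hX 0) (fun n => ?_)
    rw [norm_mul, Complex.norm_real, Real.norm_eq_abs, pow_zero]
    exact mul_le_mul_of_nonneg_right (chi_norm_le hχ n.2 m) (abs_nonneg _)
  have hW : Wm χ w m X = ∑ j : J, (χ (ωg ^ 3 * r j) m : ℂ) * ∑' z : GI, ((w (normSq (tc z + ((tc m + Lam * tc (r j)) / (Lam * tc m))) / Y) : ℝ) : ℂ) := by
    unfold Wm
    have hs2 := e.summable_iff.mpr hsum
    simp only [Function.comp_def] at hs2
    rw [← e.tsum_eq, Summable.tsum_prod hs2, tsum_fintype]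
    refine Finset.sum_congr rfl (fun j _ => ?_)
    rw [← tsum_mul_left]
    congr 1; ext z
    exact ht (j, z)
  rw [hW, Finset.mul_sum, ← Finset.sum_sub_distrib]
  refine (norm_sum_le _ _).trans ?_
  have hB : ∀ j ∈ (Finset.univ : Finset J), ‖(χ (ωg ^ 3 * r j) m : ℂ) * (∑' z : GI, ((w (normSq (tc z + ((tc m + Lam * tc (r j)) / (Lam * tc m))) / Y) : ℝ) : ℂ)) -
      X * ((χ (ωg ^ 3 * r j) m : ℂ) * (cw w / (8 * Nm m)))‖ ≤ C * (Y ^ A)⁻¹ * (1 + Y) ^ 2 := by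
    intro j _
    have h2 := (h ((tc m + Lam * tc (r j)) / (Lam * tc m)) Y hY0).2
    have hYc : (Y : ℂ) = X / (8 * Nm m) := by rw [hY]; push_cast; ring
    generalize (∑' z : GI, ((w (normSq (tc z + ((tc m + Lam * tc (r j)) / (Lam * tc m))) / Y) : ℝ) : ℂ)) = S at *
    have e3 : (χ (ωg ^ 3 * r j) m : ℂ) * S - X * ((χ (ωg ^ 3 * r j) m : ℂ) * (cw w / (8 * Nm m))) =
      (χ (ωg ^ 3 * r j) m : ℂ) * (S - Y * cw w) := by rw [hYc]; ring
    rw [e3, norm_mul]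
    calc _ ≤ 1 * (C * (Y ^ A)⁻¹ * (1 + Y) ^ 2) := by
          gcongr
          exact chi_norm_le hχ hm _
      _ = _ := one_mul _
  refine (Finset.sum_le_card_nsmul _ _ _ hB).trans ?_
  rw [nsmul_eq_mul, Finset.card_univ]
  calc (Fintype.card J : ℝ) * (C * (Y ^ A)⁻¹ * (1 + Y) ^ 2) ≤ Nm m ^ 2 * (C * (Y ^ A)⁻¹ * (1 + Y) ^ 2) := by gcongr
    _ = _ := by ring

end GH

namespace GH

variable {χ : GI → GI → ℤ}

/-- the smoothed average of theta functions -/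
def Zf (χ : GI → GI → ℤ) (w : SchwartzMap ℝ ℝ) (X u : ℝ) : ℂ :=
  ∑' n : Prm, ((w (Nm n.1 / X) : ℝ) : ℂ) * Df χ n.1 u

lemma Z_swap (hχ : IsQuadSym χ) (w : SchwartzMap ℝ ℝ) {X u : ℝ} (hX : 0 < X) (hu : 0 < u) :
    HasSum (fun m : Prm => (phi (u * Nm m.1) : ℂ) * Wm χ w m.1 X) (Zf χ w X u) := by
  have h1 := w_prm_summable w hX 0
  have h2 := summable_Nm_pow_prm (j := 2) le_rfl
  have h3 : Summable (fun p : Prm × Prm => ((w (Nm p.1.1 / X) : ℝ) : ℂ) * ((χ p.2.1 p.1.1 : ℂ) * (phi (u * Nm p.2.1) : ℂ))) := by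
    have h4 := h1.mul_of_nonneg (h2.mul_left (10 * (u ^ 2)⁻¹)) (fun n => by positivity) (fun n => by positivity)
    refine Summable.of_norm_bounded h4 (fun p => ?_)
    rw [norm_mul, Complex.norm_real, Real.norm_eq_abs, pow_zero, one_mul]
    exact mul_le_mul_of_nonneg_left (phi_term_le hχ p.1.2 hu p.2 _) (abs_nonneg _)
  have e1 : ∑' p : Prm × Prm, ((w (Nm p.1.1 / X) : ℝ) : ℂ) * ((χ p.2.1 p.1.1 : ℂ) * (phi (u * Nm p.2.1) : ℂ)) = Zf χ w X u := by
    rw [h3.tsum_prod]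
    unfold Zf Df
    congr 1; ext n
    rw [← tsum_mul_left]
  have h5 := (Equiv.prodComm Prm Prm).hasSum_iff.mpr h3.hasSum
  rw [e1] at h5
  have h6 := h5.prod_fiberwise (g := fun m : Prm => (phi (u * Nm m.1) : ℂ) * Wm χ w m.1 X) (fun m => ?_)
  · exact h6
  · have hs : Summable (fun n : Prm => (χ m.1 n.1 : ℂ) * ((w (Nm n.1 / X) : ℝ) : ℂ)) := by
      refine Summable.of_norm_bounded h1 (fun n => ?_)
      rw [norm_mul, Complex.norm_real, Real.norm_eq_abs, pow_zero]
      exact mul_le_mul_of_nonneg_right (chi_norm_le hχ n.2 _) (abs_nonneg _)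
    refine (hs.hasSum.mul_left (phi (u * Nm m.1) : ℂ)).congr_fun (fun n => ?_)
    simp only [Function.comp, Equiv.prodComm_apply, Prod.swap]
    ring

theorem I_bound (hχ : IsQuadSym χ) (w : SchwartzMap ℝ ℝ) (A : ℕ) : ∃ C : ℝ, 0 < C ∧ ∀ u X X' : ℝ, 0 < u → 1 ≤ X → X ≤ X' →
    ‖Zf χ w X u / X - Zf χ w X' u / X'‖ ≤ C * X ^ 6 * ((u * X) ^ (A + 5))⁻¹ := by
  obtain ⟨C, hC, h⟩ := Wm_asymp hχ w (A + 1) (by omega)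
  have h2 := summable_Nm_pow_prm (j := 2) le_rfl
  set S := ∑' m : Prm, (Nm m.1 ^ 2)⁻¹ with hS
  have hS0 : 0 ≤ S := tsum_nonneg (fun m => by positivity)
  set K : ℝ := 2 * (C * 8 ^ (A + 1) * 4) * (5 * (A + 5).factorial) with hK
  have hK0 : 0 < K := by positivity
  refine ⟨K * S + 1, by positivity, fun u X X' hu hX hXX => ?_⟩
  have hX0 : 0 < X := by linarith
  have hX'0 : 0 < X' := by linarith
  have hd := ((Z_swap hχ w hX0 hu).div_const (X : ℂ)).sub ((Z_swap hχ w hX'0 hu).div_const (X' : ℂ))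
  rw [← hd.tsum_eq]
  have key : ∀ m : GI, IsPrimary m → ∀ c : ℂ, (∀ X : ℝ, 0 < X →
    ‖Wm χ w m X - X * c‖ ≤ C * Nm m ^ 2 * ((X / (8 * Nm m)) ^ (A + 1))⁻¹ * (1 + X / (8 * Nm m)) ^ 2) →
    ∀ T : ℝ, X ≤ T → ‖Wm χ w m T / T - c‖ ≤ (C * 8 ^ (A + 1) * 4) * Nm m ^ (A + 3) * (X ^ A)⁻¹ * X := by
    intro m hm c hc T hT
    have hT0 : 0 < T := by linarith
    have hT1 : 1 ≤ T := by linarith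
    have hmN := Nm_pos (primary_ne_zero hm)
    have hm1 := one_le_Nm (primary_ne_zero hm)
    have e : Wm χ w m T / T - c = (Wm χ w m T - T * c) / T := by
      have : (T : ℂ) ≠ 0 := by exact_mod_cast hT0.ne'
      field_simp
    rw [e, norm_div, Complex.norm_real, Real.norm_eq_abs, abs_of_pos hT0, div_le_iff₀ hT0]
    refine (hc T hT0).trans ?_
    have e1 : 1 + T / (8 * Nm m) ≤ 2 * T := by
      have : T / (8 * Nm m) ≤ T := div_le_self hT0.le (by linarith)
      linarith
    have e2 : ((T / (8 * Nm m)) ^ (A + 1))⁻¹ = 8 ^ (A + 1) * Nm m ^ (A + 1) * (T ^ (A + 1))⁻¹ := by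
      rw [div_pow, inv_div, mul_pow, div_eq_mul_inv]
    rw [e2]
    have e3 : (T ^ A)⁻¹ ≤ (X ^ A)⁻¹ := inv_anti₀ (by positivity) (by gcongr)
    have e4 : (T ^ (A + 1))⁻¹ * T = (T ^ A)⁻¹ := by
      rw [pow_succ]; field_simp
    calc C * Nm m ^ 2 * (8 ^ (A + 1) * Nm m ^ (A + 1) * (T ^ (A + 1))⁻¹) * (1 + T / (8 * Nm m)) ^ 2
        ≤ C * Nm m ^ 2 * (8 ^ (A + 1) * Nm m ^ (A + 1) * (T ^ (A + 1))⁻¹) * (2 * T) ^ 2 := by gcongr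
      _ = (C * 8 ^ (A + 1) * 4) * Nm m ^ (A + 3) * ((T ^ (A + 1))⁻¹ * T) * T := by ring
      _ = (C * 8 ^ (A + 1) * 4) * Nm m ^ (A + 3) * (T ^ A)⁻¹ * T := by rw [e4]
      _ ≤ (C * 8 ^ (A + 1) * 4) * Nm m ^ (A + 3) * (X ^ A)⁻¹ * X * T := by
          have : (C * 8 ^ (A + 1) * 4) * Nm m ^ (A + 3) * (T ^ A)⁻¹ * 1 ≤ (C * 8 ^ (A + 1) * 4) * Nm m ^ (A + 3) * (X ^ A)⁻¹ * X := by gcongr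
          nlinarith
  have hb : ∀ m : Prm, ‖(phi (u * Nm m.1) : ℂ) * Wm χ w m.1 X / X - (phi (u * Nm m.1) : ℂ) * Wm χ w m.1 X' / X'‖
      ≤ K * X ^ 6 * ((u * X) ^ (A + 5))⁻¹ * (Nm m.1 ^ 2)⁻¹ := by
    intro m
    obtain ⟨c, hc⟩ := h m.1 m.2
    have hmN := Nm_pos (primary_ne_zero m.2)
    have k1 := key m.1 m.2 c hc X le_rfl
    have k2 := key m.1 m.2 c hc X' hXX
    have e : (phi (u * Nm m.1) : ℂ) * Wm χ w m.1 X / X - (phi (u * Nm m.1) : ℂ) * Wm χ w m.1 X' / X' =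
      (phi (u * Nm m.1) : ℂ) * ((Wm χ w m.1 X / X - c) - (Wm χ w m.1 X' / X' - c)) := by ring
    rw [e, norm_mul, Complex.norm_real, Real.norm_eq_abs]
    have k3 := phi_le (A + 5) (x := u * Nm m.1) (by positivity)
    have k4 := (norm_sub_le (Wm χ w m.1 X / X - c) (Wm χ w m.1 X' / X' - c)).trans (add_le_add k1 k2)
    refine (mul_le_mul k3 k4 (norm_nonneg _) (by positivity)).trans (le_of_eq ?_)
    rw [hK]
    have hN0 := hmN.ne'
    simp only [mul_pow]
    field_simp
    ring
  refine (tsum_of_norm_bounded (h2.hasSum.mul_left _) hb).trans ?_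
  have h9 : 0 ≤ X ^ 6 * ((u * X) ^ (A + 5))⁻¹ := by positivity
  rw [← hS]
  linear_combination h9

end GH

namespace GH

open MeasureTheory

/-- sharp cutoff -/
def ind (x y : ℝ) : ℝ := if x ≤ y then 1 else 0

lemma ind_nonneg (x y : ℝ) : 0 ≤ ind x y := by unfold ind; split_ifs <;> norm_num
lemma ind_le_one (x y : ℝ) : ind x y ≤ 1 := by unfold ind; split_ifs <;> norm_num

lemma disc_finite (b : ℂ) (R : ℝ) : {z : GI | normSq (tc z + b) ≤ R}.Finite := by
  refine (finite_Nm_le (2 * R + 2 * normSq b)).subset ?_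
  intro z hz
  simp only [Set.mem_ofPred_eq] at hz ⊢
  rw [← normSq_tc]
  rw [normSq_apply, Complex.add_re, Complex.add_im] at hz
  rw [normSq_apply, normSq_apply]
  nlinarith [sq_nonneg ((tc z).re + 2 * b.re), sq_nonneg ((tc z).im + 2 * b.im)]

/-- the unit square -/
def usq (c : ℂ) : Set ℂ := Complex.measurableEquivRealProd ⁻¹' ((Set.Ico c.re (c.re + 1)) ×ˢ (Set.Ico c.im (c.im + 1)))

lemma mem_usq (c p : ℂ) : p ∈ usq c ↔ (c.re ≤ p.re ∧ p.re < c.re + 1) ∧ (c.im ≤ p.im ∧ p.im < c.im + 1) := Iff.rfl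

lemma usq_meas (c : ℂ) : MeasurableSet (usq c) :=
  Complex.measurableEquivRealProd.measurable (measurableSet_Ico.prod measurableSet_Ico)

lemma usq_vol (c : ℂ) : volume (usq c) = 1 := by
  unfold usq
  rw [Complex.volume_preserving_equiv_real_prod.measure_preimage (measurableSet_Ico.prod measurableSet_Ico).nullMeasurableSet,
    Measure.volume_eq_prod, Measure.prod_prod, Real.volume_Ico, Real.volume_Ico]
  simp

lemma usq_close {c p : ℂ} (h : p ∈ usq c) : ‖p - c‖ ≤ 2 := by
  rw [mem_usq] at h
  refine (Complex.norm_le_abs_re_add_abs_im _).trans ?_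
  rw [Complex.sub_re, Complex.sub_im, abs_of_nonneg (by linarith), abs_of_nonneg (by linarith)]
  linarith

theorem disc_count (b : ℂ) {R : ℝ} (hR : 0 ≤ R) :
    |((disc_finite b R).toFinset.card : ℝ) - π * R| ≤ 13 * (√R + 1) := by
  set s := (disc_finite b R).toFinset with hs
  have hmem : ∀ z, z ∈ s ↔ ‖tc z + b‖ ≤ √R := by
    intro z
    rw [hs, Set.Finite.mem_toFinset, Set.mem_ofPred_eq, Complex.normSq_eq_norm_sq, Real.le_sqrt (norm_nonneg _) hR]
  have hdisj : Set.PairwiseDisjoint (↑s) (fun z : GI => usq (tc z + b)) := by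
    intro z _ z' _ hne
    refine Set.disjoint_left.mpr (fun p hp hp' => hne ?_)
    rw [mem_usq] at hp hp'
    simp only [Complex.add_re, Complex.add_im, tc_re, tc_im] at hp hp'
    obtain ⟨⟨a1, a2⟩, a3, a4⟩ := hp
    obtain ⟨⟨b1, b2⟩, b3, b4⟩ := hp'
    have c1 : (z.re : ℝ) < z'.re + 1 := by linarith
    have c2 : (z'.re : ℝ) < z.re + 1 := by linarith
    have c3 : (z.im : ℝ) < z'.im + 1 := by linarith
    have c4 : (z'.im : ℝ) < z.im + 1 := by linarith
    norm_cast at c1 c2 c3 c4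
    apply Zsqrtd.ext <;> omega
  have hvol : volume (⋃ z ∈ s, usq (tc z + b)) = (s.card : ENNReal) := by
    rw [measure_biUnion_finset hdisj (fun z _ => usq_meas _)]
    simp [usq_vol]
  have hR0 := Real.sqrt_nonneg R
  have hRR := Real.sq_sqrt hR
  have up : (s.card : ℝ) ≤ π * (√R + 2) ^ 2 := by
    have h1 : (⋃ z ∈ s, usq (tc z + b)) ⊆ Metric.closedBall (0 : ℂ) (√R + 2) := by
      intro p hp
      simp only [Set.mem_iUnion] at hp
      obtain ⟨z, hz, hp⟩ := hp
      rw [mem_closedBall_zero_iff]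
      have h2 := usq_close hp
      have h3 := (hmem z).mp hz
      calc ‖p‖ = ‖(p - (tc z + b)) + (tc z + b)‖ := by ring_nf
        _ ≤ ‖p - (tc z + b)‖ + ‖tc z + b‖ := norm_add_le _ _
        _ ≤ _ := by linarith
    have h2 := measure_mono (μ := volume) h1
    rw [hvol, Complex.volume_closedBall] at h2
    have h3 := ENNReal.toReal_mono (by finiteness) h2
    rw [ENNReal.toReal_mul, ENNReal.toReal_pow, ENNReal.toReal_ofReal (by positivity)] at h3
    simp at h3
    linarith
  have lo : 2 ≤ √R → π * (√R - 2) ^ 2 ≤ (s.card : ℝ) := by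
    intro h2R
    have h1 : Metric.closedBall (0 : ℂ) (√R - 2) ⊆ (⋃ z ∈ s, usq (tc z + b)) := by
      intro p hp
      rw [mem_closedBall_zero_iff] at hp
      simp only [Set.mem_iUnion]
      have hin : p ∈ usq (tc (⟨⌊p.re - b.re⌋, ⌊p.im - b.im⌋⟩ : GI) + b) := by
        rw [mem_usq]
        simp only [Complex.add_re, Complex.add_im, tc_re, tc_im]
        have a1 := Int.floor_le (p.re - b.re)
        have a2 := Int.lt_floor_add_one (p.re - b.re)
        have a3 := Int.floor_le (p.im - b.im)
        have a4 := Int.lt_floor_add_one (p.im - b.im)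
        refine ⟨⟨?_, ?_⟩, ?_, ?_⟩ <;> linarith
      refine ⟨⟨⌊p.re - b.re⌋, ⌊p.im - b.im⌋⟩, ?_, hin⟩
      rw [hmem]
      have h3 := usq_close hin
      generalize tc (⟨⌊p.re - b.re⌋, ⌊p.im - b.im⌋⟩ : GI) + b = q at *
      calc ‖q‖ = ‖p - (p - q)‖ := by ring_nf
        _ ≤ ‖p‖ + ‖p - q‖ := norm_sub_le _ _
        _ ≤ _ := by linarith
    have h2 := measure_mono (μ := volume) h1
    rw [hvol, Complex.volume_closedBall] at h2
    have h3 := ENNReal.toReal_mono (by finiteness) h2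
    rw [ENNReal.toReal_mul, ENNReal.toReal_pow, ENNReal.toReal_ofReal (by linarith)] at h3
    simp at h3
    linarith
  have p3 := Real.pi_gt_three
  have p4 : π < 3.2 := Real.pi_lt_d2.trans (by norm_num)
  have hcard : (0 : ℝ) ≤ s.card := by positivity
  rw [abs_le]
  constructor
  · by_cases h : 2 ≤ √R
    · have := lo h
      nlinarith
    · push Not at h
      nlinarith
  · nlinarith

lemma disc_sum (b : ℂ) {R : ℝ} (hR : 0 ≤ R) : Summable (fun z : GI => (ind (normSq (tc z + b)) R : ℂ)) ∧
    ‖∑' z : GI, (ind (normSq (tc z + b)) R : ℂ) - π * R‖ ≤ 13 * (√R + 1) := by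
  have hz : ∀ z ∉ (disc_finite b R).toFinset, (ind (normSq (tc z + b)) R : ℂ) = 0 := by
    intro z hz
    rw [Set.Finite.mem_toFinset, Set.mem_ofPred_eq] at hz
    unfold ind; rw [if_neg hz]; simp
  refine ⟨summable_of_ne_finset_zero hz, ?_⟩
  rw [tsum_eq_sum hz]
  have : ∑ z ∈ (disc_finite b R).toFinset, (ind (normSq (tc z + b)) R : ℂ) = (disc_finite b R).toFinset.card := by
    rw [Finset.card_eq_sum_ones, Nat.cast_sum]
    refine Finset.sum_congr rfl (fun z hz => ?_)
    rw [Set.Finite.mem_toFinset, Set.mem_ofPred_eq] at hz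
    unfold ind; rw [if_pos hz]; simp
  rw [this]
  have h := disc_count b hR
  rw [← Real.norm_eq_abs, ← Complex.norm_real] at h
  push_cast at h
  exact h

end GH

namespace GH

variable {χ : GI → GI → ℤ}

/-- character sum with sharp cutoff over primary `n` -/
def Sk (χ : GI → GI → ℤ) (κ : GI) (y : ℝ) : ℂ := ∑' n : Prm, (χ κ n.1 : ℂ) * (ind (Nm n.1) y : ℂ)

lemma prm_finite (y : ℝ) : {n : Prm | Nm n.1 ≤ y}.Finite :=
  Set.Finite.preimage Subtype.val_injective.injOn (finite_Nm_le y)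

lemma ind_zero {x y : ℝ} (h : ¬ x ≤ y) : ind x y = 0 := by unfold ind; rw [if_neg h]

lemma Sk_summable (κ : GI) (y : ℝ) : Summable (fun n : Prm => (χ κ n.1 : ℂ) * (ind (Nm n.1) y : ℂ)) := by
  refine summable_of_ne_finset_zero (s := (prm_finite y).toFinset) (fun n hn => ?_)
  rw [Set.Finite.mem_toFinset, Set.mem_ofPred_eq] at hn
  rw [ind_zero hn]; simp

lemma Sk_small (κ : GI) {y : ℝ} (hy : y < 1) : Sk χ κ y = 0 := by
  unfold Sk
  have : ∀ n : Prm, (χ κ n.1 : ℂ) * (ind (Nm n.1) y : ℂ) = 0 := by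
    intro n
    rw [ind_zero (by have := one_le_Nm (primary_ne_zero n.2); linarith)]; simp
  simp [this]

theorem Sk_asymp0 (hχ : IsQuadSym χ) : ∃ C : ℝ, 0 < C ∧
    ∀ κ : GI, κ ≠ 0 → ∃ ρ : ℂ, ‖ρ‖ ≤ C * Nm κ ^ 4 ∧ ∀ y : ℝ, 0 ≤ y →
    ‖Sk χ κ y - y * ρ‖ ≤ C * Nm κ ^ 4 * (√y + 1) := by
  refine ⟨(8 : ℝ) ^ 4 * 13, by positivity, fun κ hκ => ?_⟩
  have hκN := Nm_pos hκ
  have hκ1 := one_le_Nm hκ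
  set K : GI := ((8 * κ.norm : ℤ) : GI) with hK
  have hNK : Nm K = (8 * Nm κ) ^ 2 := by
    rw [Nm_eq, hK, Zsqrtd.re_intCast, Zsqrtd.im_intCast]; unfold Nm; push_cast; ring
  have hKN : 0 < Nm K := by rw [hNK]; positivity
  have hK1 : 1 ≤ Nm K := by rw [hNK]; nlinarith
  have hK0 : K ≠ 0 := by
    intro h; rw [h, Nm_zero] at hKN; exact lt_irrefl _ hKN
  obtain ⟨J, hJ, r, hr, hcard⟩ := exists_crs hK0
  have hcard' : (Fintype.card J : ℝ) ≤ 8 ^ 4 * Nm κ ^ 4 := by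
    refine hcard.trans (le_of_eq ?_); rw [hNK]; ring
  let nj : J → Prm := fun j => prmE primary_one (r j)
  have hb := crs_bij hr hK0 (isCoprime_one_right)
  let e := (Equiv.ofBijective _ hb).trans (prmE primary_one)
  refine ⟨∑ j : J, (χ κ (nj j).1 : ℂ) * (π / (8 * Nm K)), ?_, fun y hy => ?_⟩
  · refine (norm_sum_le _ _).trans ?_
    have : ∀ j ∈ (Finset.univ : Finset J), ‖(χ κ (nj j).1 : ℂ) * (π / (8 * Nm K))‖ ≤ 13 := by
      intro j _
      rw [norm_mul]
      have h1 := chi_norm_le hχ (nj j).2 κ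
      have h2 : ‖((π : ℂ) / (8 * Nm K))‖ = π / (8 * Nm K) := by
        have : ((π : ℂ) / (8 * Nm K)) = ((π / (8 * Nm K) : ℝ) : ℂ) := by push_cast; ring
        rw [this, Complex.norm_real, Real.norm_eq_abs, abs_of_pos (by positivity)]
      have h3 : π / (8 * Nm K) ≤ 13 := by
        rw [div_le_iff₀ (by positivity)]
        have := Real.pi_lt_d2
        nlinarith
      rw [h2]
      calc _ ≤ 1 * (13 : ℝ) := by gcongr
        _ = _ := by norm_num
    refine (Finset.sum_le_card_nsmul _ _ _ this).trans ?_
    rw [nsmul_eq_mul, Finset.card_univ]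
    nlinarith
  set Y := y / (8 * Nm K) with hY
  have hY0 : 0 ≤ Y := by positivity
  have hYy : Y ≤ y := div_le_self hy (by linarith)
  have hKL : Lam * tc K ≠ 0 := mul_ne_zero Lam_ne (tc_ne hK0)
  have ht : ∀ x : J × GI, (χ κ (e x).1 : ℂ) * (ind (Nm (e x).1) y : ℂ) =
      (χ κ (nj x.1).1 : ℂ) * (ind (normSq (tc x.2 + ((1 + Lam * tc (r x.1)) / (Lam * tc K)))) Y : ℂ) := by
    intro x
    have hx : (e x).1 = 1 + ωg ^ 3 * (x.2 * K + r x.1 * 1) := rfl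
    have hx2 : (nj x.1).1 = 1 + ωg ^ 3 * r x.1 := rfl
    congr 2
    · have hd : (e x).1 - (nj x.1).1 = ((8 * κ.norm : ℤ) : GI) * (ωg ^ 3 * x.2) := by
        rw [hx, hx2]; ring
      apply chi_den_per hχ hκ (e x).2 (nj x.1).2
      · have := congrArg Zsqrtd.re hd
        rw [Zsqrtd.re_sub] at this
        rw [this]
        exact ⟨(ωg ^ 3 * x.2).re, by simp [Zsqrtd.re_mul]⟩
      · have := congrArg Zsqrtd.im hd
        rw [Zsqrtd.im_sub] at this
        rw [this]
        exact ⟨(ωg ^ 3 * x.2).im, by simp [Zsqrtd.im_mul]⟩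
    · have h1 : tc (e x).1 = (Lam * tc K) * (tc x.2 + ((1 + Lam * tc (r x.1)) / (Lam * tc K))) := by
        rw [mul_add, mul_div_cancel₀ _ hKL, hx, Lam]
        simp only [tc, map_add, map_mul, map_one]
        ring
      rw [← normSq_tc (e x).1, h1, normSq_mul, normSq_mul, normSq_Lam, normSq_tc K, hY]
      unfold ind
      congr 1
      rw [le_div_iff₀' (by positivity)]
  have hW : Sk χ κ y = ∑ j : J, (χ κ (nj j).1 : ℂ) * ∑' z : GI, (ind (normSq (tc z + ((1 + Lam * tc (r j)) / (Lam * tc K)))) Y : ℂ) := by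
    unfold Sk
    have hs2 := e.summable_iff.mpr (Sk_summable (χ := χ) κ y)
    simp only [Function.comp_def] at hs2
    rw [← e.tsum_eq, Summable.tsum_prod hs2, tsum_fintype]
    refine Finset.sum_congr rfl (fun j _ => ?_)
    rw [← tsum_mul_left]
    congr 1; ext z
    exact ht (j, z)
  rw [hW, Finset.mul_sum, ← Finset.sum_sub_distrib]
  refine (norm_sum_le _ _).trans ?_
  have hB : ∀ j ∈ (Finset.univ : Finset J), ‖(χ κ (nj j).1 : ℂ) * (∑' z : GI, (ind (normSq (tc z + ((1 + Lam * tc (r j)) / (Lam * tc K)))) Y : ℂ)) -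
      y * ((χ κ (nj j).1 : ℂ) * (π / (8 * Nm K)))‖ ≤ 13 * (√y + 1) := by
    intro j _
    have h2 := (disc_sum ((1 + Lam * tc (r j)) / (Lam * tc K)) hY0).2
    have hYc : (Y : ℂ) = y / (8 * Nm K) := by rw [hY]; push_cast; ring
    generalize (∑' z : GI, (ind (normSq (tc z + ((1 + Lam * tc (r j)) / (Lam * tc K)))) Y : ℂ)) = S at *
    have e3 : (χ κ (nj j).1 : ℂ) * S - y * ((χ κ (nj j).1 : ℂ) * (π / (8 * Nm K))) =
      (χ κ (nj j).1 : ℂ) * (S - π * Y) := by rw [hYc]; ring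
    rw [e3, norm_mul]
    have h4 : √Y ≤ √y := Real.sqrt_le_sqrt hYy
    calc _ ≤ 1 * (13 * (√Y + 1)) := by
          gcongr
          exact chi_norm_le hχ (nj j).2 _
      _ ≤ _ := by linarith
  refine (Finset.sum_le_card_nsmul _ _ _ hB).trans ?_
  rw [nsmul_eq_mul, Finset.card_univ]
  calc (Fintype.card J : ℝ) * (13 * (√y + 1)) ≤ (8 ^ 4 * Nm κ ^ 4) * (13 * (√y + 1)) := by gcongr
    _ = _ := by ring

/-- clean form, valid for all `y ≥ 0`, `0 ≤ δ ≤ 1/2`. -/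
theorem Sk_asymp (hχ : IsQuadSym χ) : ∃ C : ℝ, 0 < C ∧
    ∀ κ : GI, κ ≠ 0 → ∃ ρ : ℂ, ‖ρ‖ ≤ C * Nm κ ^ 4 ∧ ∀ δ : ℝ, 0 ≤ δ → δ ≤ 1 / 2 → ∀ y : ℝ, 0 < y →
    ‖Sk χ κ y - y * ρ‖ ≤ C * Nm κ ^ 4 * y ^ (1 / 2 + δ) := by
  obtain ⟨C, hC, h⟩ := Sk_asymp0 hχ
  refine ⟨2 * C, by positivity, fun κ hκ => ?_⟩
  obtain ⟨ρ, hρ, h1⟩ := h κ hκ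
  have hκN := Nm_pos hκ
  have hP : 0 < C * Nm κ ^ 4 := by positivity
  refine ⟨ρ, by linarith, fun δ hδ hδ2 y hy => ?_⟩
  rcases lt_or_ge y 1 with hy1 | hy1
  · rw [Sk_small κ hy1, zero_sub, norm_neg, norm_mul, Complex.norm_real, Real.norm_eq_abs, abs_of_pos hy]
    have h3 : y ≤ y ^ (1 / 2 + δ) := by
      have := Real.rpow_le_rpow_of_exponent_ge hy hy1.le (show 1 / 2 + δ ≤ 1 by linarith)
      rwa [Real.rpow_one] at this
    calc y * ‖ρ‖ ≤ y ^ (1 / 2 + δ) * (C * Nm κ ^ 4) := by gcongr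
      _ ≤ _ := by nlinarith [Real.rpow_pos_of_pos hy (1 / 2 + δ), mul_pos (Real.rpow_pos_of_pos hy (1 / 2 + δ)) hP]
  · refine (h1 y hy.le).trans ?_
    have h3 : √y ≤ y ^ (1 / 2 + δ) := by
      rw [Real.sqrt_eq_rpow]
      exact Real.rpow_le_rpow_of_exponent_le hy1 (by linarith)
    have h4 : 1 ≤ √y := Real.one_le_sqrt.mpr hy1
    calc C * Nm κ ^ 4 * (√y + 1) ≤ C * Nm κ ^ 4 * (y ^ (1 / 2 + δ) + y ^ (1 / 2 + δ)) := by
          gcongr; linarith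
      _ = _ := by ring

end GH

namespace GH

variable {χ : GI → GI → ℤ}

/-- character sum with sharp cutoff over squarefree primary `n` -/
def Ak (χ : GI → GI → ℤ) (κ : GI) (x : ℝ) : ℂ := ∑' a : SqP, (χ κ a.1 : ℂ) * (ind (Nm a.1) x : ℂ)

lemma Ak_eq (hχ : IsQuadSym χ) (κ : GI) (x : ℝ) :
    HasSum (fun e : Prm => (mu e.1 : ℂ) * (χ κ e.1 : ℂ) ^ 2 * Sk χ κ (x / Nm e.1 ^ 2)) (Ak χ κ x) := by
  let t : Prm × Prm → ℂ := fun p => if p.2.1 ^ 2 ∣ p.1.1 then (mu p.2.1 : ℂ) * ((χ κ p.1.1 : ℂ) * (ind (Nm p.1.1) x : ℂ)) else 0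
  have hdv : ∀ n e : Prm, e.1 ^ 2 ∣ n.1 → e ∈ pdiv n.1 := by
    intro n e h
    rw [mem_pdiv (primary_ne_zero n.2)]
    exact (dvd_pow_self _ two_ne_zero).trans h
  have hs : Summable t := by
    refine summable_of_ne_finset_zero (s := (prm_finite x).toFinset ×ˢ (prm_finite x).toFinset) (fun p hp => ?_)
    by_contra hne
    apply hp
    have h1 : p.2.1 ^ 2 ∣ p.1.1 := by
      by_contra h; exact hne (if_neg h)
    have h2 : Nm p.1.1 ≤ x := by
      by_contra h
      apply hne
      simp only [t]
      rw [ind_zero h]; simp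
    rw [Finset.mem_product]
    simp only [Set.Finite.mem_toFinset, Set.mem_ofPred_eq]
    refine ⟨h2, (Nm_le_of_dvd (primary_ne_zero p.1.2) ((dvd_pow_self _ two_ne_zero).trans h1)).trans h2⟩
  have e1 : ∑' p, t p = Ak χ κ x := by
    rw [hs.tsum_prod]
    have hrow : ∀ n : Prm, ∑' e : Prm, t (n, e) = if Squarefree n.1 then (χ κ n.1 : ℂ) * (ind (Nm n.1) x : ℂ) else 0 := by
      intro n
      rw [tsum_eq_sum (s := pdiv n.1) (fun e he => if_neg (fun h => he (hdv n e h)))]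
      have h1 := congrArg (fun z : ℤ => (z : ℂ)) (sqfree_ind n.2)
      simp only [Int.cast_sum, Int.cast_ite, Int.cast_one, Int.cast_zero] at h1
      have h2 : ∀ e ∈ pdiv n.1, t (n, e) = (if e.1 ^ 2 ∣ n.1 then (mu e.1 : ℂ) else 0) * ((χ κ n.1 : ℂ) * (ind (Nm n.1) x : ℂ)) := by
        intro e _
        simp only [t, ite_mul, zero_mul]
      rw [Finset.sum_congr rfl h2, ← Finset.sum_mul, h1]
      simp only [ite_mul, zero_mul, one_mul]
    simp only [hrow]
    unfold Ak
    let f : SqP → Prm := fun a => ⟨a.1, a.2.1⟩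
    have hf : Function.Injective f := fun a b h => Subtype.ext (congrArg (fun z : Prm => z.1) h)
    rw [← hf.tsum_eq]
    · congr 1; ext a
      exact if_pos a.2.2
    · intro n hn
      rw [Function.mem_support] at hn
      have : Squarefree n.1 := by
        by_contra h; exact hn (if_neg h)
      exact ⟨⟨n.1, n.2, this⟩, rfl⟩
  have h5 := (Equiv.prodComm Prm Prm).hasSum_iff.mpr hs.hasSum
  rw [e1] at h5
  refine h5.prod_fiberwise (fun e => ?_)
  have he := Nm_pos (primary_ne_zero e.2)
  let f : Prm → Prm := fun n => ⟨e.1 ^ 2 * n.1, primary_mul (by rw [sq]; exact primary_mul e.2 e.2) n.2⟩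
  have hf : Function.Injective f := by
    intro a b h
    have h1 : e.1 ^ 2 * a.1 = e.1 ^ 2 * b.1 := congrArg (fun z : Prm => z.1) h
    exact Subtype.ext (mul_left_cancel₀ (pow_ne_zero 2 (primary_ne_zero e.2)) h1)
  have h6 := (Sk_summable (χ := χ) κ (x / Nm e.1 ^ 2)).hasSum.mul_left ((mu e.1 : ℂ) * (χ κ e.1 : ℂ) ^ 2)
  have h7 : (fun n : Prm => ((mu e.1 : ℂ) * (χ κ e.1 : ℂ) ^ 2) * ((χ κ n.1 : ℂ) * (ind (Nm n.1) (x / Nm e.1 ^ 2) : ℂ))) =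
      (fun n : Prm => (t ∘ Equiv.prodComm Prm Prm) (e, n)) ∘ f := by
    ext n
    simp only [Function.comp, Equiv.prodComm_apply, Prod.swap, t, f]
    rw [if_pos ⟨n.1, rfl⟩, sq e.1, chi_den_mul hχ κ (primary_mul e.2 e.2) n.2, chi_den_mul hχ κ e.2 e.2, Nm_mul, Nm_mul]
    have : ind (Nm n.1) (x / Nm e.1 ^ 2) = ind (Nm e.1 * Nm e.1 * Nm n.1) x := by
      unfold ind; congr 1
      rw [le_div_iff₀' (by positivity), sq]
    rw [this]; push_cast; ring
  rw [h7, hf.hasSum_iff] at h6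
  · exact h6
  · intro n hn
    apply if_neg
    rintro ⟨k, hk⟩
    apply hn
    simp only [Equiv.prodComm_apply, Prod.swap] at hk
    exact ⟨⟨k, primary_of_mul (by rw [sq]; exact primary_mul e.2 e.2) (hk ▸ n.2)⟩, Subtype.ext hk.symm⟩

theorem Ak_asymp (hχ : IsQuadSym χ) {δ : ℝ} (hδ : 0 < δ) (hδ2 : δ ≤ 1 / 2) : ∃ C : ℝ, 0 < C ∧
    ∀ κ : GI, κ ≠ 0 → ∃ ρ : ℂ, ∀ x : ℝ, 0 < x →
    ‖Ak χ κ x - x * ρ‖ ≤ C * Nm κ ^ 4 * x ^ (1 / 2 + δ) := by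
  obtain ⟨C, hC, h⟩ := Sk_asymp hχ
  have hsum := summable_Nm_prm (s := 1 + 2 * δ) (by linarith)
  set S := ∑' e : Prm, Nm e.1 ^ (-(1 + 2 * δ)) with hS
  have hS0 : 0 ≤ S := tsum_nonneg (fun e => Real.rpow_nonneg (Nm_nonneg _) _)
  refine ⟨C * S + 1, by positivity, fun κ hκ => ?_⟩
  obtain ⟨ρ, -, h1⟩ := h κ hκ
  have hcoef : ∀ e : Prm, ‖(mu e.1 : ℂ) * (χ κ e.1 : ℂ) ^ 2‖ ≤ 1 := by
    intro e
    have a1 : ‖(mu e.1 : ℂ)‖ ≤ 1 := by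
      have := mu_abs e.1
      rw [Complex.norm_intCast]; exact_mod_cast this
    have a2 := chi_norm_le hχ e.2 κ
    rw [norm_mul, norm_pow]
    calc _ ≤ 1 * 1 ^ 2 := by gcongr
      _ = (1 : ℝ) := by norm_num
  have hs2 : Summable (fun e : Prm => (mu e.1 : ℂ) * (χ κ e.1 : ℂ) ^ 2 * (ρ / Nm e.1 ^ 2)) := by
    refine Summable.of_norm_bounded ((summable_Nm_pow_prm (j := 2) le_rfl).mul_left ‖ρ‖) (fun e => ?_)
    rw [norm_mul, norm_div, norm_pow, Complex.norm_real, Real.norm_eq_abs, sq_abs, div_eq_mul_inv]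
    exact mul_le_of_le_one_left (mul_nonneg (norm_nonneg _) (inv_nonneg.mpr (sq_nonneg _))) (hcoef e)
  refine ⟨∑' e : Prm, (mu e.1 : ℂ) * (χ κ e.1 : ℂ) ^ 2 * (ρ / Nm e.1 ^ 2), fun x hx => ?_⟩
  have hd := (Ak_eq hχ κ x).sub (hs2.hasSum.mul_left (x : ℂ))
  rw [← hd.tsum_eq]
  have hb : ∀ e : Prm, ‖(mu e.1 : ℂ) * (χ κ e.1 : ℂ) ^ 2 * Sk χ κ (x / Nm e.1 ^ 2) - x * ((mu e.1 : ℂ) * (χ κ e.1 : ℂ) ^ 2 * (ρ / Nm e.1 ^ 2))‖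
      ≤ C * Nm κ ^ 4 * x ^ (1 / 2 + δ) * Nm e.1 ^ (-(1 + 2 * δ)) := by
    intro e
    have he := Nm_pos (primary_ne_zero e.2)
    have e3 : (mu e.1 : ℂ) * (χ κ e.1 : ℂ) ^ 2 * Sk χ κ (x / Nm e.1 ^ 2) - x * ((mu e.1 : ℂ) * (χ κ e.1 : ℂ) ^ 2 * (ρ / Nm e.1 ^ 2)) =
      (mu e.1 : ℂ) * (χ κ e.1 : ℂ) ^ 2 * (Sk χ κ (x / Nm e.1 ^ 2) - ((x / Nm e.1 ^ 2 : ℝ) : ℂ) * ρ) := by push_cast; ring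
    rw [e3, norm_mul]
    have e4 := h1 δ hδ.le hδ2 (x / Nm e.1 ^ 2) (by positivity)
    have e5 : (x / Nm e.1 ^ 2) ^ (1 / 2 + δ) = x ^ (1 / 2 + δ) * Nm e.1 ^ (-(1 + 2 * δ)) := by
      rw [Real.div_rpow hx.le (by positivity), ← Real.rpow_natCast, ← Real.rpow_mul he.le, Real.rpow_neg he.le, div_eq_mul_inv]
      congr 3
      push_cast; ring
    rw [e5] at e4
    calc _ ≤ 1 * (C * Nm κ ^ 4 * (x ^ (1 / 2 + δ) * Nm e.1 ^ (-(1 + 2 * δ)))) := by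
          gcongr
          exact hcoef e
      _ = _ := by ring
  refine (tsum_of_norm_bounded (hsum.hasSum.mul_left _) hb).trans ?_
  rw [← hS]
  have h9 : 0 ≤ Nm κ ^ 4 * x ^ (1 / 2 + δ) := by positivity
  linear_combination h9

lemma Ak_norm_le (hχ : IsQuadSym χ) : ∃ C : ℝ, 0 < C ∧ ∀ (κ : GI) (x : ℝ), 0 < x → ‖Ak χ κ x‖ ≤ C * x ^ 2 := by
  have hs : Summable (fun a : SqP => (Nm a.1 ^ 2)⁻¹) := by
    have h := (summable_Nm_pow (j := 2) le_rfl)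
    exact h.comp_injective (Subtype.val_injective (p := fun n : GI => IsPrimary n ∧ Squarefree n))
  refine ⟨∑' a : SqP, (Nm a.1 ^ 2)⁻¹ + 1, ?_, fun κ x hx => ?_⟩
  · have : 0 ≤ ∑' a : SqP, (Nm a.1 ^ 2)⁻¹ := tsum_nonneg (fun a => by positivity)
    linarith
  unfold Ak
  have := tsum_of_norm_bounded (hs.hasSum.mul_left (x ^ 2)) (f := fun a : SqP => (χ κ a.1 : ℂ) * (ind (Nm a.1) x : ℂ)) (fun a => by
    have ha := Nm_pos (primary_ne_zero a.2.1)
    rw [norm_mul, Complex.norm_real, Real.norm_eq_abs, abs_of_nonneg (ind_nonneg _ _)]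
    have h1 := chi_norm_le hχ a.2.1 κ
    have h2 : ind (Nm a.1) x ≤ x ^ 2 * (Nm a.1 ^ 2)⁻¹ := by
      unfold ind; split_ifs with h
      · rw [← div_eq_mul_inv, le_div_iff₀ (by positivity), one_mul]
        gcongr
      · positivity
    calc _ ≤ 1 * (x ^ 2 * (Nm a.1 ^ 2)⁻¹) := by
          gcongr
          exact ind_nonneg _ _
      _ = _ := one_mul _)
  refine this.trans ?_
  nlinarith [sq_nonneg x]

end GH

namespace GH
open MeasureTheory Set

variable {χ : GI → GI → ℤ}

lemma summable_Nm_pow_sqp {j : ℕ} (hj : 2 ≤ j) : Summable fun a : SqP => (Nm a.1 ^ j)⁻¹ := by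
  have h := summable_Nm_pow hj
  exact h.comp_injective (i := fun a : SqP => a.1) (fun a b hab => Subtype.ext hab)

lemma sq_int {s : ℝ} (hs : 0 < s) : s ^ 2 * ((1 + s) ^ 4)⁻¹ ≤ (1 + s ^ 2)⁻¹ := by
  rw [← div_eq_mul_inv, div_le_iff₀ (by positivity), inv_mul_eq_div, le_div_iff₀ (by positivity)]
  nlinarith [pow_pos hs 2, pow_pos hs 3]

lemma pow_int {s δ : ℝ} (hs : 0 < s) (hδ : 0 < δ) (hδ' : δ ≤ 1 / 2) :
    s ^ (1 / 2 + δ) * ((1 + s) ^ 4)⁻¹ ≤ (1 + s ^ 2)⁻¹ := by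
  have h1 : s ^ (1 / 2 + δ) ≤ 1 + s := by
    rcases le_total s 1 with h | h
    · have := Real.rpow_le_one hs.le h (by linarith : 0 ≤ 1 / 2 + δ)
      linarith
    · have := Real.rpow_le_rpow_of_exponent_le h (by linarith : 1 / 2 + δ ≤ 1)
      rw [Real.rpow_one] at this
      linarith
  rw [← div_eq_mul_inv, div_le_iff₀ (by positivity), inv_mul_eq_div, le_div_iff₀ (by positivity)]
  calc s ^ (1 / 2 + δ) * (1 + s ^ 2) ≤ (1 + s) * (1 + s ^ 2) := by gcongr
    _ ≤ (1 + s) ^ 4 := by nlinarith [pow_pos hs 2, pow_pos hs 3, pow_pos hs 4]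

lemma int_cauchy : IntegrableOn (fun s : ℝ => (1 + s ^ 2)⁻¹) (Ioi 0) := integrable_inv_one_add_sq.integrableOn

lemma int_cauchy_le : ∫ s in Ioi (0 : ℝ), (1 + s ^ 2)⁻¹ ≤ π := by
  rw [← integral_univ_inv_one_add_sq]
  exact setIntegral_le_integral integrable_inv_one_add_sq (Eventually.of_forall fun s => by positivity)

lemma ind_le_sq {x y : ℝ} (hx : 0 < x) (hy : 0 < y) : ind x y ≤ (y / x) ^ 2 := by
  unfold ind
  split_ifs with h
  · exact one_le_pow₀ (by rwa [le_div_iff₀ hx, one_mul])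
  · positivity

lemma ind_meas (x X : ℝ) : Measurable fun s : ℝ => ind x (X * s) := by
  unfold ind
  exact Measurable.ite (measurableSet_le measurable_const (by fun_prop)) measurable_const measurable_const

/-- layer-cake formula -/
lemma layer {g g' : ℝ → ℝ} {M : ℝ}
    (hg : ∀ s, 0 < s → HasDerivAt g (g' s) s) (hc : ContinuousOn g' (Ioi 0))
    (hb : ∀ s, 0 < s → |g' s| ≤ M * ((1 + s) ^ 4)⁻¹) (h0 : Tendsto g atTop (𝓝 0))
    {x X : ℝ} (hx : 0 < x) (hX : 0 < X) :
    ∫ s in Ioi (0:ℝ), ind x (X * s) * g' s = - g (x / X) := by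
  have hxX : 0 < x / X := by positivity
  have hintg : IntegrableOn g' (Ioi (x / X)) := by
    have hM : 0 ≤ M := by
      have := (abs_nonneg _).trans (hb 1 one_pos)
      by_contra hneg
      push Not at hneg
      have : M * ((1 + (1:ℝ)) ^ 4)⁻¹ < 0 := mul_neg_of_neg_of_pos hneg (by positivity)
      linarith
    have h1 : IntegrableOn (fun s : ℝ => M * (1 + s ^ 2)⁻¹) (Ioi (x / X)) := (integrable_inv_one_add_sq.const_mul M).integrableOn
    refine Integrable.mono' h1 ((hc.mono (Ioi_subset_Ioi hxX.le)).aestronglyMeasurable measurableSet_Ioi) ?_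
    filter_upwards [ae_restrict_mem measurableSet_Ioi] with s hs
    have hs : 0 < s := hxX.trans hs
    rw [Real.norm_eq_abs]
    refine (hb s hs).trans (mul_le_mul_of_nonneg_left ?_ hM)
    apply inv_anti₀ (by positivity)
    nlinarith [pow_pos hs 2, pow_pos hs 3, pow_pos hs 4]
  have h2 := integral_Ioi_of_hasDerivAt_of_tendsto (hg _ hxX).continuousAt.continuousWithinAt
    (fun s hs => hg s (hxX.trans hs)) hintg h0
  rw [zero_sub] at h2
  rw [← h2, ← integral_indicator measurableSet_Ioi, ← integral_indicator measurableSet_Ioi]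
  apply integral_congr_ae
  have : ∀ᵐ s : ℝ, s ≠ x / X := by
    simp [ae_iff]
  filter_upwards [this] with s hs
  by_cases h : x / X < s
  · have h0s : 0 < s := hxX.trans h
    rw [indicator_of_mem (by exact h0s), indicator_of_mem (by exact h)]
    have : x ≤ X * s := by rw [div_lt_iff₀ hX] at h; linarith
    simp [ind, this]
  · have h' : s < x / X := lt_of_le_of_ne (not_lt.mp h) hs
    rw [indicator_of_notMem (s := Ioi (x / X)) (by simpa using h)]
    by_cases h0s : 0 < s
    · rw [indicator_of_mem (by exact h0s)]
      have : ¬ x ≤ X * s := by rw [lt_div_iff₀ hX] at h'; linarith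
      simp [ind, this]
    · rw [indicator_of_notMem (by simpa using h0s)]

theorem abel (hχ : IsQuadSym χ) {g g' : ℝ → ℝ} {M : ℝ} (hM : 0 ≤ M)
    (hg : ∀ s, 0 < s → HasDerivAt g (g' s) s) (hc : ContinuousOn g' (Ioi 0))
    (hb : ∀ s, 0 < s → |g' s| ≤ M * ((1 + s) ^ 4)⁻¹) (h0 : Tendsto g atTop (𝓝 0))
    (κ : GI) {X : ℝ} (hX : 0 < X) :
    (∑' a : SqP, (χ κ a.1 : ℂ) * (g (Nm a.1 / X) : ℂ)) = - ∫ s in Ioi (0:ℝ), (g' s : ℂ) * Ak χ κ (X * s) := by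
  have hN : ∀ a : SqP, 0 < Nm a.1 := fun a => Nm_pos (primary_ne_zero a.2.1)
  let F : SqP → ℝ → ℂ := fun a s => (χ κ a.1 : ℂ) * ((ind (Nm a.1) (X * s) * g' s : ℝ) : ℂ)
  have hbd : ∀ a : SqP, ∀ s, 0 < s → ‖F a s‖ ≤ M * X ^ 2 * (Nm a.1 ^ 2)⁻¹ * (1 + s ^ 2)⁻¹ := by
    intro a s hs
    have h1 : ind (Nm a.1) (X * s) ≤ (X * s / Nm a.1) ^ 2 := ind_le_sq (hN a) (by positivity)
    have hNa := hN a
    simp only [F]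
    rw [norm_mul, Complex.norm_real, Real.norm_eq_abs, abs_mul, abs_of_nonneg (ind_nonneg _ _)]
    calc ‖(χ κ a.1 : ℂ)‖ * (ind (Nm a.1) (X * s) * |g' s|)
        ≤ 1 * ((X * s / Nm a.1) ^ 2 * (M * ((1 + s) ^ 4)⁻¹)) := by
          gcongr
          · exact mul_nonneg (ind_nonneg _ _) (abs_nonneg _)
          · exact chi_norm_le hχ a.2.1 κ
          · exact hb s hs
      _ = M * X ^ 2 * (Nm a.1 ^ 2)⁻¹ * (s ^ 2 * ((1 + s) ^ 4)⁻¹) := by field_simp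
      _ ≤ _ := by gcongr; exact sq_int hs
  have hmeas : ∀ a, AEStronglyMeasurable (F a) (volume.restrict (Ioi 0)) := by
    intro a
    refine AEStronglyMeasurable.const_mul ?_ _
    refine Complex.continuous_ofReal.comp_aestronglyMeasurable ?_
    exact (ind_meas _ _).aestronglyMeasurable.mul (hc.aestronglyMeasurable measurableSet_Ioi)
  have hintg : ∀ a, Integrable (F a) (volume.restrict (Ioi 0)) := by
    intro a
    refine Integrable.mono' (int_cauchy.const_mul (M * X ^ 2 * (Nm a.1 ^ 2)⁻¹)) (hmeas a) ?_
    filter_upwards [ae_restrict_mem measurableSet_Ioi] with s hs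
    exact hbd a s hs
  have hsum : Summable fun a => ∫ s in Ioi (0:ℝ), ‖F a s‖ := by
    refine Summable.of_norm_bounded ((summable_Nm_pow_sqp (j := 2) le_rfl).mul_left (M * X ^ 2 * π)) ?_
    intro a
    rw [Real.norm_eq_abs, abs_of_nonneg (integral_nonneg fun s => norm_nonneg _)]
    calc ∫ s in Ioi (0:ℝ), ‖F a s‖ ≤ ∫ s in Ioi (0:ℝ), M * X ^ 2 * (Nm a.1 ^ 2)⁻¹ * (1 + s ^ 2)⁻¹ :=
          setIntegral_mono_on (hintg a).norm (int_cauchy.const_mul _) measurableSet_Ioi (fun s hs => hbd a s hs)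
      _ = M * X ^ 2 * (Nm a.1 ^ 2)⁻¹ * ∫ s in Ioi (0:ℝ), (1 + s ^ 2)⁻¹ := by rw [integral_const_mul]
      _ ≤ M * X ^ 2 * (Nm a.1 ^ 2)⁻¹ * π := by
          have := hN a
          gcongr
          exact int_cauchy_le
      _ = _ := by ring
  have h := hasSum_integral_of_summable_integral_norm hintg hsum
  have h1 : ∀ a, ∫ s in Ioi (0:ℝ), F a s = - ((χ κ a.1 : ℂ) * (g (Nm a.1 / X) : ℂ)) := by
    intro a
    simp only [F]
    rw [integral_const_mul, integral_complex_ofReal, layer hg hc hb h0 (hN a) hX]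
    push_cast; ring
  have h2 : ∫ s in Ioi (0:ℝ), ∑' a, F a s = ∫ s in Ioi (0:ℝ), (g' s : ℂ) * Ak χ κ (X * s) := by
    congr 1
    ext s
    unfold Ak
    rw [← tsum_mul_left]
    congr 1
    ext a
    simp only [F]
    push_cast; ring
  rw [h2] at h
  simp only [h1] at h
  rw [← h.tsum_eq, tsum_neg, neg_neg]

lemma Ak_meas (hχ : IsQuadSym χ) (κ : GI) (X : ℝ) : Measurable fun s : ℝ => Ak χ κ (X * s) := by
  have hs : ∀ s : ℝ, Summable fun a : SqP => (χ κ a.1 : ℂ) * (ind (Nm a.1) (X * s) : ℂ) := by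
    intro s
    refine Summable.of_norm_bounded ((summable_Nm_pow_sqp (j := 2) le_rfl).mul_left ((X * s) ^ 2)) ?_
    intro a
    have hN := Nm_pos (primary_ne_zero a.2.1)
    rw [norm_mul, Complex.norm_real, Real.norm_eq_abs, abs_of_nonneg (ind_nonneg _ _)]
    calc _ ≤ 1 * (X * s / Nm a.1) ^ 2 := by
          gcongr
          · exact ind_nonneg _ _
          · exact chi_norm_le hχ a.2.1 κ
          · by_cases h : 0 < X * s
            · exact ind_le_sq hN h
            · rw [ind_zero (by linarith)]; positivity
      _ = _ := by rw [div_pow]; ring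
  refine measurable_of_tendsto_metrizable' (u := atTop) (f := fun (t : Finset SqP) s => ∑ a ∈ t, (χ κ a.1 : ℂ) * (ind (Nm a.1) (X * s) : ℂ)) ?_ ?_
  · intro t
    refine Finset.measurable_fun_sum _ fun a _ => ?_
    exact (Complex.measurable_ofReal.comp (ind_meas _ _)).const_mul _
  · rw [tendsto_pi_nhds]
    intro s
    exact (hs s).hasSum

theorem T_asymp (hχ : IsQuadSym χ) {δ : ℝ} (hδ : 0 < δ) (hδ' : δ ≤ 1 / 2) : ∃ C : ℝ, 0 < C ∧
    ∀ κ : GI, κ ≠ 0 → ∀ (g g' : ℝ → ℝ) (M : ℝ), 0 ≤ M →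
    (∀ s, 0 < s → HasDerivAt g (g' s) s) → (ContinuousOn g' (Ioi 0)) →
    (∀ s, 0 < s → |g' s| ≤ M * ((1 + s) ^ 4)⁻¹) → (Tendsto g atTop (𝓝 0)) → ∃ γ : ℂ, ∀ X : ℝ, 0 < X →
    ‖(∑' a : SqP, (χ κ a.1 : ℂ) * (g (Nm a.1 / X) : ℂ)) / X - γ‖ ≤ C * M * Nm κ ^ 4 * X ^ (-(1 / 2) + δ) := by
  obtain ⟨C, hC, H⟩ := Ak_asymp hχ hδ hδ'
  obtain ⟨C2, hC2, H2⟩ := Ak_norm_le hχ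
  refine ⟨C * π, by positivity, ?_⟩
  intro κ hκ g g' M hM hg hc hb h0
  obtain ⟨ρ, hρ⟩ := H κ hκ
  have hNκ : 0 < Nm κ := Nm_pos hκ
  refine ⟨-∫ s in Ioi (0:ℝ), (g' s : ℂ) * (s * ρ), ?_⟩
  intro X hX
  rw [abel hχ hM hg hc hb h0 κ hX]
  have hgm : AEStronglyMeasurable (fun s => (g' s : ℂ)) (volume.restrict (Ioi 0)) :=
    Complex.continuous_ofReal.comp_aestronglyMeasurable (hc.aestronglyMeasurable measurableSet_Ioi)
  have i1 : Integrable (fun s => (g' s : ℂ) * Ak χ κ (X * s)) (volume.restrict (Ioi 0)) := by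
    refine Integrable.mono' (int_cauchy.const_mul (M * C2 * X ^ 2))
      (hgm.mul (Ak_meas hχ κ X).aestronglyMeasurable) ?_
    filter_upwards [ae_restrict_mem measurableSet_Ioi] with s hs
    have hs : 0 < s := hs
    rw [norm_mul, Complex.norm_real, Real.norm_eq_abs]
    calc |g' s| * ‖Ak χ κ (X * s)‖ ≤ (M * ((1 + s) ^ 4)⁻¹) * (C2 * (X * s) ^ 2) := by
          gcongr
          · exact hb s hs
          · exact H2 κ _ (by positivity)
      _ = M * C2 * X ^ 2 * (s ^ 2 * ((1 + s) ^ 4)⁻¹) := by ring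
      _ ≤ _ := by gcongr; exact sq_int hs
  have hdiff : ∀ s, 0 < s → ‖(g' s : ℂ) * Ak χ κ (X * s) - X * ((g' s : ℂ) * (s * ρ))‖ ≤
      C * M * Nm κ ^ 4 * X ^ (1 / 2 + δ) * (1 + s ^ 2)⁻¹ := by
    intro s hs
    have e : (g' s : ℂ) * Ak χ κ (X * s) - X * ((g' s : ℂ) * (s * ρ)) =
      (g' s : ℂ) * (Ak χ κ (X * s) - ((X * s : ℝ) : ℂ) * ρ) := by push_cast; ring
    rw [e, norm_mul, Complex.norm_real, Real.norm_eq_abs]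
    calc |g' s| * ‖Ak χ κ (X * s) - ((X * s : ℝ) : ℂ) * ρ‖
        ≤ (M * ((1 + s) ^ 4)⁻¹) * (C * Nm κ ^ 4 * (X * s) ^ (1 / 2 + δ)) := by
          gcongr
          · exact hb s hs
          · exact hρ _ (by positivity)
      _ = C * M * Nm κ ^ 4 * X ^ (1 / 2 + δ) * (s ^ (1 / 2 + δ) * ((1 + s) ^ 4)⁻¹) := by
          rw [Real.mul_rpow hX.le hs.le]; ring
      _ ≤ _ := by
          have := Real.rpow_nonneg hX.le (1 / 2 + δ)
          gcongr
          exact pow_int hs hδ hδ'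
  have i3 : Integrable (fun s => (g' s : ℂ) * Ak χ κ (X * s) - X * ((g' s : ℂ) * (s * ρ))) (volume.restrict (Ioi 0)) := by
    refine Integrable.mono' (int_cauchy.const_mul _) ?_ ((ae_restrict_mem measurableSet_Ioi).mono fun s hs => hdiff s hs)
    exact i1.aestronglyMeasurable.sub ((hgm.mul (by fun_prop)).const_mul _)
  have i2 : Integrable (fun s => (X : ℂ) * ((g' s : ℂ) * (s * ρ))) (volume.restrict (Ioi 0)) := by
    have := i1.sub i3
    refine this.congr (Eventually.of_forall fun s => ?_)
    simp
  have hXc : (X : ℂ) ≠ 0 := by exact_mod_cast hX.ne'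
  have e : (-∫ s in Ioi (0:ℝ), (g' s : ℂ) * Ak χ κ (X * s)) / X - (-∫ s in Ioi (0:ℝ), (g' s : ℂ) * (s * ρ)) =
      -((X : ℂ)⁻¹) * ∫ s in Ioi (0:ℝ), ((g' s : ℂ) * Ak χ κ (X * s) - X * ((g' s : ℂ) * (s * ρ))) := by
    rw [integral_sub i1 i2, integral_const_mul]
    generalize (∫ s in Ioi (0:ℝ), (g' s : ℂ) * Ak χ κ (X * s)) = I1
    generalize (∫ s in Ioi (0:ℝ), (g' s : ℂ) * (s * ρ)) = I2
    field_simp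
    ring
  rw [e, norm_mul, norm_neg, norm_inv, Complex.norm_real, Real.norm_eq_abs, abs_of_pos hX]
  have h5 := norm_integral_le_of_norm_le (int_cauchy.const_mul (C * M * Nm κ ^ 4 * X ^ (1 / 2 + δ)))
    ((ae_restrict_mem measurableSet_Ioi).mono fun s hs => hdiff s hs)
  rw [integral_const_mul] at h5
  have hp := Real.rpow_nonneg hX.le (1 / 2 + δ)
  have h6 : C * M * Nm κ ^ 4 * X ^ (1 / 2 + δ) * ∫ s in Ioi (0:ℝ), (1 + s ^ 2)⁻¹ ≤
    C * M * Nm κ ^ 4 * X ^ (1 / 2 + δ) * π := mul_le_mul_of_nonneg_left int_cauchy_le (by positivity)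
  have h7 : X ^ (-(1 / 2) + δ) = X⁻¹ * X ^ (1 / 2 + δ) := by
    rw [← Real.rpow_neg_one, ← Real.rpow_add hX]; congr 1; ring
  rw [h7]
  calc X⁻¹ * _ ≤ X⁻¹ * (C * M * Nm κ ^ 4 * X ^ (1 / 2 + δ) * π) := by
        have := h5.trans h6
        gcongr
    _ = _ := by ring

end GH

namespace GH
open MeasureTheory Set

variable {χ : GI → GI → ℤ}

/-- the derivative of `Ef` -/
def Ef' (x : ℝ) : ℝ := -(π ^ 2 / 8) * Real.exp (-(π ^ 2 / 8 * x)) + (π ^ 2 / 32) * Real.exp (-(π ^ 2 / 32 * x))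

lemma Ef_deriv (x : ℝ) : HasDerivAt Ef (Ef' x) x := by
  have h : ∀ b : ℝ, HasDerivAt (fun x : ℝ => Real.exp (-(b * x))) (Real.exp (-(b * x)) * (-(b * 1))) x := by
    intro b
    exact (((hasDerivAt_id x).const_mul b).neg).exp
  have := (h (π ^ 2 / 8)).sub (h (π ^ 2 / 32))
  refine this.congr_deriv ?_
  unfold Ef'
  ring

lemma Ef'_le (A : ℕ) {x : ℝ} (hx : 0 < x) : |Ef' x| ≤ 2 * (4 ^ A * A.factorial * (x ^ A)⁻¹) := by
  have h8 := eight_le_pi_sq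
  have h16 : π ^ 2 ≤ 10 := by nlinarith [Real.pi_lt_d2, Real.pi_pos]
  have h1 : Real.exp (-(π ^ 2 / 8 * x)) ≤ Real.exp (-(x / 4)) := Real.exp_le_exp.mpr (by nlinarith)
  have h2 : Real.exp (-(π ^ 2 / 32 * x)) ≤ Real.exp (-(x / 4)) := Real.exp_le_exp.mpr (by nlinarith)
  have h3 := Real.exp_pos (-(π ^ 2 / 8 * x))
  have h4 := Real.exp_pos (-(π ^ 2 / 32 * x))
  have h5 := exp_neg_le A (x := x / 4) (by positivity)
  have e : (A.factorial : ℝ) * ((x / 4) ^ A)⁻¹ = 4 ^ A * A.factorial * (x ^ A)⁻¹ := by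
    rw [div_pow, inv_div]; field_simp
  rw [← e]
  refine le_trans ?_ (mul_le_mul_of_nonneg_left h5 zero_le_two)
  unfold Ef'
  rw [abs_le]
  constructor <;> nlinarith [Real.exp_pos (-(x/4))]

/-- the test function -/
def Gc (w : SchwartzMap ℝ ℝ) (c τ : ℝ) : ℝ := w τ * (Real.sqrt τ)⁻¹ * Ef (c / τ)

/-- its derivative -/
def Gc' (w : SchwartzMap ℝ ℝ) (c τ : ℝ) : ℝ :=
  (deriv w τ * (Real.sqrt τ)⁻¹ + w τ * (-(1 / (2 * Real.sqrt τ)) / (Real.sqrt τ) ^ 2)) * Ef (c / τ)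
    + w τ * (Real.sqrt τ)⁻¹ * (Ef' (c / τ) * (-c / τ ^ 2))

lemma Gc_deriv (w : SchwartzMap ℝ ℝ) (c : ℝ) {τ : ℝ} (hτ : 0 < τ) : HasDerivAt (Gc w c) (Gc' w c τ) τ := by
  have h1 : HasDerivAt w (deriv w τ) τ := (w.differentiableAt (x := τ)).hasDerivAt
  have h2 : HasDerivAt (fun τ => (Real.sqrt τ)⁻¹) (-(1 / (2 * Real.sqrt τ)) / (Real.sqrt τ) ^ 2) τ :=
    (Real.hasDerivAt_sqrt hτ.ne').inv (Real.sqrt_pos.mpr hτ).ne'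
  have h3 : HasDerivAt (fun τ : ℝ => c / τ) (-c / τ ^ 2) τ := by
    have := (hasDerivAt_inv hτ.ne').const_mul c
    refine (this.congr_deriv ?_)
    ring
  exact (h1.mul h2).mul ((Ef_deriv _).comp τ h3)

lemma Gc'_cont (w : SchwartzMap ℝ ℝ) (c : ℝ) : ContinuousOn (Gc' w c) (Ioi 0) := by
  have hw : Continuous w := w.continuous
  have hw' : Continuous (deriv w) := by
    have : (deriv w : ℝ → ℝ) = SchwartzMap.derivCLM ℝ ℝ w := by
      ext t; simp [SchwartzMap.derivCLM_apply]
    rw [this]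
    exact SchwartzMap.continuous _
  have hE : Continuous Ef := by unfold Ef; fun_prop
  have hE' : Continuous Ef' := by unfold Ef'; fun_prop
  have hd : ContinuousOn (fun τ : ℝ => c / τ) (Ioi 0) :=
    continuousOn_const.div continuousOn_id (fun τ hτ => (ne_of_gt hτ))
  have hq : ContinuousOn (fun τ : ℝ => Real.sqrt τ) (Ioi 0) := Real.continuous_sqrt.continuousOn
  have hq0 : ∀ τ ∈ Ioi (0:ℝ), Real.sqrt τ ≠ 0 := fun τ hτ => (Real.sqrt_pos.mpr hτ).ne'
  have hEc : ContinuousOn (fun τ => Ef (c / τ)) (Ioi 0) := hE.comp_continuousOn hd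
  have hEc' : ContinuousOn (fun τ => Ef' (c / τ)) (Ioi 0) := hE'.comp_continuousOn hd
  unfold Gc'
  refine ContinuousOn.add (ContinuousOn.mul (ContinuousOn.add (hw'.continuousOn.mul (hq.inv₀ hq0))
    (hw.continuousOn.mul (ContinuousOn.div (ContinuousOn.neg (ContinuousOn.div continuousOn_const (hq.const_mul 2) ?_)) (hq.pow 2) ?_))) hEc)
    ((hw.continuousOn.mul (hq.inv₀ hq0)).mul (hEc'.mul (ContinuousOn.div continuousOn_const (continuousOn_id.pow 2) ?_)))
  · intro τ hτ; simpa using hq0 τ hτ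
  · intro τ hτ; simpa using hq0 τ hτ
  · intro τ hτ; simpa using (ne_of_gt hτ)

lemma sqrt_le_one_add {τ : ℝ} (hτ : 0 < τ) : Real.sqrt τ ≤ 1 + τ := by
  rw [Real.sqrt_le_left (by positivity)]; nlinarith

lemma Gc_bounds (w : SchwartzMap ℝ ℝ) : ∃ C : ℝ, 0 < C ∧ ∀ c τ : ℝ, 0 < c → 0 < τ →
    |Gc w c τ| ≤ C * (c ^ 6)⁻¹ * ((1 + τ) ^ 4)⁻¹ ∧ |Gc' w c τ| ≤ C * (c ^ 6)⁻¹ * ((1 + τ) ^ 4)⁻¹ := by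
  obtain ⟨C0, hC0, h0⟩ := schwartz_decay w 10
  obtain ⟨C1, hC1, h1⟩ := schwartz_decay (SchwartzMap.derivCLM ℝ ℝ w) 10
  let K : ℝ := 2 * (4 ^ 6 * Nat.factorial 6)
  let K' : ℝ := 2 * (4 ^ 7 * Nat.factorial 7)
  have hK : 0 < K := by positivity
  have hK' : 0 < K' := by positivity
  refine ⟨(C1 + C0) * K + C0 * K', by positivity, ?_⟩
  intro c τ hc hτ
  have hq := Real.sqrt_pos.mpr hτ
  have hq2 : Real.sqrt τ ^ 2 = τ := Real.sq_sqrt hτ.le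
  have hql := sqrt_le_one_add hτ
  have h0 := h0 τ
  have h1 := h1 τ
  rw [abs_of_pos hτ] at h0 h1
  rw [SchwartzMap.derivCLM_apply] at h1
  have hE : |Ef (c / τ)| ≤ K * ((c / τ) ^ 6)⁻¹ := by
    refine (Ef_le 6 (by positivity)).trans ?_
    simp only [K]
    have : 0 ≤ ((c / τ) ^ 6)⁻¹ := by positivity
    nlinarith
  have hE' : |Ef' (c / τ)| ≤ K' * ((c / τ) ^ 7)⁻¹ := by
    refine (Ef'_le 7 (by positivity)).trans (le_of_eq ?_)
    simp only [K']; ring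
  have p1 : (Real.sqrt τ)⁻¹ * τ ^ 6 ≤ (1 + τ) ^ 6 := by
    have : (Real.sqrt τ)⁻¹ * τ ^ 6 = Real.sqrt τ * τ ^ 5 := by
      field_simp; rw [hq2]
    rw [this]
    calc Real.sqrt τ * τ ^ 5 ≤ (1 + τ) * (1 + τ) ^ 5 := by gcongr; linarith
      _ = _ := by ring
  have p2 : (Real.sqrt τ)⁻¹ * τ ^ 5 ≤ (1 + τ) ^ 6 := by
    have : (Real.sqrt τ)⁻¹ * τ ^ 5 = Real.sqrt τ * τ ^ 4 := by
      field_simp; rw [hq2]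
    rw [this]
    calc Real.sqrt τ * τ ^ 4 ≤ (1 + τ) * (1 + τ) ^ 4 := by gcongr; linarith
      _ ≤ _ := by rw [← pow_succ']; exact pow_le_pow_right₀ (by linarith) (by norm_num)
  have wb : |w τ| * (1 + τ) ^ 6 ≤ C0 * ((1 + τ) ^ 4)⁻¹ := by
    rw [← div_eq_mul_inv, le_div_iff₀ (by positivity)]
    calc _ = |w τ| * (1 + τ) ^ 10 := by ring
      _ ≤ _ := h0
  have wb' : |deriv w τ| * (1 + τ) ^ 6 ≤ C1 * ((1 + τ) ^ 4)⁻¹ := by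
    rw [← div_eq_mul_inv, le_div_iff₀ (by positivity)]
    calc _ = |deriv w τ| * (1 + τ) ^ 10 := by ring
      _ ≤ _ := h1
  have hP : 0 ≤ ((1 + τ) ^ 4)⁻¹ := by positivity
  have hcc : 0 < (c ^ 6)⁻¹ := by positivity
  -- three generic estimates
  have b1 : |deriv w τ * (Real.sqrt τ)⁻¹ * Ef (c / τ)| ≤ C1 * K * (c ^ 6)⁻¹ * ((1 + τ) ^ 4)⁻¹ := by
    rw [abs_mul, abs_mul, abs_of_pos (inv_pos.mpr hq)]
    calc |deriv w τ| * (Real.sqrt τ)⁻¹ * |Ef (c / τ)| ≤ |deriv w τ| * (Real.sqrt τ)⁻¹ * (K * ((c / τ) ^ 6)⁻¹) := by gcongr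
      _ = K * (c ^ 6)⁻¹ * (|deriv w τ| * ((Real.sqrt τ)⁻¹ * τ ^ 6)) := by rw [div_pow, inv_div]; ring
      _ ≤ K * (c ^ 6)⁻¹ * (|deriv w τ| * (1 + τ) ^ 6) := by gcongr
      _ ≤ K * (c ^ 6)⁻¹ * (C1 * ((1 + τ) ^ 4)⁻¹) := by gcongr
      _ = _ := by ring
  have b0 : |w τ * (Real.sqrt τ)⁻¹ * Ef (c / τ)| ≤ C0 * K * (c ^ 6)⁻¹ * ((1 + τ) ^ 4)⁻¹ := by
    rw [abs_mul, abs_mul, abs_of_pos (inv_pos.mpr hq)]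
    calc |w τ| * (Real.sqrt τ)⁻¹ * |Ef (c / τ)| ≤ |w τ| * (Real.sqrt τ)⁻¹ * (K * ((c / τ) ^ 6)⁻¹) := by gcongr
      _ = K * (c ^ 6)⁻¹ * (|w τ| * ((Real.sqrt τ)⁻¹ * τ ^ 6)) := by rw [div_pow, inv_div]; ring
      _ ≤ K * (c ^ 6)⁻¹ * (|w τ| * (1 + τ) ^ 6) := by gcongr
      _ ≤ K * (c ^ 6)⁻¹ * (C0 * ((1 + τ) ^ 4)⁻¹) := by gcongr
      _ = _ := by ring
  have b2 : |w τ * (-(1 / (2 * Real.sqrt τ)) / (Real.sqrt τ) ^ 2) * Ef (c / τ)| ≤ C0 * K * (c ^ 6)⁻¹ * ((1 + τ) ^ 4)⁻¹ := by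
    have e : -(1 / (2 * Real.sqrt τ)) / (Real.sqrt τ) ^ 2 = -((1/2) * ((Real.sqrt τ)⁻¹ * τ⁻¹)) := by
      rw [hq2]; field_simp
    rw [e, abs_mul, abs_mul, abs_neg, abs_of_pos (by positivity : 0 < (1/2) * ((Real.sqrt τ)⁻¹ * τ⁻¹))]
    calc |w τ| * ((1/2) * ((Real.sqrt τ)⁻¹ * τ⁻¹)) * |Ef (c / τ)| ≤ |w τ| * (1 * ((Real.sqrt τ)⁻¹ * τ⁻¹)) * (K * ((c / τ) ^ 6)⁻¹) := by
          gcongr; norm_num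
      _ = K * (c ^ 6)⁻¹ * (|w τ| * ((Real.sqrt τ)⁻¹ * τ ^ 5)) := by rw [div_pow, inv_div]; field_simp
      _ ≤ K * (c ^ 6)⁻¹ * (|w τ| * (1 + τ) ^ 6) := by gcongr
      _ ≤ K * (c ^ 6)⁻¹ * (C0 * ((1 + τ) ^ 4)⁻¹) := by gcongr
      _ = _ := by ring
  have b3 : |w τ * (Real.sqrt τ)⁻¹ * (Ef' (c / τ) * (-c / τ ^ 2))| ≤ C0 * K' * (c ^ 6)⁻¹ * ((1 + τ) ^ 4)⁻¹ := by
    have e : -c / τ ^ 2 = -(c / τ ^ 2) := by ring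
    rw [e, abs_mul, abs_mul, abs_mul, abs_neg, abs_of_pos (inv_pos.mpr hq), abs_of_pos (by positivity : 0 < c / τ ^ 2)]
    calc |w τ| * (Real.sqrt τ)⁻¹ * (|Ef' (c / τ)| * (c / τ ^ 2)) ≤ |w τ| * (Real.sqrt τ)⁻¹ * ((K' * ((c / τ) ^ 7)⁻¹) * (c / τ ^ 2)) := by
          gcongr
      _ = K' * (c ^ 6)⁻¹ * (|w τ| * ((Real.sqrt τ)⁻¹ * τ ^ 5)) := by rw [div_pow, inv_div]; field_simp
      _ ≤ K' * (c ^ 6)⁻¹ * (|w τ| * (1 + τ) ^ 6) := by gcongr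
      _ ≤ K' * (c ^ 6)⁻¹ * (C0 * ((1 + τ) ^ 4)⁻¹) := by gcongr
      _ = _ := by ring
  have hQ : 0 ≤ (c ^ 6)⁻¹ * ((1 + τ) ^ 4)⁻¹ := by positivity
  have q1 : 0 ≤ C1 * K * ((c ^ 6)⁻¹ * ((1 + τ) ^ 4)⁻¹) := by positivity
  have q2 : 0 ≤ C0 * K' * ((c ^ 6)⁻¹ * ((1 + τ) ^ 4)⁻¹) := by positivity
  constructor
  · refine b0.trans ?_
    linarith
  · unfold Gc'
    rw [add_mul]
    refine (abs_add_le _ _).trans ?_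
    have := (abs_add_le (deriv w τ * (Real.sqrt τ)⁻¹ * Ef (c / τ)) (w τ * (-(1 / (2 * Real.sqrt τ)) / (Real.sqrt τ) ^ 2) * Ef (c / τ)))
    linarith

lemma Gc_tendsto (w : SchwartzMap ℝ ℝ) {c : ℝ} (hc : 0 < c) : Tendsto (Gc w c) atTop (𝓝 0) := by
  obtain ⟨C, hC, h⟩ := Gc_bounds w
  have h1 : Tendsto (fun τ : ℝ => C * (c ^ 6)⁻¹ * τ⁻¹) atTop (𝓝 0) := by
    simpa using tendsto_inv_atTop_zero.const_mul (C * (c ^ 6)⁻¹)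
  refine squeeze_zero_norm' ?_ h1
  filter_upwards [eventually_gt_atTop 0] with τ hτ
  rw [Real.norm_eq_abs]
  refine (h c τ hc hτ).1.trans ?_
  gcongr
  calc τ ≤ (1 + τ) ^ 1 := by linarith
    _ ≤ (1 + τ) ^ 4 := pow_le_pow_right₀ (by linarith) (by norm_num)

/-- `T_{κ,c}(X)` -/
def Tf (χ : GI → GI → ℤ) (w : SchwartzMap ℝ ℝ) (κ : GI) (c X : ℝ) : ℂ :=
  ∑' a : SqP, (χ κ a.1 : ℂ) * (Gc w c (Nm a.1 / X) : ℂ)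

theorem Tf_asymp (hχ : IsQuadSym χ) (w : SchwartzMap ℝ ℝ) {δ : ℝ} (hδ : 0 < δ) (hδ' : δ ≤ 1 / 2) : ∃ C : ℝ, 0 < C ∧
    ∀ κ : GI, κ ≠ 0 → ∀ c : ℝ, 0 < c → ∃ γ : ℂ, ∀ X : ℝ, 0 < X →
    ‖Tf χ w κ c X / X - γ‖ ≤ C * (c ^ 6)⁻¹ * Nm κ ^ 4 * X ^ (-(1 / 2) + δ) := by
  obtain ⟨C, hC, H⟩ := T_asymp hχ hδ hδ'
  obtain ⟨C2, hC2, h⟩ := Gc_bounds w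
  refine ⟨C * C2, by positivity, ?_⟩
  intro κ hκ c hc
  obtain ⟨γ, hγ⟩ := H κ hκ (Gc w c) (Gc' w c) (C2 * (c ^ 6)⁻¹) (by positivity) (fun s hs => Gc_deriv w c hs) (Gc'_cont w c)
    (fun s hs => (h c s hc hs).2) (Gc_tendsto w hc)
  refine ⟨γ, fun X hX => (hγ X hX).trans (le_of_eq (by ring))⟩

end GH

namespace GH
open MeasureTheory Set

variable {χ : GI → GI → ℤ}

/-- scale parameter -/
def cc (r : ℝ) (l d k : GI) : ℝ := Nm k * Nm l ^ 2 / (r * Nm d)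

/-- coefficient -/
def cf (r : ℝ) (l d k : GI) : ℂ := ((π / (8 * r) * (mu d / Nm d) * (Nm l)⁻¹ : ℝ) : ℂ) * psi k

/-- summand -/
def tt (χ : GI → GI → ℤ) (w : SchwartzMap ℝ ℝ) (X r : ℝ) (l : Prm) (k : GI) (a : SqP) : ℂ :=
  ∑ d ∈ pdiv l.1, cf r l.1 d.1 k * ((χ (ig * ωg * k * d.1) a.1 : ℂ) *
    (Gc w (cc r l.1 d.1 k) (Nm a.1 / (X / Nm l.1 ^ 2)) : ℂ)) / (X / Nm l.1 ^ 2 : ℝ)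

lemma cf_norm {r : ℝ} (hr : 0 < r) {l d : GI} (hl : IsPrimary l) (hd : IsPrimary d) (k : GI) :
    ‖cf r l d k‖ ≤ r⁻¹ * (Nm d)⁻¹ * (Nm l)⁻¹ := by
  have hNl := Nm_pos (primary_ne_zero hl)
  have hNd := Nm_pos (primary_ne_zero hd)
  unfold cf
  rw [norm_mul, norm_psi, mul_one, Complex.norm_real, Real.norm_eq_abs, abs_mul, abs_mul,
    abs_of_pos (inv_pos.mpr hNl), abs_of_pos (by positivity : 0 < π / (8 * r)), abs_div, abs_of_pos hNd]
  have h1 : |(mu d : ℝ)| ≤ 1 := by exact_mod_cast mu_abs d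
  have h2 : π / (8 * r) ≤ r⁻¹ := by
    rw [div_le_iff₀ (by positivity)]
    field_simp
    linarith [Real.pi_le_four]
  rw [div_eq_mul_inv (|(mu d : ℝ)|)]
  calc π / (8 * r) * (|(mu d : ℝ)| * (Nm d)⁻¹) * (Nm l)⁻¹ ≤ r⁻¹ * (1 * (Nm d)⁻¹) * (Nm l)⁻¹ := by gcongr
    _ = _ := by ring

lemma Gc_zero (w : SchwartzMap ℝ ℝ) (τ : ℝ) : Gc w 0 τ = 0 := by simp [Gc, Ef_zero]

lemma cc_zero (r : ℝ) (l d : GI) : cc r l d 0 = 0 := by simp [cc, Nm_zero]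

/-- summation over `k` -/
lemma tt_sum_k (hχ : IsQuadSym χ) (w : SchwartzMap ℝ ℝ) {X r : ℝ} (hX : 0 < X) (hr : 0 < r) (l : Prm) (a : SqP) :
    HasSum (fun k : GI => tt χ w X r l k a)
      (((X * Real.sqrt X)⁻¹ : ℝ) * (((w (Nm (a.1 * l.1 ^ 2) / X) : ℝ) : ℂ) * Df χ (a.1 * l.1 ^ 2) (r / X))) := by
  have hNl := Nm_pos (primary_ne_zero l.2)
  have hNa := Nm_pos (primary_ne_zero a.2.1)
  have hsX := Real.sqrt_pos.mpr hX
  have hsa := Real.sqrt_pos.mpr hNa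
  have hu : 0 < r / X := by positivity
  rw [D_eq hχ a.2.1 l.2 hu, Finset.mul_sum, Finset.mul_sum]
  unfold tt
  refine hasSum_sum (fun d _ => ?_)
  have hNd := Nm_pos (primary_ne_zero d.2)
  have hB := B_formula hχ a.2.1 a.2.2 (v := r / X * Nm d.1) (by positivity)
  have hB2 := (hB.mul_left ((mu d.1 : ℂ) * (χ d.1 a.1 : ℂ))).mul_left (((w (Nm (a.1 * l.1 ^ 2) / X) : ℝ) : ℂ))
  have hB3 := hB2.mul_left (((X * Real.sqrt X)⁻¹ : ℝ) : ℂ)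
  refine hB3.congr_fun (fun k => ?_)
  have e1 : Nm a.1 / (X / Nm l.1 ^ 2) = Nm (a.1 * l.1 ^ 2) / X := by
    rw [Nm_mul, Nm_pow]; field_simp
  have e2 : cc r l.1 d.1 k / (Nm (a.1 * l.1 ^ 2) / X) = Nm k / (r / X * Nm d.1 * Nm a.1) := by
    unfold cc; rw [Nm_mul, Nm_pow]; field_simp
  have e3 : Real.sqrt (Nm (a.1 * l.1 ^ 2) / X) = Real.sqrt (Nm a.1) * Nm l.1 / Real.sqrt X := by
    rw [Nm_mul, Nm_pow, Real.sqrt_div (by positivity), Real.sqrt_mul hNa.le, Real.sqrt_sq hNl.le]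
  rw [e1]
  unfold Gc cf
  rw [e2, e3, chi_mul hχ _ _ a.2.1]
  have c1 : (X : ℂ) ≠ 0 := by exact_mod_cast hX.ne'
  have c2 : (Nm l.1 : ℂ) ≠ 0 := by exact_mod_cast hNl.ne'
  have c3 : (Nm d.1 : ℂ) ≠ 0 := by exact_mod_cast hNd.ne'
  have c4 : (r : ℂ) ≠ 0 := by exact_mod_cast hr.ne'
  have c5 : (Real.sqrt X : ℂ) ≠ 0 := by exact_mod_cast hsX.ne'
  have c6 : (Real.sqrt (Nm a.1) : ℂ) ≠ 0 := by exact_mod_cast hsa.ne'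
  have c7 : (Real.sqrt X : ℂ) * (Real.sqrt X : ℂ) = X := by exact_mod_cast Real.mul_self_sqrt hX.le
  generalize Ef (Nm k / (r / X * Nm d.1 * Nm a.1)) = E
  generalize w (Nm (a.1 * l.1 ^ 2) / X) = W
  generalize psi k = P
  generalize χ (ig * ωg * k) a.1 = Q1
  generalize χ d.1 a.1 = Q2
  generalize mu d.1 = m
  push_cast
  generalize (Real.sqrt X : ℂ) = sX at *
  generalize (Real.sqrt (Nm a.1) : ℂ) = sa at *
  rw [← c7]
  rw [← c7] at c1
  field_simp

lemma tt_bound (hχ : IsQuadSym χ) (w : SchwartzMap ℝ ℝ) {X r : ℝ} (hX : 0 < X) (hr : 0 < r) : ∃ C : ℝ, 0 < C ∧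
    ∀ (l : Prm) (k : GI) (a : SqP), ‖tt χ w X r l k a‖ ≤ C * ((Nm l.1 ^ 2)⁻¹ * (Nm k ^ 2)⁻¹ * (Nm a.1 ^ 2)⁻¹) := by
  obtain ⟨C, hC, h⟩ := Gc_bounds w
  have hs := summable_Nm_pow_prm (j := 2) le_rfl
  set S := ∑' d : Prm, (Nm d.1 ^ 2)⁻¹ with hS
  have hS0 : 0 ≤ S := tsum_nonneg fun d => by have := Nm_nonneg d.1; positivity
  refine ⟨C * r ^ 5 * X * S + 1, by positivity, ?_⟩
  intro l k a
  have hl1 := one_le_Nm (primary_ne_zero l.2)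
  have ha1 := one_le_Nm (primary_ne_zero a.2.1)
  by_cases hk : k = 0
  · have : tt χ w X r l k a = 0 := by
      unfold tt
      apply Finset.sum_eq_zero
      intro d _
      rw [hk, cc_zero, Gc_zero]; simp
    rw [this, norm_zero]
    have := Nm_nonneg k
    positivity
  have hk1 := one_le_Nm hk
  have hterm : ∀ d ∈ pdiv l.1, ‖cf r l.1 d.1 k * ((χ (ig * ωg * k * d.1) a.1 : ℂ) *
    (Gc w (cc r l.1 d.1 k) (Nm a.1 / (X / Nm l.1 ^ 2)) : ℂ)) / (X / Nm l.1 ^ 2 : ℝ)‖ ≤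
      C * r ^ 5 * X * ((Nm l.1 ^ 2)⁻¹ * (Nm k ^ 2)⁻¹ * (Nm a.1 ^ 2)⁻¹) * (Nm d.1 ^ 2)⁻¹ := by
    intro d hd
    have hd1 := one_le_Nm (primary_ne_zero d.2)
    have hdl : Nm d.1 ≤ Nm l.1 := Nm_le_of_dvd (primary_ne_zero l.2) ((mem_pdiv (primary_ne_zero l.2) d).mp hd)
    have hcc : 0 < cc r l.1 d.1 k := by unfold cc; positivity
    have hτ : 0 < Nm a.1 / (X / Nm l.1 ^ 2) := by positivity
    have hG := (h _ _ hcc hτ).1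
    have hG2 : |Gc w (cc r l.1 d.1 k) (Nm a.1 / (X / Nm l.1 ^ 2))| ≤
        C * ((cc r l.1 d.1 k) ^ 6)⁻¹ * ((Nm a.1 / (X / Nm l.1 ^ 2)) ^ 2)⁻¹ := by
      refine hG.trans ?_
      gcongr
      calc (Nm a.1 / (X / Nm l.1 ^ 2)) ^ 2 ≤ (1 + Nm a.1 / (X / Nm l.1 ^ 2)) ^ 2 := by gcongr; linarith
        _ ≤ _ := pow_le_pow_right₀ (by linarith) (by norm_num)
    rw [norm_div, norm_mul, norm_mul, Complex.norm_real, Complex.norm_real, Real.norm_eq_abs, Real.norm_eq_abs,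
      abs_of_pos (by positivity : 0 < X / Nm l.1 ^ 2)]
    calc _ ≤ (r⁻¹ * (Nm d.1)⁻¹ * (Nm l.1)⁻¹) * (1 * (C * ((cc r l.1 d.1 k) ^ 6)⁻¹ * ((Nm a.1 / (X / Nm l.1 ^ 2)) ^ 2)⁻¹)) / (X / Nm l.1 ^ 2) := by
          gcongr
          · exact cf_norm hr l.2 d.2 k
          · exact chi_norm_le hχ a.2.1 _
      _ = C * r ^ 5 * X * (Nm d.1 ^ 5 * (Nm l.1 ^ 15)⁻¹ * (Nm k ^ 6)⁻¹ * (Nm a.1 ^ 2)⁻¹) := by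
          unfold cc; field_simp
      _ ≤ C * r ^ 5 * X * (((Nm l.1 ^ 2)⁻¹ * (Nm d.1 ^ 2)⁻¹) * (Nm k ^ 2)⁻¹ * (Nm a.1 ^ 2)⁻¹) := by
          gcongr ?_ * (?_ * ?_ * ?_)
          · rw [← mul_inv, ← div_eq_mul_inv, div_le_iff₀ (by positivity), inv_mul_eq_div, le_div_iff₀ (by positivity)]
            calc Nm d.1 ^ 5 * (Nm l.1 ^ 2 * Nm d.1 ^ 2) = Nm d.1 ^ 7 * Nm l.1 ^ 2 := by ring
              _ ≤ Nm l.1 ^ 7 * Nm l.1 ^ 2 := by gcongr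
              _ = Nm l.1 ^ 9 := by ring
              _ ≤ _ := pow_le_pow_right₀ hl1 (by norm_num)
          · gcongr
            norm_num
      _ = _ := by ring
  unfold tt
  refine (norm_sum_le_of_le _ hterm).trans ?_
  rw [← Finset.mul_sum]
  have h9 : ∑ d ∈ pdiv l.1, (Nm d.1 ^ 2)⁻¹ ≤ S := hs.sum_le_tsum _ (fun d _ => by have := Nm_nonneg d.1; positivity)
  calc _ ≤ C * r ^ 5 * X * ((Nm l.1 ^ 2)⁻¹ * (Nm k ^ 2)⁻¹ * (Nm a.1 ^ 2)⁻¹) * S := by gcongr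
    _ = C * r ^ 5 * X * S * ((Nm l.1 ^ 2)⁻¹ * (Nm k ^ 2)⁻¹ * (Nm a.1 ^ 2)⁻¹) := by ring
    _ ≤ _ := by gcongr; linarith

lemma tt_summable (hχ : IsQuadSym χ) (w : SchwartzMap ℝ ℝ) {X r : ℝ} (hX : 0 < X) (hr : 0 < r) :
    Summable fun p : (Prm × GI) × SqP => tt χ w X r p.1.1 p.1.2 p.2 := by
  obtain ⟨C, hC, h⟩ := tt_bound hχ w hX hr
  have h1 : Summable fun p : (Prm × GI) => (Nm p.1.1 ^ 2)⁻¹ * (Nm p.2 ^ 2)⁻¹ :=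
    (summable_Nm_pow_prm (j := 2) le_rfl).mul_of_nonneg (summable_Nm_pow (j := 2) le_rfl)
      (fun d => by have := Nm_nonneg d.1; positivity) (fun d => by have := Nm_nonneg d; positivity)
  have h2 : Summable fun p : (Prm × GI) × SqP => (Nm p.1.1.1 ^ 2)⁻¹ * (Nm p.1.2 ^ 2)⁻¹ * (Nm p.2.1 ^ 2)⁻¹ :=
    h1.mul_of_nonneg (summable_Nm_pow_sqp (j := 2) le_rfl)
      (fun d => by have := Nm_nonneg d.1.1; have := Nm_nonneg d.2; positivity) (fun d => by have := Nm_nonneg d.1; positivity)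
  exact Summable.of_norm_bounded (h2.mul_left C) (fun p => h p.1.1 p.1.2 p.2)

lemma Gc_summable (hχ : IsQuadSym χ) (w : SchwartzMap ℝ ℝ) {X r : ℝ} (hX : 0 < X) (hr : 0 < r) (l d : Prm) (k : GI) :
    Summable fun a : SqP => (χ (ig * ωg * k * d.1) a.1 : ℂ) *
        (Gc w (cc r l.1 d.1 k) (Nm a.1 / (X / Nm l.1 ^ 2)) : ℂ) := by
  obtain ⟨C, hC, h⟩ := Gc_bounds w
  have hl1 := one_le_Nm (primary_ne_zero l.2)
  have hd1 := one_le_Nm (primary_ne_zero d.2)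
  by_cases hk : k = 0
  · rw [hk, cc_zero]; simp only [Gc_zero, Complex.ofReal_zero, mul_zero]; exact summable_zero
  have hk1 := one_le_Nm hk
  have hcc : 0 < cc r l.1 d.1 k := by unfold cc; positivity
  refine Summable.of_norm_bounded ((summable_Nm_pow_sqp (j := 2) le_rfl).mul_left
    (C * ((cc r l.1 d.1 k) ^ 6)⁻¹ * (X / Nm l.1 ^ 2) ^ 2)) ?_
  intro a
  have ha1 := one_le_Nm (primary_ne_zero a.2.1)
  have hτ : 0 < Nm a.1 / (X / Nm l.1 ^ 2) := by positivity
  rw [norm_mul, Complex.norm_real, Real.norm_eq_abs]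
  have h2 : |Gc w (cc r l.1 d.1 k) (Nm a.1 / (X / Nm l.1 ^ 2))| ≤
      C * ((cc r l.1 d.1 k) ^ 6)⁻¹ * ((Nm a.1 / (X / Nm l.1 ^ 2)) ^ 2)⁻¹ := by
    refine (h _ _ hcc hτ).1.trans ?_
    gcongr
    calc (Nm a.1 / (X / Nm l.1 ^ 2)) ^ 2 ≤ (1 + Nm a.1 / (X / Nm l.1 ^ 2)) ^ 2 := by gcongr; linarith
      _ ≤ _ := pow_le_pow_right₀ (by linarith) (by norm_num)
  calc _ ≤ 1 * (C * ((cc r l.1 d.1 k) ^ 6)⁻¹ * ((Nm a.1 / (X / Nm l.1 ^ 2)) ^ 2)⁻¹) :=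
        mul_le_mul (chi_norm_le hχ a.2.1 _) h2 (abs_nonneg _) zero_le_one
    _ = _ := by rw [div_pow (Nm a.1), inv_div]; ring

/-- reordering of the index triple -/
def tripE : (SqP × Prm) × GI ≃ (Prm × GI) × SqP :=
    { toFun := fun p => ((p.1.2, p.2), p.1.1)
      invFun := fun p => ((p.2, p.1.1), p.1.2)
      left_inv := fun _ => rfl
      right_inv := fun _ => rfl }

lemma trip_sum (F : Prm → GI → SqP → ℂ) (h : Summable fun p : (Prm × GI) × SqP => F p.1.1 p.1.2 p.2) :
    Summable (fun p : (SqP × Prm) × GI => F p.1.2 p.2 p.1.1) ∧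
    (∑' p : (Prm × GI) × SqP, F p.1.1 p.1.2 p.2) = ∑' p : (SqP × Prm) × GI, F p.1.2 p.2 p.1.1 :=
  ⟨h.comp_injective tripE.injective, (tripE.tsum_eq (fun p : (Prm × GI) × SqP => F p.1.1 p.1.2 p.2)).symm⟩

lemma tt_total (hχ : IsQuadSym χ) (w : SchwartzMap ℝ ℝ) {X r : ℝ} (hX : 0 < X) (hr : 0 < r) :
    (∑' p : (Prm × GI) × SqP, tt χ w X r p.1.1 p.1.2 p.2) = ((X * Real.sqrt X)⁻¹ : ℝ) * Zf χ w X (r / X) := by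
  obtain ⟨hs', t1⟩ := trip_sum (tt χ w X r) (tt_summable hχ w hX hr)
  rw [t1, hs'.tsum_prod]
  unfold Zf
  rw [← tsum_mul_left, ← decompE.tsum_eq]
  refine tsum_congr (fun q => ?_)
  rw [(tt_sum_k hχ w hX hr q.2 q.1).tsum_eq, decompE_val]

lemma tt_sum_a (hχ : IsQuadSym χ) (w : SchwartzMap ℝ ℝ) {X r : ℝ} (hX : 0 < X) (hr : 0 < r) (l : Prm) (k : GI) :
    HasSum (fun a : SqP => tt χ w X r l k a) (∑ d ∈ pdiv l.1, cf r l.1 d.1 k *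
      (Tf χ w (ig * ωg * k * d.1) (cc r l.1 d.1 k) (X / Nm l.1 ^ 2) / (X / Nm l.1 ^ 2 : ℝ))) := by
  unfold tt
  refine hasSum_sum (fun d hd => ?_)
  have := ((Gc_summable hχ w hX hr l d k).hasSum.mul_left (cf r l.1 d.1 k)).div_const ((X / Nm l.1 ^ 2 : ℝ) : ℂ)
  unfold Tf
  rw [← mul_div_assoc]
  exact this

/-- the full expansion of `Z` -/
theorem Z_expand (hχ : IsQuadSym χ) (w : SchwartzMap ℝ ℝ) {X r : ℝ} (hX : 0 < X) (hr : 0 < r) :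
    HasSum (fun p : Prm × GI => ∑ d ∈ pdiv p.1.1, cf r p.1.1 d.1 p.2 *
      (Tf χ w (ig * ωg * p.2 * d.1) (cc r p.1.1 d.1 p.2) (X / Nm p.1.1 ^ 2) / (X / Nm p.1.1 ^ 2 : ℝ)))
      (((X * Real.sqrt X)⁻¹ : ℝ) * Zf χ w X (r / X)) := by
  rw [← tt_total hχ w hX hr]
  exact (tt_summable hχ w hX hr).hasSum.prod_fiberwise (fun p => tt_sum_a hχ w hX hr p.1 p.2)

end GH

namespace GH
open MeasureTheory Set

variable {χ : GI → GI → ℤ}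

lemma Tf_zero (w : SchwartzMap ℝ ℝ) (κ : GI) (X : ℝ) : Tf χ w κ 0 X = 0 := by
  unfold Tf; simp [Gc_zero]

lemma Nm_kappa (k d : GI) : Nm (ig * ωg * k * d) = 2 * Nm k * Nm d := by
  rw [Nm_mul, Nm_mul, Nm_mul]
  have h1 : Nm ig = 1 := by simp [Nm_eq, ig]
  have h2 : Nm ωg = 2 := by simp [Nm_eq, ωg]; norm_num
  rw [h1, h2]; ring

lemma kappa_ne {k d : GI} (hk : k ≠ 0) (hd : d ≠ 0) : ig * ωg * k * d ≠ 0 := by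
  have h := Nm_kappa k d
  intro h0
  rw [h0, Nm_zero] at h
  have := Nm_pos hk
  have := Nm_pos hd
  have : 0 < 2 * Nm k * Nm d := by positivity
  linarith

lemma dl_bound {d l : ℝ} (hd : 1 ≤ d) (hdl : d ≤ l) : d ^ 9 * (l ^ 12)⁻¹ ≤ l ^ (-(3 / 2) : ℝ) * d ^ (-(3 / 2) : ℝ) := by
  have hl : 0 < l := by linarith
  have hd0 : 0 < d := by linarith
  have h1 : d ^ 9 * (l ^ 12)⁻¹ ≤ (l ^ 3)⁻¹ := by
    rw [← div_eq_mul_inv, div_le_iff₀ (by positivity), inv_mul_eq_div, le_div_iff₀ (by positivity)]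
    calc d ^ 9 * l ^ 3 ≤ l ^ 9 * l ^ 3 := by gcongr
      _ = _ := by ring
  have h2 : (l ^ 3)⁻¹ = l ^ (-(3 / 2) : ℝ) * l ^ (-(3 / 2) : ℝ) := by
    rw [← Real.rpow_add hl, ← Real.rpow_natCast, ← Real.rpow_neg hl.le]; norm_num
  refine h1.trans ?_
  rw [h2]
  exact mul_le_mul_of_nonneg_left (Real.rpow_le_rpow_of_nonpos hd0 hdl (by norm_num)) (by positivity)

lemma II_arith {r l d k C P : ℝ} (hr : 0 < r) (hl : 0 < l) (hd : 0 < d) (hk : 0 < k) :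
    (r⁻¹ * d⁻¹ * l⁻¹) * (2 * ((C * ((k * l ^ 2 / (r * d)) ^ 6)⁻¹ * (2 * k * d) ^ 4) * (P * l))) =
      32 * C * r ^ 5 * P * (k ^ 2)⁻¹ * (d ^ 9 * (l ^ 12)⁻¹) := by
  field_simp
  ring

theorem II_bound (hχ : IsQuadSym χ) (w : SchwartzMap ℝ ℝ) {δ : ℝ} (hδ : 0 < δ) (hδ' : δ ≤ 1 / 2) : ∃ C : ℝ, 0 < C ∧
    ∀ r X X' : ℝ, 0 < r → 0 < X → X ≤ X' →
    ‖(((X * Real.sqrt X)⁻¹ : ℝ) : ℂ) * Zf χ w X (r / X) - (((X' * Real.sqrt X')⁻¹ : ℝ) : ℂ) * Zf χ w X' (r / X')‖ ≤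
      C * r ^ 5 * X ^ (-(1 / 2) + δ) := by
  obtain ⟨C, hC, H⟩ := Tf_asymp hχ w hδ hδ'
  have s1 := summable_Nm_prm (s := 3 / 2) (by norm_num)
  have s2 := summable_Nm_pow (j := 2) le_rfl
  set S := ∑' d : Prm, Nm d.1 ^ (-(3 / 2) : ℝ) with hS
  have hS0 : 0 ≤ S := tsum_nonneg fun d => Real.rpow_nonneg (Nm_nonneg d.1) _
  have s3 : Summable fun p : (Prm × GI) => Nm p.1.1 ^ (-(3 / 2) : ℝ) * (Nm p.2 ^ 2)⁻¹ :=
    s1.mul_of_nonneg s2 (fun d => Real.rpow_nonneg (Nm_nonneg d.1) _) (fun d => by have := Nm_nonneg d; positivity)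
  set S3 := ∑' p : (Prm × GI), Nm p.1.1 ^ (-(3 / 2) : ℝ) * (Nm p.2 ^ 2)⁻¹ with hS3
  have hS30 : 0 ≤ S3 := tsum_nonneg fun d => by
    have := Nm_nonneg d.2; have := Real.rpow_nonneg (Nm_nonneg d.1.1) (-(3 / 2)); positivity
  refine ⟨32 * C * S * S3 + 1, by positivity, ?_⟩
  intro r X X' hr hX hXX'
  have hX' : 0 < X' := by linarith
  have hXp := Real.rpow_pos_of_pos hX (-(1 / 2) + δ)
  have hmain := (Z_expand hχ w hX hr).sub (Z_expand hχ w hX' hr)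
  rw [← hmain.tsum_eq]
  have hb := tsum_of_norm_bounded (f := fun p : Prm × GI => (∑ d ∈ pdiv p.1.1, cf r p.1.1 d.1 p.2 *
      (Tf χ w (ig * ωg * p.2 * d.1) (cc r p.1.1 d.1 p.2) (X / Nm p.1.1 ^ 2) / (X / Nm p.1.1 ^ 2 : ℝ))) -
      ∑ d ∈ pdiv p.1.1, cf r p.1.1 d.1 p.2 *
      (Tf χ w (ig * ωg * p.2 * d.1) (cc r p.1.1 d.1 p.2) (X' / Nm p.1.1 ^ 2) / (X' / Nm p.1.1 ^ 2 : ℝ)))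
      (s3.hasSum.mul_left (32 * C * r ^ 5 * X ^ (-(1 / 2) + δ) * S)) ?_
  · refine hb.trans ?_
    rw [← hS3]
    calc 32 * C * r ^ 5 * X ^ (-(1 / 2) + δ) * S * S3 = (32 * C * S * S3) * r ^ 5 * X ^ (-(1 / 2) + δ) := by ring
      _ ≤ _ := by gcongr; linarith
  rintro ⟨l, k⟩
  have hl1 := one_le_Nm (primary_ne_zero l.2)
  have hlp := Real.rpow_pos_of_pos (by linarith : 0 < Nm l.1) (-(3 / 2))
  simp only
  rw [← Finset.sum_sub_distrib]
  by_cases hk : k = 0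
  · rw [Finset.sum_eq_zero]
    · rw [norm_zero]
      have := Nm_nonneg k
      positivity
    · intro d _
      rw [hk, cc_zero, Tf_zero, Tf_zero]; simp
  have hk1 := one_le_Nm hk
  have hterm : ∀ d ∈ pdiv l.1, ‖cf r l.1 d.1 k *
      (Tf χ w (ig * ωg * k * d.1) (cc r l.1 d.1 k) (X / Nm l.1 ^ 2) / (X / Nm l.1 ^ 2 : ℝ)) - cf r l.1 d.1 k *
      (Tf χ w (ig * ωg * k * d.1) (cc r l.1 d.1 k) (X' / Nm l.1 ^ 2) / (X' / Nm l.1 ^ 2 : ℝ))‖ ≤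
      32 * C * r ^ 5 * X ^ (-(1 / 2) + δ) * (Nm k ^ 2)⁻¹ * Nm l.1 ^ (-(3 / 2) : ℝ) * Nm d.1 ^ (-(3 / 2) : ℝ) := by
    intro d hd
    have hd1 := one_le_Nm (primary_ne_zero d.2)
    have hdl : Nm d.1 ≤ Nm l.1 := Nm_le_of_dvd (primary_ne_zero l.2) ((mem_pdiv (primary_ne_zero l.2) d).mp hd)
    have hcc : 0 < cc r l.1 d.1 k := by unfold cc; positivity
    obtain ⟨γ, hγ⟩ := H _ (kappa_ne hk (primary_ne_zero d.2)) _ hcc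
    have g1 := hγ (X / Nm l.1 ^ 2) (by positivity)
    have g2 := hγ (X' / Nm l.1 ^ 2) (by positivity)
    have hXl : (X / Nm l.1 ^ 2) ^ (-(1 / 2) + δ) ≤ X ^ (-(1 / 2) + δ) * Nm l.1 := by
      rw [Real.div_rpow hX.le (by positivity), div_eq_mul_inv, ← Real.rpow_neg (by positivity)]
      gcongr
      calc (Nm l.1 ^ 2) ^ (-(-(1 / 2) + δ)) ≤ (Nm l.1 ^ 2) ^ (1 / 2 : ℝ) := by
            apply Real.rpow_le_rpow_of_exponent_le (one_le_pow₀ hl1); linarith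
        _ = Nm l.1 := by rw [← Real.sqrt_eq_rpow, Real.sqrt_sq (by linarith)]
    have hXl' : (X' / Nm l.1 ^ 2) ^ (-(1 / 2) + δ) ≤ (X / Nm l.1 ^ 2) ^ (-(1 / 2) + δ) := by
      apply Real.rpow_le_rpow_of_nonpos (by positivity) (by gcongr) (by linarith)
    rw [Nm_kappa] at g1 g2
    set Y := C * (cc r l.1 d.1 k ^ 6)⁻¹ * (2 * Nm k * Nm d.1) ^ 4 with hY
    have hY0 : 0 ≤ Y := by positivity
    rw [← mul_sub, norm_mul]
    have hdist : ‖Tf χ w (ig * ωg * k * d.1) (cc r l.1 d.1 k) (X / Nm l.1 ^ 2) / (X / Nm l.1 ^ 2 : ℝ) -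
      Tf χ w (ig * ωg * k * d.1) (cc r l.1 d.1 k) (X' / Nm l.1 ^ 2) / (X' / Nm l.1 ^ 2 : ℝ)‖ ≤
        2 * (Y * (X ^ (-(1 / 2) + δ) * Nm l.1)) := by
      have e1 := mul_le_mul_of_nonneg_left hXl hY0
      have e2 := mul_le_mul_of_nonneg_left hXl' hY0
      have e3 := norm_sub_le_norm_sub_add_norm_sub
        (Tf χ w (ig * ωg * k * d.1) (cc r l.1 d.1 k) (X / Nm l.1 ^ 2) / (X / Nm l.1 ^ 2 : ℝ)) γ
        (Tf χ w (ig * ωg * k * d.1) (cc r l.1 d.1 k) (X' / Nm l.1 ^ 2) / (X' / Nm l.1 ^ 2 : ℝ))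
      rw [norm_sub_rev γ] at e3
      linarith
    have e5 := mul_le_mul (cf_norm hr l.2 d.2 k) hdist (norm_nonneg _) (by positivity)
    refine e5.trans ?_
    have e6 := II_arith (C := C) (P := X ^ (-(1 / 2) + δ)) hr (by linarith : 0 < Nm l.1) (by linarith : 0 < Nm d.1) (by linarith : 0 < Nm k)
    rw [hY, cc, e6]
    have e7 := mul_le_mul_of_nonneg_left (dl_bound hd1 hdl)
      (by positivity : 0 ≤ 32 * C * r ^ 5 * X ^ (-(1 / 2) + δ) * (Nm k ^ 2)⁻¹)
    rw [← mul_assoc (32 * C * r ^ 5 * X ^ (-(1 / 2) + δ) * (Nm k ^ 2)⁻¹) (Nm l.1 ^ (-(3 / 2) : ℝ))] at e7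
    exact e7
  refine (norm_sum_le_of_le _ hterm).trans ?_
  rw [← Finset.mul_sum]
  have h9 : ∑ d ∈ pdiv l.1, Nm d.1 ^ (-(3 / 2) : ℝ) ≤ S :=
    s1.sum_le_tsum _ (fun d _ => Real.rpow_nonneg (Nm_nonneg d.1) _)
  calc _ ≤ 32 * C * r ^ 5 * X ^ (-(1 / 2) + δ) * (Nm k ^ 2)⁻¹ * Nm l.1 ^ (-(3 / 2) : ℝ) * S := by gcongr
    _ = _ := by ring

end GH

namespace GH
open MeasureTheory Set

variable {χ : GI → GI → ℤ}

/-- the weighted moment -/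
def Sf (L : ℂ → GI → ℂ) (w : SchwartzMap ℝ ℝ) (X : ℝ) : ℂ :=
  ∑' n : Prm, L (1 / 2) (ωg ^ 2 * n.1) * ((w (Nm n.1 / X) : ℝ) : ℂ)

/-- integrand in `u` -/
def gu (χ : GI → GI → ℤ) (w : SchwartzMap ℝ ℝ) (X u : ℝ) : ℂ := ((u ^ (-(1 / 2) : ℝ) : ℝ) : ℂ) * Zf χ w X u

/-- integrand in `r` -/
def hr (χ : GI → GI → ℤ) (w : SchwartzMap ℝ ℝ) (X r : ℝ) : ℂ :=
  ((r ^ (-(1 / 2) : ℝ) : ℝ) : ℂ) * ((((X * Real.sqrt X)⁻¹ : ℝ) : ℂ) * Zf χ w X (r / X))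

lemma min_le_one' {u : ℝ} (hu : 0 < u) : min u (u ^ 2)⁻¹ ≤ 1 := by
  rcases le_total u 1 with h | h
  · exact (min_le_left _ _).trans h
  · exact (min_le_right _ _).trans (inv_le_one_of_one_le₀ (one_le_pow₀ h))

lemma Zf_contOn (hχ : IsQuadSym χ) (w : SchwartzMap ℝ ℝ) {X : ℝ} (hX : 0 < X) : ContinuousOn (Zf χ w X) (Ioi 0) := by
  obtain ⟨C, hC, h⟩ := D_bound hχ
  unfold Zf
  refine continuousOn_tsum (u := fun n : Prm => C * (Nm n.1 ^ 2 * |w (Nm n.1 / X)|)) ?_ ?_ ?_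
  · intro n
    exact continuousOn_const.mul (D_contOn hχ n.2)
  · exact (w_prm_summable w hX 2).mul_left C
  · intro n u hu
    rw [norm_mul, Complex.norm_real, Real.norm_eq_abs]
    have h1 := h n.1 n.2 u hu
    have h2 := mul_le_mul_of_nonneg_left (min_le_one' hu) (by positivity : 0 ≤ C * Nm n.1 ^ 2)
    have h3 : ‖Df χ n.1 u‖ ≤ C * Nm n.1 ^ 2 := by linarith
    calc |w (Nm n.1 / X)| * ‖Df χ n.1 u‖ ≤ |w (Nm n.1 / X)| * (C * Nm n.1 ^ 2) := by gcongr
      _ = _ := by ring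

lemma S_eq (hχ : IsQuadSym χ) {L : ℂ → GI → ℂ} (hL : IsHeckeL χ L) (w : SchwartzMap ℝ ℝ) {X : ℝ} (hX : 0 < X) :
    IntegrableOn (gu χ w X) (Ioi 0) ∧ -(Real.sqrt π : ℂ) * Sf L w X = ∫ u in Ioi (0:ℝ), gu χ w X u := by
  obtain ⟨C, hC, h⟩ := D_bound hχ
  have hw := w_prm_summable w hX 2
  let F : Prm → ℝ → ℂ := fun n u => ((w (Nm n.1 / X) : ℝ) : ℂ) * (((u ^ (-(1 / 2) : ℝ) : ℝ) : ℂ) * Df χ n.1 u)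
  have hb : ∀ n : Prm, ∀ u, 0 < u → ‖F n u‖ ≤ C * (Nm n.1 ^ 2 * |w (Nm n.1 / X)|) * kf u := by
    intro n u hu
    simp only [F]
    rw [norm_mul, Complex.norm_real, Real.norm_eq_abs]
    have := D_term_bound hu (h n.1 n.2 u hu)
    calc _ ≤ |w (Nm n.1 / X)| * (C * Nm n.1 ^ 2 * kf u) := by gcongr
      _ = _ := by ring
  have hintg : ∀ n, Integrable (F n) (volume.restrict (Ioi 0)) := fun n => (D_integrable hχ n.2).const_mul _
  have hsum : Summable fun n => ∫ u in Ioi (0:ℝ), ‖F n u‖ := by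
    refine Summable.of_norm_bounded ((hw.mul_left C).mul_right (∫ u in Ioi (0:ℝ), kf u)) ?_
    intro n
    rw [Real.norm_eq_abs, abs_of_nonneg (integral_nonneg fun s => norm_nonneg _), ← integral_const_mul]
    exact setIntegral_mono_on (hintg n).norm (kf_integrable.const_mul _) measurableSet_Ioi (fun s hs => hb n s hs)
  have hs := hasSum_integral_of_summable_integral_norm hintg hsum
  have e : ∀ u, ∑' n, F n u = gu χ w X u := by
    intro u
    unfold gu Zf
    rw [← tsum_mul_left]
    refine tsum_congr fun n => ?_
    simp only [F]; ring
  simp only [e] at hs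
  refine ⟨?_, ?_⟩
  · refine Integrable.mono' ((kf_integrable.const_mul (∑' n : Prm, C * (Nm n.1 ^ 2 * |w (Nm n.1 / X)|)))) ?_ ?_
    · apply AEStronglyMeasurable.mul
      · apply Measurable.aestronglyMeasurable
        fun_prop
      · exact (Zf_contOn hχ w hX).aestronglyMeasurable measurableSet_Ioi
    · filter_upwards [ae_restrict_mem measurableSet_Ioi] with u hu
      rw [← e u]
      exact tsum_of_norm_bounded ((hw.mul_left C).hasSum.mul_right _) (fun n => hb n u hu)
  · rw [← hs.tsum_eq]
    unfold Sf
    rw [← tsum_mul_left]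
    refine tsum_congr fun n => ?_
    simp only [F]
    rw [integral_const_mul, ← L_half hχ hL n.2]
    ring

lemma hr_eq (w : SchwartzMap ℝ ℝ) {X r : ℝ} (hX : 0 < X) (h0 : 0 < r) :
    hr χ w X r = (((X ^ 2)⁻¹ : ℝ) : ℂ) * gu χ w X (X⁻¹ * r) := by
  unfold hr gu
  have e : X⁻¹ * r = r / X := by ring
  rw [e]
  have e2 : (r / X) ^ (-(1 / 2) : ℝ) = r ^ (-(1 / 2) : ℝ) * Real.sqrt X := by
    rw [Real.div_rpow h0.le hX.le, Real.rpow_neg hX.le, div_inv_eq_mul, Real.sqrt_eq_rpow]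
  rw [e2, ← mul_assoc, ← mul_assoc, ← Complex.ofReal_mul, ← Complex.ofReal_mul]
  congr 2
  have h1 := Real.sqrt_pos.mpr hX
  have h2 := Real.mul_self_sqrt hX.le
  field_simp
  rw [sq, h2]

lemma I_eq (hχ : IsQuadSym χ) {L : ℂ → GI → ℂ} (hL : IsHeckeL χ L) (w : SchwartzMap ℝ ℝ) {X : ℝ} (hX : 0 < X) :
    IntegrableOn (hr χ w X) (Ioi 0) ∧ -(Real.sqrt π : ℂ) * (Sf L w X / X) = ∫ r in Ioi (0:ℝ), hr χ w X r := by
  obtain ⟨h1, h2⟩ := S_eq hχ hL w hX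
  have hXi : 0 < X⁻¹ := inv_pos.mpr hX
  constructor
  · have h3 : IntegrableOn (fun r => gu χ w X (X⁻¹ * r)) (Ioi 0) := by
      rw [integrableOn_Ioi_comp_mul_left_iff _ _ hXi, mul_zero]; exact h1
    have h4 : IntegrableOn (fun r => (((X ^ 2)⁻¹ : ℝ) : ℂ) * gu χ w X (X⁻¹ * r)) (Ioi 0) := h3.const_mul _
    exact h4.congr_fun (fun r hr0 => (hr_eq w hX hr0).symm) measurableSet_Ioi
  · rw [setIntegral_congr_fun measurableSet_Ioi (fun r hr0 => hr_eq w hX hr0), integral_const_mul,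
      integral_comp_mul_left_Ioi _ _ hXi, mul_zero, ← h2]
    have : (X : ℂ) ≠ 0 := by exact_mod_cast hX.ne'
    simp only [inv_inv, Complex.real_smul]
    push_cast
    field_simp

/-- heads -/
lemma head_bound (hχ : IsQuadSym χ) {L : ℂ → GI → ℂ} (hL : IsHeckeL χ L) (w : SchwartzMap ℝ ℝ) {δ : ℝ} (hδ : 0 < δ) (hδ' : δ ≤ 1 / 2) :
    ∃ C : ℝ, 0 < C ∧ ∀ ρ X X' : ℝ, 1 ≤ ρ → 0 < X → X ≤ X' →
    ‖(∫ r in Ioc 0 ρ, hr χ w X r) - ∫ r in Ioc 0 ρ, hr χ w X' r‖ ≤ C * ρ ^ 6 * X ^ (-(1 / 2) + δ) := by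
  obtain ⟨C, hC, h⟩ := II_bound hχ w hδ hδ'
  refine ⟨2 * C, by positivity, ?_⟩
  intro ρ X X' hρ hX hXX'
  have hX' : 0 < X' := by linarith
  have hp := Real.rpow_pos_of_pos hX (-(1 / 2) + δ)
  have hρ0 : 0 < ρ := by linarith
  have hi : IntegrableOn (fun r : ℝ => r ^ (-(1 / 2) : ℝ)) (Ioc 0 ρ) := by
    have := intervalIntegral.intervalIntegrable_rpow' (a := 0) (b := ρ) (r := -(1 / 2)) (by norm_num)
    rwa [intervalIntegrable_iff_integrableOn_Ioc_of_le hρ0.le] at this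
  rw [← integral_sub ((I_eq hχ hL w hX).1.mono_set Ioc_subset_Ioi_self) ((I_eq hχ hL w hX').1.mono_set Ioc_subset_Ioi_self)]
  have hb := norm_integral_le_of_norm_le (μ := volume.restrict (Ioc 0 ρ)) (f := fun r => hr χ w X r - hr χ w X' r)
    (hi.const_mul (C * ρ ^ 5 * X ^ (-(1 / 2) + δ))) ?_
  · refine hb.trans ?_
    rw [integral_const_mul, ← intervalIntegral.integral_of_le hρ0.le, integral_rpow (by left; norm_num)]
    have e : (-(1/2) : ℝ) + 1 = 1 / 2 := by norm_num
    rw [e, Real.zero_rpow (by norm_num), sub_zero]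
    have h2 : ρ ^ (1 / 2 : ℝ) ≤ ρ := by
      calc ρ ^ (1 / 2 : ℝ) ≤ ρ ^ (1 : ℝ) := Real.rpow_le_rpow_of_exponent_le hρ (by norm_num)
        _ = ρ := Real.rpow_one _
    calc C * ρ ^ 5 * X ^ (-(1 / 2) + δ) * (ρ ^ (1 / 2 : ℝ) / (1 / 2)) ≤ C * ρ ^ 5 * X ^ (-(1 / 2) + δ) * (ρ / (1 / 2)) := by gcongr
      _ = _ := by ring
  · filter_upwards [ae_restrict_mem measurableSet_Ioc] with r hr0
    have h0 : 0 < r := hr0.1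
    have := h r X X' h0 hX hXX'
    unfold hr
    rw [← mul_sub, norm_mul, Complex.norm_real, Real.norm_eq_abs, abs_of_nonneg (Real.rpow_nonneg h0.le _)]
    calc _ ≤ r ^ (-(1 / 2) : ℝ) * (C * r ^ 5 * X ^ (-(1 / 2) + δ)) := by gcongr
      _ ≤ r ^ (-(1 / 2) : ℝ) * (C * ρ ^ 5 * X ^ (-(1 / 2) + δ)) := by
          gcongr
          exact hr0.2
      _ = _ := by ring

/-- tails -/
lemma tail_bound (hχ : IsQuadSym χ) {L : ℂ → GI → ℂ} (hL : IsHeckeL χ L) (w : SchwartzMap ℝ ℝ) (A : ℕ) :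
    ∃ C : ℝ, 0 < C ∧ ∀ ρ τ X : ℝ, 1 ≤ ρ → 1 ≤ X → 1 ≤ τ →
    ‖(∫ r in Ioi ρ, hr χ w X r) - ∫ r in Ioi (τ * ρ), hr χ w (τ * X) r‖ ≤ C * X ^ 6 * (ρ ^ A)⁻¹ := by
  obtain ⟨C, hC, h⟩ := I_bound hχ w A
  refine ⟨C, by positivity, ?_⟩
  intro ρ τ X hρ hX hτ
  have hX0 : 0 < X := by linarith
  have hτ0 : 0 < τ := by linarith
  have hρ0 : 0 < ρ := by linarith
  have hτX : 0 < τ * X := by positivity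
  have e1 : ∫ r in Ioi (τ * ρ), hr χ w (τ * X) r = ∫ r in Ioi ρ, (τ : ℂ) * hr χ w (τ * X) (τ * r) := by
    rw [integral_const_mul, integral_comp_mul_left_Ioi _ _ hτ0]
    have : (τ : ℂ) ≠ 0 := by exact_mod_cast hτ0.ne'
    simp only [Complex.real_smul]
    push_cast
    field_simp
  have i1 : IntegrableOn (hr χ w X) (Ioi ρ) := (I_eq hχ hL w hX0).1.mono_set (Ioi_subset_Ioi hρ0.le)
  have i2 : IntegrableOn (fun r => (τ : ℂ) * hr χ w (τ * X) (τ * r)) (Ioi ρ) := by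
    have : IntegrableOn (fun r => hr χ w (τ * X) (τ * r)) (Ioi ρ) := by
      rw [integrableOn_Ioi_comp_mul_left_iff _ _ hτ0]
      exact (I_eq hχ hL w hτX).1.mono_set (Ioi_subset_Ioi (by positivity))
    exact this.const_mul _
  rw [e1, ← integral_sub i1 i2]
  have hi : IntegrableOn (fun r : ℝ => r ^ (-2 : ℝ)) (Ioi ρ) := integrableOn_Ioi_rpow_of_lt (by norm_num) hρ0
  have hb := norm_integral_le_of_norm_le (μ := volume.restrict (Ioi ρ)) (f := fun r => hr χ w X r - (τ : ℂ) * hr χ w (τ * X) (τ * r))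
    (hi.const_mul (C * X ^ 6 * (ρ ^ A)⁻¹)) ?_
  · refine hb.trans ?_
    rw [integral_const_mul, integral_Ioi_rpow_of_lt (by norm_num) hρ0]
    have : -ρ ^ (-2 + 1 : ℝ) / (-2 + 1) ≤ 1 := by
      have e : (-2 + 1 : ℝ) = -1 := by norm_num
      rw [e, Real.rpow_neg_one]
      have := inv_le_one_of_one_le₀ hρ
      linarith
    exact mul_le_of_le_one_right (by positivity) this
  · filter_upwards [ae_restrict_mem measurableSet_Ioi] with r hr0
    have hr1 : ρ < r := hr0
    have h0 : 0 < r := hρ0.trans hr1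
    have hb := h (r / X) X (τ * X) (by positivity) hX (by nlinarith)
    have e2 : r / X * X = r := by field_simp
    rw [e2] at hb
    have hsX := Real.sqrt_pos.mpr hX0
    have e3 : hr χ w X r - (τ : ℂ) * hr χ w (τ * X) (τ * r) =
        ((r ^ (-(1 / 2) : ℝ) * (Real.sqrt X)⁻¹ : ℝ) : ℂ) * (Zf χ w X (r / X) / X - Zf χ w (τ * X) (r / X) / ((τ * X : ℝ) : ℂ)) := by
      unfold hr
      have e4 : τ * r / (τ * X) = r / X := by field_simp
      have e5 : (τ * r) ^ (-(1 / 2) : ℝ) = (Real.sqrt τ)⁻¹ * r ^ (-(1 / 2) : ℝ) := by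
        rw [Real.mul_rpow hτ0.le h0.le, Real.rpow_neg hτ0.le, Real.sqrt_eq_rpow]
      rw [e4, e5, Real.sqrt_mul hτ0.le]
      have c1 : (X : ℂ) ≠ 0 := by exact_mod_cast hX0.ne'
      have c2 : (τ : ℂ) ≠ 0 := by exact_mod_cast hτ0.ne'
      have c3 : (Real.sqrt X : ℂ) ≠ 0 := by exact_mod_cast hsX.ne'
      have c4 : (Real.sqrt τ : ℂ) ≠ 0 := by exact_mod_cast (Real.sqrt_pos.mpr hτ0).ne'
      have c5 : (Real.sqrt τ : ℂ) * (Real.sqrt τ : ℂ) = τ := by exact_mod_cast Real.mul_self_sqrt hτ0.le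
      generalize Zf χ w X (r / X) = Z1
      generalize Zf χ w (τ * X) (r / X) = Z2
      generalize r ^ (-(1 / 2) : ℝ) = R
      push_cast
      generalize (Real.sqrt τ : ℂ) = s at *
      rw [← c5]
      field_simp
    rw [e3, norm_mul, Complex.norm_real, Real.norm_eq_abs, abs_of_nonneg (by positivity)]
    have hr1' : 1 ≤ r := by linarith
    have h5 : r ^ (-(1 / 2) : ℝ) * (Real.sqrt X)⁻¹ ≤ 1 := by
      have a1 : r ^ (-(1 / 2) : ℝ) ≤ 1 := Real.rpow_le_one_of_one_le_of_nonpos hr1' (by norm_num)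
      have a2 : (Real.sqrt X)⁻¹ ≤ 1 := inv_le_one_of_one_le₀ (Real.one_le_sqrt.mpr hX)
      calc _ ≤ 1 * (1:ℝ) := by gcongr
        _ = 1 := by norm_num
    have h6 : (r ^ (A + 5))⁻¹ ≤ (ρ ^ A)⁻¹ * r ^ (-2 : ℝ) := by
      rw [Real.rpow_neg h0.le, Real.rpow_ofNat, ← mul_inv]
      apply inv_anti₀ (by positivity)
      calc ρ ^ A * r ^ 2 ≤ r ^ A * r ^ 2 := by gcongr
        _ = r ^ (A + 2) := by ring
        _ ≤ _ := pow_le_pow_right₀ hr1' (by norm_num)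
    calc _ ≤ 1 * (C * X ^ 6 * (r ^ (A + 5))⁻¹) := by gcongr
      _ ≤ 1 * (C * X ^ 6 * ((ρ ^ A)⁻¹ * r ^ (-2 : ℝ))) := by gcongr
      _ = _ := by ring

end GH

namespace GH
open MeasureTheory Set
variable {χ : GI → GI → ℤ}

lemma geom_lim {K r : ℝ} (_hr0 : 0 < r) (hr1 : r < 1) (u : ℕ → ℂ) (h : ∀ n, ‖u (n + 1) - u n‖ ≤ K * r ^ n) :
    ∃ l : ℂ, Tendsto u atTop (𝓝 l) ∧ ‖u 0 - l‖ ≤ K / (1 - r) := by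
  have h' : ∀ n, dist (u n) (u (n + 1)) ≤ K * r ^ n := by
    intro n; rw [dist_comm, dist_eq_norm]; exact h n
  obtain ⟨l, hl⟩ := cauchySeq_tendsto_of_complete (cauchySeq_of_le_geometric r K hr1 h')
  refine ⟨l, hl, ?_⟩
  have := dist_le_of_le_geometric_of_tendsto₀ r K hr1 h' hl
  rwa [dist_eq_norm] at this

lemma exp_nat_shift (a x : ℝ) (n : ℕ) : Real.exp (-a * (x + n)) = Real.exp (-a * x) * Real.exp (-a) ^ n := by
  rw [← Real.exp_nat_mul, ← Real.exp_add]; congr 1; ring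

lemma bdd_arith {z : ℂ} {M : ℝ} (h : ∀ n : ℕ, (n : ℝ) * ‖z‖ ≤ M) : z = 0 := by
  by_contra hz
  have hz : 0 < ‖z‖ := norm_pos_iff.mpr hz
  obtain ⟨n, hn⟩ := exists_nat_gt (M / ‖z‖)
  rw [div_lt_iff₀ hz] at hn
  linarith [h n]

lemma lin_lemma (H : ℝ → ℂ) {a C B : ℝ} (ha : 0 < a) (hC : 0 ≤ C)
    (h : ∀ x s t : ℝ, 0 ≤ x → 0 ≤ s → s ≤ 1 → 0 ≤ t → t ≤ 1 →
      ‖H (x + s) - H x - H (x + s + t) + H (x + t)‖ ≤ C * Real.exp (-a * x))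
    (hB : ∀ x : ℝ, 0 ≤ x → x ≤ 1 → ‖H x‖ ≤ B) :
    ∃ c e : ℂ, ∃ C' : ℝ, ∀ x : ℝ, 0 ≤ x → ‖H x - c * x - e‖ ≤ C' * Real.exp (-a * x) := by
  have hr0 : 0 < Real.exp (-a) := Real.exp_pos _
  have hr1 : Real.exp (-a) < 1 := by rw [Real.exp_lt_one_iff]; linarith
  have hr2 : 0 < 1 - Real.exp (-a) := by linarith
  -- first differences
  have h1 : ∀ x : ℝ, 0 ≤ x → ∃ l : ℂ, Tendsto (fun n : ℕ => H (x + n + 1) - H (x + n)) atTop (𝓝 l) ∧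
      ‖H (x + 1) - H x - l‖ ≤ C * Real.exp (-a * x) / (1 - Real.exp (-a)) := by
    intro x hx
    obtain ⟨l, hl, hl2⟩ := geom_lim (K := C * Real.exp (-a * x)) hr0 hr1 (fun n : ℕ => H (x + n + 1) - H (x + n)) (by
      intro n
      have := h (x + n) 1 1 (by positivity) (by norm_num) le_rfl (by norm_num) le_rfl
      rw [exp_nat_shift, ← mul_assoc, ← norm_neg] at this
      refine le_trans (le_of_eq ?_) this
      congr 1
      push_cast
      rw [← add_assoc x]
      ring)
    refine ⟨l, hl, ?_⟩
    simpa using hl2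
  obtain ⟨c, hc, -⟩ := h1 0 le_rfl
  have hdecay : ∀ x : ℝ, Tendsto (fun n : ℕ => C * Real.exp (-a * (x + n))) atTop (𝓝 0) := by
    intro x
    have : Tendsto (fun n : ℕ => C * (Real.exp (-a * x) * Real.exp (-a) ^ n)) atTop (𝓝 (C * (Real.exp (-a * x) * 0))) :=
      ((tendsto_pow_atTop_nhds_zero_of_lt_one hr0.le hr1).const_mul _).const_mul _
    rw [mul_zero, mul_zero] at this
    refine this.congr (fun n => ?_)
    rw [exp_nat_shift]
  have hc1 : ∀ x : ℝ, 0 ≤ x → x ≤ 1 → Tendsto (fun n : ℕ => H (x + n + 1) - H (x + n)) atTop (𝓝 c) := by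
    intro x hx hx1
    have hd : Tendsto (fun n : ℕ => (H (0 + n + 1) - H (0 + n)) - (H (x + n + 1) - H (x + n))) atTop (𝓝 0) := by
      refine squeeze_zero_norm (fun n => ?_) (hdecay 0)
      have := h (0 + n) 1 x (by positivity) (by norm_num) le_rfl hx hx1
      refine le_trans (le_of_eq ?_) this
      congr 1
      rw [show (0 + n + 1 + x : ℝ) = x + n + 1 by ring, show (0 + n + x : ℝ) = x + n by ring]
      ring
    have := hc.sub hd
    rw [sub_zero] at this
    refine this.congr (fun n => ?_)
    ring
  have hc2 : ∀ x : ℝ, 0 ≤ x → Tendsto (fun n : ℕ => H (x + n + 1) - H (x + n)) atTop (𝓝 c) := by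
    intro x hx
    have hx0 := Nat.floor_le hx
    have hx1 := (Nat.lt_floor_add_one x).le
    have := hc1 (x - ⌊x⌋₊) (by linarith) (by linarith)
    have h2 := this.comp (tendsto_add_atTop_nat ⌊x⌋₊)
    refine h2.congr (fun n => ?_)
    simp only [Function.comp]
    push_cast
    rw [show (x - ⌊x⌋₊ + (n + ⌊x⌋₊) : ℝ) = x + n by ring]
  have h3 : ∀ x : ℝ, 0 ≤ x → ‖H (x + 1) - H x - c‖ ≤ C / (1 - Real.exp (-a)) * Real.exp (-a * x) := by
    intro x hx
    obtain ⟨l, hl, hl2⟩ := h1 x hx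
    rw [tendsto_nhds_unique hl (hc2 x hx)] at hl2
    refine hl2.trans (le_of_eq ?_)
    ring
  set C1 : ℝ := C / (1 - Real.exp (-a)) with hC1
  -- E
  set E : ℝ → ℂ := fun x => H x - c * x with hE
  have h4 : ∀ x : ℝ, 0 ≤ x → ∃ l : ℂ, Tendsto (fun n : ℕ => E (x + n)) atTop (𝓝 l) ∧
      ‖E x - l‖ ≤ C1 / (1 - Real.exp (-a)) * Real.exp (-a * x) := by
    intro x hx
    obtain ⟨l, hl, hl2⟩ := geom_lim (K := C1 * Real.exp (-a * x)) hr0 hr1 (fun n : ℕ => E (x + n)) (by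
      intro n
      have := h3 (x + n) (by positivity)
      rw [exp_nat_shift, ← mul_assoc] at this
      refine le_trans (le_of_eq ?_) this
      congr 1
      simp only [hE]
      push_cast
      rw [← add_assoc x]
      ring)
    refine ⟨l, hl, ?_⟩
    simp only [Nat.cast_zero, add_zero] at hl2
    refine hl2.trans (le_of_eq ?_)
    ring
  set C2 : ℝ := C1 / (1 - Real.exp (-a)) with hC2
  have hC2' : 0 ≤ C2 := by positivity
  choose! p hp hp2 using h4
  have hper : ∀ x : ℝ, 0 ≤ x → ∀ k : ℕ, p (x + k) = p x := by
    intro x hx k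
    refine tendsto_nhds_unique (hp (x + k) (by positivity)) ?_
    refine ((hp x hx).comp (tendsto_add_atTop_nat k)).congr (fun n => ?_)
    simp only [Function.comp]
    push_cast
    congr 1
    ring
  have hpb : ∀ x : ℝ, 0 ≤ x → ‖p x‖ ≤ B + ‖c‖ + C2 := by
    intro x hx
    have hx0 := Nat.floor_le hx
    have hx1 := (Nat.lt_floor_add_one x).le
    set y := x - ⌊x⌋₊ with hy
    have hy0 : 0 ≤ y := by linarith
    have hy1 : y ≤ 1 := by linarith
    have e1 := hper y hy0 ⌊x⌋₊
    rw [show y + ⌊x⌋₊ = x by rw [hy]; ring] at e1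
    rw [e1]
    have e2 := hp2 y hy0
    have e3 := hB y hy0 hy1
    have e4 : Real.exp (-a * y) ≤ 1 := by rw [Real.exp_le_one_iff]; nlinarith
    have e5 : p y = H y - c * y - (E y - p y) := by simp only [hE]; ring
    rw [e5]
    refine (norm_sub_le _ _).trans (add_le_add ((norm_sub_le _ _).trans (add_le_add e3 ?_)) (e2.trans ?_))
    · rw [norm_mul, Complex.norm_real, Real.norm_eq_abs, abs_of_nonneg hy0]
      exact mul_le_of_le_one_right (norm_nonneg _) hy1
    · exact mul_le_of_le_one_right hC2' e4
  have hsd : ∀ x s : ℝ, 0 ≤ x → 0 ≤ s → s ≤ 1 → p (x + s + s) - p (x + s) = p (x + s) - p x := by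
    intro x s hx hs hs1
    have t1 := (((hp (x + s) (by positivity)).sub (hp x hx)).sub (hp (x + s + s) (by positivity))).add (hp (x + s) (by positivity))
    have t2 : Tendsto (fun n : ℕ => E (x + s + n) - E (x + n) - E (x + s + s + n) + E (x + s + n)) atTop (𝓝 0) := by
      refine squeeze_zero_norm (fun n => ?_) (hdecay x)
      have := h (x + n) s s (by positivity) hs hs1 hs hs1
      refine le_trans (le_of_eq ?_) this
      congr 1
      simp only [hE]
      rw [show (x + s + n : ℝ) = x + n + s by ring, show (x + s + s + n : ℝ) = x + n + s + s by ring]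
      push_cast
      ring
    have := tendsto_nhds_unique t1 t2
    linear_combination -this
  have har : ∀ s : ℝ, 0 ≤ s → s ≤ 1 → ∀ n : ℕ, p (n * s + s) - p (n * s) = p s - p 0 ∧ p (n * s) = p 0 + n * (p s - p 0) := by
    intro s hs hs1 n
    induction n with
    | zero => simp
    | succ n ih =>
      have := hsd (n * s) s (by positivity) hs hs1
      push_cast
      rw [show ((n : ℝ) + 1) * s = n * s + s by ring]
      refine ⟨by rw [this, ih.1], ?_⟩
      linear_combination ih.1 + ih.2
  have hconst : ∀ s : ℝ, 0 ≤ s → s ≤ 1 → p s = p 0 := by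
    intro s hs hs1
    rw [← sub_eq_zero]
    refine bdd_arith (M := 2 * (B + ‖c‖ + C2)) (fun n => ?_)
    have e1 := (har s hs hs1 n).2
    have e2 : (n : ℂ) * (p s - p 0) = p (n * s) - p 0 := by rw [e1]; ring
    have e3 : (n : ℝ) * ‖p s - p 0‖ = ‖p (n * s) - p 0‖ := by rw [← e2, norm_mul, Complex.norm_natCast]
    rw [e3]
    refine (norm_sub_le _ _).trans ?_
    linarith [hpb (n * s) (by positivity), hpb 0 le_rfl]
  refine ⟨c, p 0, C2, fun x hx => ?_⟩
  have hx0 := Nat.floor_le hx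
  have hx1 := (Nat.lt_floor_add_one x).le
  have e1 := hper (x - ⌊x⌋₊) (by linarith) ⌊x⌋₊
  rw [hconst (x - ⌊x⌋₊) (by linarith) (by linarith), show x - ⌊x⌋₊ + ⌊x⌋₊ = x by ring] at e1
  rw [← e1]
  exact hp2 x hx

lemma lin_unique {c e : ℂ} {a K : ℝ} (ha : 0 < a) (h : ∀ x : ℝ, 0 ≤ x → ‖c * x + e‖ ≤ K * Real.exp (-a * x)) : c = 0 ∧ e = 0 := by
  have hK : 0 ≤ K := by
    have := h 0 le_rfl
    simp at this
    exact (norm_nonneg _).trans this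
  have hb : ∀ x : ℝ, 0 ≤ x → ‖c * x + e‖ ≤ K := fun x hx => by
    refine (h x hx).trans (mul_le_of_le_one_right hK ?_)
    rw [Real.exp_le_one_iff]; nlinarith
  have hc : c = 0 := by
    refine bdd_arith (M := K + ‖e‖) (fun n => ?_)
    have e1 := hb n (by positivity)
    have e2 : (n : ℝ) * ‖c‖ = ‖(c * ((n : ℝ) : ℂ) + e) - e‖ := by
      rw [add_sub_cancel_right, norm_mul]; simp [mul_comm]
    rw [e2]
    exact (norm_sub_le _ _).trans (by linarith)
  refine ⟨hc, ?_⟩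
  have t1 : Tendsto (fun n : ℕ => K * Real.exp (-a) ^ n) atTop (𝓝 (K * 0)) :=
    (tendsto_pow_atTop_nhds_zero_of_lt_one (Real.exp_pos _).le (by rw [Real.exp_lt_one_iff]; linarith)).const_mul _
  rw [mul_zero] at t1
  have t2 : ‖e‖ ≤ 0 := by
    refine ge_of_tendsto' t1 (fun n => ?_)
    have := h n (by positivity)
    rw [hc, zero_mul, zero_add] at this
    refine this.trans (le_of_eq ?_)
    have := exp_nat_shift a 0 n
    rw [zero_add] at this
    rw [this]; simp
  exact norm_le_zero_iff.mp t2
end GH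

namespace GH
open MeasureTheory Set
variable {χ : GI → GI → ℤ}

lemma Sf_term_bound (hχ : IsQuadSym χ) {L : ℂ → GI → ℂ} (hL : IsHeckeL χ L) (w : SchwartzMap ℝ ℝ) :
    ∃ C : ℝ, 0 < C ∧ ∀ X : ℝ, 0 < X → ∀ n : Prm, ‖L (1 / 2) (ωg ^ 2 * n.1)‖ * |w (Nm n.1 / X)| ≤ C * X ^ 4 * (Nm n.1 ^ 2)⁻¹ := by
  obtain ⟨C, hC, h⟩ := L_bound hχ hL
  obtain ⟨D, hD, h2⟩ := schwartz_decay w 4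
  refine ⟨C * D, by positivity, ?_⟩
  intro X hX n
  have hN : 0 < Nm n.1 := lt_of_lt_of_le one_pos (one_le_Nm (primary_ne_zero n.2))
  have h1 := h n.1 n.2
  have h3 := h2 (Nm n.1 / X)
  have h4 : |w (Nm n.1 / X)| * (Nm n.1 / X) ^ 4 ≤ D := by
    refine le_trans (mul_le_mul_of_nonneg_left ?_ (abs_nonneg _)) h3
    refine pow_le_pow_left₀ (by positivity) ?_ 4
    rw [abs_of_pos (by positivity)]; linarith
  have h5 : |w (Nm n.1 / X)| ≤ D * X ^ 4 / Nm n.1 ^ 4 := by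
    rw [le_div_iff₀ (by positivity)]
    rw [div_pow, ← mul_div_assoc, div_le_iff₀ (by positivity)] at h4
    exact h4
  refine (mul_le_mul h1 h5 (abs_nonneg _) (by positivity)).trans (le_of_eq ?_)
  field_simp

lemma Sf_bound (hχ : IsQuadSym χ) {L : ℂ → GI → ℂ} (hL : IsHeckeL χ L) (w : SchwartzMap ℝ ℝ) :
    ∃ C : ℝ, 0 < C ∧ ∀ X : ℝ, 0 < X → ‖Sf L w X‖ ≤ C * X ^ 4 := by
  obtain ⟨C, hC, h⟩ := Sf_term_bound hχ hL w
  have hs := summable_Nm_pow_prm (j := 2) le_rfl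
  refine ⟨C * (∑' n : Prm, (Nm n.1 ^ 2)⁻¹) + 1, ?_, ?_⟩
  · have : 0 ≤ ∑' n : Prm, (Nm n.1 ^ 2)⁻¹ := tsum_nonneg (fun n => by have := Nm_nonneg n.1; positivity)
    positivity
  intro X hX
  have h1 : ‖Sf L w X‖ ≤ C * X ^ 4 * ∑' n : Prm, (Nm n.1 ^ 2)⁻¹ := by
    refine tsum_of_norm_bounded (hs.hasSum.mul_left (C * X ^ 4)) (fun n => ?_)
    rw [norm_mul, Complex.norm_real, Real.norm_eq_abs]
    exact h X hX n
  refine h1.trans ?_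
  have : 0 < X ^ 4 := by positivity
  nlinarith

lemma rpow_arith1 {X δ : ℝ} (hX : 1 ≤ X) : (X ^ (δ / 6)) ^ 6 * X ^ (-(1 / 2) + δ) = X ^ (-(1 / 2) + 2 * δ) := by
  have h0 : 0 < X := by linarith
  rw [← Real.rpow_natCast (X ^ (δ / 6)), ← Real.rpow_mul h0.le, ← Real.rpow_add h0]
  congr 1; push_cast; ring

lemma rpow_arith2 {X δ : ℝ} (hX : 1 ≤ X) (hδ : 0 < δ) : X ^ 6 * ((X ^ (δ / 6)) ^ (⌈42 / δ⌉₊))⁻¹ ≤ X ^ (-(1 / 2) + 2 * δ) := by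
  have h0 : 0 < X := by linarith
  rw [← Real.rpow_natCast (X ^ (δ / 6)), ← Real.rpow_mul h0.le, ← Real.rpow_natCast X 6, ← Real.rpow_neg h0.le, ← Real.rpow_add h0]
  refine Real.rpow_le_rpow_of_exponent_le hX ?_
  have h1 := Nat.le_ceil (42 / δ)
  have h2 : δ / 6 * (42 / δ) ≤ δ / 6 * ⌈42 / δ⌉₊ := mul_le_mul_of_nonneg_left h1 (by positivity)
  have h3 : δ / 6 * (42 / δ) = 7 := by field_simp; norm_num
  push_cast
  linarith

lemma split_I (hχ : IsQuadSym χ) {L : ℂ → GI → ℂ} (hL : IsHeckeL χ L) (w : SchwartzMap ℝ ℝ) {X ρ : ℝ} (hX : 0 < X) (hρ : 0 < ρ) :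
    -(Real.sqrt π : ℂ) * (Sf L w X / X) = (∫ r in Ioc 0 ρ, hr χ w X r) + ∫ r in Ioi ρ, hr χ w X r := by
  obtain ⟨h1, h2⟩ := I_eq hχ hL w hX
  rw [h2, ← Ioc_union_Ioi_eq_Ioi hρ.le, setIntegral_union (Ioc_disjoint_Ioi le_rfl) measurableSet_Ioi
    (h1.mono_set Ioc_subset_Ioi_self) (h1.mono_set (Ioi_subset_Ioi hρ.le))]

lemma four_norm {z a b c d : ℂ} {A : ℝ} (h : z = a - b + c - d) (ha : ‖a‖ ≤ A) (hb : ‖b‖ ≤ A) (hc : ‖c‖ ≤ A) (hd : ‖d‖ ≤ A) :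
    ‖z‖ ≤ 4 * A := by
  rw [h]
  have h1 := norm_sub_le (a - b + c) d
  have h2 := norm_add_le (a - b) c
  have h3 := norm_sub_le a b
  linarith

lemma second_diff (hχ : IsQuadSym χ) {L : ℂ → GI → ℂ} (hL : IsHeckeL χ L) (w : SchwartzMap ℝ ℝ) {δ : ℝ} (hδ : 0 < δ) (hδ' : δ ≤ 1 / 2) :
    ∃ C : ℝ, 0 < C ∧ ∀ X σ τ : ℝ, 1 ≤ X → 1 ≤ σ → σ ≤ 3 → 1 ≤ τ → τ ≤ 3 →
      ‖-(Real.sqrt π : ℂ) * (Sf L w (σ * X) / ((σ * X : ℝ) : ℂ)) - -(Real.sqrt π : ℂ) * (Sf L w X / X)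
        - -(Real.sqrt π : ℂ) * (Sf L w (τ * (σ * X)) / ((τ * (σ * X) : ℝ) : ℂ)) + -(Real.sqrt π : ℂ) * (Sf L w (τ * X) / ((τ * X : ℝ) : ℂ))‖
      ≤ C * X ^ (-(1 / 2) + 2 * δ) := by
  obtain ⟨C1, hC1, h1⟩ := head_bound hχ hL w hδ hδ'
  obtain ⟨C2, hC2, h2⟩ := tail_bound hχ hL w ⌈42 / δ⌉₊
  refine ⟨4 * (3 ^ 6 * (C1 + C2)), by positivity, ?_⟩
  intro X σ τ hX hσ hσ' hτ hτ'
  have hX0 : 0 < X := by linarith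
  have hσ0 : 0 < σ := by linarith
  have hτ0 : 0 < τ := by linarith
  set ρ := X ^ (δ / 6) with hρd
  have hρ : 1 ≤ ρ := Real.one_le_rpow hX (by positivity)
  have hρ0 : 0 < ρ := by linarith
  have hτρ : 1 ≤ τ * ρ := by nlinarith
  have hσX : 1 ≤ σ * X := by nlinarith
  have hXσ : X ≤ σ * X := by nlinarith
  have hp := Real.rpow_pos_of_pos hX0 (-(1 / 2) + δ)
  have ar1 : ρ ^ 6 * X ^ (-(1 / 2) + δ) = X ^ (-(1 / 2) + 2 * δ) := rpow_arith1 hX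
  have ar2 : X ^ 6 * (ρ ^ (⌈42 / δ⌉₊))⁻¹ ≤ X ^ (-(1 / 2) + 2 * δ) := rpow_arith2 hX hδ
  set P := X ^ (-(1 / 2) + 2 * δ) with hP
  have hP0 : 0 < P := Real.rpow_pos_of_pos hX0 _
  rw [split_I hχ hL w (by positivity : 0 < σ * X) hρ0, split_I hχ hL w hX0 hρ0,
    split_I hχ hL w (by positivity : 0 < τ * (σ * X)) (by positivity : 0 < τ * ρ),
    split_I hχ hL w (by positivity : 0 < τ * X) (by positivity : 0 < τ * ρ)]
  have b1 := h1 ρ X (σ * X) hρ hX0 hXσ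
  have b2 := h1 (τ * ρ) (τ * X) (τ * (σ * X)) hτρ (by positivity) (mul_le_mul_of_nonneg_left hXσ hτ0.le)
  have b3 := h2 ρ τ (σ * X) hρ hσX hτ
  have b4 := h2 ρ τ X hρ hX hτ
  have q : (τ * X) ^ (-(1 / 2) + δ) ≤ X ^ (-(1 / 2) + δ) :=
    Real.rpow_le_rpow_of_nonpos hX0 (by nlinarith) (by linarith)
  have q2 : (τ * ρ) ^ 6 ≤ 3 ^ 6 * ρ ^ 6 := by
    rw [mul_pow]; exact mul_le_mul_of_nonneg_right (pow_le_pow_left₀ hτ0.le hτ' 6) (by positivity)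
  have q3 : (σ * X) ^ 6 ≤ 3 ^ 6 * X ^ 6 := by
    rw [mul_pow]; exact mul_le_mul_of_nonneg_right (pow_le_pow_left₀ hσ0.le hσ' 6) (by positivity)
  have hq : 0 < (ρ ^ (⌈42 / δ⌉₊))⁻¹ := by positivity
  set R := (ρ ^ (⌈42 / δ⌉₊))⁻¹ with hR
  set V := X ^ (-(1 / 2) + δ) with hV
  have f1 : C1 * ρ ^ 6 * V ≤ 3 ^ 6 * (C1 + C2) * P := by
    rw [mul_assoc, ar1]; nlinarith [mul_pos hC1 hP0, mul_pos hC2 hP0]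
  have f2 : C1 * (τ * ρ) ^ 6 * (τ * X) ^ (-(1 / 2) + δ) ≤ 3 ^ 6 * (C1 + C2) * P := by
    have : (τ * ρ) ^ 6 * (τ * X) ^ (-(1 / 2) + δ) ≤ 3 ^ 6 * ρ ^ 6 * V :=
      mul_le_mul q2 q (Real.rpow_pos_of_pos (by positivity) _).le (by positivity)
    rw [mul_assoc (3 ^ 6), ar1] at this
    rw [mul_assoc C1]
    nlinarith [mul_le_mul_of_nonneg_left this hC1.le, mul_pos hC2 hP0]
  have f3 : C2 * (σ * X) ^ 6 * R ≤ 3 ^ 6 * (C1 + C2) * P := by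
    have : (σ * X) ^ 6 * R ≤ 3 ^ 6 * P := by
      refine (mul_le_mul_of_nonneg_right q3 hq.le).trans ?_
      rw [mul_assoc]; linarith
    rw [mul_assoc C2]
    nlinarith [mul_le_mul_of_nonneg_left this hC2.le, mul_pos hC1 hP0]
  have f4 : C2 * X ^ 6 * R ≤ 3 ^ 6 * (C1 + C2) * P := by
    rw [mul_assoc C2]
    nlinarith [mul_le_mul_of_nonneg_left ar2 hC2.le, mul_pos hC1 hP0, mul_pos hC2 hP0]
  rw [norm_sub_rev] at b1
  rw [mul_assoc 4]
  refine four_norm ?_ (b1.trans f1) ((norm_sub_rev _ _).trans_le (b2.trans f2)) (b3.trans f3) (b4.trans f4)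
  ring

lemma G_asymp (hχ : IsQuadSym χ) {L : ℂ → GI → ℂ} (hL : IsHeckeL χ L) (w : SchwartzMap ℝ ℝ) {δ : ℝ} (hδ : 0 < δ) (hδ' : δ < 1 / 4) :
    ∃ c e : ℂ, ∃ C : ℝ, ∀ x : ℝ, 0 ≤ x →
      ‖Sf L w (Real.exp x) / ((Real.exp x : ℝ) : ℂ) - c * x - e‖ ≤ C * Real.exp (-(1 / 2 - 2 * δ) * x) := by
  obtain ⟨C, hC, h⟩ := second_diff hχ hL w hδ (by linarith)
  obtain ⟨D, hD, hB⟩ := Sf_bound hχ hL w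
  have hsp : 0 < Real.sqrt π := Real.sqrt_pos.mpr Real.pi_pos
  have he3 : Real.exp 1 ≤ 3 := by linarith [Real.exp_one_lt_d9]
  refine lin_lemma (fun x => Sf L w (Real.exp x) / ((Real.exp x : ℝ) : ℂ)) (a := 1 / 2 - 2 * δ) (C := (Real.sqrt π)⁻¹ * C)
    (B := D * 81) (by linarith) (by positivity) ?_ ?_
  · intro x s t hx hs hs1 ht ht1
    have hb := h (Real.exp x) (Real.exp s) (Real.exp t) (Real.one_le_exp hx) (Real.one_le_exp hs)
      ((Real.exp_le_exp.mpr hs1).trans he3) (Real.one_le_exp ht) ((Real.exp_le_exp.mpr ht1).trans he3)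
    rw [← Real.exp_add, ← Real.exp_add, ← Real.exp_add, ← Real.exp_mul, show s + x = x + s by ring, show t + (x + s) = x + s + t by ring,
      show t + x = x + t by ring, show x * (-(1 / 2) + 2 * δ) = -(1 / 2 - 2 * δ) * x by ring] at hb
    rw [mul_assoc, inv_mul_eq_div, le_div_iff₀ hsp]
    refine le_trans (le_of_eq ?_) hb
    have hn : ‖(Real.sqrt π : ℂ)‖ = Real.sqrt π := by rw [Complex.norm_real, Real.norm_eq_abs, abs_of_pos hsp]
    rw [mul_comm]
    nth_rewrite 1 [← hn]
    rw [← norm_mul, ← norm_neg]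
    congr 1
    ring
  · intro x hx hx1
    rw [norm_div, Complex.norm_real, Real.norm_eq_abs, abs_of_pos (Real.exp_pos _), div_le_iff₀ (Real.exp_pos _)]
    have h1 := hB (Real.exp x) (Real.exp_pos _)
    have h2 : Real.exp x ^ 4 ≤ 3 ^ 4 := pow_le_pow_left₀ (Real.exp_pos _).le ((Real.exp_le_exp.mpr hx1).trans he3) 4
    have h3 := Real.one_le_exp hx
    nlinarith [mul_le_mul_of_nonneg_left h2 hD.le]

/-- asymptotic expansion with power saving, constants depending on `w` -/
lemma main_asymp (hχ : IsQuadSym χ) {L : ℂ → GI → ℂ} (hL : IsHeckeL χ L) (w : SchwartzMap ℝ ℝ) :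
    ∃ c e : ℂ, ∀ ε : ℝ, 0 < ε → ∃ C : ℝ, 0 < C ∧ ∀ X : ℝ, 1 ≤ X →
      ‖Sf L w X - X * (c * (Real.log X : ℂ) + e)‖ ≤ C * X ^ (1 / 2 + ε) := by
  obtain ⟨c, e, C0, h0⟩ := G_asymp hχ hL w (δ := 1 / 8) (by norm_num) (by norm_num)
  have key : ∀ δ : ℝ, 0 < δ → δ < 1 / 4 → ∃ C : ℝ, ∀ x : ℝ, 0 ≤ x →
      ‖Sf L w (Real.exp x) / ((Real.exp x : ℝ) : ℂ) - c * x - e‖ ≤ C * Real.exp (-(1 / 2 - 2 * δ) * x) := by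
    intro δ hδ hδ'
    obtain ⟨c', e', C, h⟩ := G_asymp hχ hL w hδ hδ'
    have hC0 : 0 ≤ C0 := by
      have := (norm_nonneg _).trans (h0 0 le_rfl)
      simpa using this
    have hC : 0 ≤ C := by
      have := (norm_nonneg _).trans (h 0 le_rfl)
      simpa using this
    obtain ⟨u1, u2⟩ := lin_unique (c := c' - c) (e := e' - e) (a := min (1 / 2 - 2 * δ) (1 / 4)) (K := C + C0)
      (lt_min (by linarith) (by norm_num)) (by
        intro x hx
        have e1 := h x hx
        have e2 := h0 x hx
        set G := Sf L w (Real.exp x) / ((Real.exp x : ℝ) : ℂ)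
        rw [show (c' - c) * x + (e' - e) = (G - c * x - e) - (G - c' * x - e') by ring]
        refine (norm_sub_le _ _).trans ?_
        rw [add_mul, add_comm]
        refine add_le_add (e1.trans ?_) (e2.trans ?_)
        · refine mul_le_mul_of_nonneg_left (Real.exp_le_exp.mpr ?_) hC
          have := min_le_left (1 / 2 - 2 * δ) (1 / 4)
          nlinarith
        · refine mul_le_mul_of_nonneg_left (Real.exp_le_exp.mpr ?_) hC0
          have := min_le_right (1 / 2 - 2 * δ) (1 / 4)
          nlinarith)
    rw [sub_eq_zero] at u1 u2
    rw [u1, u2] at h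
    exact ⟨C, h⟩
  refine ⟨c, e, fun ε hε => ?_⟩
  obtain ⟨C, h⟩ := key (min (ε / 2) (1 / 8)) (lt_min (by linarith) (by norm_num)) ((min_le_right _ _).trans_lt (by norm_num))
  have hC : 0 ≤ C := by
    have := (norm_nonneg _).trans (h 0 le_rfl)
    simpa using this
  refine ⟨C + 1, by positivity, fun X hX => ?_⟩
  have hX0 : 0 < X := by linarith
  have h1 := h (Real.log X) (Real.log_nonneg hX)
  rw [Real.exp_log hX0] at h1
  have hXc : (X : ℂ) ≠ 0 := by exact_mod_cast hX0.ne'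
  rw [show Sf L w X - X * (c * (Real.log X : ℂ) + e) = X * (Sf L w X / X - c * (Real.log X : ℂ) - e) by field_simp; ring, norm_mul, Complex.norm_real,
    Real.norm_eq_abs, abs_of_pos hX0]
  refine (mul_le_mul_of_nonneg_left h1 hX0.le).trans ?_
  rw [mul_comm (-(1 / 2 - 2 * min (ε / 2) (1 / 8))), Real.exp_mul, Real.exp_log hX0]
  have h2 : X * X ^ (-(1 / 2 - 2 * min (ε / 2) (1 / 8))) ≤ X ^ (1 / 2 + ε) := by
    nth_rewrite 1 [← Real.rpow_one X]
    rw [← Real.rpow_add hX0]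
    refine Real.rpow_le_rpow_of_exponent_le hX ?_
    have := min_le_left (ε / 2) (1 / 8)
    linarith
  have h3 := Real.rpow_pos_of_pos hX0 (1 / 2 + ε)
  nlinarith [mul_le_mul_of_nonneg_left h2 hC]
end GH

namespace GH
open MeasureTheory Set
variable {χ : GI → GI → ℤ}

/-- complexified weight -/
def wc (w : SchwartzMap ℝ ℝ) (t : ℝ) : ℂ := ((w t : ℝ) : ℂ)

lemma wc_cont (w : SchwartzMap ℝ ℝ) : Continuous (wc w) := Complex.continuous_ofReal.comp w.continuous

lemma wc_top (w : SchwartzMap ℝ ℝ) : wc w =O[atTop] (fun t : ℝ => t ^ (-(2:ℝ))) := by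
  obtain ⟨C, hC, h⟩ := schwartz_decay w 2
  refine Asymptotics.IsBigO.of_bound C ?_
  filter_upwards [eventually_gt_atTop 0] with t ht
  have := h t
  rw [wc, Complex.norm_real, Real.norm_eq_abs, Real.norm_eq_abs, abs_of_pos (Real.rpow_pos_of_pos ht _), Real.rpow_neg ht.le,
    ← div_eq_mul_inv, le_div_iff₀ (Real.rpow_pos_of_pos ht _)]
  refine le_trans (mul_le_mul_of_nonneg_left ?_ (abs_nonneg _)) this
  rw [Real.rpow_two, abs_of_pos ht]
  exact pow_le_pow_left₀ ht.le (by linarith) 2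

lemma wc_zero (w : SchwartzMap ℝ ℝ) : wc w =O[𝓝[>] 0] (fun t : ℝ => t ^ (-(0:ℝ))) := by
  obtain ⟨C, hC, h⟩ := schwartz_decay w 0
  refine Asymptotics.IsBigO.of_bound C ?_
  filter_upwards with t
  have := h t
  rw [pow_zero, mul_one] at this
  simpa [wc] using this

lemma wc_loc (w : SchwartzMap ℝ ℝ) : LocallyIntegrableOn (wc w) (Ioi 0) :=
  (wc_cont w).continuousOn.locallyIntegrableOn measurableSet_Ioi

lemma wc_mellin (w : SchwartzMap ℝ ℝ) {s : ℂ} (h1 : s.re < 2) (h0 : 0 < s.re) : MellinConvergent (wc w) s :=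
  mellinConvergent_of_isBigO_rpow (wc_loc w) (wc_top w) h1 (wc_zero w) h0

lemma wc_int (w : SchwartzMap ℝ ℝ) : IntegrableOn (wc w) (Ioi 0) := by
  have := wc_mellin w (s := 1) (by norm_num) (by norm_num)
  rw [MellinConvergent] at this
  simpa using this

lemma wc_mellin_one (w : SchwartzMap ℝ ℝ) : mellin (wc w) 1 = ∫ t in Ioi 0, wc w t := by
  simp [mellin]

lemma wc_mellin_deriv (w : SchwartzMap ℝ ℝ) : IntegrableOn (fun t => (Real.log t : ℂ) * wc w t) (Ioi 0) ∧
    deriv (mellin (wc w)) 1 = ∫ t in Ioi 0, (Real.log t : ℂ) * wc w t := by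
  obtain ⟨h1, h2⟩ := mellin_hasDerivAt_of_isBigO_rpow (s := 1) (wc_loc w) (wc_top w) (by norm_num) (wc_zero w) (by norm_num)
  constructor
  · rw [MellinConvergent] at h1
    simpa using h1
  · rw [h2.deriv]; simp [mellin]

lemma wc_rpow_int (w : SchwartzMap ℝ ℝ) : IntegrableOn (fun t => t ^ (-(1 / 4) : ℝ) * |w t|) (Ioi 0) := by
  have h : IntegrableOn (fun a : ℝ => ‖(a : ℂ) ^ (((3 / 4 : ℝ) : ℂ) - 1) • wc w a‖) (Ioi 0) := (wc_mellin w (s := ((3 / 4 : ℝ) : ℂ)) (by rw [Complex.ofReal_re]; norm_num) (by rw [Complex.ofReal_re]; norm_num)).norm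
  refine h.congr_fun (fun t ht => ?_) measurableSet_Ioi
  have ht : 0 < t := ht
  simp only
  rw [norm_smul, wc, Complex.norm_real, Real.norm_eq_abs, Complex.norm_cpow_eq_rpow_re_of_pos ht]
  congr 2
  simp; norm_num

lemma Sf_all (hχ : IsQuadSym χ) {L : ℂ → GI → ℂ} (hL : IsHeckeL χ L) (w : SchwartzMap ℝ ℝ) {c e : ℂ}
    (h : ∃ C : ℝ, 0 < C ∧ ∀ X : ℝ, 1 ≤ X → ‖Sf L w X - X * (c * (Real.log X : ℂ) + e)‖ ≤ C * X ^ (1 / 2 + (1 / 4) : ℝ)) :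
    ∃ C : ℝ, 0 < C ∧ ∀ X : ℝ, 0 < X → ‖Sf L w X - X * (c * (Real.log X : ℂ) + e)‖ ≤ C * X ^ (3 / 4 : ℝ) := by
  obtain ⟨C, hC, h⟩ := h
  obtain ⟨D, hD, hB⟩ := Sf_bound hχ hL w
  refine ⟨C + (D + (4 * ‖c‖ + ‖e‖)), by positivity, ?_⟩
  intro X hX
  have hp := Real.rpow_pos_of_pos hX (3 / 4 : ℝ)
  rcases le_total 1 X with h1 | h1
  · refine (h X h1).trans ?_
    rw [show (1 / 2 + 1 / 4 : ℝ) = 3 / 4 by norm_num]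
    refine mul_le_mul_of_nonneg_right ?_ hp.le
    have : 0 ≤ D + (4 * ‖c‖ + ‖e‖) := by positivity
    linarith
  · have e1 : X ≤ X ^ (3 / 4 : ℝ) := by
      nth_rewrite 1 [← Real.rpow_one X]
      exact Real.rpow_le_rpow_of_exponent_ge hX h1 (by norm_num)
    have e2 : X ^ 4 ≤ X := by
      calc X ^ 4 = X ^ 3 * X := by ring
        _ ≤ 1 * X := mul_le_mul_of_nonneg_right (pow_le_one₀ hX.le h1) hX.le
        _ = X := one_mul _
    have e3 := Real.abs_log_mul_self_rpow_lt X (1 / 4) hX h1 (by norm_num)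
    have e4 : X * |Real.log X| ≤ 4 * X ^ (3 / 4 : ℝ) := by
      rw [abs_mul, abs_of_pos (Real.rpow_pos_of_pos hX _)] at e3
      have : X = X ^ (1 / 4 : ℝ) * X ^ (3 / 4 : ℝ) := by
        rw [← Real.rpow_add hX]; norm_num
      calc X * |Real.log X| = (|Real.log X| * X ^ (1 / 4 : ℝ)) * X ^ (3 / 4 : ℝ) := by
            nth_rewrite 1 [this]; ring
        _ ≤ 4 * X ^ (3 / 4 : ℝ) := mul_le_mul_of_nonneg_right (by norm_num at e3 ⊢; linarith) hp.le
    have e5 : ‖(X : ℂ) * (c * (Real.log X : ℂ) + e)‖ ≤ (4 * ‖c‖ + ‖e‖) * X ^ (3 / 4 : ℝ) := by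
      rw [norm_mul, Complex.norm_real, Real.norm_eq_abs, abs_of_pos hX]
      have : ‖c * (Real.log X : ℂ) + e‖ ≤ ‖c‖ * |Real.log X| + ‖e‖ := by
        refine (norm_add_le _ _).trans ?_
        rw [norm_mul, Complex.norm_real, Real.norm_eq_abs]
      refine (mul_le_mul_of_nonneg_left this hX.le).trans ?_
      nlinarith [mul_le_mul_of_nonneg_left e4 (norm_nonneg c), mul_le_mul_of_nonneg_left e1 (norm_nonneg e)]
    have e6 : ‖Sf L w X‖ ≤ D * X ^ (3 / 4 : ℝ) := (hB X hX).trans (mul_le_mul_of_nonneg_left (e2.trans e1) hD.le)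
    refine (norm_sub_le _ _).trans ?_
    nlinarith [mul_pos hC hp]

lemma Sf_cont (hχ : IsQuadSym χ) {L : ℂ → GI → ℂ} (hL : IsHeckeL χ L) (w : SchwartzMap ℝ ℝ) : ContinuousOn (Sf L w) (Ioi 0) := by
  obtain ⟨C, hC, h⟩ := Sf_term_bound hχ hL w
  intro x hx
  have hx : 0 < x := hx
  have hc : ContinuousOn (Sf L w) (Ioo 0 (x + 1)) := by
    refine continuousOn_tsum (u := fun n : Prm => C * (x + 1) ^ 4 * (Nm n.1 ^ 2)⁻¹) ?_ ((summable_Nm_pow_prm (j := 2) le_rfl).mul_left _) ?_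
    · intro n
      refine continuousOn_const.mul (Complex.continuous_ofReal.comp_continuousOn (w.continuous.comp_continuousOn ?_))
      exact continuousOn_const.div continuousOn_id (fun y hy => (ne_of_gt hy.1))
    · intro n y hy
      rw [norm_mul, Complex.norm_real, Real.norm_eq_abs]
      refine (h y hy.1 n).trans ?_
      have := Nm_nonneg n.1
      refine mul_le_mul_of_nonneg_right (mul_le_mul_of_nonneg_left (pow_le_pow_left₀ hy.1.le hy.2.le 4) hC.le) (by positivity)
  exact (hc.continuousAt (Ioo_mem_nhds hx (by linarith))).continuousWithinAt

/-- the bilinear form -/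
def Bil (L : ℂ → GI → ℂ) (w1 w2 : SchwartzMap ℝ ℝ) (X : ℝ) : ℂ := ∫ s in Ioi (0:ℝ), (s : ℂ)⁻¹ * (wc w2 s * Sf L w1 (X * s))

lemma cube_int (w : SchwartzMap ℝ ℝ) : IntegrableOn (fun s : ℝ => s ^ 3 * |w s|) (Ioi 0) := by
  have h := (w.integrable_pow_mul volume 3).integrableOn (s := Ioi 0)
  refine h.congr_fun (fun t ht => ?_) measurableSet_Ioi
  have ht : 0 < t := ht
  simp [abs_of_pos ht]

lemma Bil_integrable (hχ : IsQuadSym χ) {L : ℂ → GI → ℂ} (hL : IsHeckeL χ L) (w1 w2 : SchwartzMap ℝ ℝ) {X : ℝ} (hX : 0 < X) :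
    IntegrableOn (fun s : ℝ => (s : ℂ)⁻¹ * (wc w2 s * Sf L w1 (X * s))) (Ioi 0) := by
  obtain ⟨C, hC, h⟩ := Sf_bound hχ hL w1
  refine Integrable.mono' ((cube_int w2).const_mul (C * X ^ 4)) ?_ ?_
  · refine ContinuousOn.aestronglyMeasurable ?_ measurableSet_Ioi
    refine ContinuousOn.mul ?_ ((wc_cont w2).continuousOn.mul ((Sf_cont hχ hL w1).comp (by fun_prop) ?_))
    · refine Complex.continuous_ofReal.continuousOn.inv₀ (fun s hs => ?_)
      have hs : 0 < s := hs
      exact_mod_cast hs.ne'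
    · intro s hs
      have hs : 0 < s := hs
      exact mul_pos hX hs
  · refine (ae_restrict_iff' measurableSet_Ioi).mpr (Filter.Eventually.of_forall (fun s hs => ?_))
    have hs : 0 < s := hs
    rw [norm_mul, norm_mul, norm_inv, wc, Complex.norm_real, Complex.norm_real, Real.norm_eq_abs, Real.norm_eq_abs, abs_of_pos hs]
    have h1 := h (X * s) (by positivity)
    have h2 : s⁻¹ * (|w2 s| * ‖Sf L w1 (X * s)‖) ≤ s⁻¹ * (|w2 s| * (C * (X * s) ^ 4)) := by
      refine mul_le_mul_of_nonneg_left (mul_le_mul_of_nonneg_left h1 (abs_nonneg _)) (by positivity)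
    refine h2.trans (le_of_eq ?_)
    field_simp

lemma Bil_tsum (hχ : IsQuadSym χ) {L : ℂ → GI → ℂ} (hL : IsHeckeL χ L) (w1 w2 : SchwartzMap ℝ ℝ) {X : ℝ} (hX : 0 < X) :
    Bil L w1 w2 X = ∑' n : Prm, L (1 / 2) (ωg ^ 2 * n.1) * mellin (fun s => wc w2 s * wc w1 ((Nm n.1 / X) * s⁻¹)) 0 := by
  obtain ⟨C, hC, h⟩ := Sf_term_bound hχ hL w1
  set F : Prm → ℝ → ℂ := fun n s => (s : ℂ)⁻¹ * (wc w2 s * (L (1 / 2) (ωg ^ 2 * n.1) * wc w1 (Nm n.1 / (X * s)))) with hF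
  have hb : ∀ n : Prm, ∀ s ∈ Ioi (0:ℝ), ‖F n s‖ ≤ (C * X ^ 4 * (Nm n.1 ^ 2)⁻¹) * (s ^ 3 * |w2 s|) := by
    intro n s hs
    have hs : 0 < s := hs
    simp only [hF]
    rw [norm_mul, norm_mul, norm_mul, norm_inv, wc, wc, Complex.norm_real, Complex.norm_real, Complex.norm_real, Real.norm_eq_abs, Real.norm_eq_abs,
      Real.norm_eq_abs, abs_of_pos hs]
    have h1 := h (X * s) (by positivity) n
    refine (mul_le_mul_of_nonneg_left (mul_le_mul_of_nonneg_left h1 (abs_nonneg _)) (by positivity)).trans (le_of_eq ?_)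
    field_simp
  have hintg : ∀ n : Prm, IntegrableOn (F n) (Ioi 0) := by
    intro n
    refine Integrable.mono' ((cube_int w2).const_mul _) ?_ ((ae_restrict_iff' measurableSet_Ioi).mpr (Filter.Eventually.of_forall (hb n)))
    refine ContinuousOn.aestronglyMeasurable ?_ measurableSet_Ioi
    refine ContinuousOn.mul ?_ ((wc_cont w2).continuousOn.mul (continuousOn_const.mul ((wc_cont w1).comp_continuousOn ?_)))
    · refine Complex.continuous_ofReal.continuousOn.inv₀ (fun s hs => ?_)
      have hs : 0 < s := hs
      exact_mod_cast hs.ne'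
    · refine continuousOn_const.div (by fun_prop) (fun s hs => ?_)
      have hs : 0 < s := hs
      positivity
  have hsum : Summable (fun n : Prm => ∫ s in Ioi 0, ‖F n s‖) := by
    refine Summable.of_nonneg_of_le (fun n => integral_nonneg (fun s => norm_nonneg _)) (fun n => ?_)
      ((summable_Nm_pow_prm (j := 2) le_rfl).mul_left (C * X ^ 4 * ∫ s in Ioi 0, s ^ 3 * |w2 s|))
    refine (setIntegral_mono_on (hintg n).norm ((cube_int w2).const_mul _) measurableSet_Ioi (hb n)).trans (le_of_eq ?_)
    rw [integral_const_mul]; ring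
  have hs := hasSum_integral_of_summable_integral_norm (μ := volume.restrict (Ioi 0)) hintg hsum
  have e1 : Bil L w1 w2 X = ∫ s in Ioi 0, ∑' n, F n s := by
    refine setIntegral_congr_fun measurableSet_Ioi (fun s hs => ?_)
    simp only [hF]
    rw [tsum_mul_left, tsum_mul_left]
    rfl
  rw [e1, ← hs.tsum_eq]
  refine tsum_congr (fun n => ?_)
  rw [mellin, ← integral_const_mul]
  refine setIntegral_congr_fun measurableSet_Ioi (fun s hs => ?_)
  simp only [hF]
  rw [zero_sub, Complex.cpow_neg_one, smul_eq_mul, show Nm n.1 / X * s⁻¹ = Nm n.1 / (X * s) by rw [← div_eq_mul_inv, div_div]]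
  ring

lemma mellin_swap (f g : ℝ → ℂ) {k : ℝ} (hk : 0 < k) :
    mellin (fun s => f s * g (k * s⁻¹)) 0 = mellin (fun s => g s * f (k * s⁻¹)) 0 := by
  have h1 := mellin_comp_mul_left (fun s => f s * g (k * s⁻¹)) 0 hk
  have h2 := mellin_comp_inv (fun t => (fun s => f s * g (k * s⁻¹)) (k * t)) 0
  rw [neg_zero] at h1 h2
  rw [Complex.cpow_zero, one_smul] at h1
  rw [← h1, ← h2, mellin, mellin]
  refine setIntegral_congr_fun measurableSet_Ioi (fun s hs => ?_)
  have hs : 0 < s := hs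
  simp only
  rw [show k * (k * s⁻¹)⁻¹ = s by field_simp, mul_comm (g s)]

lemma Bil_symm (hχ : IsQuadSym χ) {L : ℂ → GI → ℂ} (hL : IsHeckeL χ L) (w1 w2 : SchwartzMap ℝ ℝ) {X : ℝ} (hX : 0 < X) :
    Bil L w1 w2 X = Bil L w2 w1 X := by
  rw [Bil_tsum hχ hL w1 w2 hX, Bil_tsum hχ hL w2 w1 hX]
  refine tsum_congr (fun n => ?_)
  rw [mellin_swap _ _ (div_pos (lt_of_lt_of_le one_pos (one_le_Nm (primary_ne_zero n.2))) hX)]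

lemma Bil_asymp (hχ : IsQuadSym χ) {L : ℂ → GI → ℂ} (hL : IsHeckeL χ L) (w1 w2 : SchwartzMap ℝ ℝ) {c e : ℂ}
    (h : ∃ C : ℝ, 0 < C ∧ ∀ X : ℝ, 0 < X → ‖Sf L w1 X - X * (c * (Real.log X : ℂ) + e)‖ ≤ C * X ^ (3 / 4 : ℝ)) :
    ∃ C : ℝ, ∀ X : ℝ, 0 < X →
      ‖Bil L w1 w2 X - X * ((c * mellin (wc w2) 1) * (Real.log X : ℂ) + (c * deriv (mellin (wc w2)) 1 + e * mellin (wc w2) 1))‖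
        ≤ C * X ^ (3 / 4 : ℝ) := by
  obtain ⟨C, hC, h⟩ := h
  obtain ⟨hd1, hd2⟩ := wc_mellin_deriv w2
  refine ⟨C * ∫ t in Ioi 0, t ^ (-(1 / 4) : ℝ) * |w2 t|, fun X hX => ?_⟩
  have hi1 := Bil_integrable hχ hL w1 w2 hX
  have hi2 : IntegrableOn (fun s : ℝ => (X * (c * (Real.log X : ℂ) + e)) * wc w2 s + (X * c) * ((Real.log s : ℂ) * wc w2 s)) (Ioi 0) :=
    ((wc_int w2).const_mul _).add (hd1.const_mul _)
  have e1 : X * ((c * mellin (wc w2) 1) * (Real.log X : ℂ) + (c * deriv (mellin (wc w2)) 1 + e * mellin (wc w2) 1))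
      = ∫ s in Ioi (0:ℝ), ((X * (c * (Real.log X : ℂ) + e)) * wc w2 s + (X * c) * ((Real.log s : ℂ) * wc w2 s)) := by
    rw [integral_add ((wc_int w2).const_mul _) (hd1.const_mul _), integral_const_mul, integral_const_mul, ← hd2, ← wc_mellin_one]
    ring
  rw [e1, Bil, ← integral_sub hi1 hi2]
  rw [show (C * ∫ t in Ioi 0, t ^ (-(1 / 4) : ℝ) * |w2 t|) * X ^ (3 / 4 : ℝ) = ∫ t in Ioi 0, (C * X ^ (3 / 4 : ℝ)) * (t ^ (-(1 / 4) : ℝ) * |w2 t|) by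
    rw [integral_const_mul]; ring]
  refine norm_integral_le_of_norm_le ((wc_rpow_int w2).const_mul _) ((ae_restrict_iff' measurableSet_Ioi).mpr (Filter.Eventually.of_forall (fun s hs => ?_)))
  have hs : 0 < s := hs
  have h1 := h (X * s) (by positivity)
  have hsc : (s : ℂ) ≠ 0 := by exact_mod_cast hs.ne'
  have e2 : (s : ℂ)⁻¹ * (wc w2 s * Sf L w1 (X * s)) - ((X * (c * (Real.log X : ℂ) + e)) * wc w2 s + (X * c) * ((Real.log s : ℂ) * wc w2 s))
      = (s : ℂ)⁻¹ * (wc w2 s * (Sf L w1 (X * s) - ((X * s : ℝ) : ℂ) * (c * (Real.log (X * s) : ℂ) + e))) := by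
    rw [Real.log_mul hX.ne' hs.ne']
    push_cast
    field_simp
    ring
  rw [e2, norm_mul, norm_mul, norm_inv, wc, Complex.norm_real, Complex.norm_real, Real.norm_eq_abs, Real.norm_eq_abs, abs_of_pos hs]
  refine (mul_le_mul_of_nonneg_left (mul_le_mul_of_nonneg_left h1 (abs_nonneg _)) (by positivity)).trans (le_of_eq ?_)
  rw [Real.mul_rpow hX.le hs.le]
  have e3 : s⁻¹ * s ^ (3 / 4 : ℝ) = s ^ (-(1 / 4) : ℝ) := by
    rw [← Real.rpow_neg_one, ← Real.rpow_add hs]; norm_num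
  rw [← e3]; ring

lemma coeff_rel (hχ : IsQuadSym χ) {L : ℂ → GI → ℂ} (hL : IsHeckeL χ L) (w1 w2 : SchwartzMap ℝ ℝ) {c1 e1 c2 e2 : ℂ}
    (h1 : ∃ C : ℝ, 0 < C ∧ ∀ X : ℝ, 0 < X → ‖Sf L w1 X - X * (c1 * (Real.log X : ℂ) + e1)‖ ≤ C * X ^ (3 / 4 : ℝ))
    (h2 : ∃ C : ℝ, 0 < C ∧ ∀ X : ℝ, 0 < X → ‖Sf L w2 X - X * (c2 * (Real.log X : ℂ) + e2)‖ ≤ C * X ^ (3 / 4 : ℝ)) :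
    c1 * mellin (wc w2) 1 = c2 * mellin (wc w1) 1 ∧
    c1 * deriv (mellin (wc w2)) 1 + e1 * mellin (wc w2) 1 = c2 * deriv (mellin (wc w1)) 1 + e2 * mellin (wc w1) 1 := by
  obtain ⟨A, hA⟩ := Bil_asymp hχ hL w1 w2 h1
  obtain ⟨B, hB⟩ := Bil_asymp hχ hL w2 w1 h2
  generalize mellin (wc w1) 1 = m1 at *
  generalize mellin (wc w2) 1 = m2 at *
  generalize deriv (mellin (wc w1)) 1 = d1 at *
  generalize deriv (mellin (wc w2)) 1 = d2 at *
  obtain ⟨u1, u2⟩ := lin_unique (c := c1 * m2 - c2 * m1) (e := (c1 * d2 + e1 * m2) - (c2 * d1 + e2 * m1)) (a := 1 / 4) (K := B + A) (by norm_num) (by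
    intro x hx
    have hX := Real.exp_pos x
    have a1 := hA _ hX
    have a2 := hB _ hX
    rw [Bil_symm hχ hL w1 w2 hX] at a1
    rw [Real.log_exp, ← Real.exp_mul] at a1 a2
    set Y := Bil L w2 w1 (Real.exp x)
    have a3 : ‖((Real.exp x : ℝ) : ℂ) * ((c1 * m2 - c2 * m1) * x + ((c1 * d2 + e1 * m2) - (c2 * d1 + e2 * m1)))‖ ≤ (B + A) * Real.exp (x * (3 / 4)) := by
      rw [show ((Real.exp x : ℝ) : ℂ) * ((c1 * m2 - c2 * m1) * x + ((c1 * d2 + e1 * m2) - (c2 * d1 + e2 * m1)))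
        = (Y - ((Real.exp x : ℝ) : ℂ) * (c2 * m1 * x + (c2 * d1 + e2 * m1))) - (Y - ((Real.exp x : ℝ) : ℂ) * (c1 * m2 * x + (c1 * d2 + e1 * m2))) by ring]
      refine (norm_sub_le _ _).trans ?_
      rw [add_mul]
      exact add_le_add a2 a1
    rw [norm_mul, Complex.norm_real, Real.norm_eq_abs, abs_of_pos hX, mul_comm, ← le_div_iff₀ hX] at a3
    refine a3.trans (le_of_eq ?_)
    rw [mul_div_assoc, ← Real.exp_sub]
    congr 2; ring)
  exact ⟨sub_eq_zero.mp u1, sub_eq_zero.mp u2⟩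
end GH

namespace GH
open MeasureTheory Set
variable {χ : GI → GI → ℤ}

lemma exists_ref : ∃ w : SchwartzMap ℝ ℝ, mellin (wc w) 1 ≠ 0 := by
  let f : ContDiffBump (2 : ℝ) := ⟨1 / 2, 1, by norm_num, by norm_num⟩
  refine ⟨f.hasCompactSupport.toSchwartzMap f.contDiff, ?_⟩
  have h1 : ∀ t, wc (f.hasCompactSupport.toSchwartzMap f.contDiff) t = ((f t : ℝ) : ℂ) := fun t => rfl
  rw [wc_mellin_one]
  simp only [h1]
  rw [integral_complex_ofReal]
  have h2 : ∫ t in Ioi (0:ℝ), f t = ∫ t, f t := by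
    refine setIntegral_eq_integral_of_forall_compl_eq_zero (fun t ht => ?_)
    by_contra hne
    have : t ∈ Function.support f := hne
    rw [f.support_eq, Metric.mem_ball, Real.dist_eq, abs_lt] at this
    apply ht
    have h3 := this.1
    simp only [f] at h3
    change 0 < t
    linarith
  rw [h2]
  have := f.integral_pos (μ := volume)
  exact_mod_cast this.ne'

lemma final (hχ : IsQuadSym χ) {L : ℂ → GI → ℂ} (hL : IsHeckeL χ L) :
    ∃ Q1 Q0 : ℂ → ℂ → ℂ, ∀ w : SchwartzMap ℝ ℝ, ∀ ε : ℝ, 0 < ε → ∃ C : ℝ, 0 < C ∧ ∀ X : ℝ, 2 ≤ X →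
      ‖Sf L w X - (X : ℂ) * (Q1 (mellin (wc w) 1) (deriv (mellin (wc w)) 1) * (Real.log X : ℂ)
        + Q0 (mellin (wc w) 1) (deriv (mellin (wc w)) 1))‖ ≤ C * X ^ (1 / 2 + ε) := by
  obtain ⟨w2, hw2⟩ := exists_ref
  obtain ⟨c2, e2, h2⟩ := main_asymp hχ hL w2
  refine ⟨fun m _ => c2 * m / mellin (wc w2) 1,
    fun m d => (c2 * d + e2 * m - c2 * m / mellin (wc w2) 1 * deriv (mellin (wc w2)) 1) / mellin (wc w2) 1, ?_⟩
  intro w ε hε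
  obtain ⟨c, e, h⟩ := main_asymp hχ hL w
  obtain ⟨r1, r2⟩ := coeff_rel hχ hL w w2 (Sf_all hχ hL w (h (1 / 4) (by norm_num))) (Sf_all hχ hL w2 (h2 (1 / 4) (by norm_num)))
  obtain ⟨C, hC, hb⟩ := h ε hε
  refine ⟨C, hC, fun X hX => ?_⟩
  have q1 : c2 * mellin (wc w) 1 / mellin (wc w2) 1 = c := by rw [← r1]; field_simp
  have q0 : (c2 * deriv (mellin (wc w)) 1 + e2 * mellin (wc w) 1 - c * deriv (mellin (wc w2)) 1) / mellin (wc w2) 1 = e := by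
    rw [← r2]; field_simp; ring
  simp only [q1, q0]
  exact hb X (by linarith)
end GH

/-- the smoothed first moment of central values of quadratic Hecke
`L`-functions equals `X·Q(log X) + O(X^{1/2+ε})`, where `Q` is a linear polynomial whose
coefficients depend only on absolute constants and on `ŵ(1)` and `ŵ'(1)`
(Corollary 1.3 of the paper). -/
theorem first_moment_central_values_quadratic_Hecke_Gaussian
    (χ : GaussianInt → GaussianInt → ℤ) (hχ : IsQuadSym χ)
    (L : ℂ → GaussianInt → ℂ) (hL : IsHeckeL χ L) :
    -- the two coefficients of `Q` are functions of `ŵ(1)` and `ŵ'(1)` only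
    ∃ Q1 Q0 : ℂ → ℂ → ℂ,
      ∀ (w : SchwartzMap ℝ ℝ), (∀ t : ℝ, 0 ≤ w t) →
        ∀ ε : ℝ, 0 < ε → ∃ C : ℝ, 0 < C ∧ ∀ X : ℝ, 2 ≤ X →
          ‖(∑' n : {n : GaussianInt // IsPrimary n},
                L (1 / 2) (ωg ^ 2 * n.1) * ((w (Nm n.1 / X) : ℝ) : ℂ)) -
              (X : ℂ) *
                (Q1 (mellin (fun t : ℝ => ((w t : ℝ) : ℂ)) 1)
                      (deriv (mellin (fun t : ℝ => ((w t : ℝ) : ℂ))) 1) * (Real.log X : ℂ) +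
                  Q0 (mellin (fun t : ℝ => ((w t : ℝ) : ℂ)) 1)
                      (deriv (mellin (fun t : ℝ => ((w t : ℝ) : ℂ))) 1))‖ ≤
            C * X ^ (1 / 2 + ε) := by
  obtain ⟨Q1, Q0, h⟩ := GH.final hχ hL
  exact ⟨Q1, Q0, fun w _ ε hε => h w ε hε⟩
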